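/- (Wedge decomposition with Fourier estimates.) Assume g = χ_E ∏_{i=1}^n |f_i|^{γ_i} is of the standard form and that it is not the case that E contains a neighborhood of the origin with every f_i(0,0) ≠ 0. Then a sufficiently small disk B centered at the origin can be written as B = ∪_{i=1}^M B_i, where each B_i is a wedge bounded by two lines through the origin and the boundary circle of B, such that each B_i has one of the following two forms, where α is any function supported in B with |α| ≤ A and |∇α(x,y)| ≤ A(x²+y²)^{−1/2}. Type (1): letting n_j denote the order of the zero of f_j at the origin, there are constants with c_j (x²+y²)^{n_j/2} < |f_j(x,y)| < C_j (x²+y²)^{n_j/2} on B_i for every j, the boundary curves of E do not intersect cl(B_i), and |∫_{B_i} α χ_E ∏|f_j|^{γ_j} e^{i(tx+uy)} dx dy| ≤ C ∫_{B_i} (1+|tx|+|uy|)^{−1} χ_E ∏|f_j|^{γ_j} dx dy for all (t,u). Type (2): there is a line l_i through the origin intersecting B_i that is either contained in the zero set of some F_j (the lowest-degree Taylor part of f_j at (0,0)) or tangent at the origin to a boundary curve of E, and, with v a unit vector along l_i and v^⊥ orthogonal to it, |∫_{B_i} α χ_E ∏|f_j|^{γ_j} e^{i(tx+uy)} dx dy|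 ≤ C ∫_{B_i} (1 + |(t,u)·v| |(x,y)| + |(t,u)·v^⊥| |(x,y)·v^⊥|)^{−1/2} χ_E ∏|f_j|^{γ_j} dx dy for all (t,u). -/

import Mathlib

open MeasureTheory Real Set Filter Metric
open scoped Topology ENNReal

noncomputable section

/-- The Euclidean magnitude `|(x,y)| = √(x²+y²)` of a point of `ℝ²`. -/
def nrm2 (p : ℝ × ℝ) : ℝ := Real.sqrt (p.1 ^ 2 + p.2 ^ 2)

/-- The open Euclidean disk `{(x,y) : x²+y² < r²}` centered at the origin. -/
def disk2 (r : ℝ) : Set (ℝ × ℝ) := {p : ℝ × ℝ | p.1 ^ 2 + p.2 ^ 2 < r ^ 2}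

/-- The closed Euclidean disk `{(x,y) : x²+y² ≤ r²}` centered at the origin. -/
def closedDisk2 (r : ℝ) : Set (ℝ × ℝ) := {p : ℝ × ℝ | p.1 ^ 2 + p.2 ^ 2 ≤ r ^ 2}

/-- The circle `{(x,y) : x²+y² = r²}` centered at the origin. -/
def circle2 (r : ℝ) : Set (ℝ × ℝ) := {p : ℝ × ℝ | p.1 ^ 2 + p.2 ^ 2 = r ^ 2}

/-- Dot product on `ℝ²`. -/
def dot2 (p q : ℝ × ℝ) : ℝ := p.1 * q.1 + p.2 * q.2

/-- The perpendicular vector `v^⊥ = (v₂, −v₁)`. -/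
def perp2 (v : ℝ × ℝ) : ℝ × ℝ := (v.2, -v.1)

/-- The function `g = χ_E · ∏ᵢ |fᵢ|^(γᵢ)`. -/
def stdFun (n : ℕ) (f : Fin n → ℝ × ℝ → ℝ) (γ : Fin n → ℝ) (E : Set (ℝ × ℝ)) :
    ℝ × ℝ → ℝ :=
  E.indicator fun p => ∏ i, |f i p| ^ (γ i)

/-- A boundary curve for the region `E`: one half of a graph `y = h(|x|^{1/N})` or
`x = h(|y|^{1/N})` with `h` real analytic, `h 0 = 0`, joining the origin to the circle
of radius `r₀`. -/
def IsPuiseuxBdryCurve (r₀ : ℝ) (C : Set (ℝ × ℝ)) : Prop :=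
  ∃ (N : ℕ) (h : ℝ → ℝ) (I : Set ℝ) (σ : ℝ),
    0 < N ∧ (σ = 1 ∨ σ = -1) ∧ IsOpen I ∧ Icc (0:ℝ) (r₀ ^ ((N:ℝ)⁻¹)) ⊆ I ∧
    AnalyticOnNhd ℝ h I ∧ h 0 = 0 ∧
    (C = {p : ℝ × ℝ | p ∈ closedDisk2 r₀ ∧ 0 ≤ σ * p.1 ∧
            p.2 = h (|p.1| ^ ((N:ℝ)⁻¹))} ∨
     C = {p : ℝ × ℝ | p ∈ closedDisk2 r₀ ∧ 0 ≤ σ * p.2 ∧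
            p.1 = h (|p.2| ^ ((N:ℝ)⁻¹))}) ∧
    (0:ℝ×ℝ) ∈ C ∧ ∃ p ∈ C, nrm2 p = r₀

/-- The admissible form of the set `E`: either a disk centered at the origin, or a finite
disjoint union of open regions, each bounded by two Puiseux boundary curves joining the
origin to the circle of radius `r₀` together with an arc of that circle, where all the
boundary curves are pairwise disjoint in the closed disk minus the origin. -/
def IsStdDomain (E : Set (ℝ × ℝ)) : Prop :=
  (∃ r₀ > (0:ℝ), E = disk2 r₀) ∨
  (∃ r₀ > (0:ℝ), ∃ m : ℕ, ∃ Es : Fin m → Set (ℝ × ℝ), ∃ Cs : Fin m → Fin 2 → Set (ℝ × ℝ),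
    E = Set.iUnion Es ∧
    (Pairwise fun i j => Disjoint (Es i) (Es j)) ∧
    (∀ i, IsOpen (Es i) ∧ Es i ⊆ disk2 r₀ ∧ (0:ℝ×ℝ) ∈ closure (Es i) ∧
      frontier (Es i) ⊆ Cs i 0 ∪ Cs i 1 ∪ circle2 r₀) ∧
    (∀ i j, IsPuiseuxBdryCurve r₀ (Cs i j)) ∧
    (Pairwise fun (q q' : Fin m × Fin 2) =>
      Disjoint (Cs q.1 q.2 ∩ (closedDisk2 r₀ \ {0}))
               (Cs q'.1 q'.2 ∩ (closedDisk2 r₀ \ {0}))))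

/-- The standard form of the paper: the `fᵢ` are real analytic and not identically zero
near the origin, `g = χ_E ∏ |fᵢ|^(γᵢ)` is integrable near the origin, and `E` is an
admissible domain. -/
structure StandardForm (n : ℕ) (f : Fin n → ℝ × ℝ → ℝ) (γ : Fin n → ℝ)
    (E : Set (ℝ × ℝ)) : Prop where
  analytic : ∃ U ∈ 𝓝 (0 : ℝ × ℝ), ∀ i, AnalyticOnNhd ℝ (f i) U
  nontriv : ∀ i, ¬ (∀ᶠ p in 𝓝 (0 : ℝ × ℝ), f i p = 0)
  integ : ∃ U ∈ 𝓝 (0 : ℝ × ℝ), IntegrableOn (stdFun n f γ E) U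
  domain : IsStdDomain E

/-- The two-sided bound `c₁ rᵉ |log r|^d ≤ ∫_{x²+y²<r²} g ≤ c₂ rᵉ |log r|^d` for all small
`r` ("ball exponents" `ε`, `d` of `g`, as in Lemma 1.1). -/
def BallBound (g : ℝ × ℝ → ℝ) (ε : ℝ) (d : ℕ) : Prop :=
  0 < ε ∧ d ≤ 1 ∧ ∃ c₁ > (0:ℝ), ∃ c₂ > (0:ℝ), ∃ c₃ > (0:ℝ), ∀ r : ℝ, 0 < r → r < c₃ →
    c₁ * r ^ ε * |Real.log r| ^ d ≤ (∫ p in disk2 r, g p) ∧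
    (∫ p in disk2 r, g p) ≤ c₂ * r ^ ε * |Real.log r| ^ d

/-- The strip `{(x,y) : |(x,y)·v| < r, |(x,y)·v^⊥| < c}`. -/
def strip2 (v : ℝ × ℝ) (r c : ℝ) : Set (ℝ × ℝ) :=
  {p : ℝ × ℝ | |dot2 p v| < r ∧ |dot2 p (perp2 v)| < c}

/-- The two-sided bound `a r^δ |log r|^e ≤ ∫_{strip} g ≤ b r^δ |log r|^e` for all small `r`,
for every small `c` ("strip exponents" `δ_v`, `e_v` of `g` in the direction `v`, as in
Lemma 1.2). -/
def StripBound (g : ℝ × ℝ → ℝ) (v : ℝ × ℝ) (δ : ℝ) (e : ℕ) : Prop :=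
  0 < δ ∧ e ≤ 1 ∧ ∃ cv > (0:ℝ), ∀ c : ℝ, 0 < c → c < cv →
    ∃ a > (0:ℝ), ∃ b > (0:ℝ), ∀ r : ℝ, 0 < r → r < c →
      a * r ^ δ * |Real.log r| ^ e ≤ (∫ p in strip2 v r c, g p) ∧
      (∫ p in strip2 v r c, g p) ≤ b * r ^ δ * |Real.log r| ^ e

/-- The order of vanishing of `f` at the origin. -/
def vanishingOrder (f : ℝ × ℝ → ℝ) : ℕ :=
  sInf {k : ℕ | iteratedFDeriv ℝ k f 0 ≠ 0}

/-- (A constant multiple of) the sum of the terms of lowest total degree in the Taylor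
expansion of `f` at the origin, as a homogeneous function on `ℝ²`. -/
def lowestPart (f : ℝ × ℝ → ℝ) (p : ℝ × ℝ) : ℝ :=
  iteratedFDeriv ℝ (vanishingOrder f) f 0 (fun _ => p)

/-- `w` is a tangent direction of the set `C` at the origin. -/
def IsTangentDirAt (C : Set (ℝ × ℝ)) (w : ℝ × ℝ) : Prop :=
  ∃ p : ℕ → ℝ × ℝ, (∀ k, p k ∈ C ∧ p k ≠ 0) ∧
    Tendsto p atTop (𝓝 (0:ℝ×ℝ)) ∧
    (Tendsto (fun k => (nrm2 (p k))⁻¹ • p k) atTop (𝓝 w) ∨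
     Tendsto (fun k => (nrm2 (p k))⁻¹ • p k) atTop (𝓝 (-w)))

/-- `w` is the direction of one of the lines `l₁, …, l_p`: a line through the origin in the
zero set of the lowest-degree Taylor part of some `fᵢ`, or a tangent line at the origin to
one of the boundary curves of `E`. -/
def ExceptionalDir (n : ℕ) (f : Fin n → ℝ × ℝ → ℝ) (E : Set (ℝ × ℝ)) (w : ℝ × ℝ) : Prop :=
  (∃ i, lowestPart (f i) w = 0) ∨ IsTangentDirAt (frontier E) w

/-- Conditions (1.2)-(1.3) on the factor `α`: `C¹` away from the origin, bounded by `A`,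
with gradient bounded by `A (x²+y²)^{-1/2}`. -/
def AlphaBound (α : ℝ × ℝ → ℝ) (A : ℝ) : Prop :=
  ContDiffOn ℝ 1 α {(0:ℝ×ℝ)}ᶜ ∧ (∀ p, |α p| ≤ A) ∧
  ∀ p : ℝ × ℝ, p ≠ 0 → ‖fderiv ℝ α p‖ ≤ A * (nrm2 p)⁻¹

/-- A smooth bump function equal to `1` near `(x₀, y₀)`, supported within (Euclidean)
distance `r` of `(x₀, y₀)`. -/
def IsBump (φ : ℝ × ℝ → ℝ) (x₀ y₀ : ℝ) (r : ℝ) : Prop :=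
  ContDiff ℝ (⊤ : ℕ∞) φ ∧ HasCompactSupport φ ∧ (∀ᶠ p in 𝓝 ((x₀, y₀) : ℝ × ℝ), φ p = 1) ∧
    tsupport φ ⊆ {p : ℝ × ℝ | (p.1 - x₀) ^ 2 + (p.2 - y₀) ^ 2 < r ^ 2}

/-- The oscillatory integral `∫_S h(x,y) e^{i(tx+uy)} dx dy`. -/
def oscInt (h : ℝ × ℝ → ℝ) (S : Set (ℝ × ℝ)) (t u : ℝ) : ℂ :=
  ∫ p in S, (h p : ℂ) * Complex.exp (Complex.I * ((t : ℂ) * (p.1 : ℂ) + (u : ℂ) * (p.2 : ℂ)))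

/-- The convolution kernel `K(t,u) = ∫ m(x,y) e^{i(tx+uy)} dx dy`. -/
def Kfull (m : ℝ × ℝ → ℝ) (t u : ℝ) : ℂ :=
  oscInt m Set.univ t u

/-- The localized kernel `K_φ(t,u) = ∫ φ(x,y) m(x,y) e^{i(tx+uy)} dx dy`. -/
def Kphi (φ m : ℝ × ℝ → ℝ) (t u : ℝ) : ℂ :=
  oscInt (fun p => φ p * m p) Set.univ t u

/-- `k` is a Puiseux function of index `N` on `[0,a]`: `k(x) = k'(x^{1/N})` for a function
`k'` real analytic on an open set containing `[0, a^{1/N}]`; equivalently `x ↦ k(x^N)` is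
real analytic. -/
def PuiseuxOn (N : ℕ) (a : ℝ) (k : ℝ → ℝ) : Prop :=
  ∃ (k' : ℝ → ℝ) (I : Set ℝ), IsOpen I ∧ Icc (0:ℝ) (a ^ ((N:ℝ)⁻¹)) ⊆ I ∧
    AnalyticOnNhd ℝ k' I ∧ ∀ x ∈ Icc (0:ℝ) a, k x = k' (x ^ ((N:ℝ)⁻¹))

/-- `k(x) = l·x^s + higher order terms` as `x → 0⁺`. -/
def LeadingTerm (k : ℝ → ℝ) (l s : ℝ) : Prop :=
  Tendsto (fun x => k x / x ^ s) (𝓝[>] (0:ℝ)) (𝓝 l)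

/-- The mixed partial derivative `∂_x^l ∂_y^m F`. -/
def pderiv2 (l m : ℕ) (F : ℝ × ℝ → ℝ) (p : ℝ × ℝ) : ℝ :=
  iteratedDeriv l (fun x => iteratedDeriv m (fun y => F (x, y)) p.2) p.1

/-- The descending product `α(α−1)⋯(α−l+1)`. -/
def descProd (α : ℝ) (l : ℕ) : ℝ := ∏ j ∈ Finset.range l, (α - (j : ℝ))

/-- The sliver `{(x,y) : 0 < x < a, g(x) < y < G(x)}`. -/
def sliverSet (a : ℝ) (g G : ℝ → ℝ) : Set (ℝ × ℝ) :=
  {q : ℝ × ℝ | 0 < q.1 ∧ q.1 < a ∧ g q.1 < q.2 ∧ q.2 < G q.1}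

/-- A wedge of radius `r₀` at the origin: a region bounded by two lines through the origin
and the circle of radius `r₀`. -/
def IsWedge (r₀ : ℝ) (W : Set (ℝ × ℝ)) : Prop :=
  ∃ θ₁ θ₂ : ℝ, θ₁ < θ₂ ∧ θ₂ ≤ θ₁ + 2 * π ∧
    W = {p : ℝ × ℝ | ∃ ρ θ : ℝ, 0 < ρ ∧ ρ < r₀ ∧ θ₁ < θ ∧ θ < θ₂ ∧
      p = (ρ * Real.cos θ, ρ * Real.sin θ)}

local notation "Rl" => ℝ
local notation "Pl" => ℝ × ℝ
local notation "Fl" => ℝ × ℝ → ℝ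
local notation "Fr" => ℝ → ℝ
local notation "Zr" => (0 : ℝ)
local notation "mh" => (-(1 / 2 : ℝ))
local notation "pz" => (by positivity)
local notation "fz" => (by fun_prop)
local notation:max "Un" v:max => (v).1 ^ 2 + (v).2 ^ 2 = 1
local notation:max "pol" r:max θ:max => (r * cos θ, r * sin θ)
variable {p v w : Pl} {a b R ε d r A s B κ x τ σ t δ β : Rl} {f α g : Fl} {q h η : Fr} {N k n e e1 : Nat}

lemma osc_T (hab : a ≤ b) {c0 C0 : Rl} (hc0 : 0 < c0) (hC0 : 0 ≤ C0) (hε : 0 < ε)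
    (hε1 : ε ≤ 1) {φ1 φ2 φ3 : Fr}     (h1 : ∀ x ∈ Icc a b, HasDerivAt φ1 (φ2 x) x) (h2 : ∀ x ∈ Icc a b, HasDerivAt φ2 (φ3 x) x)
    (h3c : ContinuousOn φ3 (Icc a b))
    (b2 : ∀ x ∈ Icc a b, |φ2 x| ≤ C0) (b3 : ∀ x ∈ Icc a b, |φ3 x| ≤ C0)
    (hlow : ∀ x ∈ Icc a b, c0 ≤ φ1 x ^ 2 + φ2 x ^ 2) :
    ∫ x in a..b, ε ^ 2 / (ε ^ 2 + φ1 x ^ 2) ≤ ε * (((b - a) + 4 * C0 + 2 * C0 * (b - a)) / c0) := by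
  have hu : uIcc a b = Icc a b := uIcc_of_le hab
  have h1c : ContinuousOn φ1 (Icc a b) := fun x hx => (h1 x hx).continuousAt.continuousWithinAt
  have h2c : ContinuousOn φ2 (Icc a b) := fun x hx => (h2 x hx).continuousAt.continuousWithinAt
  have hpos : ∀ x, 0 < ε ^ 2 + φ1 x ^ 2 := fun x => by positivity
  have hden : ContinuousOn (fun x => ε ^ 2 + φ1 x ^ 2) (Icc a b) :=
    continuousOn_const.add (h1c.pow 2)
  have ibp : ∫ x in a..b, φ2 x * (ε * φ2 x / (ε ^ 2 + φ1 x ^ 2)) =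
      φ2 b * arctan (φ1 b / ε) - φ2 a * arctan (φ1 a / ε) -
        ∫ x in a..b, φ3 x * arctan (φ1 x / ε) := by
    apply intervalIntegral.integral_mul_deriv_eq_deriv_mul
    · rw [hu]; exact h2
    · rw [hu]; intro x hx
      refine (((h1 x hx).div_const ε).arctan).congr_deriv ?_
      have := hpos x
      field_simp
    · apply ContinuousOn.intervalIntegrable; rwa [hu]
    · apply ContinuousOn.intervalIntegrable; rw [hu]
      exact (continuousOn_const.mul h2c).div hden (fun x _ => (hpos x).ne')
  have atb : ∀ x : Rl, |arctan x| ≤ 2 := fun x => by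
    have := arctan_lt_pi_div_two x
    have := neg_pi_div_two_lt_arctan x
    have := pi_lt_four
    rw [abs_le]; constructor <;> linarith
  have i3 : |∫ x in a..b, φ3 x * arctan (φ1 x / ε)| ≤ 2 * C0 * (b - a) := by
    have := intervalIntegral.norm_integral_le_of_norm_le_const (a := a) (b := b)
      (f := fun x => φ3 x * arctan (φ1 x / ε)) (C := C0 * 2) (by
        intro x hx
        rw [uIoc_of_le hab] at hx
        rw [norm_mul]
        exact mul_le_mul (b3 x (Ioc_subset_Icc_self hx)) (atb _) (norm_nonneg _) hC0)
    rw [abs_of_nonneg (sub_nonneg.2 hab)] at this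
    rw [Real.norm_eq_abs] at this
    linarith
  have e1 : ∀ x ∈ Icc a b, |φ2 x * arctan (φ1 x / ε)| ≤ C0 * 2 := fun x hx => by
    rw [abs_mul]; exact mul_le_mul (b2 x hx) (atb _) (abs_nonneg _) hC0
  have key : ∫ x in a..b, φ2 x * (ε * φ2 x / (ε ^ 2 + φ1 x ^ 2)) ≤ 4 * C0 + 2 * C0 * (b - a) := by
    rw [ibp]
    have := abs_le.1 (e1 a (left_mem_Icc.2 hab))
    have := abs_le.1 (e1 b (right_mem_Icc.2 hab))
    have := abs_le.1 i3
    linarith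
  have hmono : ∫ x in a..b, c0 * (ε ^ 2 / (ε ^ 2 + φ1 x ^ 2)) ≤
      ∫ x in a..b, (ε + ε * (φ2 x * (ε * φ2 x / (ε ^ 2 + φ1 x ^ 2)))) := by
    apply intervalIntegral.integral_mono_on hab
    · apply ContinuousOn.intervalIntegrable; rw [hu]
      exact continuousOn_const.mul (continuousOn_const.div hden (fun x _ => (hpos x).ne'))
    · apply ContinuousOn.intervalIntegrable; rw [hu]
      exact continuousOn_const.add (continuousOn_const.mul (h2c.mul
        ((continuousOn_const.mul h2c).div hden (fun x _ => (hpos x).ne'))))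
    · intro x hx
      refine (mul_le_mul_of_nonneg_right (hlow x hx) pz).trans ?_
      have e : (φ1 x ^ 2 + φ2 x ^ 2) * (ε ^ 2 / (ε ^ 2 + φ1 x ^ 2)) =
        ε ^ 2 * (φ1 x ^ 2 / (ε ^ 2 + φ1 x ^ 2)) + ε * (φ2 x * (ε * φ2 x / (ε ^ 2 + φ1 x ^ 2))) := by
        field_simp
      rw [e]
      have : φ1 x ^ 2 / (ε ^ 2 + φ1 x ^ 2) ≤ 1 := by
        rw [div_le_one (hpos x)]; nlinarith [sq_nonneg ε]
      have h0 : 0 ≤ φ1 x ^ 2 / (ε ^ 2 + φ1 x ^ 2) := by positivity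
      nlinarith
  rw [intervalIntegral.integral_const_mul, intervalIntegral.integral_add, intervalIntegral.integral_const_mul,
    intervalIntegral.integral_const] at hmono
  · rw [mul_div_assoc', le_div_iff₀ hc0]
    simp only [smul_eq_mul] at hmono
    nlinarith
  · simp
  · apply ContinuousOn.intervalIntegrable; rw [hu]
    exact (continuousOn_const.mul (h2c.mul
        ((continuousOn_const.mul h2c).div hden (fun x _ => (hpos x).ne'))))

lemma osc_main (hab : a ≤ b) {c0 C0 : Rl} (hc0 : 0 < c0) (hC0 : 0 ≤ C0) (hε : 0 < ε)
    (hε1 : ε ≤ 1) {φ φ1 φ2 φ3 h1 : Fr}     (d0 : ∀ x ∈ Icc a b, HasDerivAt φ (φ1 x) x)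
    (d1 : ∀ x ∈ Icc a b, HasDerivAt φ1 (φ2 x) x) (d2 : ∀ x ∈ Icc a b, HasDerivAt φ2 (φ3 x) x)
    (h3c : ContinuousOn φ3 (Icc a b))
    (b2 : ∀ x ∈ Icc a b, |φ2 x| ≤ C0) (b3 : ∀ x ∈ Icc a b, |φ3 x| ≤ C0)
    (hlow : ∀ x ∈ Icc a b, c0 ≤ φ1 x ^ 2 + φ2 x ^ 2)
    (dh : ∀ x ∈ Icc a b, HasDerivAt h (h1 x) x) (hh1 : ContinuousOn h1 (Icc a b))
    (bh : ∀ x ∈ Icc a b, |h x| ≤ B) (bh1 : ∀ x ∈ Icc a b, |h1 x| ≤ B) :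
    ‖∫ x in a..b, (h x : ℂ) * Complex.exp (Complex.I * ((φ x / ε ^ 2 : Rl) : ℂ))‖ ≤
      B * ε * ((1 + C0) * (((b - a) + 4 * C0 + 2 * C0 * (b - a)) / c0) + 2 + (b - a)) := by
  have hu : uIcc a b = Icc a b := uIcc_of_le hab
  have hB : 0 ≤ B := (abs_nonneg _).trans (bh a (left_mem_Icc.2 hab))
  have hT := osc_T hab hc0 hC0 hε hε1 d1 d2 h3c b2 b3 hlow
  set T0 := ((b - a) + 4 * C0 + 2 * C0 * (b - a)) / c0 with hT0
  have cφ : ContinuousOn φ (Icc a b) := fun x hx => (d0 x hx).continuousAt.continuousWithinAt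
  have c1 : ContinuousOn φ1 (Icc a b) := fun x hx => (d1 x hx).continuousAt.continuousWithinAt
  have c2 : ContinuousOn φ2 (Icc a b) := fun x hx => (d2 x hx).continuousAt.continuousWithinAt
  have ch : ContinuousOn h (Icc a b) := fun x hx => (dh x hx).continuousAt.continuousWithinAt
  have hpos : ∀ x, 0 < ε ^ 2 + φ1 x ^ 2 := fun x => by positivity
  have hden : ContinuousOn (fun x => ε ^ 2 + φ1 x ^ 2) (Icc a b) :=
    continuousOn_const.add (c1.pow 2)
  set e : Rl → ℂ := fun x => Complex.exp (Complex.I * ((φ x / ε ^ 2 : Rl) : ℂ)) with he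
  have ne : ∀ x, ‖e x‖ = 1 := fun x => by
    rw [he]; simp only []
    rw [mul_comm]; exact Complex.norm_exp_ofReal_mul_I _
  have de : ∀ x ∈ Icc a b, HasDerivAt e (Complex.I * ((φ1 x / ε ^ 2 : Rl) : ℂ) * e x) x := by
    intro x hx
    rw [mul_comm]
    exact (((((d0 x hx).div_const (ε ^ 2)).ofReal_comp).const_mul Complex.I).cexp)
  have ce : ContinuousOn e (Icc a b) := fun x hx => (de x hx).continuousAt.continuousWithinAt
  set r : Fr := fun x => h x * φ1 x / (ε ^ 2 + φ1 x ^ 2) with hr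
  set r1 : Fr := fun x => ((h1 x * φ1 x + h x * φ2 x) * (ε ^ 2 + φ1 x ^ 2) -
    (h x * φ1 x) * (2 * φ1 x * φ2 x)) / (ε ^ 2 + φ1 x ^ 2) ^ 2 with hr1
  have dr : ∀ x ∈ Icc a b, HasDerivAt r (r1 x) x := by
    intro x hx
    refine (((dh x hx).mul (d1 x hx)).div (((d1 x hx).pow 2).const_add (ε ^ 2)) (hpos x).ne').congr_deriv ?_
    simp only [hr1]
    congr 2
    norm_num
  have ofR : ∀ {f : Fr}, ContinuousOn f (Icc a b) →
      ContinuousOn (fun x => (f x : ℂ)) (Icc a b) := fun hf =>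
    Complex.continuous_ofReal.comp_continuousOn hf
  have ibp : ∫ x in a..b, (r x : ℂ) * (Complex.I * ((φ1 x / ε ^ 2 : Rl) : ℂ) * e x) =
      (r b : ℂ) * e b - (r a : ℂ) * e a - ∫ x in a..b, (r1 x : ℂ) * e x := by
    apply intervalIntegral.integral_mul_deriv_eq_deriv_mul
    · rw [hu]; intro x hx; exact (dr x hx).ofReal_comp
    · rw [hu]; exact de
    · apply ContinuousOn.intervalIntegrable; rw [hu]; exact ofR (by
      apply ContinuousOn.div _ (hden.pow 2) (fun x _ => (pow_pos (hpos x) 2).ne')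
      exact (((hh1.mul c1).add (ch.mul c2)).mul hden).sub
        ((ch.mul c1).mul ((continuousOn_const.mul c1).mul c2)))
    · apply ContinuousOn.intervalIntegrable; rw [hu]
      exact (continuousOn_const.mul (ofR (c1.div_const _))).mul ce
  have hsplit : ∫ x in a..b, (h x : ℂ) * e x =
      (∫ x in a..b, ((h x * (ε ^ 2 / (ε ^ 2 + φ1 x ^ 2)) : Rl) : ℂ) * e x) +
      (-Complex.I * ((ε ^ 2 : Rl) : ℂ)) *
        ∫ x in a..b, (r x : ℂ) * (Complex.I * ((φ1 x / ε ^ 2 : Rl) : ℂ) * e x) := by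
    rw [← intervalIntegral.integral_const_mul, ← intervalIntegral.integral_add]
    · apply intervalIntegral.integral_congr
      intro x hx
      have h0 : ((ε : ℂ) ^ 2 + (φ1 x : ℂ) ^ 2) ≠ 0 := by
        exact_mod_cast ((hpos x).ne')
      have h00 : (ε : ℂ) ≠ 0 := by exact_mod_cast hε.ne'
      simp only [hr]
      push_cast
      field_simp
      rw [Complex.I_sq]; ring
    · apply ContinuousOn.intervalIntegrable; rw [hu]
      exact (ofR (ch.mul (continuousOn_const.div hden (fun x _ => (hpos x).ne')))).mul ce
    · apply ContinuousOn.intervalIntegrable; rw [hu]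
      refine continuousOn_const.mul ((ofR ?_).mul ((continuousOn_const.mul (ofR (c1.div_const _))).mul ce))
      exact (ch.mul c1).div hden (fun x _ => (hpos x).ne')
  have cT : ContinuousOn (fun x => ε ^ 2 / (ε ^ 2 + φ1 x ^ 2)) (Icc a b) :=
    continuousOn_const.div hden (fun x _ => (hpos x).ne')
  have A1 : ‖∫ x in a..b, ((h x * (ε ^ 2 / (ε ^ 2 + φ1 x ^ 2)) : Rl) : ℂ) * e x‖ ≤ B * (ε * T0) := by
    calc _ ≤ ∫ x in a..b, B * (ε ^ 2 / (ε ^ 2 + φ1 x ^ 2)) := by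
          apply intervalIntegral.norm_integral_le_of_norm_le hab
          · refine ae_of_all _ fun x hx => ?_
            rw [norm_mul, ne, mul_one, Complex.norm_real, norm_mul]
            have : 0 ≤ ε ^ 2 / (ε ^ 2 + φ1 x ^ 2) := by have := hpos x; positivity
            rw [Real.norm_of_nonneg this]
            exact mul_le_mul_of_nonneg_right (bh x (Ioc_subset_Icc_self hx)) this
          · apply ContinuousOn.intervalIntegrable; rw [hu]; exact continuousOn_const.mul cT
      _ ≤ _ := by
          rw [intervalIntegral.integral_const_mul]
          exact mul_le_mul_of_nonneg_left hT hB
  have frac : ∀ x, ε * |φ1 x| / (ε ^ 2 + φ1 x ^ 2) ≤ 1 := fun x => by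
    rw [div_le_one (hpos x)]
    nlinarith [sq_nonneg (ε - |φ1 x|), sq_abs (φ1 x), abs_nonneg (φ1 x)]
  have br : ∀ x ∈ Icc a b, ε * |r x| ≤ B := by
    intro x hx
    have : ε * |r x| = |h x| * (ε * |φ1 x| / (ε ^ 2 + φ1 x ^ 2)) := by
      simp only [hr]; rw [abs_div, abs_mul, abs_of_pos (hpos x)]; ring
    rw [this]
    calc _ ≤ B * 1 := mul_le_mul (bh x hx) (frac x) (by have := hpos x; positivity) hB
      _ = B := mul_one _
  have br1 : ∀ x ∈ Icc a b, ε ^ 2 * |r1 x| ≤ B * ε + B * C0 * (ε ^ 2 / (ε ^ 2 + φ1 x ^ 2)) := by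
    intro x hx
    have hp := hpos x
    have e1 : r1 x = h1 x * (φ1 x / (ε ^ 2 + φ1 x ^ 2)) +
        h x * φ2 x * ((ε ^ 2 - φ1 x ^ 2) / (ε ^ 2 + φ1 x ^ 2) / (ε ^ 2 + φ1 x ^ 2)) := by
      simp only [hr1]; field_simp; ring
    have g1 : |h1 x * (φ1 x / (ε ^ 2 + φ1 x ^ 2))| * ε ≤ B := by
      rw [abs_mul, mul_assoc]
      calc _ ≤ B * 1 := mul_le_mul (bh1 x hx) (by
        rw [abs_div, abs_of_pos hp]; rw [div_mul_eq_mul_div, mul_comm]; exact (frac x)) pz hB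
        _ = B := mul_one _
    calc _ ≤ ε ^ 2 * (|h1 x * (φ1 x / (ε ^ 2 + φ1 x ^ 2))| + B * C0 * (1 / (ε ^ 2 + φ1 x ^ 2))) :=
          mul_le_mul_of_nonneg_left (by
            rw [e1]; exact (abs_add_le _ _).trans (add_le_add_right (by
              rw [abs_mul, abs_mul]
              exact mul_le_mul (mul_le_mul (bh x hx) (b2 x hx) (abs_nonneg _) hB) (by
                rw [abs_div, abs_of_pos hp]
                gcongr
                rw [abs_div, abs_of_pos hp, div_le_one hp, abs_le]
                constructor <;> nlinarith [sq_nonneg ε, sq_nonneg (φ1 x)]) (abs_nonneg _)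
                pz) _)) pz
      _ = ε * (|h1 x * (φ1 x / (ε ^ 2 + φ1 x ^ 2))| * ε) + B * C0 * (ε ^ 2 / (ε ^ 2 + φ1 x ^ 2)) := by ring
      _ ≤ ε * B + B * C0 * (ε ^ 2 / (ε ^ 2 + φ1 x ^ 2)) := by gcongr
      _ = _ := by ring
  have A2 : ‖(-Complex.I * ((ε ^ 2 : Rl) : ℂ)) *
        ∫ x in a..b, (r x : ℂ) * (Complex.I * ((φ1 x / ε ^ 2 : Rl) : ℂ) * e x)‖ ≤
        2 * B * ε + (B * ε * (b - a) + B * C0 * (ε * T0)) := by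
    rw [ibp, mul_assoc, norm_mul, norm_neg, Complex.norm_I, one_mul, mul_sub, mul_sub]
    refine (norm_sub_le _ _).trans (add_le_add ((norm_sub_le _ _).trans ?_) (by
      rw [← intervalIntegral.integral_const_mul]
      calc _ ≤ ∫ x in a..b, (B * ε + B * C0 * (ε ^ 2 / (ε ^ 2 + φ1 x ^ 2))) := by
            apply intervalIntegral.norm_integral_le_of_norm_le hab
            · refine ae_of_all _ fun x hx => ?_
              rw [norm_mul, norm_mul, ne, mul_one, Complex.norm_real, Complex.norm_real,
                Real.norm_of_nonneg pz, Real.norm_eq_abs]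
              exact br1 x (Ioc_subset_Icc_self hx)
            · apply ContinuousOn.intervalIntegrable; rw [hu]
              exact continuousOn_const.add (continuousOn_const.mul cT)
        _ = B * ε * (b - a) + B * C0 * ∫ x in a..b, (ε ^ 2 / (ε ^ 2 + φ1 x ^ 2)) := by
            rw [intervalIntegral.integral_add, intervalIntegral.integral_const_mul,
              intervalIntegral.integral_const]
            · simp; ring
            · simp
            · apply ContinuousOn.intervalIntegrable; rw [hu]
              exact (continuousOn_const.mul cT)
        _ ≤ _ := by gcongr))
    have q : ∀ x ∈ Icc a b, ‖((ε ^ 2 : Rl) : ℂ) * ((r x : ℂ) * e x)‖ ≤ B * ε := fun x hx => by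
      rw [norm_mul, norm_mul, ne, mul_one, Complex.norm_real, Complex.norm_real,
              Real.norm_of_nonneg pz, Real.norm_eq_abs]
      have := br x hx
      nlinarith
    have := q a (left_mem_Icc.2 hab)
    have := q b (right_mem_Icc.2 hab)
    linarith
  rw [hsplit]
  refine (norm_add_le _ _).trans ((add_le_add A1 A2).trans (le_of_eq ?_))
  ring

lemma osc_bound (hab : a ≤ b) {c0 C0 : Rl} (hc0 : 0 < c0) (hC0 : 0 ≤ C0) :
    ∃ C : Rl, 0 < C ∧ ∀ (Λ B : Rl) (φ φ1 φ2 φ3 h h1 : Fr), 0 ≤ Λ →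
    (∀ x ∈ Icc a b, HasDerivAt φ (φ1 x) x) →
    (∀ x ∈ Icc a b, HasDerivAt φ1 (φ2 x) x) → (∀ x ∈ Icc a b, HasDerivAt φ2 (φ3 x) x) →
    (ContinuousOn φ3 (Icc a b)) →
    (∀ x ∈ Icc a b, |φ2 x| ≤ C0) → (∀ x ∈ Icc a b, |φ3 x| ≤ C0) →
    (∀ x ∈ Icc a b, c0 ≤ φ1 x ^ 2 + φ2 x ^ 2) →
    (∀ x ∈ Icc a b, HasDerivAt h (h1 x) x) → (ContinuousOn h1 (Icc a b)) →
    (∀ x ∈ Icc a b, |h x| ≤ B) → (∀ x ∈ Icc a b, |h1 x| ≤ B) →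
    ‖∫ x in a..b, (h x : ℂ) * Complex.exp (Complex.I * ((Λ * φ x : Rl) : ℂ))‖ ≤
      C * B * (1 + Λ) ^ mh := by
  set K := ((1 + C0) * (((b - a) + 4 * C0 + 2 * C0 * (b - a)) / c0) + 2 + (b - a)) with hK
  have hK2 : 2 + (b - a) ≤ K := by
    have : 0 ≤ ((1 + C0) * (((b - a) + 4 * C0 + 2 * C0 * (b - a)) / c0)) := by positivity
    linarith
  refine ⟨2 * K, by linarith, ?_⟩
  intro Λ B φ φ1 φ2 φ3 h h1 hΛ d0 d1 d2 h3c b2 b3 hlow dh hh1 bh bh1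
  have hB : 0 ≤ B := (abs_nonneg _).trans (bh a (left_mem_Icc.2 hab))
  have hs : (1 + Λ) ^ mh = 1 / √(1 + Λ) := by
    rw [Real.rpow_neg (by linarith), ← Real.sqrt_eq_rpow, one_div]
  rw [hs]
  have sp : 0 < √(1 + Λ) := Real.sqrt_pos.2 (by linarith)
  by_cases hL : Λ ≤ 1
  · have i1 : ‖∫ x in a..b, (h x : ℂ) * Complex.exp (Complex.I * ((Λ * φ x : Rl) : ℂ))‖ ≤ B * |b - a| := by
      apply intervalIntegral.norm_integral_le_of_norm_le_const
      intro x hx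
      rw [uIoc_of_le hab] at hx
      rw [norm_mul, mul_comm Complex.I, Complex.norm_exp_ofReal_mul_I, mul_one, Complex.norm_real]
      exact bh x (Ioc_subset_Icc_self hx)
    rw [abs_of_nonneg (sub_nonneg.2 hab)] at i1
    refine i1.trans ?_
    have : √(1 + Λ) ≤ 2 := by
      rw [Real.sqrt_le_left (by norm_num)]; linarith
    rw [mul_one_div, le_div_iff₀ sp]
    have : B * (b - a) * √(1 + Λ) ≤ B * (b - a) * 2 := by gcongr
    nlinarith
  · push Not at hL
    have hΛ0 : 0 < Λ := by linarith
    set ε := 1 / √Λ with hε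
    have sΛ : 1 ≤ √Λ := by rw [Real.one_le_sqrt]; linarith
    have hε1 : ε ≤ 1 := by rw [hε, div_le_one (by linarith)]; exact sΛ
    have := osc_main hab hc0 hC0 pz hε1 d0 d1 d2 h3c b2 b3 hlow dh hh1 bh bh1
    have e2 : ∀ x, φ x / ε ^ 2 = Λ * φ x := fun x => by
      rw [hε, div_pow, Real.sq_sqrt hΛ]; field_simp
    simp only [e2] at this
    refine this.trans ?_
    rw [← hK]
    rw [mul_one_div (2 * K * B), le_div_iff₀ sp]
    have : ε * √(1 + Λ) ≤ 2 := by
      rw [hε, one_div, inv_mul_le_iff₀ (by linarith)]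
      rw [Real.sqrt_le_left (by linarith), mul_pow, Real.sq_sqrt hΛ]; linarith
    calc B * ε * K * √(1 + Λ) = B * K * (ε * √(1 + Λ)) := by ring
      _ ≤ _ := (mul_le_mul_of_nonneg_left this (mul_nonneg hB (by linarith)))
      _ = _ := by ring

set_option maxHeartbeats 800000 in
lemma nondeg_aux (N e k : Nat) (hN : 1 ≤ N) (he : N < e) (hk : 1 ≤ k) :
    ∃ η d0 c0 : Rl, 0 < η ∧ η ≤ 1 ∧ 0 < d0 ∧ 0 < c0 ∧ ∀ A B D t x v1 v2 p1 p2 : Rl,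
      |A| + |B| + |D| = 1 → |D| ≤ d0 → 1 ≤ t → t ≤ 2 → 2 ≤ x → x ≤ 4 →
      |v1 - e * x ^ e| ≤ η * x ^ e → |v2 - e * (e - 1) * x ^ e| ≤ η * x ^ e →
      x * p1 = A * (N * x ^ N) + B * v1 + D * (t * (k * x ^ k)) →
      x ^ 2 * p2 = A * (N * (N - 1) * x ^ N) + B * v2 + D * (t * (k * (k - 1) * x ^ k)) →
      c0 ≤ p1 ^ 2 + p2 ^ 2 := by
  have hNr : (1:Rl) ≤ N := by exact_mod_cast hN
  have hkr : (1:Rl) ≤ k := by exact_mod_cast hk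
  have her : (N:Rl) + 1 ≤ e := by exact_mod_cast he
  have he0 : Zr < e := by linarith
  have hk0 : Zr < k := by linarith
  set d0 : Rl := 1 / (32 * k * (k + e) * 4 ^ k) with hd0
  set η : Rl := 1 / (4 * e * 4 ^ e) with hη
  have hx4e : (1:Rl) ≤ 4 ^ e := one_le_pow₀ (by norm_num)
  have hx4k : (1:Rl) ≤ 4 ^ k := one_le_pow₀ (by norm_num)
  have hηp : 0 < η := by rw [hη]; positivity
  have hd0p : 0 < d0 := by rw [hd0]; positivity
  have h1 : e * η * 4 ^ e = 1 / 4 := by rw [hη]; field_simp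
  have h2 : 2 * d0 * k * (k + e) * 4 ^ k = 1 / 16 := by rw [hd0]; field_simp; norm_num
  have h3 : e * η ≤ 1 / 4 := by
    have : 0 < e * η := by positivity
    nlinarith
  have hd04 : d0 ≤ 1 / 4 := by
    have : 1 ≤ (k:Rl) * (k + e) * 4 ^ k := by
      have : 1 ≤ (k:Rl) * (k + e) := by nlinarith
      nlinarith
    nlinarith
  clear_value d0 η
  refine ⟨η, d0, (1 / (16 * (16 + 4 * e))) ^ 2 / 2, hηp, by nlinarith, hd0p, by positivity, ?_⟩
  intro A B D t x v1 v2 p1 p2 hs hD t1 t2 x2 x4 hv1 hv2 hp1 hp2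
  have hxe : x ^ e ≤ 4 ^ e := by gcongr
  have hxk : x ^ k ≤ 4 ^ k := by gcongr
  have hxe1 : 1 ≤ x ^ e := one_le_pow₀ (by linarith)
  have hxk0 : 1 ≤ x ^ k := one_le_pow₀ (by linarith)
  set E1 := v1 - e * x ^ e with hE1
  set E2 := v2 - e * (e - 1) * x ^ e with hE2
  have hDt : ∀ s : Rl, |s| ≤ k + e → |D * (t * (k * s * x ^ k))| ≤ 1 / 16 := by
    intro s hs
    have a1 : |D * (t * (k * s * x ^ k))| = |D| * (t * (k * |s| * x ^ k)) := by
      rw [abs_mul, abs_mul, abs_mul, abs_mul, abs_of_nonneg (by linarith : Zr ≤ t),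
        abs_of_nonneg (by linarith : Zr ≤ k), abs_of_nonneg (by linarith : 0 ≤ x ^ k)]
    rw [a1]
    calc |D| * (t * (k * |s| * x ^ k)) ≤ d0 * (2 * (k * (k + e) * 4 ^ k)) := by gcongr
      _ = 1 / 16 := by rw [← h2]; ring
  have main : 1 / 16 ≤ 16 * |p2| + 4 * e * |p1| := by
    have hP : |x * p1| ≤ 4 * |p1| := by
      rw [abs_mul, abs_of_nonneg (by linarith : Zr ≤ x)]; gcongr
    have hR : |x ^ 2 * p2| ≤ 16 * |p2| := by
      rw [abs_mul, abs_of_nonneg (by positivity : Zr ≤ x ^ 2)]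
      gcongr
      calc x ^ 2 ≤ 4 ^ 2 := by gcongr
        _ = 16 := by norm_num
    have tri : ∀ s : Rl, 0 ≤ s → s ≤ e → |x ^ 2 * p2 - s * (x * p1)| ≤ 16 * |p2| + 4 * e * |p1| := by
      intro s s0 se
      refine (abs_sub _ _).trans ?_
      rw [abs_mul s, abs_of_nonneg s0]
      have : s * |x * p1| ≤ e * (4 * |p1|) := by gcongr
      linarith
    have cases : 1 / 4 ≤ |B| ∨ 1 / 2 ≤ |A| := by
      by_cases h : 1 / 4 ≤ |B|
      · exact Or.inl h
      · right; push Not at h; linarith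
    rcases cases with hB | hA
    · refine le_trans ?_ (tri (N - 1) (by linarith) (by linarith))
      have id1 : x ^ 2 * p2 - (N - 1) * (x * p1) =
        B * (E2 - (N - 1) * E1 + e * (e - N) * x ^ e) + D * (t * (k * (k - N) * x ^ k)) := by
        rw [hp1, hp2, hE1, hE2]; ring
      rw [id1]
      have b1 := hDt (k - N) (by rw [abs_le]; constructor <;> linarith)
      have b2 : 1 / 2 ≤ E2 - (N - 1) * E1 + e * (e - N) * x ^ e := by
        have q1 := (abs_le.1 hv2).1
        have q3 : ((N:Rl) - 1) * E1 ≤ (N - 1) * (η * x ^ e) := by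
          apply mul_le_mul_of_nonneg_left ((abs_le.1 hv1).2); linarith
        have q4 : 1 * x ^ e ≤ e * (e - N) * x ^ e := by
          apply mul_le_mul_of_nonneg_right _ (by linarith)
          have : (1:Rl) * 1 ≤ e * (e - N) := by apply mul_le_mul <;> linarith
          linarith
        have q5 : N * η ≤ 1 / 4 := by
          have : N * η ≤ e * η := by gcongr
          linarith
        have q6 : N * η * x ^ e ≤ 1 / 4 * x ^ e := by gcongr
        linarith
      have b3 : 1 / 8 ≤ |B * (E2 - (N - 1) * E1 + e * (e - N) * x ^ e)| := by
        rw [abs_mul, abs_of_nonneg (by linarith : 0 ≤ E2 - (N - 1) * E1 + e * (e - N) * x ^ e)]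
        have := mul_le_mul hB b2 (by norm_num) (abs_nonneg B)
        linarith
      have := abs_sub_abs_le_abs_sub (B * (E2 - (N - 1) * E1 + e * (e - N) * x ^ e))
        (-(D * (t * (k * (k - N) * x ^ k))))
      rw [abs_neg, sub_neg_eq_add] at this
      linarith
    · refine le_trans ?_ (tri (e - 1) (by linarith) (by linarith))
      have id1 : x ^ 2 * p2 - (e - 1) * (x * p1) =
        -(A * (N * (e - N) * x ^ N)) + (B * (E2 - (e - 1) * E1) + D * (t * (k * (k - e) * x ^ k))) := by
        rw [hp1, hp2, hE1, hE2]; ring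
      rw [id1]
      have b1 := hDt (k - e) (by rw [abs_le]; constructor <;> linarith)
      have b2 : |B * (E2 - (e - 1) * E1)| ≤ 1 / 4 := by
        rw [abs_mul]
        have : |E2 - (e - 1) * E1| ≤ 1 / 4 := by
          refine (abs_sub _ _).trans ?_
          rw [abs_mul, abs_of_nonneg (by linarith : Zr ≤ e - 1)]
          have : ((e:Rl) - 1) * |E1| ≤ (e - 1) * (η * x ^ e) := by
            apply mul_le_mul_of_nonneg_left hv1; linarith
          have : e * η * x ^ e ≤ e * η * 4 ^ e := by gcongr
          linarith
        have hB1 : |B| ≤ 1 := by have := abs_nonneg A; have := abs_nonneg D; linarith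
        have := mul_le_mul hB1 this (abs_nonneg _) (by norm_num)
        linarith
      have b3 : 1 / 2 ≤ |-(A * (N * (e - N) * x ^ N))| := by
        have : 1 ≤ N * (e - N) * x ^ N := by
          have : (1:Rl) * 1 ≤ (N:Rl) * (e - N) := by apply mul_le_mul <;> linarith
          have : (1 * 1) * 1 ≤ N * (e - N) * x ^ N := by
            apply mul_le_mul this (one_le_pow₀ (by linarith)) <;> linarith
          linarith
        rw [abs_neg, abs_mul, abs_of_nonneg (by linarith : 0 ≤ N * (e - N) * x ^ N)]
        have := mul_le_mul hA this (by norm_num) (abs_nonneg A)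
        linarith
      have := abs_sub_abs_le_abs_sub (-(A * (N * (e - N) * x ^ N)))
        (-(B * (E2 - (e - 1) * E1) + D * (t * (k * (k - e) * x ^ k))))
      rw [abs_neg (B * (E2 - (e - 1) * E1) + D * (t * (k * (k - e) * x ^ k))), sub_neg_eq_add] at this
      have := abs_add_le (B * (E2 - (e - 1) * E1)) (D * (t * (k * (k - e) * x ^ k)))
      linarith
  have L : 0 < (16 + 4 * e : Rl) := by linarith
  have m : 1 / (16 * (16 + 4 * e)) ≤ max |p1| |p2| := by
    rw [div_le_iff₀ pz]
    have a1 := le_max_left |p1| |p2|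
    have a2 := le_max_right |p1| |p2|
    have : 4 * e * |p1| ≤ 4 * e * max |p1| |p2| := by gcongr
    linarith
  have : (1 / (16 * (16 + 4 * e : Rl))) ^ 2 ≤ (max |p1| |p2|) ^ 2 := by gcongr
  have : (max |p1| |p2|) ^ 2 ≤ p1 ^ 2 + p2 ^ 2 := by
    rcases max_cases |p1| |p2| with ⟨h, _⟩ | ⟨h, _⟩ <;> rw [h, sq_abs]
    · linarith [sq_nonneg p2]
    · linarith [sq_nonneg p1]
  have : 0 ≤ (1 / (16 * (16 + 4 * e : Rl))) ^ 2 := by positivity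
  linarith

lemma pow_d1 (n : Nat) (hn : 1 ≤ n) (x : Rl) : x * (n * x ^ (n - 1)) = n * x ^ n := by
  obtain ⟨m, rfl⟩ := Nat.exists_eq_add_of_le' hn
  simp; ring

lemma pow_d2 (n : Nat) (hn : 1 ≤ n) (x : Rl) :
    x ^ 2 * (n * ((n - 1 : Nat) * x ^ (n - 1 - 1))) = n * (n - 1) * x ^ n := by
  obtain ⟨m, rfl⟩ := Nat.exists_eq_add_of_le' hn
  rcases m with _ | m
  · simp
  · push_cast; ring

lemma pow_b2 (n : Nat) (h2 : 2 ≤ x) (h4 : x ≤ 4) :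
    |n * ((n - 1 : Nat) * x ^ (n - 1 - 1))| ≤ n ^ 3 * 4 ^ n ∧
    |n * ((n - 1 : Nat) * ((n - 1 - 1 : Nat) * x ^ (n - 1 - 1 - 1)))| ≤ n ^ 3 * 4 ^ n := by
  have h1 : ∀ j ≤ n, |x ^ j| ≤ 4 ^ n := fun j hj => by
    rw [abs_of_nonneg pz]
    calc x ^ j ≤ 4 ^ j := by gcongr
      _ ≤ 4 ^ n := pow_le_pow_right₀ (by norm_num) hj
  have h3 : ∀ j ≤ n, |(j : Rl)| ≤ n := fun j hj => by
    exact_mod_cast hj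
  rcases Nat.eq_zero_or_pos n with rfl | hn
  · simp
  constructor
  · rw [abs_mul, abs_mul]
    calc _ ≤ (n:Rl) * (n * 4 ^ n) := by
          gcongr
          · simp
          · simp
          · exact h1 _ (by omega)
      _ ≤ n * (n * 4 ^ n) * n := le_mul_of_one_le_right pz (by exact_mod_cast hn)
      _ = _ := by ring
  · rw [abs_mul, abs_mul, abs_mul]
    calc _ ≤ (n:Rl) * (n * (n * 4 ^ n)) := by
          gcongr
          · simp
          · simp
          · exact h3 _ (by omega)
          · exact h1 _ (by omega)
      _ = _ := by ring

lemma box_bound (N e k : Nat) (hN : 1 ≤ N) (he : N < e) (hk : 1 ≤ k) :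
    ∃ η : Rl, 0 < η ∧ ∀ M : Rl, 0 ≤ M → ∃ C : Rl, 0 < C ∧
    ∀ (A B D β Λ : Rl) (V V1 V2 V3 : Fr) (H Hx Ht : Fl),
    |A| + |B| + |D| = 1 → 0 ≤ Λ →
    (∀ x ∈ Icc (2:Rl) 4, HasDerivAt V (V1 x) x) → (∀ x ∈ Icc (2:Rl) 4, HasDerivAt V1 (V2 x) x) →
    (∀ x ∈ Icc (2:Rl) 4, HasDerivAt V2 (V3 x) x) → ContinuousOn V3 (Icc 2 4) →
    (∀ x ∈ Icc (2:Rl) 4, |x * V1 x - e * x ^ e| ≤ η * x ^ e) →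
    (∀ x ∈ Icc (2:Rl) 4, |x ^ 2 * V2 x - e * (e - 1) * x ^ e| ≤ η * x ^ e) →
    (∀ x ∈ Icc (2:Rl) 4, |V3 x| ≤ M) →
    (∀ x ∈ Icc (2:Rl) 4, ∀ t ∈ Icc (1:Rl) 2, HasDerivAt (fun x => H (x, t)) (Hx (x, t)) x) →
    (∀ x ∈ Icc (2:Rl) 4, ∀ t ∈ Icc (1:Rl) 2, HasDerivAt (fun t => H (x, t)) (Ht (x, t)) t) →
    ContinuousOn H (Icc (2:Rl) 4 ×ˢ Icc (1:Rl) 2) → ContinuousOn Hx (Icc (2:Rl) 4 ×ˢ Icc (1:Rl) 2) →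
    ContinuousOn Ht (Icc (2:Rl) 4 ×ˢ Icc (1:Rl) 2) →
    (∀ p ∈ (Icc (2:Rl) 4 ×ˢ Icc (1:Rl) 2), |H p| ≤ β ∧ |Hx p| ≤ β ∧ |Ht p| ≤ β) →
    ‖∫ p in (Icc (2:Rl) 4 ×ˢ Icc (1:Rl) 2), (H p : ℂ) * Complex.exp (Complex.I *
        ((Λ * (A * p.1 ^ N + B * V p.1 + D * (p.2 * p.1 ^ k)) : Rl) : ℂ))‖ ≤
      C * β * (1 + Λ) ^ mh := by
  obtain ⟨η, d0, c0, hη, hη1, hd0, hc0, hnd⟩ := nondeg_aux N e k hN he hk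
  refine ⟨η, hη, fun M hM => ?_⟩
  set C0 : Rl := N ^ 3 * 4 ^ N + ((e ^ 2 + 1) * 4 ^ e + M) + 2 * (k ^ 3 * 4 ^ k) with hC0
  have hC0p : 0 ≤ C0 := by positivity
  obtain ⟨C1, hC1, hb1⟩ := osc_bound (a := 2) (b := 4) (by norm_num) hc0 hC0p
  obtain ⟨C2, hC2, hb2⟩ := osc_bound (a := 1) (b := 2) (c0 := d0 ^ 2) (C0 := 0) (by norm_num) pz le_rfl
  refine ⟨2 * C1 + 2 * C2, by positivity, ?_⟩
  intro A B D β Λ V V1 V2 V3 H Hx Ht hs hΛ dV dV1 dV2 cV3 bV1 bV2 bV3 dx dt cH cHx cHt bH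
  have hβ : 0 ≤ β := (abs_nonneg _).trans (bH (2, 1) (by simp; norm_num)).1
  have cV : ContinuousOn V (Icc 2 4) := fun x hx => (dV x hx).continuousAt.continuousWithinAt
  set F : Pl → ℂ := fun p => (H p : ℂ) * Complex.exp (Complex.I *
        ((Λ * (A * p.1 ^ N + B * V p.1 + D * (p.2 * p.1 ^ k)) : Rl) : ℂ)) with hF
  have cF : ContinuousOn F (Icc (2:Rl) 4 ×ˢ Icc (1:Rl) 2) := by
    apply (Complex.continuous_ofReal.comp_continuousOn cH).mul
    apply ContinuousOn.cexp
    apply continuousOn_const.mul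
    apply Complex.continuous_ofReal.comp_continuousOn
    exact continuousOn_const.mul (((by fun_prop : Continuous (fun p : Pl => A * p.1 ^ N)).continuousOn.add
      (continuousOn_const.mul (cV.comp continuous_fst.continuousOn (fun p hp => hp.1)))).add
      (by fun_prop : Continuous (fun p : Pl => D * (p.2 * p.1 ^ k))).continuousOn)
  have iF : IntegrableOn F (Icc (2:Rl) 4 ×ˢ Icc (1:Rl) 2) (volume.prod volume) :=
    cF.integrableOn_compact (isCompact_Icc.prod isCompact_Icc)
  have sub : ∀ x, 2 ≤ x → x ≤ 4 → ∀ t, 1 ≤ t → t ≤ 2 → (x, t) ∈ (Icc (2:Rl) 4 ×ˢ Icc (1:Rl) 2) :=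
    fun x h1 h2 t h3 h4 => ⟨⟨h1, h2⟩, ⟨h3, h4⟩⟩
  have hw : 0 ≤ (1 + Λ) ^ mh := by positivity
  have hA1 : |A| ≤ 1 := by linarith [abs_nonneg B, abs_nonneg D]
  have hB1 : |B| ≤ 1 := by linarith [abs_nonneg A, abs_nonneg D]
  have hD1 : |D| ≤ 1 := by linarith [abs_nonneg A, abs_nonneg B]
  by_cases hD : d0 ≤ |D|
  · rw [Measure.volume_eq_prod, setIntegral_prod F iF]
    refine (norm_setIntegral_le_of_norm_le_const (μ := (volume : Measure Rl)) (s := Icc (2:Rl) 4) (by simp) (by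
      intro x hx
      rw [integral_Icc_eq_integral_Ioc, ← intervalIntegral.integral_of_le (by norm_num)]
      refine hb2 Λ β (fun t => A * x ^ N + B * V x + D * (t * x ^ k)) (fun t => D * x ^ k) (fun t => 0)
        (fun t => 0) (fun t => H (x, t)) (fun t => Ht (x, t)) hΛ ?_ ?_ ?_ continuousOn_const
        ?_ ?_ ?_ ?_ ?_ ?_ ?_
      · intro t _
        simpa using ((((hasDerivAt_id t).mul_const (x ^ k)).const_mul D).const_add (A * x ^ N + B * V x))
      · intro t _; exact hasDerivAt_const _ _
      · intro t _; exact hasDerivAt_const _ _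
      · simp
      · simp
      · intro t _
        have : d0 ^ 2 ≤ (|D| * x ^ k) ^ 2 := by
          gcongr
          calc d0 ≤ |D| := hD
            _ ≤ |D| * x ^ k := le_mul_of_one_le_right (abs_nonneg _) (one_le_pow₀ (by linarith [hx.1]))
        rw [mul_pow, sq_abs, ← mul_pow] at this
        simpa using this
      · intro t ht; exact dt x hx t ht
      · exact cHt.comp fz (fun t ht => ⟨hx, ht⟩)
      · intro t ht; exact (bH _ ⟨hx, ht⟩).1
      · intro t ht; exact (bH _ ⟨hx, ht⟩).2.2)).trans ?_
    have e1 : (volume : Measure Rl).real (Icc (2:Rl) 4) = 2 := by simp [Measure.real]; norm_num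
    rw [e1]
    have : 0 ≤ C1 * β * (1 + Λ) ^ mh := by positivity
    linarith
  · push Not at hD
    rw [Measure.volume_eq_prod, ← Measure.prod_restrict, integral_prod_symm]
    · refine (norm_setIntegral_le_of_norm_le_const (μ := (volume : Measure Rl)) (s := Icc (1:Rl) 2) (by simp) (by
      intro t ht
      rw [integral_Icc_eq_integral_Ioc, ← intervalIntegral.integral_of_le (by norm_num)]
      refine hb1 Λ β (fun x => A * x ^ N + B * V x + D * (t * x ^ k))
        (fun x => A * (N * x ^ (N - 1)) + B * V1 x + D * (t * (k * x ^ (k - 1))))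
        (fun x => A * (N * ((N - 1 : Nat) * x ^ (N - 1 - 1))) + B * V2 x +
          D * (t * (k * ((k - 1 : Nat) * x ^ (k - 1 - 1)))))
        (fun x => A * (N * ((N - 1 : Nat) * ((N - 1 - 1 : Nat) * x ^ (N - 1 - 1 - 1)))) + B * V3 x +
          D * (t * (k * ((k - 1 : Nat) * ((k - 1 - 1 : Nat) * x ^ (k - 1 - 1 - 1))))))
        (fun x => H (x, t)) (fun x => Hx (x, t)) hΛ ?_ ?_ ?_ ?_ ?_ ?_ ?_ ?_ ?_ ?_ ?_
      · intro x hx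
        exact (((hasDerivAt_pow N x).const_mul A).add ((dV x hx).const_mul B)).add
          (((hasDerivAt_pow k x).const_mul t).const_mul D)
      · intro x hx
        exact ((((hasDerivAt_pow (N-1) x).const_mul (N:Rl)).const_mul A).add ((dV1 x hx).const_mul B)).add
          ((((hasDerivAt_pow (k-1) x).const_mul (k:Rl)).const_mul t).const_mul D)
      · intro x hx
        exact (((((hasDerivAt_pow (N-1-1) x).const_mul ((N-1:Nat):Rl)).const_mul (N:Rl)).const_mul A).add
          ((dV2 x hx).const_mul B)).add
          (((((hasDerivAt_pow (k-1-1) x).const_mul ((k-1:Nat):Rl)).const_mul (k:Rl)).const_mul t).const_mul D)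
      · fun_prop
      · intro x hx
        refine (abs_add_three _ _ _).trans ?_
        rw [hC0]
        gcongr
        · rw [abs_mul]; exact (mul_le_of_le_one_left (abs_nonneg _) hA1).trans ((pow_b2 N hx.1 hx.2).1)
        · rw [abs_mul]; exact (mul_le_of_le_one_left (abs_nonneg _) hB1).trans (by
          have := bV2 x hx
          have h1 : |x ^ 2 * V2 x| ≤ (e ^ 2 + 1) * x ^ e := by
            have h2 : |x ^ 2 * V2 x| ≤ |x ^ 2 * V2 x - e * (e - 1) * x ^ e| + |e * (e - 1) * x ^ e| := by
              have := abs_add_le (x ^ 2 * V2 x - e * (e - 1) * x ^ e) (e * (e - 1) * x ^ e)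
              simpa using this
            have he1 : (1:Rl) ≤ e := by exact_mod_cast (by omega : 1 ≤ e)
            have hx0 : 0 ≤ x ^ e := pow_nonneg (by linarith [hx.1]) _
            have h3 : |(e:Rl) * (e - 1) * x ^ e| = e * (e - 1) * x ^ e := by
              apply abs_of_nonneg
              have : Zr ≤ e - 1 := by linarith
              positivity
            rw [h3] at h2
            have h4 : η * x ^ e ≤ 1 * x ^ e := by gcongr
            have h5 : 1 * x ^ e ≤ e * x ^ e := by gcongr
            linarith
          have h6 : |V2 x| ≤ |x ^ 2 * V2 x| := by
            rw [abs_mul]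
            apply le_mul_of_one_le_left (abs_nonneg _)
            rw [abs_of_nonneg pz]
            exact one_le_pow₀ (by linarith [hx.1])
          have h7 : x ^ e ≤ 4 ^ e := by
            have := hx.2; have := hx.1
            gcongr
          have h8 : ((e:Rl) ^ 2 + 1) * x ^ e ≤ (e ^ 2 + 1) * 4 ^ e := by gcongr
          linarith)
        · rw [abs_mul]; refine (mul_le_of_le_one_left (abs_nonneg _) hD1).trans ?_
          rw [abs_mul, abs_of_nonneg (by linarith [ht.1] : Zr ≤ t)]
          exact mul_le_mul ht.2 ((pow_b2 k hx.1 hx.2).1) (abs_nonneg _) (by norm_num)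
      · intro x hx
        refine (abs_add_three _ _ _).trans ?_
        rw [hC0]
        gcongr
        · rw [abs_mul]; exact (mul_le_of_le_one_left (abs_nonneg _) hA1).trans ((pow_b2 N hx.1 hx.2).2)
        · rw [abs_mul]; exact (mul_le_of_le_one_left (abs_nonneg _) hB1).trans (by
          have := bV3 x hx
          have : Zr ≤ (e ^ 2 + 1) * 4 ^ e := by positivity
          linarith)
        · rw [abs_mul]; refine (mul_le_of_le_one_left (abs_nonneg _) hD1).trans ?_
          rw [abs_mul, abs_of_nonneg (by linarith [ht.1] : Zr ≤ t)]
          exact mul_le_mul ht.2 ((pow_b2 k hx.1 hx.2).2) (abs_nonneg _) (by norm_num)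
      · intro x hx
        refine hnd A B D t x (x * V1 x) (x ^ 2 * V2 x) _ _ hs hD.le ht.1 ht.2 hx.1 hx.2 (bV1 x hx) (bV2 x hx) ?_ ?_
        · rw [← (pow_d1 N hN x), ← (pow_d1 k hk x)]; ring
        · rw [← (pow_d2 N hN x), ← (pow_d2 k hk x)]; ring
      · intro x hx; exact dx x hx t ht
      · exact cHx.comp fz (fun x hx => ⟨hx, ht⟩)
      · intro x hx; exact (bH _ ⟨hx, ht⟩).1
      · intro x hx; exact (bH _ ⟨hx, ht⟩).2.1)).trans ?_
      have e1 : (volume : Measure Rl).real (Icc (1:Rl) 2) = 1 := by simp [Measure.real]; norm_num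
      rw [e1]
      have : 0 ≤ C1 * β * (1 + Λ) ^ mh := by positivity
      have : 0 ≤ C2 * β * (1 + Λ) ^ mh := by positivity
      linarith
    · rw [Measure.prod_restrict]; exact iF

lemma det_prod2 (L : Pl →L[Rl] Pl) :
    L.det = (L (1, 0)).1 * (L (0, 1)).2 - (L (0, 1)).1 * (L (1, 0)).2 := by
  have : L.det = LinearMap.det (L : Pl →ₗ[Rl] Pl) := rfl
  rw [this, ← LinearMap.det_toMatrix (Module.Basis.finTwoProd Rl), Matrix.det_fin_two]
  simp [LinearMap.toMatrix_apply]

def QQ : Set Pl := Ioi 0 ×ˢ Ioi 0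

lemma QQ_open : IsOpen QQ := isOpen_Ioi.prod isOpen_Ioi
lemma QQ_meas : MeasurableSet QQ := QQ_open.measurableSet

def scaleL (x t : Rl) : Pl →L[Rl] Pl :=
  (x • ContinuousLinearMap.fst Rl Rl Rl).prod (t • ContinuousLinearMap.snd Rl Rl Rl)

lemma scaleL_apply (x t : Rl) (p : Pl) : scaleL x t p = (x * p.1, t * p.2) := rfl

lemma scaleL_det (x t : Rl) : (scaleL x t).det = x * t := by
  rw [det_prod2]; simp [scaleL_apply]

lemma scaleL_image (hx : 0 < x) (ht : 0 < t) : scaleL x t '' QQ = QQ := by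
  ext p; constructor
  · rintro ⟨q, hq, rfl⟩
    exact ⟨mul_pos hx hq.1, mul_pos ht hq.2⟩
  · intro hp
    refine ⟨(p.1 / x, p.2 / t), ⟨div_pos hp.1 hx, div_pos hp.2 ht⟩, ?_⟩
    rw [scaleL_apply]; ext <;> simp <;> field_simp

lemma scaleL_inj (hx : 0 < x) (ht : 0 < t) : InjOn (scaleL x t) QQ := by
  intro p _ q _ h
  rw [Prod.mk.injEq] at h
  ext
  · exact mul_left_cancel₀ hx.ne' h.1
  · exact mul_left_cancel₀ ht.ne' h.2

lemma scale_int {G : Type*} [NormedAddCommGroup G] [NormedSpace Rl G] (F : Pl → G)     (hx : 0 < x) (ht : 0 < t) :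
    ∫ p in QQ, F (x * p.1, t * p.2) = (x * t)⁻¹ • ∫ p in QQ, F p := by
  have := integral_image_eq_integral_abs_det_fderiv_smul volume QQ_meas
    (fun p _ => (scaleL x t).hasFDerivAt.hasFDerivWithinAt) (scaleL_inj hx ht) F
  rw [scaleL_image hx ht] at this
  simp only [scaleL_det, scaleL_apply] at this
  rw [this, abs_of_pos pz, integral_smul, smul_smul, inv_mul_cancel₀ pz, one_smul]

lemma scale_integrable {G : Type*} [NormedAddCommGroup G] [NormedSpace Rl G] (F : Pl → G)     (hx : 0 < x) (ht : 0 < t) (hF : IntegrableOn F QQ) :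
    IntegrableOn (fun p => F (x * p.1, t * p.2)) QQ := by
  have := (integrableOn_image_iff_integrableOn_abs_det_fderiv_smul volume QQ_meas
    (fun p _ => (scaleL x t).hasFDerivAt.hasFDerivWithinAt) (scaleL_inj hx ht) F).1
    (by rwa [scaleL_image hx ht])
  simp only [scaleL_det, scaleL_apply] at this
  refine (this.smul (x * t)⁻¹).congr ?_
  filter_upwards with p
  simp only [Pi.smul_apply]
  rw [abs_of_pos pz, smul_smul, inv_mul_cancel₀ pz, one_smul]

def BX : Set Pl := Icc (2:Rl) 4 ×ˢ Icc (1:Rl) 2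

lemma BX_compact : IsCompact BX := isCompact_Icc.prod isCompact_Icc
lemma BX_meas : MeasurableSet BX := BX_compact.measurableSet

lemma BX_int : ∫ x in BX, (x.1 * x.2)⁻¹ = Real.log 2 ^ 2 := by
  unfold BX
  rw [Measure.volume_eq_prod]
  simp only [mul_inv]
  rw [(setIntegral_prod_mul (μ := volume) (ν := volume)
    (fun x : Rl => x⁻¹) (fun x : Rl => x⁻¹) (Icc 2 4) (Icc 1 2))]
  rw [integral_Icc_eq_integral_Ioc, integral_Icc_eq_integral_Ioc,
    ← intervalIntegral.integral_of_le (by norm_num), ← intervalIntegral.integral_of_le (by norm_num),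
    integral_inv (by norm_num)]
  norm_num; ring

lemma avg_lemma (F : Pl → ℂ) (cF : ContinuousOn F QQ) (iF : IntegrableOn F QQ) :
    Real.log 2 ^ 2 • ∫ p in QQ, F p = ∫ z in QQ, ∫ x in BX, F (x.1 * z.1, x.2 * z.2) := by
  have hpos : ∀ x ∈ BX, 0 < x.1 ∧ 0 < x.2 := fun x hx =>
    ⟨by linarith [hx.1.1], by linarith [hx.2.1]⟩
  rw [← integral_integral_swap (by
    rw [Measure.prod_restrict]
    have hm : AEStronglyMeasurable (Function.uncurry fun x z => F (x.1 * z.1, x.2 * z.2))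
        ((volume.prod volume).restrict (BX ×ˢ QQ)) := by
      apply ContinuousOn.aestronglyMeasurable _ (BX_meas.prod QQ_meas)
      apply cF.comp fz
      rintro ⟨x, z⟩ ⟨hx, hz⟩
      exact ⟨mul_pos (hpos x hx).1 hz.1, mul_pos (hpos x hx).2 hz.2⟩
    rw [← Measure.prod_restrict] at hm ⊢
    rw [integrable_prod_iff hm]
    constructor
    · rw [ae_restrict_iff' BX_meas]
      filter_upwards with x hx
      exact scale_integrable F (hpos x hx).1 (hpos x hx).2 iF
    · have : IntegrableOn (fun x : Pl => (x.1 * x.2)⁻¹ • ∫ p in QQ, ‖F p‖) BX := by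
        refine ContinuousOn.integrableOn_compact BX_compact ?_
        exact (ContinuousOn.inv₀ fz fun x hx => (mul_pos (hpos x hx).1 (hpos x hx).2).ne').smul continuousOn_const
      refine Integrable.congr this ?_
      filter_upwards [ae_restrict_mem BX_meas] with x hx
      exact (scale_int (fun p => ‖F p‖) (hpos x hx).1 (hpos x hx).2).symm), ← BX_int, ← integral_smul_const]
  apply setIntegral_congr_fun BX_meas
  intro x hx
  exact (scale_int F (hpos x hx).1 (hpos x hx).2).symm


lemma split3 (a b c : Rl) : ∃ A B D , |A| + |B| + |D| = 1 ∧
    a = (|a| + |b| + |c|) * A ∧ b = (|a| + |b| + |c|) * B ∧ c = (|a| + |b| + |c|) * D := by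
  by_cases h : |a| + |b| + |c| = 0
  · have ha := abs_nonneg a
    have hb := abs_nonneg b
    have hc := abs_nonneg c
    refine ⟨1, 0, 0, by simp, ?_, ?_, ?_⟩ <;> rw [h, zero_mul, ← abs_eq_zero] <;> linarith
  · refine ⟨a / (|a| + |b| + |c|), b / (|a| + |b| + |c|), c / (|a| + |b| + |c|), ?_, ?_, ?_, ?_⟩
    · rw [abs_div, abs_div, abs_div, abs_of_pos (lt_of_le_of_ne pz (Ne.symm h)), ← add_div, ← add_div, div_self h]
    all_goals field_simp

theorem TL (N e k : Nat) (hN : 1 ≤ N) (he : N < e) (hk : 1 ≤ k) :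
    ∃ η : Rl, 0 < η ∧ ∀ M : Rl, 0 ≤ M → ∃ C : Rl, 0 < C ∧
    ∀ (z0 : Rl) (V V1 V2 V3 : Fr),
    (∀ z ∈ Ioo 0 (4 * z0), HasDerivAt V (V1 z) z) → (∀ z ∈ Ioo 0 (4 * z0), HasDerivAt V1 (V2 z) z) →
    (∀ z ∈ Ioo 0 (4 * z0), HasDerivAt V2 (V3 z) z) → ContinuousOn V3 (Ioo 0 (4 * z0)) →
    (∀ z ∈ Ioo 0 (4 * z0), |z * V1 z - e * z ^ e| ≤ η * z ^ e) →
    (∀ z ∈ Ioo 0 (4 * z0), |z ^ 2 * V2 z - e * (e - 1) * z ^ e| ≤ η * z ^ e) →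
    (∀ z ∈ Ioo 0 (4 * z0), |z ^ 3 * V3 z| ≤ M * z ^ e) →
    ∀ (l m n : Rl) (H Hz Hy ρ : Fl),
    (∀ p ∈ QQ, HasDerivAt (fun z => H (z, p.2)) (Hz p) p.1) →
    (∀ p ∈ QQ, HasDerivAt (fun y => H (p.1, y)) (Hy p) p.2) →
    ContinuousOn H QQ → ContinuousOn Hz QQ → ContinuousOn Hy QQ → IntegrableOn H QQ →
    (∀ p ∈ QQ, ∀ x ∈ BX, |H (x.1 * p.1, x.2 * p.2)| ≤ ρ p ∧
      |x.1 * p.1 * Hz (x.1 * p.1, x.2 * p.2)| ≤ ρ p ∧ |x.2 * p.2 * Hy (x.1 * p.1, x.2 * p.2)| ≤ ρ p) →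
    IntegrableOn ρ QQ → (∀ p ∈ QQ, z0 ≤ p.1 → ρ p = 0) →
    ‖∫ p in QQ, (H p : ℂ) * Complex.exp (Complex.I *
        ((l * p.1 ^ N + m * V p.1 + n * (p.2 * p.1 ^ k) : Rl) : ℂ))‖ ≤
      C * ∫ p in QQ, (1 + (|l| * p.1 ^ N + |m| * p.1 ^ e + |n| * (p.2 * p.1 ^ k))) ^ mh * ρ p := by
  obtain ⟨η, hη, hbox⟩ := box_bound N e k hN he hk
  refine ⟨η, hη, fun M hM => ?_⟩
  obtain ⟨C, hC, hb⟩ := hbox (M * 4 ^ e) pz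
  have hl2 : 0 < Real.log 2 ^ 2 := by have := Real.log_pos (by norm_num : (1:Rl) < 2); positivity
  refine ⟨(Real.log 2 ^ 2)⁻¹ * C, by positivity, ?_⟩
  intro z0 V V1 V2 V3 dV dV1 dV2 cV3 bV1 bV2 bV3 l m n H Hz Hy ρ dHz dHy cH cHz cHy iH hρ iρ hρ0
  set F : Pl → ℂ := fun p => (H p : ℂ) * Complex.exp (Complex.I *
        ((l * p.1 ^ N + m * V p.1 + n * (p.2 * p.1 ^ k) : Rl) : ℂ)) with hF
  have H0 : ∀ p ∈ QQ, 2 * z0 ≤ p.1 → H p = 0 := by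
    intro p hp h
    have hh : (p.1 / 2, p.2) ∈ QQ := by
      have h1 : 0 < p.1 := hp.1
      have : 0 < p.1 / 2 := by linarith
      exact ⟨this, hp.2⟩
    have h1 := (hρ (p.1 / 2, p.2) hh (2, 1) (by unfold BX; simp; norm_num)).1
    rw [hρ0 (p.1 / 2, p.2) hh (by simp; linarith)] at h1
    have := abs_nonpos_iff.1 h1
    simp only [one_mul] at this
    rwa [mul_div_cancel₀ _ (by norm_num)] at this
  have cF : ContinuousOn F QQ := by
    intro p hp
    by_cases hz : p.1 < 4 * z0
    · apply ContinuousWithinAt.mul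
      · exact (Complex.continuous_ofReal.comp_continuousOn cH) p hp
      · apply ContinuousWithinAt.cexp
        apply continuousWithinAt_const.mul
        apply Complex.continuous_ofReal.continuousAt.comp_continuousWithinAt
        apply ContinuousAt.continuousWithinAt
        exact (((by fun_prop : Continuous (fun p : Pl => l * p.1 ^ N)).continuousAt.add
          (continuousAt_const.mul (ContinuousAt.comp (f := Prod.fst) (dV p.1 ⟨hp.1, hz⟩).continuousAt continuous_fst.continuousAt))).add
            (by fun_prop : Continuous (fun p : Pl => n * (p.2 * p.1 ^ k))).continuousAt)
    · push Not at hz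
      have hz0 : 2 * z0 < p.1 := by
        have : 0 < p.1 := hp.1
        by_cases h : 0 ≤ z0 <;> [skip; linarith]
        rcases h.lt_or_eq with h | h <;> linarith
      have hev : F =ᶠ[𝓝[QQ] p] fun _ => 0 := by
        filter_upwards [(nhdsWithin_le_nhds (continuous_fst.continuousAt.eventually (lt_mem_nhds hz0))), self_mem_nhdsWithin] with q hq hq'
        simp only [hF, H0 q hq' hq.le, Complex.ofReal_zero, zero_mul]
      refine ContinuousWithinAt.congr_of_eventuallyEq continuousWithinAt_const hev ?_
      simp only [hF, H0 p hp hz0.le, Complex.ofReal_zero, zero_mul]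
  have e1 : ∫ p in QQ, F p = (Real.log 2 ^ 2)⁻¹ • ∫ z in QQ, ∫ x in BX, F (x.1 * z.1, x.2 * z.2) := by
    rw [← (avg_lemma F cF (by
      refine Integrable.mono iH (cF.aestronglyMeasurable QQ_meas) ?_
      filter_upwards with p
      rw [hF]; simp only []
      rw [norm_mul, mul_comm Complex.I, Complex.norm_exp_ofReal_mul_I, mul_one, Complex.norm_real])), smul_smul, inv_mul_cancel₀ hl2.ne', one_smul]
  rw [e1, norm_smul, mul_assoc, Real.norm_of_nonneg pz]
  apply mul_le_mul_of_nonneg_left _ pz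
  rw [← integral_const_mul]
  have hwm : ContinuousOn (fun p : Pl => (1 + (|l| * p.1 ^ N + |m| * p.1 ^ e + |n| * (p.2 * p.1 ^ k))) ^ mh) QQ := by
    apply ContinuousOn.rpow_const fz
    intro p hp
    left
    have h1 : 0 < p.1 := hp.1
    have h2 : 0 < p.2 := hp.2
    positivity
  apply norm_integral_le_of_norm_le
  · apply Integrable.const_mul
    refine Integrable.mono iρ ((hwm.aestronglyMeasurable QQ_meas).mul iρ.1) ?_
    filter_upwards [ae_restrict_mem QQ_meas] with p hp
    have h1 : 0 < p.1 := hp.1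
    have h2 : 0 < p.2 := hp.2
    rw [norm_mul]
    apply mul_le_of_le_one_left (norm_nonneg _)
    rw [Real.norm_of_nonneg pz]
    apply Real.rpow_le_one_of_one_le_of_nonpos _ (by norm_num)
    have : 0 ≤ (|l| * p.1 ^ N + |m| * p.1 ^ e + |n| * (p.2 * p.1 ^ k)) := by positivity
    linarith
  · filter_upwards [ae_restrict_mem QQ_meas] with p hp
    have h1 : 0 < p.1 := hp.1
    have h2 : 0 < p.2 := hp.2
    have hmem : ∀ x ∈ BX, (x.1 * p.1, x.2 * p.2) ∈ QQ := fun x hx =>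
      ⟨mul_pos (by linarith [hx.1.1]) h1, mul_pos (by linarith [hx.2.1]) h2⟩
    by_cases hz : z0 ≤ p.1
    · have : ∫ x in BX, F (x.1 * p.1, x.2 * p.2) = 0 := by
        apply setIntegral_eq_zero_of_forall_eq_zero
        intro x hx
        have := (hρ p hp x hx).1
        rw [(hρ0 p hp hz)] at this
        simp only [hF, abs_nonpos_iff.1 this, Complex.ofReal_zero, zero_mul]
      rw [this, (hρ0 p hp hz)]; simp
    · push Not at hz
      obtain ⟨A, B, D, hs, ha, hb', hc⟩ := split3 (l * p.1 ^ N) (m * p.1 ^ e) (n * (p.2 * p.1 ^ k))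
      have hΛ : |l * p.1 ^ N| + |m * p.1 ^ e| + |n * (p.2 * p.1 ^ k)| =
          |l| * p.1 ^ N + |m| * p.1 ^ e + |n| * (p.2 * p.1 ^ k) := by
        rw [abs_mul, abs_mul, abs_mul, abs_of_pos (pow_pos h1 N), abs_of_pos (pow_pos h1 e),
          abs_of_pos (mul_pos h2 (pow_pos h1 k))]
      rw [hΛ] at ha hb' hc
      set Λ := |l| * p.1 ^ N + |m| * p.1 ^ e + |n| * (p.2 * p.1 ^ k) with hΛd
      have hz1 : ∀ x ∈ Icc (2:Rl) 4, x * p.1 ∈ Ioo 0 (4 * z0) := fun x hx =>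
        ⟨mul_pos (by linarith [hx.1]) h1, by
          have : x * p.1 ≤ 4 * p.1 := by gcongr; exact hx.2
          linarith⟩
      have hpe : 0 < p.1 ^ e := pow_pos h1 e
      have dsc : ∀ x : Rl, HasDerivAt (fun x => x * p.1) p.1 x := fun x => by
        simpa using (hasDerivAt_id x).mul_const p.1
      have := hb A B D (ρ p) Λ (fun x => V (x * p.1) / p.1 ^ e) (fun x => V1 (x * p.1) * p.1 / p.1 ^ e)
        (fun x => V2 (x * p.1) * p.1 * p.1 / p.1 ^ e) (fun x => V3 (x * p.1) * p.1 * p.1 * p.1 / p.1 ^ e)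
        (fun x => H (x.1 * p.1, x.2 * p.2)) (fun x => Hz (x.1 * p.1, x.2 * p.2) * p.1)
        (fun x => Hy (x.1 * p.1, x.2 * p.2) * p.2) hs pz
        (fun x hx => ((dV _ (hz1 x hx)).comp x (dsc x)).div_const _)
        (fun x hx => (((dV1 _ (hz1 x hx)).comp x (dsc x)).mul_const _).div_const _)
        (fun x hx => ((((dV2 _ (hz1 x hx)).comp x (dsc x)).mul_const _).mul_const _).div_const _)
        (by
          exact ((((cV3.comp fz (fun x hx => hz1 x hx)).mul continuousOn_const).mul continuousOn_const).mul continuousOn_const).div_const _)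
        (fun x hx => by
          have e' : x * (V1 (x * p.1) * p.1 / p.1 ^ e) - e * x ^ e =
            (x * p.1 * V1 (x * p.1) - e * (x * p.1) ^ e) / p.1 ^ e := by rw [mul_pow x p.1 e]; field_simp
          rw [e', abs_div, abs_of_pos hpe, div_le_iff₀ hpe]
          refine (bV1 _ (hz1 x hx)).trans (le_of_eq ?_)
          rw [mul_pow]; ring)
        (fun x hx => by
          have e' : x ^ 2 * (V2 (x * p.1) * p.1 * p.1 / p.1 ^ e) - e * (e - 1) * x ^ e =
            ((x * p.1) ^ 2 * V2 (x * p.1) - e * (e - 1) * (x * p.1) ^ e) / p.1 ^ e := by rw [mul_pow x p.1 e]; field_simp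
          rw [e', abs_div, abs_of_pos hpe, div_le_iff₀ hpe]
          refine (bV2 _ (hz1 x hx)).trans (le_of_eq ?_)
          rw [mul_pow]; ring)
        (fun x hx => by
          have hx0 : 0 < x := by linarith [hx.1]
          have h4 : x ^ e ≤ 4 ^ e := by have := hx.2; gcongr
          rw [abs_div, abs_of_pos hpe, div_le_iff₀ hpe]
          calc |V3 (x * p.1) * p.1 * p.1 * p.1| ≤ x ^ 3 * |V3 (x * p.1) * p.1 * p.1 * p.1| :=
                le_mul_of_one_le_left (abs_nonneg _) (one_le_pow₀ (by linarith [hx.1]))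
            _ = |(x * p.1) ^ 3 * V3 (x * p.1)| := by
                rw [show (x * p.1) ^ 3 * V3 (x * p.1) = x ^ 3 * (V3 (x * p.1) * p.1 * p.1 * p.1) by ring,
                  abs_mul (x ^ 3), abs_of_pos (pow_pos hx0 3)]
            _ ≤ _ := (bV3 _ (hz1 x hx))
            _ = M * x ^ e * p.1 ^ e := by rw [mul_pow]; ring
            _ ≤ _ := by gcongr)
        (fun x hx t ht => by
          exact ((dHz _ (hmem (x, t) ⟨hx, ht⟩)).comp x (dsc x)))
        (fun x hx t ht => by
          exact ((dHy _ (hmem (x, t) ⟨hx, ht⟩)).comp t (by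
            simpa using (hasDerivAt_id t).mul_const p.2)))
        (cH.comp fz hmem)
        ((cHz.comp fz hmem).mul continuousOn_const)
        ((cHy.comp fz hmem).mul continuousOn_const)
        (fun x hx => by
          obtain ⟨q1, q2, q3⟩ := hρ p hp x hx
          refine ⟨q1, ?_, ?_⟩
          · refine le_trans ?_ q2
            rw [mul_assoc, abs_mul x.1, mul_comm p.1]
            apply le_mul_of_one_le_left (abs_nonneg _)
            exact le_trans (by linarith [hx.1.1]) (le_abs_self _)
          · refine le_trans ?_ q3
            rw [mul_assoc, abs_mul x.2, mul_comm p.2]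
            apply le_mul_of_one_le_left (abs_nonneg _)
            exact le_trans (hx.2.1) (le_abs_self _))
      have e2 : ∫ x in BX, F (x.1 * p.1, x.2 * p.2) = ∫ x in (Icc (2:Rl) 4 ×ˢ Icc (1:Rl) 2),
        ((H (x.1 * p.1, x.2 * p.2)) : ℂ) * Complex.exp (Complex.I *
        ((Λ * (A * x.1 ^ N + B * (V (x.1 * p.1) / p.1 ^ e) + D * (x.2 * x.1 ^ k)) : Rl) : ℂ)) := by
        apply setIntegral_congr_fun BX_meas
        intro x hx
        simp only [hF]
        congr 4
        have : m * V (x.1 * p.1) = (m * p.1 ^ e) * (V (x.1 * p.1) / p.1 ^ e) := by field_simp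
        rw [this, hb', mul_pow, mul_pow]
        calc l * (x.1 ^ N * p.1 ^ N) + Λ * B * (V (x.1 * p.1) / p.1 ^ e) + n * (x.2 * p.2 * (x.1 ^ k * p.1 ^ k))
            = (l * p.1 ^ N) * x.1 ^ N + Λ * B * (V (x.1 * p.1) / p.1 ^ e) +
              (n * (p.2 * p.1 ^ k)) * (x.2 * x.1 ^ k) := by ring
          _ = _ := by rw [ha, hc]; ring
      rw [e2]
      refine this.trans (le_of_eq ?_)
      ring

lemma analytic_avg {E : Type*} [NormedAddCommGroup E] [NormedSpace Rl E] (F : E → Rl)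
    (hF : AnalyticAt Rl F 0) (A : Rl → E →L[Rl] E) (cA : Continuous A)
    (bA : ∀ t ∈ Icc Zr 1, ‖A t‖ ≤ 1) :
    AnalyticAt Rl (fun v => ∫ t in Zr..1, F (A t v)) 0 := by
  obtain ⟨p, r, hp⟩ := hF
  have cq : ∀ n, Continuous (fun t => (p n).compContinuousLinearMap (fun _ => A t)) := by
    intro n
    exact ((((ContinuousMultilinearMap.compContinuousLinearMapContinuousMultilinear Rl
      (fun _ : Fin n => E) (fun _ : Fin n => E) Rl).cont).comp fz).clm_apply (continuous_const (y := p n)))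
  have bq : ∀ n, ∀ t ∈ Icc Zr 1, ‖(p n).compContinuousLinearMap (fun _ => A t)‖ ≤ ‖p n‖ := by
    intro n t ht
    refine ((p n).norm_compContinuousLinearMap_le _).trans ?_
    apply mul_le_of_le_one_right (norm_nonneg _)
    apply Finset.prod_le_one (fun _ _ => norm_nonneg _) (fun _ _ => bA t ht)
  let q : FormalMultilinearSeries Rl E Rl :=
    fun n => ∫ t in Zr..1, (p n).compContinuousLinearMap (fun _ => A t)
  refine ⟨q, r, ⟨hp.r_le.trans (FormalMultilinearSeries.radius_le_of_le (by
    intro n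
    simpa using (intervalIntegral.norm_integral_le_of_norm_le_const (a := Zr) (b := 1)
      (f := fun t => (p n).compContinuousLinearMap (fun _ => A t)) (C := ‖p n‖) (fun t ht => by
        rw [uIoc_of_le zero_le_one] at ht
        exact bq n t ⟨ht.1.le, ht.2⟩)))), hp.r_pos, ?_⟩⟩
  intro y hy
  have hAy : ∀ t ∈ Icc Zr 1, ‖A t y‖ ≤ ‖y‖ := fun t ht =>
    ((A t).le_opNorm y).trans (mul_le_of_le_one_left (norm_nonneg _) (bA t ht))
  have e1 : ∀ n, (q n) (fun _ => y) = ∫ t in Zr..1, (p n) (fun _ => A t y) := by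
    intro n
    exact ((ContinuousMultilinearMap.apply Rl (fun _ : Fin n => E) Rl (fun _ => y)).intervalIntegral_comp_comm
      ((cq n).intervalIntegrable (μ := volume) 0 1)).symm
  simp only [e1]
  have hy' : ‖y‖ₑ < r := by simpa using hy
  apply intervalIntegral.hasSum_integral_of_dominated_convergence (fun n _ => ‖p n‖ * ‖y‖ ^ n)
  · intro n
    apply Continuous.aestronglyMeasurable
    exact (p n).cont.comp (continuous_pi fun _ => fz)
  · intro n
    filter_upwards with t ht
    rw [uIoc_of_le zero_le_one] at ht
    refine ((p n).le_opNorm _).trans ?_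
    simp only [Finset.prod_const, Finset.card_univ, Fintype.card_fin]
    have := hAy t ⟨ht.1.le, ht.2⟩
    gcongr
  · filter_upwards with t ht using (by
    simpa using (p.summable_norm_mul_pow (r := ‖y‖₊) (lt_of_lt_of_le hy' hp.r_le)))
  · exact intervalIntegrable_const
  · filter_upwards with t ht
    rw [uIoc_of_le zero_le_one] at ht
    simpa using hp.hasSum (by
      simp only [Metric.mem_eball, edist_zero_right]
      refine lt_of_le_of_lt ?_ hy'
      rw [← ofReal_norm, ← ofReal_norm]
      exact ENNReal.ofReal_le_ofReal (hAy t ⟨ht.1.le, ht.2⟩))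

/-- division by the last variable -/
lemma div_lemma {E : Type*} [NormedAddCommGroup E] [NormedSpace Rl E] (f : E × Rl → Rl)
    (hf : AnalyticAt Rl f 0) :
    ∃ f1 : E × Rl → Rl, AnalyticAt Rl f1 0 ∧ ∀ᶠ p in nhds (0 : E × Rl), f p = f (p.1, 0) + p.2 * f1 p := by
  let A : Rl → (E × Rl) →L[Rl] (E × Rl) := fun t =>
    (ContinuousLinearMap.fst Rl E Rl).prod (t • ContinuousLinearMap.snd Rl E Rl)
  have hAa : ∀ t p, A t p = (p.1, t * p.2) := fun t p => rfl
  have bA0 : ∀ t ∈ Icc Zr 1, ∀ p, ‖A t p‖ ≤ ‖p‖ := by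
    intro t ht p
    rw [hAa, Prod.norm_def, Prod.norm_def]
    apply max_le_max le_rfl
    rw [norm_mul]
    apply mul_le_of_le_one_left (norm_nonneg _)
    rw [Real.norm_of_nonneg ht.1]; exact ht.2
  have hd : AnalyticAt Rl (fun p => fderiv Rl f p (0, 1)) 0 := by
    exact ((ContinuousLinearMap.apply Rl Rl ((0, 1) : E × Rl)).analyticAt _).comp hf.fderiv
  refine ⟨_, analytic_avg _ hd A (by
    have e : A = fun t => (ContinuousLinearMap.inl Rl E Rl).comp (ContinuousLinearMap.fst Rl E Rl) +
       t • (ContinuousLinearMap.inr Rl E Rl).comp (ContinuousLinearMap.snd Rl E Rl) := by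
      funext t; ext p <;> simp [A]
    rw [e]; fun_prop) (fun t ht =>
    ContinuousLinearMap.opNorm_le_bound _ zero_le_one (fun p => by rw [one_mul]; exact bA0 t ht p)), ?_⟩
  obtain ⟨ε, hε, hball⟩ := Metric.eventually_nhds_iff.1 hf.eventually_analyticAt
  filter_upwards [Metric.ball_mem_nhds (0:E × Rl) hε] with p hp
  have hm : ∀ t ∈ Icc Zr 1, AnalyticAt Rl f (p.1, t * p.2) := by
    intro t ht
    apply hball
    rw [dist_zero_right]
    have := bA0 t ht p
    rw [hAa] at this
    exact this.trans_lt (by simpa using hp)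
  have hder : ∀ t ∈ Icc Zr 1, HasDerivAt (fun t => f (p.1, t * p.2)) (fderiv Rl f (p.1, t * p.2) (0, p.2)) t := by
    intro t ht
    exact ((hm t ht).differentiableAt.hasFDerivAt).comp_hasDerivAt t (by
      exact ((hasDerivAt_const t p.1)).prodMk (by simpa using (hasDerivAt_id t).mul_const p.2))
  have hlin : ∀ t, fderiv Rl f (p.1, t * p.2) (0, p.2) = p.2 * fderiv Rl f (p.1, t * p.2) (0, 1) := by
    intro t
    have : ((0, p.2) : E × Rl) = p.2 • (0, 1) := by simp
    rw [this, map_smul, smul_eq_mul]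
  have ftc := intervalIntegral.integral_eq_sub_of_hasDerivAt (a := Zr) (b := 1)
    (f := fun t => f (p.1, t * p.2)) (f' := fun t => fderiv Rl f (p.1, t * p.2) (0, p.2))
    (fun t ht => hder t (by rwa [uIcc_of_le zero_le_one] at ht))
    (by
      apply ContinuousOn.intervalIntegrable
      rw [uIcc_of_le zero_le_one]
      intro t ht
      apply ContinuousAt.continuousWithinAt
      exact (ContinuousAt.comp (g := fderiv Rl f) (f := fun t : Rl => ((p.1, t * p.2) : E × Rl)) ((hm t ht).fderiv.continuousAt) fz).clm_apply continuousAt_const)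
  simp only [hlin, intervalIntegral.integral_const_mul, one_mul, zero_mul] at ftc
  simp only [hAa]
  linarith

lemma exp_lemma {E : Type*} [NormedAddCommGroup E] [NormedSpace Rl E] (m : Nat) : ∀ (f : E × Rl → Rl)
    (_ : AnalyticAt Rl f 0), ∃ (c : Nat → E → Rl) (U : E × Rl → Rl), (∀ i, AnalyticAt Rl (c i) 0) ∧
    AnalyticAt Rl U 0 ∧
    ∀ᶠ p in nhds 0, f p = ∑ i ∈ Finset.range m, c i p.1 * p.2 ^ i + p.2 ^ m * U p := by
  induction m with
  | zero => intro f hf; exact ⟨fun _ _ => 0, f, by fun_prop, hf, by simp⟩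
  | succ m ih =>
    intro f hf
    obtain ⟨f1, hf1, e1⟩ := div_lemma f hf
    obtain ⟨c, U, hc, hU, e2⟩ := ih f1 hf1
    refine ⟨fun i => match i with
      | 0 => fun x => f (x, 0)
      | i+1 => c i, U, ?_, hU, ?_⟩
    · intro i
      cases i with
      | zero =>
        fun_prop
      | succ i => exact hc i
    · filter_upwards [e1, e2] with p h1 h2
      rw [h1, h2, Finset.sum_range_succ']
      simp  [mul_add, Finset.mul_sum]
      have : ∀ i, p.2 * c i p.1 * p.2 ^ i = c i p.1 * p.2 ^ (i + 1) := fun i => by ring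
      ring

lemma uniq_lemma (m : Nat) : ∀ (c : Nat → Rl) (u : Fr), ContinuousAt u 0 →
    (∀ᶠ y in 𝓝[≠] 0, ∑ i ∈ Finset.range m, c i * y ^ i + y ^ m * u y = 0) →
    (∀ i < m, c i = 0) ∧ u 0 = 0 := by
  induction m with
  | zero =>
    intro c u hu h
    refine ⟨by simp, ?_⟩
    exact tendsto_nhds_unique (hu.tendsto.mono_left nhdsWithin_le_nhds) (by
      refine tendsto_const_nhds.congr' ?_
      filter_upwards [h] with y hy
      simpa using hy.symm)
  | succ m ih =>
    intro c u hu h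
    have h2 : Tendsto (fun y => ∑ i ∈ Finset.range (m+1), c i * y ^ i + y ^ (m+1) * u y) (𝓝[≠] 0) (nhds 0) := by
      refine tendsto_const_nhds.congr' ?_
      filter_upwards [h] with y hy using hy.symm
    have h3 := tendsto_nhds_unique (by
      have : ContinuousAt (fun y => ∑ i ∈ Finset.range (m+1), c i * y ^ i + y ^ (m+1) * u y) 0 := by
        fun_prop
      exact this.tendsto.mono_left nhdsWithin_le_nhds) h2
    rw [Finset.sum_range_succ'] at h3
    simp at h3
    obtain ⟨i1, i2⟩ := ih (fun i => c (i+1)) u hu (by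
      filter_upwards [h, self_mem_nhdsWithin] with y hy hy0
      rw [Finset.sum_range_succ', h3] at hy
      exact (mul_eq_zero.1 (by
        rw [mul_add, Finset.mul_sum]
        have h4 : ∀ i, y * c (i+1) * y ^ i = c (i+1) * y ^ (i + 1) := fun i => by ring
        rw [← hy]; ring)).resolve_left hy0)
    refine ⟨?_, i2⟩
    intro i hi
    cases i with
    | zero => exact h3
    | succ i => exact i1 i (by omega)

attribute [fun_prop] analyticAt_fst analyticAt_snd

lemma pow_exp2 (k : Nat) : ∃ Q , (∀ p, AnalyticAt Rl Q p) ∧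
    ∀ h y : Rl, (h + y) ^ (k + 1) = y ^ (k + 1) + (k + 1) * h * y ^ k + h ^ 2 * Q (h, y) := by
  induction k with
  | zero => exact ⟨fun _ => 0, by fun_prop, fun h y => by ring⟩
  | succ k ih =>
    obtain ⟨Q, hQ, e⟩ := ih
    refine ⟨fun p => (k + 1) * p.2 ^ k + (p.1 + p.2) * Q p, fun p => ?_, fun h y => ?_⟩
    · fun_prop
    · rw [pow_succ, e h y]; push_cast; ring

lemma an_comp {E F : Type*} [NormedAddCommGroup E] [NormedSpace Rl E] [NormedAddCommGroup F]
    [NormedSpace Rl F] {g : F → Rl} {f : E → F} (x : E) {y : F} (hg : AnalyticAt Rl g y) (hf : AnalyticAt Rl f x)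
    (h : f x = y) : AnalyticAt Rl (fun x => g (f x)) x := by
  subst h
  fun_prop

lemma coef_zero (m : Nat) (f : Fl) (c : Nat → Rl → Rl) (U : Fl) (r : Fr)
    (hU : AnalyticAt Rl U 0) (hr : ContinuousAt r 0) (hr0 : r 0 ≠ 0)
    (e : ∀ᶠ p in nhds 0, f p = ∑ i ∈ Finset.range m, c i p.1 * p.2 ^ i + p.2 ^ m * U p)
    (h0 : ∀ᶠ y in nhds 0, f (0, y) = y ^ m * r y) : (∀ i < m, c i 0 = 0) ∧ U 0 ≠ 0 := by
  obtain ⟨h1, h2⟩ := uniq_lemma m (fun i => c i 0) (fun y => U (0, y) - r y) fz (by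
    apply nhdsWithin_le_nhds
    filter_upwards [(by
      have  := by
        have : ContinuousAt (fun y : Rl => ((0, y) : Pl)) 0 := by fun_prop
        exact this
      exact this.eventually e), h0] with y h1 h2
    linarith)
  refine ⟨h1, ?_⟩
  intro h
  apply hr0
  have : U (0, 0) = 0 := h
  linarith

lemma shift_lemma (k : Nat) (f : Fl) (hf : AnalyticAt Rl f 0) (r : Fr) (hr : AnalyticAt Rl r 0)
    (hr0 : r 0 ≠ 0) (h0 : ∀ᶠ y in nhds Zr, f (0, y) = y ^ (k + 1) * r y) :
    ∃ (h : Fr) (c : Nat → Rl → Rl) (U : Fl), AnalyticAt Rl h 0 ∧ h 0 = 0 ∧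
      (∀ i, AnalyticAt Rl (c i) 0) ∧ AnalyticAt Rl U 0 ∧ (∀ᶠ z in nhds Zr, c k z = 0) ∧
    ∀ᶠ p in nhds (0 : Pl), f (p.1, h p.1 + p.2) =
      ∑ i ∈ Finset.range (k + 1), c i p.1 * p.2 ^ i + p.2 ^ (k + 1) * U p := by
  have hg : AnalyticAt Rl (fun p : Pl × Rl => f (p.1.1, p.1.2 + p.2)) 0 :=
    an_comp (0 : Pl × Rl) hf fz (by simp)
  obtain ⟨c, U, hc, hU, e⟩ := exp_lemma (k + 1) _ hg
  obtain ⟨Q, hQ, eQ⟩ := pow_exp2 k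
  have hR : AnalyticAt Rl (fun p : Pl => r (p.1 + p.2)) 0 :=
    an_comp (0 : Pl) hr fz (by simp)
  obtain ⟨R1, hR1, eR⟩ := div_lemma _ hR
  have hT : AnalyticAt Rl (fun p : Pl => Q p * r (p.1 + p.2)) 0 := (hQ 0).mul hR
  obtain ⟨d, W, hd, hW, eT⟩ := exp_lemma (k + 1) _ hT
  have hck : ∀ᶠ s in nhds Zr, c k (0, s) = (k + 1) * s * r s + s ^ 2 * d k s := by
    have ev3 : ∀ᶠ s in nhds Zr, ∀ᶠ y in nhds Zr, r (s + y) = r s + y * R1 (s, y) := by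
      rw [show (0 : Pl) = (0, 0) from rfl, nhds_prod_eq] at eR
      simpa using (eR).curry
    have t0 : Tendsto (fun s : Rl => ((s, 0) : Pl)) (nhds 0) (nhds 0) := by
      have : ContinuousAt (fun s : Rl => ((s, 0) : Pl)) 0 := by fun_prop
      exact this
    have t1 : Tendsto (fun s : Rl => (((0, s), 0) : Pl × Rl)) (nhds 0) (nhds 0) := by
      have : ContinuousAt (fun s : Rl => (((0, s), 0) : Pl × Rl)) 0 := by fun_prop
      exact this
    filter_upwards [(by
      have t : Tendsto (fun q : Pl => (((0, q.1), q.2) : Pl × Rl)) (nhds (0, 0)) (nhds 0) := by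
        have : ContinuousAt (fun q : Pl => (((0, q.1), q.2) : Pl × Rl)) (0, 0) := by fun_prop
        exact this
      have := t.eventually e
      rw [nhds_prod_eq] at this
      exact this.curry), (by
      have t : Tendsto (fun q : Pl => q.1 + q.2) (nhds (0, 0)) (nhds 0) := by
        have : ContinuousAt (fun q : Pl => q.1 + q.2) (0, 0) := by fun_prop
        simpa [ContinuousAt] using this
      have := t.eventually h0
      rw [nhds_prod_eq] at this
      exact this.curry), ev3, (by
      have := eT
      rw [show (0 : Pl) = (0, 0) from rfl, nhds_prod_eq] at this
      exact this.curry), t1.eventually hU.eventually_analyticAt,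
      t0.eventually hW.eventually_analyticAt, t0.eventually hR1.eventually_analyticAt,
      t0.eventually hR.eventually_analyticAt] with s a1 a2 a3 a4 aU aW aR1 aR
    have cont : ContinuousAt (fun y => U ((0, s), y) - s ^ 2 * W (s, y) - r (s + y) - (k + 1) * s * R1 (s, y)) 0 := by
      have i1 := (an_comp Zr aU fz rfl).continuousAt
      have i2 := (an_comp Zr aW fz rfl).continuousAt
      have i3 := (an_comp Zr aR1 fz rfl).continuousAt
      have i4 := (an_comp Zr (f := fun y : Rl => ((s, y) : Pl)) aR fz rfl).continuousAt
      exact ((i1.sub (continuousAt_const.mul i2)).sub i4).sub (continuousAt_const.mul i3)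
    obtain ⟨hz, -⟩ := uniq_lemma (k + 1)
      (fun i => c i (0, s) - s ^ 2 * d i s - if i = k then (k + 1) * s * r s else 0) _ cont (by
      apply nhdsWithin_le_nhds
      filter_upwards [a1, a2, a3, a4] with y b1 b2 b3 b4
      have hsum : ∑ i ∈ Finset.range (k + 1), (c i (0, s) - s ^ 2 * d i s - if i = k then (k + 1) * s * r s else 0) * y ^ i
          = ∑ i ∈ Finset.range (k + 1), c i (0, s) * y ^ i - s ^ 2 * ∑ i ∈ Finset.range (k + 1), d i s * y ^ i
            - (k + 1) * s * r s * y ^ k := by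
        have : (k + 1) * s * r s * y ^ k = ∑ i ∈ Finset.range (k + 1), (if i = k then (k + 1) * s * r s else 0) * y ^ i := by
          rw [Finset.sum_eq_single k]
          · simp
          · intro i _ hi; simp [hi]
          · intro h; simp at h
        rw [this, Finset.mul_sum, ← Finset.sum_sub_distrib, ← Finset.sum_sub_distrib]
        apply Finset.sum_congr rfl; intro i _; ring
      rw [hsum]
      rw [b2, eQ s y] at b1
      have b5 : r s = r (s + y) - y * R1 (s, y) := by linarith
      rw [b5]
      have c1 : ∑ i ∈ Finset.range (k + 1), c i (0, s) * y ^ i =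
        (y ^ (k + 1) + (k + 1) * s * y ^ k + s ^ 2 * Q (s, y)) * r (s + y) - y ^ (k + 1) * U ((0, s), y) := by linarith
      have c2 : ∑ i ∈ Finset.range (k + 1), d i s * y ^ i = Q (s, y) * r (s + y) - y ^ (k + 1) * W (s, y) := by linarith
      rw [c1, c2]; ring)
    have := hz k (by omega)
    simp only [if_true] at this
    linarith
  have ck0 : c k (0, 0) = 0 := by
    simpa using hck.self_of_nhds
  have hder : fderiv Rl (c k) (0, 0) (0, 1) ≠ 0 := by
    have hcd : HasFDerivAt (c k) (fderiv Rl (c k) (0, 0)) (0, 0) := (hc k).differentiableAt.hasFDerivAt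
    have h3 : HasDerivAt (fun s : Rl => (k + 1) * s * r s + s ^ 2 * d k s) ((k + 1) * r 0) 0 := by
      exact ((((((hasDerivAt_id Zr).const_mul ((k:Rl) + 1)).mul hr.differentiableAt.hasDerivAt).add (((hasDerivAt_id Zr).pow 2).mul ((hd k).differentiableAt.hasDerivAt)))) : HasDerivAt (fun s : Rl => (k + 1) * s * r s + s ^ 2 * d k s) _ 0).congr_deriv (by simp)
    rw [((hcd.comp_hasDerivAt Zr ((hasDerivAt_const Zr Zr).prodMk (hasDerivAt_id Zr))).unique (h3.congr_of_eventuallyEq hck))]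
    have : Zr < k + 1 := by positivity
    exact mul_ne_zero this.ne' hr0
  have cdf : ContDiffAt Rl ⊤ (c k) ((0, 0) : Pl) := (hc k).contDiffAt
  have inv : (fderiv Rl (c k) (0, 0) ∘L ContinuousLinearMap.inr Rl Rl Rl).IsInvertible := by
    refine ⟨ContinuousLinearEquiv.unitsEquivAut Rl (Units.mk0 _ hder), ?_⟩
    ext
    simp
  let h := cdf.implicitFunction (by simp) inv
  have hh0 : h 0 = 0 := cdf.implicitFunction_apply_self (by simp) inv
  have hha : AnalyticAt Rl h 0 := by
    exact (cdf.contDiffAt_implicitFunction (by simp) inv).analyticAt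
  refine ⟨h, fun i z => c i (z, h z), fun p => U ((p.1, h p.1), p.2), hha, hh0, ?_, ?_, (by
    have := cdf.eventually_apply_implicitFunction (by simp) inv
    rw [ck0] at this
    exact this), ?_⟩
  · intro i
    exact an_comp Zr (f := fun z => (z, h z)) (hc i) (analyticAt_id.prod hha) (by simp [hh0])
  · refine an_comp (0:Pl) (f := fun p : Pl => ((p.1, h p.1), p.2)) hU ?_ (by simp [hh0])
    have : AnalyticAt Rl (fun p : Pl => h p.1) 0 := an_comp (0:Pl) hha fz rfl
    fun_prop
  · have t : Tendsto (fun p : Pl => (((p.1, h p.1), p.2) : Pl × Rl)) (nhds 0) (nhds 0) := by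
      have c2 : ContinuousAt (fun p : Pl => h p.1) 0 :=
        (an_comp (0:Pl) hha (by fun_prop : AnalyticAt Rl (fun p : Pl => p.1) 0) rfl).continuousAt
      have : ContinuousAt (fun p : Pl => (((p.1, h p.1), p.2) : Pl × Rl)) 0 := by fun_prop
      have e0 : (((0 : Pl).1, h (0 : Pl).1), (0 : Pl).2) = (0 : Pl × Rl) := by simp [hh0]
      rw [ContinuousAt, e0] at this
      exact this
    exact t.eventually e

lemma v_step (e j : Nat) (w : Fr) {z : Rl} (hz : 0 < z) (hw : DifferentiableAt Rl w z) :
    HasDerivAt (fun z => z ^ e * w z / z ^ j) (z ^ e * ((e - j) * w z + z * deriv w z) / z ^ (j + 1)) z := by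
  refine HasDerivAt.congr_deriv (((hasDerivAt_pow e z).mul hw.hasDerivAt).div (hasDerivAt_pow j z) (pow_pos hz j).ne') ?_
  have he : e * z ^ (e - 1) = e * z ^ e / z := by
    cases e with
    | zero => simp
    | succ e => simp  [Nat.add_sub_cancel, pow_succ]; field_simp
  have hj : j * z ^ (j - 1) = j * z ^ j / z := by
    cases j with
    | zero => simp
    | succ e => simp only [Nat.add_sub_cancel, pow_succ]; field_simp
  simp only [Pi.mul_apply]
  rw [he, hj]
  field_simp
  ring

lemma V_lem (e : Nat) (w : Fr) (hw : AnalyticAt Rl w 0) (hw0 : w 0 = 1) {η : Rl} (hη : 0 < η) :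
    ∃ M , 0 ≤ M ∧ ∃ d > 0, ∃ V1 V2 V3 ,
    (∀ z ∈ Ioo 0 d, HasDerivAt (fun z => z ^ e * w z) (V1 z) z) ∧ (∀ z ∈ Ioo 0 d, HasDerivAt V1 (V2 z) z) ∧
    (∀ z ∈ Ioo 0 d, HasDerivAt V2 (V3 z) z) ∧ ContinuousOn V3 (Ioo 0 d) ∧
    (∀ z ∈ Ioo 0 d, |z * V1 z - e * z ^ e| ≤ η * z ^ e) ∧
    (∀ z ∈ Ioo 0 d, |z ^ 2 * V2 z - e * (e - 1) * z ^ e| ≤ η * z ^ e) ∧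
    ∀ z ∈ Ioo 0 d, |z ^ 3 * V3 z| ≤ M * z ^ e := by
  let w1  := fun z => (e - 0) * w z + z * deriv w z
  let w2  := fun z => (e - (1:Nat)) * w1 z + z * deriv w1 z
  let w3  := fun z => (e - 2) * w2 z + z * deriv w2 z
  have a1 : AnalyticAt Rl w1 0 := (analyticAt_const.mul hw).add (analyticAt_id.mul hw.deriv)
  have a2 : AnalyticAt Rl w2 0 := (analyticAt_const.mul a1).add (analyticAt_id.mul a1.deriv)
  have a3 : AnalyticAt Rl w3 0 := (analyticAt_const.mul a2).add (analyticAt_id.mul a2.deriv)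
  have z1 : w1 0 = e := by simp [w1, hw0]
  have z2 : w2 0 = e * (e - 1) := by simp [w2, z1]; ring
  have ev1 : ∀ᶠ z in nhds 0, |w1 z - e| < η := by
    have  := by
      simpa [ContinuousAt, z1] using ((a1.continuousAt.sub (continuousAt_const (y := (e:Rl)))).abs)
    exact this.eventually (gt_mem_nhds hη)
  have ev2 : ∀ᶠ z in nhds 0, |w2 z - e * (e - 1)| < η := by
    have : Tendsto (fun z => |w2 z - e * (e - 1)|) (nhds 0) (nhds 0) := by
      simpa [ContinuousAt, z2] using ((a2.continuousAt.sub (continuousAt_const (y := (e:Rl) * (e - 1)))).abs)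
    exact this.eventually (gt_mem_nhds hη)
  obtain ⟨d, hd, hh⟩ := Metric.eventually_nhds_iff.1 (ev1.and (ev2.and ((a3.continuousAt.abs.eventually (gt_mem_nhds (lt_add_one _))).and
    (hw.eventually_analyticAt.and (a1.eventually_analyticAt.and (a2.eventually_analyticAt.and a3.eventually_analyticAt))))))
  have hh'  := fun z (hz : z ∈ Ioo 0 d) =>
    hh (y := z) (by rw [dist_zero_right, Real.norm_of_nonneg hz.1.le]; exact hz.2)
  refine ⟨|w3 0| + 1, by positivity, d, hd, fun z => z ^ e * w1 z / z ^ 1, fun z => z ^ e * w2 z / z ^ 2,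
    fun z => z ^ e * w3 z / z ^ 3, ?_, ?_, ?_, ?_, ?_, ?_, ?_⟩
  · intro z hz
    obtain ⟨-, -, -, h4, h5, h6, h7⟩ := hh' z hz
    simpa [w1] using (v_step e 0 w hz.1 h4.differentiableAt)
  · intro z hz
    obtain ⟨-, -, -, h4, h5, h6, h7⟩ := hh' z hz
    exact v_step e 1 w1 hz.1 h5.differentiableAt
  · intro z hz
    obtain ⟨-, -, -, h4, h5, h6, h7⟩ := hh' z hz
    exact v_step e 2 w2 hz.1 h6.differentiableAt
  · intro z hz
    obtain ⟨-, -, -, h4, h5, h6, h7⟩ := hh' z hz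
    exact (((continuousAt_id.pow e).mul h7.continuousAt).div (continuousAt_id.pow 3) (pow_pos hz.1 3).ne').continuousWithinAt
  · intro z hz
    have := (hh' z hz).1
    have hz0 := hz.1
    have e1 : z * (z ^ e * w1 z / z ^ 1) - e * z ^ e = (w1 z - e) * z ^ e := by field_simp
    rw [e1, abs_mul, abs_of_pos (pow_pos hz0 e)]
    gcongr
  · intro z hz
    have := (hh' z hz).2.1
    have hz0 := hz.1
    have e1 : z ^ 2 * (z ^ e * w2 z / z ^ 2) - e * (e - 1) * z ^ e = (w2 z - e * (e - 1)) * z ^ e := by field_simp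
    rw [e1, abs_mul, abs_of_pos (pow_pos hz0 e)]
    gcongr
  · intro z hz
    have := (hh' z hz).2.2.1
    have hz0 := hz.1
    have e1 : z ^ 3 * (z ^ e * w3 z / z ^ 3) = w3 z * z ^ e := by field_simp
    rw [e1, abs_mul, abs_of_pos (pow_pos hz0 e)]
    gcongr

def chart (v : Pl) (N k : Nat) (q : Fr) (p : Pl) : Pl :=
  (p.1 ^ N) • v + (q p.1 + p.1 ^ k * p.2) • perp2 v

lemma dot_chart_v (hv : Un v) (N k : Nat) (q : Fr) (p : Pl) :
    dot2 (chart v N k q p) v = p.1 ^ N := by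
  simp  [dot2, chart, perp2, Prod.fst_add, Prod.snd_add, Prod.smul_fst, Prod.smul_snd]
  linear_combination p.1 ^ N * hv

lemma dot_chart_perp (hv : Un v) (N k : Nat) (q : Fr) (p : Pl) :
    dot2 (chart v N k q p) (perp2 v) = q p.1 + p.1 ^ k * p.2 := by
  simp  [dot2, chart, perp2, Prod.fst_add, Prod.snd_add, Prod.smul_fst, Prod.smul_snd]
  linear_combination (q p.1 + p.1 ^ k * p.2) * hv

lemma chart_inj (hv : Un v) (hN : 1 ≤ N) (q : Fr) :
    InjOn (chart v N k q) {p | 0 < p.1} := by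
  intro p hp p' hp' h
  have h1 := dot_chart_v hv N k q p
  rw [h, dot_chart_v hv] at h1
  have h2 := dot_chart_perp hv N k q p
  rw [h, dot_chart_perp hv] at h2
  have e1  := (pow_left_inj₀ hp'.le hp.le (by omega)).1 h1
  rw [e1] at h2
  exact Prod.ext e1.symm (mul_left_cancel₀ (pow_pos hp k).ne' (by linarith)).symm

lemma decomp_v (hv : Un v) (p : Pl) :
    p = dot2 p v • v + dot2 p (perp2 v) • perp2 v := by
  ext
  · simp  [dot2, perp2, Prod.fst_add, Prod.smul_fst]
    linear_combination -p.1 * hv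
  · simp  [dot2, perp2, Prod.snd_add, Prod.smul_snd]
    linear_combination -p.2 * hv

lemma dot_split (hv : Un v) (t u : Rl) (p : Pl) :
    t * p.1 + u * p.2 = dot2 (t, u) v * dot2 p v + dot2 (t, u) (perp2 v) * dot2 p (perp2 v) := by
  simp  [dot2, perp2]
  linear_combination -(t * p.1 + u * p.2) * hv

lemma nrm_sq (hv : Un v) (p : Pl) :
    p.1 ^ 2 + p.2 ^ 2 = dot2 p v ^ 2 + dot2 p (perp2 v) ^ 2 := by
  simp  [dot2, perp2]
  linear_combination -(p.1 ^ 2 + p.2 ^ 2) * hv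

lemma nrm_le (hv : Un v) (p : Pl) :
    nrm2 p ≤ |dot2 p v| + |dot2 p (perp2 v)| := by
  unfold nrm2
  rw [nrm_sq hv]
  apply Real.sqrt_le_iff.2 ⟨by positivity, ?_⟩
  rw [add_sq, sq_abs, sq_abs]
  have : 0 ≤ 2 * |dot2 p v| * |dot2 p (perp2 v)| := by positivity
  linarith

lemma dot_le_nrm (hv : Un v) (p : Pl) : |dot2 p v| ≤ nrm2 p := by
  unfold nrm2
  rw [nrm_sq hv]
  apply Real.abs_le_sqrt
  nlinarith

def chartD (v : Pl) (N k : Nat) (q' : Rl) (p : Pl) : Pl →L[Rl] Pl :=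
  ((N * p.1 ^ (N - 1)) • ContinuousLinearMap.fst Rl Rl Rl).smulRight v +
  ((q' + k * p.1 ^ (k - 1) * p.2) • ContinuousLinearMap.fst Rl Rl Rl +
    p.1 ^ k • ContinuousLinearMap.snd Rl Rl Rl).smulRight (perp2 v)

lemma chart_hasFDerivAt (v : Pl) (N k : Nat) (q : Fr) (p : Pl) (hq : DifferentiableAt Rl q p.1) :
    HasFDerivAt (chart v N k q) (chartD v N k (deriv q p.1) p) p := by
  have f1 : HasFDerivAt (fun p : Pl => p.1) (ContinuousLinearMap.fst Rl Rl Rl) p := hasFDerivAt_fst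
  refine HasFDerivAt.congr_fderiv ((((hasDerivAt_pow N p.1).comp_hasFDerivAt p f1).smul_const v).add (((hq.hasDerivAt.comp_hasFDerivAt p f1).add (((hasDerivAt_pow k p.1).comp_hasFDerivAt p f1).mul hasFDerivAt_snd)).smul_const (perp2 v))) ?_
  unfold chartD
  ext <;> simp [mul_comm]

lemma chartD_det (hv : Un v) (N k : Nat) (q' : Rl) (p : Pl) :
    (chartD v N k q' p).det = -(N * p.1 ^ (N - 1) * p.1 ^ k) := by
  rw [det_prod2]
  simp [chartD, perp2]
  linear_combination - N * p.1 ^ (N - 1) * p.1 ^ k * hv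

def BD (K : Rl) (f : Fl) (p : Pl) (s : Rl) : Prop := ContDiffAt Rl 1 f p ∧ |f p| ≤ K ∧
  |p.1 * fderiv Rl f p (1, 0)| ≤ K ∧ |s * fderiv Rl f p (0, 1)| ≤ K

def LB (K : Rl) (f : Fl) : Prop := ∀ p ∈ QQ, BD K f p p.2

lemma BD.mul {K L : Rl} (hf : BD K f p s) (hg : BD L g p s) :
    BD (2 * (K * L)) (fun p => f p * g p) p s := by
  obtain ⟨f1, f2, f3, f4⟩ := hf
  obtain ⟨g1, g2, g3, g4⟩ := hg
  have hK := (abs_nonneg _).trans f2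
  have key : ∀ c a b x y : Rl, |x| ≤ K → |y| ≤ L → |c * a| ≤ K → |c * b| ≤ L →
      |c * (x * b + y * a)| ≤ 2 * (K * L) := by
    intro c a b x y hx hy ha hb
    have e : c * (x * b + y * a) = x * (c * b) + c * a * y := by ring
    rw [e]
    refine (abs_add_le _ _).trans ?_
    rw [abs_mul x, abs_mul (c * a)]
    have h1 := mul_le_mul hx hb (abs_nonneg _) hK
    have h2 := mul_le_mul ha hy (abs_nonneg _) hK
    linarith
  have hd  :=
    fderiv_fun_mul (f1.differentiableAt (by norm_num)) (g1.differentiableAt (by norm_num))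
  refine ⟨f1.mul g1, ?_, ?_, ?_⟩
  · rw [abs_mul]
    have := mul_le_mul f2 g2 (abs_nonneg _) hK
    have  := mul_nonneg hK ((abs_nonneg _).trans g2)
    linarith
  · rw [hd]; exact key _ _ _ _ _ f2 g2 f3 g3
  · rw [hd]; exact key _ _ _ _ _ f2 g2 f4 g4

lemma LB.mul {K L : Rl} (hf : LB K f) (hg : LB L g) :
    LB (2 * (K * L)) fun p => f p * g p := fun p hp => (hf p hp).mul (hg p hp)

noncomputable def mon (B β : Rl) (p : Pl) : Rl := p.1 ^ B * p.2 ^ β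

lemma mon_pos (hp : p ∈ QQ) : 0 < mon B β p :=
  mul_pos (rpow_pos_of_pos hp.1 _) (rpow_pos_of_pos hp.2 _)

lemma mon_cd (hp : p ∈ QQ) : ContDiffAt Rl 1 (mon B β) p :=
  (contDiffAt_fst.rpow_const_of_ne (ne_of_gt hp.1)).mul (contDiffAt_snd.rpow_const_of_ne (ne_of_gt hp.2))

lemma slice1 (h : DifferentiableAt Rl f p) :
    HasDerivAt (fun z => f (z, p.2)) (fderiv Rl f p (1, 0)) p.1 :=
  (show HasFDerivAt f (fderiv Rl f p) (p.1, p.2) from h.hasFDerivAt).comp_hasDerivAt p.1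
    ((hasDerivAt_id p.1).prodMk (hasDerivAt_const p.1 p.2))

lemma slice2 (h : DifferentiableAt Rl f p) :
    HasDerivAt (fun y => f (p.1, y)) (fderiv Rl f p (0, 1)) p.2 :=
  (show HasFDerivAt f (fderiv Rl f p) (p.1, p.2) from h.hasFDerivAt).comp_hasDerivAt p.2
    ((hasDerivAt_const p.2 p.1).prodMk (hasDerivAt_id p.2))

lemma mon_d1 (hp : p ∈ QQ) : p.1 * fderiv Rl (mon B β) p (1, 0) = B * mon B β p := by
  have hp1 : 0 < p.1 := hp.1
  rw [(slice1 ((mon_cd (B := B) (β := β) hp).differentiableAt (by norm_num))).unique ((Real.hasDerivAt_rpow_const (p := B) (by grind)).mul_const (p.2 ^ β)), rpow_sub_one hp1.ne']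
  unfold mon; field_simp

lemma mon_d2 (hp : p ∈ QQ) : p.2 * fderiv Rl (mon B β) p (0, 1) = β * mon B β p := by
  have hp1 : 0 < p.2 := hp.2
  rw [(slice2 ((mon_cd (B := B) (β := β) hp).differentiableAt (by norm_num))).unique ((Real.hasDerivAt_rpow_const (p := β) (by grind)).const_mul (p.1 ^ B)), rpow_sub_one hp1.ne']
  unfold mon; field_simp

lemma rpow_le_abs (h1 : 1 ≤ x) (h2 : x ≤ a) : x ^ B ≤ a ^ |B| :=
  (rpow_le_rpow_of_exponent_le h1 (le_abs_self B)).trans (by gcongr)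

lemma mon_scale {x : Pl} (hp : p ∈ QQ) (hx : x ∈ BX) :
    mon B β (x.1 * p.1, x.2 * p.2) ≤ 4 ^ |B| * 2 ^ |β| * mon B β p := by
  have hp1 : 0 < p.1 := hp.1
  have hp2 : 0 < p.2 := hp.2
  have hx1 : 2 ≤ x.1 ∧ x.1 ≤ 4 := hx.1
  have hx2 : 1 ≤ x.2 ∧ x.2 ≤ 2 := hx.2
  unfold mon
  rw [mul_rpow (by linarith) hp1.le, mul_rpow (by linarith) hp2.le]
  have h1 := rpow_le_abs (B := B) (by linarith) hx1.2
  have h2 := rpow_le_abs (B := β) hx2.1 hx2.2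
  calc _ = x.1 ^ B * x.2 ^ β * (p.1 ^ B * p.2 ^ β) := by ring
    _ ≤ _ := by
      have : 0 ≤ x.2 ^ β := rpow_nonneg (by linarith) _
      gcongr

def TT (d ε κ τ : Rl) (e1 : Nat) : Set Pl := {p | p.1 ≤ d ∧ p.2 ≤ ε ∧ κ * p.1 ^ e1 ≤ τ * p.2}

lemma TT_closed (d ε κ τ : Rl) (e1 : Nat) : IsClosed (TT d ε κ τ e1) :=
  (isClosed_le continuous_fst continuous_const).inter ((isClosed_le continuous_snd continuous_const).inter
    (isClosed_le  (g := fun p : Pl => τ * p.2) fz fz))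

def SS (d ε κ τ : Rl) (e1 : Nat) : Set Pl := {p | p ∈ QQ ∧ p.1 < d ∧ p.2 ≤ ε ∧ κ * p.1 ^ e1 ≤ τ * p.2}

lemma SS_meas (d ε κ τ : Rl) (e1 : Nat) : MeasurableSet (SS d ε κ τ e1) :=
  QQ_meas.inter ((measurableSet_lt measurable_fst measurable_const).inter
   ((measurableSet_le measurable_snd measurable_const).inter
    (measurableSet_le  (g := fun p : Pl => τ * p.2) fz fz)))

lemma SS_sub : SS d ε κ τ e1 ⊆ QQ := fun _ h => h.1

lemma core (N e k : Nat) (hN : 1 ≤ N) (he : N < e) (hk : 1 ≤ k) (w : Fr) (hw : AnalyticAt Rl w 0)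
    (hw0 : w 0 = 1) : ∃ τ > Zr, ∀ δ, 0 < δ → δ < τ → ∀ (B β ε κ τ' K : Rl) (e1 : Nat), 0 ≤ κ → 0 ≤ τ' → 0 < K →
    IntegrableOn (mon B β) (SS (3 * δ / 4) ε κ (2 * τ') e1) → ∃ C > Zr, ∀ φ : Fl,
    LB K φ → (∀ p ∈ QQ, φ p ≠ 0 → p ∈ TT δ ε κ τ' e1) → ∀ l m n : Rl,
    ‖∫ p in QQ, ((φ p * mon B β p : Rl) : ℂ) * Complex.exp (Complex.I *
        ((l * p.1 ^ N + m * (p.1 ^ e * w p.1) + n * (p.2 * p.1 ^ k) : Rl) : ℂ))‖ ≤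
      C * ∫ p in SS (3 * δ / 4) ε κ (2 * τ') e1,
        (1 + (|l| * p.1 ^ N + |m| * p.1 ^ e + |n| * (p.2 * p.1 ^ k))) ^ mh * mon B β p := by
  obtain ⟨η, hη, hTL⟩ := TL N e k hN he hk
  obtain ⟨M, hM, d, hd, V1, V2, V3, c1, c2, c3, c4, c5, c6, c7⟩ := V_lem e w hw hw0 hη
  obtain ⟨C, hC, hTL⟩ := hTL M hM
  refine ⟨d / 3, by positivity, ?_⟩
  intro δ hδ hδd B β ε κ τ' K e1 hκ hτ' hK hint
  set S := SS (3 * δ / 4) ε κ (2 * τ') e1 with hS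
  set L : Rl := (K * (1 + |B| + |β|)) * (4 ^ |B| * 2 ^ |β|) with hL
  have hL0 : 0 < L := by positivity
  refine ⟨C * L, by positivity, ?_⟩
  intro φ hφ hsupp l m n
  have sub : ∀ z ∈ Ioo 0 (4 * (3 * δ / 4)), z ∈ Ioo 0 d := fun z hz => ⟨hz.1, by have := hz.2; linarith⟩
  set H : Fl := fun p => φ p * mon B β p with hH
  have Hcd : ∀ p ∈ QQ, ContDiffAt Rl 1 H p := fun p hp => (hφ p hp).1.mul (mon_cd hp)
  have Hd : ∀ p ∈ QQ, fderiv Rl H p = φ p • fderiv Rl (mon B β) p + mon B β p • fderiv Rl φ p := fun p hp =>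
    fderiv_fun_mul ((hφ p hp).1.differentiableAt (by norm_num)) ((mon_cd hp).differentiableAt (by norm_num))
  have Hon : ContDiffOn Rl 1 H QQ := fun p hp => (Hcd p hp).contDiffWithinAt
  have cfd : ContinuousOn (fderiv Rl H) QQ := Hon.continuousOn_fderiv_of_isOpen QQ_open (by norm_num)
  set ρ : Fl := S.indicator (fun p => L * mon B β p) with hρ
  have iρ : IntegrableOn ρ QQ := by
    rw [hρ, integrableOn_indicator_iff (SS_meas _ _ _ _ _), inter_eq_left.2 SS_sub]
    exact hint.const_mul L
  have bd : ∀ p ∈ QQ, ∀ x ∈ BX, |H (x.1 * p.1, x.2 * p.2)| ≤ ρ p ∧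
      |x.1 * p.1 * fderiv Rl H (x.1 * p.1, x.2 * p.2) (1, 0)| ≤ ρ p ∧
      |x.2 * p.2 * fderiv Rl H (x.1 * p.1, x.2 * p.2) (0, 1)| ≤ ρ p := by
    intro p hp x hx
    have hp1 : 0 < p.1 := hp.1
    have hp2 : 0 < p.2 := hp.2
    have hx1 : (2:Rl) ≤ x.1 ∧ x.1 ≤ 4 := hx.1
    have hx2 : (1:Rl) ≤ x.2 ∧ x.2 ≤ 2 := hx.2
    have hms := mon_scale (B := B) (β := β) hp hx
    set q : Pl := (x.1 * p.1, x.2 * p.2) with hq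
    have hqQ : q ∈ QQ := ⟨mul_pos (by linarith) hp1, mul_pos (by linarith) hp2⟩
    by_cases hT : q ∈ TT δ ε κ τ' e1
    · have hpS : p ∈ S := by
        obtain ⟨t1, t2, t3⟩ := hT
        refine ⟨hp, ?_, ?_, ?_⟩
        · have : 2 * p.1 ≤ x.1 * p.1 := by gcongr; exact hx1.1
          simp only [hq] at t1; linarith
        · have : 1 * p.2 ≤ x.2 * p.2 := by gcongr; exact hx2.1
          simp only [hq] at t2; linarith
        · simp only [hq] at t3
          have h1 : p.1 ^ e1 ≤ (x.1 * p.1) ^ e1 := by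
            gcongr; nlinarith
          have h2 : κ * p.1 ^ e1 ≤ κ * (x.1 * p.1) ^ e1 := by gcongr
          have h3 : τ' * (x.2 * p.2) ≤ τ' * (2 * p.2) := by gcongr; exact hx2.2
          linarith
      have e : ρ p = L * mon B β p := indicator_of_mem hpS _
      obtain ⟨-, f2, f3, f4⟩ := hφ q hqQ
      have hm0 := mon_pos (B := B) (β := β) hqQ
      have key : ∀ c : Rl, c ≤ K * (1 + |B| + |β|) * mon B β q → c ≤ ρ p := by
        intro c hc
        rw [e, hL, mul_assoc]
        refine hc.trans ?_
        gcongr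
      have h0 : 0 ≤ K * |B| := by positivity
      have h0' : 0 ≤ K * |β| := by positivity
      refine ⟨key _ ?_, key _ ?_, key _ ?_⟩
      · simp only [hH]; rw [abs_mul, abs_of_pos hm0]
        gcongr
        nlinarith
      · rw [Hd q hqQ]
        have e1 : x.1 * p.1 * (φ q • fderiv Rl (mon B β) q + mon B β q • fderiv Rl φ q) (1, 0)
            = (φ q * B + q.1 * fderiv Rl φ q (1, 0)) * mon B β q := by
          change q.1 * (φ q * fderiv Rl (mon B β) q (1, 0) + mon B β q * fderiv Rl φ q (1, 0)) = _
          linear_combination (φ q) * (mon_d1 (B := B) (β := β) hqQ)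
        rw [e1, abs_mul, abs_of_pos hm0]
        gcongr
        refine (abs_add_le _ _).trans ?_
        rw [abs_mul]
        have : |φ q| * |B| ≤ K * |B| := by gcongr
        linarith
      · rw [Hd q hqQ]
        have e1 : x.2 * p.2 * (φ q • fderiv Rl (mon B β) q + mon B β q • fderiv Rl φ q) (0, 1)
            = (φ q * β + q.2 * fderiv Rl φ q (0, 1)) * mon B β q := by
          change q.2 * (φ q * fderiv Rl (mon B β) q (0, 1) + mon B β q * fderiv Rl φ q (0, 1)) = _
          linear_combination (φ q) * (mon_d2 (B := B) (β := β) hqQ)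
        rw [e1, abs_mul, abs_of_pos hm0]
        gcongr
        refine (abs_add_le _ _).trans ?_
        rw [abs_mul]
        have : |φ q| * |β| ≤ K * |β| := by gcongr
        linarith
    · have hz : H =ᶠ[nhds q] fun _ => 0 := by
        filter_upwards [(TT_closed δ ε κ τ' e1).isOpen_compl.mem_nhds hT, QQ_open.mem_nhds hqQ] with r hr hr2
        have : φ r = 0 := by
          by_contra h; exact hr (hsupp r hr2 h)
        simp [hH, this]
      rw [hz.fderiv_eq, hz.eq_of_nhds]
      simpa using (by
        refine indicator_nonneg (fun r hr => ?_) p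
        have := mon_pos (B := B) (β := β) (SS_sub hr)
        positivity)
  refine (hTL (3 * δ / 4) (fun z => z ^ e * w z) V1 V2 V3 (fun z hz => c1 z (sub z hz)) (fun z hz => c2 z (sub z hz))
    (fun z hz => c3 z (sub z hz)) (c4.mono sub) (fun z hz => c5 z (sub z hz)) (fun z hz => c6 z (sub z hz))
    (fun z hz => c7 z (sub z hz)) l m n H (fun p => fderiv Rl H p (1, 0)) (fun p => fderiv Rl H p (0, 1)) ρ
    (fun p hp => slice1 ((Hcd p hp).differentiableAt (by norm_num)))
    (fun p hp => slice2 ((Hcd p hp).differentiableAt (by norm_num)))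
    Hon.continuousOn (cfd.clm_apply continuousOn_const) (cfd.clm_apply continuousOn_const) (by
      have h1 : IntegrableOn (fun p : Pl => H (2 * p.1, 1 * p.2)) QQ := by
        refine Integrable.mono' iρ ?_ ?_
        · refine ContinuousOn.aestronglyMeasurable ?_ QQ_meas
          refine ContinuousOn.comp (t := QQ) Hon.continuousOn fz ?_
          intro p hp
          have h1 : 0 < 2 * p.1 := mul_pos two_pos hp.1
          have h2 : 0 < 1 * p.2 := mul_pos one_pos hp.2
          exact ⟨h1, h2⟩
        · filter_upwards [ae_restrict_mem QQ_meas] with p hp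
          exact (bd p hp (2, 1) (by unfold BX; simp; norm_num)).1
      refine (scale_integrable _ (x := 1/2) (t := 1) (by norm_num) (by norm_num) h1).congr (ae_of_all _ fun p => ?_)
      simp) bd iρ
    (fun p hp h => indicator_of_notMem (fun hh => absurd hh.2.1 (not_lt.2 h)) _)).trans_eq ?_
  rw [mul_assoc C L]
  congr 1
  have e1 : QQ ∩ S = S := inter_eq_right.2 SS_sub
  rw [← integral_const_mul, ← e1, ← setIntegral_indicator (SS_meas _ _ _ _ _)]
  apply setIntegral_congr_fun QQ_meas
  intro p hp
  simp only [hρ, indicator]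
  split_ifs <;> ring

def chs (v : Pl) (N k : Nat) (q : Fr) (σ : Rl) (p : Pl) : Pl := chart v N k q (p.1, σ * p.2)

def chsD (v : Pl) (N k : Nat) (q' σ : Rl) (p : Pl) : Pl →L[Rl] Pl :=
  (chartD v N k q' (p.1, σ * p.2)).comp (scaleL 1 σ)

lemma chs_fd (v : Pl) (N k : Nat) (q : Fr) (σ : Rl) (p : Pl) (hq : DifferentiableAt Rl q p.1) :
    HasFDerivAt (chs v N k q σ) (chsD v N k (deriv q p.1) σ p) p := by
  exact HasFDerivAt.comp p (chart_hasFDerivAt v N k q (p.1, σ * p.2) hq) (by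
    refine ((scaleL 1 σ).hasFDerivAt (x := p)).congr_of_eventuallyEq (Eventually.of_forall fun x => ?_)
    simp [scaleL_apply])

lemma chsD_det (hv : Un v) (N k : Nat) (q' : Rl) (hσ : σ = 1 ∨ σ = -1)
    (p : Pl) (hp : 0 < p.1) : |(chsD v N k q' σ p).det| = N * p.1 ^ (N - 1) * p.1 ^ k := by
  have : (chsD v N k q' σ p).det = -σ * (N * p.1 ^ (N - 1) * p.1 ^ k) := by
    rw [det_prod2]
    simp [chsD, scaleL_apply, chartD, perp2]
    linear_combination -σ * N * p.1 ^ (N - 1) * p.1 ^ k * hv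
  rw [this, abs_mul, abs_of_nonneg (a := N * p.1 ^ (N - 1) * p.1 ^ k) pz]
  rcases hσ with h | h <;> simp [h]

lemma chs_inj (hv : Un v) (hN : 1 ≤ N) (q : Fr)     (hσ : σ = 1 ∨ σ = -1) : InjOn (chs v N k q σ) {p | 0 < p.1} := by
  intro p hp p' hp' h
  have := chart_inj hv hN q (show (p.1, σ * p.2) ∈ {p : Pl | 0 < p.1} from hp)
    (show (p'.1, σ * p'.2) ∈ {p : Pl | 0 < p.1} from hp') h
  rw [Prod.mk.injEq] at this
  refine Prod.ext this.1 (mul_left_cancel₀ ?_ this.2)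
  rcases hσ with h | h <;> simp [h]

def Qd (d : Rl) : Set Pl := {p | p ∈ QQ ∧ p.1 < d}

lemma Qd_meas (d : Rl) : MeasurableSet (Qd d) := QQ_meas.inter (measurableSet_lt measurable_fst measurable_const)

/-- normal form of the curve function -/
def qform (N : Nat) (q : Fr) : Prop := AnalyticAt Rl q 0 ∧ ∃ q1 : Fr, AnalyticAt Rl q1 0 ∧
  ∀ᶠ z in nhds Zr, q z = z ^ (N + 1) * q1 z

lemma qform_nf (h : qform N q) : ∃ (q0 : Rl) (e : Nat) (w : Fr), N < e ∧ AnalyticAt Rl w 0 ∧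
    w 0 = 1 ∧ ∃ d > 0, d ≤ 1 ∧ (∀ z, |z| < d → DifferentiableAt Rl q z ∧ q z = q0 * (z ^ e * w z)) ∧
    ∀ z, 0 < z → z < d → |q z| ≤ 2 * (|q0| * z ^ e) ∧ |q z| ≤ z ^ N := by
  obtain ⟨hq, q1, h1, h2⟩ := h
  have main : ∃ (q0 : Rl) (e : Nat) (w : Fr), N < e ∧ AnalyticAt Rl w 0 ∧ w 0 = 1 ∧
      ∀ᶠ z in nhds 0, q z = q0 * (z ^ e * w z) := by
    by_cases hz : ∀ᶠ z in nhds 0, q1 z = 0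
    · refine ⟨0, N + 1, fun _ => 1, by omega, analyticAt_const, rfl, ?_⟩
      filter_upwards [h2, hz] with z a b
      rw [a, b]; simp
    · obtain ⟨m, u, hu, hu0, hm⟩ := h1.exists_eventuallyEq_pow_smul_nonzero_iff.2 hz
      refine ⟨u 0, N + 1 + m, fun z => u z / u 0, by omega, hu.div_const, div_self hu0, ?_⟩
      filter_upwards [h2, hm] with z a b
      rw [a, b]; field_simp; ring
  obtain ⟨q0, e, w, he, hw, hw0, ev⟩ := main
  have ev3 : ∀ᶠ z in nhds 0, 2 * |q0| * |z| < 1 :=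
    (show Continuous fun z : Rl => 2 * |q0| * |z| by fun_prop).continuousAt.eventually (gt_mem_nhds (by simp))
  obtain ⟨d, hd, hh⟩ := Metric.eventually_nhds_iff.1 (hq.eventually_analyticAt.and (ev.and ((hw.continuousAt.abs.eventually (gt_mem_nhds (show |w 0| < 2 by rw [hw0]; norm_num))).and ev3)))
  have hh' : ∀ z, |z| < min d 1 → _ := fun z hz => hh (y := z) (by
    rw [dist_zero_right]; exact hz.trans_le (min_le_left _ _))
  refine ⟨q0, e, w, he, hw, hw0, min d 1, by positivity, min_le_right _ _,
    fun z hz => ⟨(hh' z hz).1.differentiableAt, (hh' z hz).2.1⟩, fun z hz0 hz => ?_⟩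
  obtain ⟨-, b, c, a⟩ := hh' z (by rwa [abs_of_pos hz0])
  have h1 : |q z| ≤ 2 * (|q0| * z ^ e) := by
    rw [b, abs_mul, abs_mul, abs_of_pos (pow_pos hz0 e)]
    have : |q0| * z ^ e * |w z| ≤ |q0| * z ^ e * 2 := by gcongr
    linarith
  refine ⟨h1, h1.trans ?_⟩
  rw [abs_of_pos hz0] at a
  have h2  := pow_le_pow_of_le_one hz0.le ((hz.trans_le (min_le_right _ _)).le) he
  calc 2 * (|q0| * z ^ e) ≤ 2 * (|q0| * z ^ (N + 1)) := by gcongr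
    _ = 2 * |q0| * z * z ^ N := by ring
    _ ≤ 1 * z ^ N := by gcongr
    _ = z ^ N := one_mul _

def jac (N k : Nat) (p : Pl) : Rl := N * p.1 ^ (N - 1) * p.1 ^ k

lemma chs_cov (hv : Un v) (hN : 1 ≤ N)     (hσ : σ = 1 ∨ σ = -1) (hq : ∀ z, |z| < d → DifferentiableAt Rl q z) {S : Set Pl} (hS : MeasurableSet S)
    (hSd : S ⊆ Qd d) {G : Type*} [NormedAddCommGroup G] [NormedSpace Rl G] (F : Pl → G) :
    ∫ p in chs v N k q σ '' S, F p = ∫ p in S, jac N k p • F (chs v N k q σ p) ∧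
    (IntegrableOn F (chs v N k q σ '' S) ↔
      IntegrableOn (fun p => jac N k p • F (chs v N k q σ p)) S) := by
  have hd : ∀ p ∈ S, HasFDerivWithinAt (chs v N k q σ) (chsD v N k (deriv q p.1) σ p) S p := fun p hp =>
    (chs_fd v N k q σ p (hq _ (by
      have h2  := (hSd hp).2
      rwa [abs_of_pos ((hSd hp).1.1)]))).hasFDerivWithinAt
  have hi : InjOn (chs v N k q σ) S := (chs_inj hv hN q hσ).mono fun p hp => (hSd hp).1.1
  have hdet : ∀ p ∈ S, |(chsD v N k (deriv q p.1) σ p).det| • F (chs v N k q σ p) =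
      jac N k p • F (chs v N k q σ p) := fun p hp => by
    rw [chsD_det hv N k _ hσ p (hSd hp).1.1, jac]
  constructor
  · rw [integral_image_eq_integral_abs_det_fderiv_smul volume hS hd hi]
    exact setIntegral_congr_fun hS hdet
  · rw [integrableOn_image_iff_integrableOn_abs_det_fderiv_smul volume hS hd hi]
    exact integrableOn_congr_fun hdet hS

lemma psi_LB (Pt : Rl × Rl × Rl → Rl) (hP : ContDiff Rl 1 Pt) (hc : HasCompactSupport Pt) (κ : Rl) (e1 : Nat) :
    ∃ K > Zr, LB K (fun p => Pt (p.1, p.2, κ * p.1 ^ e1 / p.2)) := by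
  have cf : Continuous (fderiv Rl Pt) := hP.continuous_fderiv (by norm_num)
  obtain ⟨K1, h1⟩ := hc.exists_bound_of_continuous hP.continuous
  have hsup : ∀ L : (Rl × Rl × Rl) → (Rl × Rl × Rl), HasCompactSupport (fun x => fderiv Rl Pt x (L x)) := fun L =>
    (hc.fderiv Rl).mono (fun x hx => by
      simp   at hx ⊢
      intro h; rw [h] at hx; simp at hx)
  obtain ⟨K2, h2⟩ := (hsup (fun x => (x.1, 0, e1 * x.2.2))).exists_bound_of_continuous
    (cf.clm_apply fz)
  obtain ⟨K3, h3⟩ := (hsup (fun x => (0, x.2.1, - x.2.2))).exists_bound_of_continuous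
    (cf.clm_apply fz)
  refine ⟨max 1 (max K1 (max K2 K3)), by positivity, ?_⟩
  intro p hp
  have hp1 : 0 < p.1 := hp.1
  set ι : Pl → Rl × Rl × Rl := fun p => (p.1, p.2, κ * p.1 ^ e1 / p.2) with hι
  have cd : ContDiffAt Rl 1 (fun p => Pt (ι p)) p := hP.contDiffAt.comp p (contDiffAt_fst.prodMk (contDiffAt_snd.prodMk ((contDiffAt_const.mul (contDiffAt_fst.pow e1)).div contDiffAt_snd (hp.2).ne')))
  have dP : HasFDerivAt Pt (fderiv Rl Pt (ι p)) (ι p) := (hP.differentiable (by norm_num) _).hasFDerivAt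
  have d1 : p.1 * fderiv Rl (fun p => Pt (ι p)) p (1, 0) = fderiv Rl Pt (ι p) ((ι p).1, 0, e1 * (ι p).2.2) := by
    rw [(slice1 (cd.differentiableAt (by norm_num))).unique (HasFDerivAt.comp_hasDerivAt p.1   dP ((hasDerivAt_id p.1).prodMk ((hasDerivAt_const p.1 p.2).prodMk (((hasDerivAt_pow e1 p.1).const_mul κ).div_const p.2)))), ← smul_eq_mul, ← map_smul]
    simp  [hι, ]
    cases e1 with
    | zero => simp
    | succ m => simp; ring
  have d2 : p.2 * fderiv Rl (fun p => Pt (ι p)) p (0, 1) = fderiv Rl Pt (ι p) (0, (ι p).2.1, -(ι p).2.2) := by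
    rw [(slice2 (cd.differentiableAt (by norm_num))).unique (HasFDerivAt.comp_hasDerivAt p.2   dP ((hasDerivAt_const p.2 p.1).prodMk ((hasDerivAt_id p.2).prodMk
        ((hasDerivAt_const p.2 (κ * p.1 ^ e1)).div (hasDerivAt_id p.2) (hp.2).ne')))), ← smul_eq_mul, ← map_smul]
    simp only [Prod.smul_mk, smul_eq_mul, hι, mul_one, mul_zero, true_and]
    field_simp; ring
  refine ⟨cd, ?_, ?_, ?_⟩
  · exact (h1 _).trans (by simp)
  · rw [d1]; exact (h2 (ι p)).trans (by simp)
  · rw [d2]; exact (h3 (ι p)).trans (by simp)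

lemma mollify (P : Rl × Rl × Rl → Rl) (hP : ContDiffAt Rl 1 P 0) (h0 : 0 < P 0) :
    ∃ (Pt : Rl × Rl × Rl → Rl) (c r : Rl), ContDiff Rl 1 Pt ∧ HasCompactSupport Pt ∧ 0 < c ∧ 0 < r ∧
      ∀ x, ‖x‖ ≤ r → Pt x = P x ∧ c ≤ P x := by
  have ev2 : ∀ᶠ x in nhds 0, P 0 / 2 < P x := hP.continuousAt.eventually (lt_mem_nhds (by linarith))
  obtain ⟨r, hr, hh⟩ := Metric.eventually_nhds_iff.1 ((hP.eventually (by simp)).and ev2)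
  let χ : ContDiffBump (0 : Rl × Rl × Rl) := ⟨r / 3, r / 2, by positivity, by linarith⟩
  refine ⟨fun x => χ x * P x, P 0 / 2, r / 3, ?_, ?_, by positivity, by positivity, ?_⟩
  · rw [contDiff_iff_contDiffAt]
    intro x
    by_cases hx : dist x 0 < r
    · exact χ.contDiff.contDiffAt.mul (hh hx).1
    · exact contDiffAt_const.congr_of_eventuallyEq (by
          have : ∀ᶠ y in nhds x, r / 2 < dist y 0 :=
            (continuous_id.dist continuous_const).continuousAt.eventually
              (lt_mem_nhds (show r / 2 < dist x 0 by linarith))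
          filter_upwards [this] with y hy
          rw [χ.zero_of_le_dist hy.le, zero_mul])
  · exact χ.hasCompactSupport.mul_right
  · intro x hx
    refine ⟨by simp [(χ.one_of_mem_closedBall (by simpa using hx))], (hh  ?_).2.le⟩
    rw [dist_zero_right]; linarith

lemma SS_Qd {D : Rl} (h : d ≤ D) : SS d ε κ τ e1 ⊆ Qd D := fun _ hp => ⟨hp.1, hp.2.1.trans_le h⟩

lemma iota_small (hκ : 0 ≤ κ) (hp : p ∈ QQ)
    (h : p ∈ TT δ ε κ τ e1) (h1 : δ ≤ r) (h2 : ε ≤ r) (h3 : τ ≤ r) :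
    ‖(p.1, p.2, κ * p.1 ^ e1 / p.2)‖ ≤ r := by
  have hp1 : 0 < p.1 := hp.1
  have hp2 : 0 < p.2 := hp.2
  obtain ⟨a, b, c⟩ := h
  refine norm_prod_le_iff.2 ⟨?_, norm_prod_le_iff.2 ⟨?_, ?_⟩⟩
  · rw [Real.norm_of_nonneg hp1.le]; linarith
  · rw [Real.norm_of_nonneg hp2.le]; linarith
  · rw [Real.norm_of_nonneg pz]
    exact ((div_le_iff₀ hp2).2 c).trans h3

/-- the terminal estimate in chart coordinates -/
lemma term_a (hv : Un v) (hN : 1 ≤ N) (hk : N ≤ k)     {q0 : Rl} {w : Fr} (he : N < e) (hw : AnalyticAt Rl w 0) (hw0 : w 0 = 1) (hd : 0 < d)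
    (hq : ∀ z, |z| < d → DifferentiableAt Rl q z ∧ q z = q0 * (z ^ e * w z))
    (ig : Integrable g) (hσ : σ = 1 ∨ σ = -1) (hκ : 0 ≤ κ) (e1 : Nat)
    (b β : Rl) (P : Rl × Rl × Rl → Rl) (hP : ContDiffAt Rl 1 P 0) (hP0 : 0 < P 0) {τ0 : Rl} (hτ0 : 0 < τ0)
    (hg : ∀ p ∈ QQ, p ∈ TT τ0 τ0 κ τ0 e1 → g (chs v N k q σ p) = mon b β p * P (p.1, p.2, κ * p.1 ^ e1 / p.2)) :
    ∃ τ > Zr, τ ≤ d ∧ ∃ c > Zr, ∃ B : Rl, ∀ ε δ, 0 < ε → ε < τ → 0 < δ → δ < τ →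
      IntegrableOn (mon B β) (SS (3 * δ / 4) ε κ (2 * τ) e1) ∧
      (∀ p ∈ SS (3 * δ / 4) ε κ (2 * τ) e1, c * mon B β p ≤ jac N k p * g (chs v N k q σ p)) ∧
      ∀ A > Zr, ∃ C > Zr, ∀ α : Fl, LB A (fun p => α (chs v N k q σ p)) →
        (∀ p ∈ QQ, α (chs v N k q σ p) ≠ 0 → p ∈ TT δ ε κ τ e1) → ∀ t u : Rl,
        ‖oscInt (fun p => α p * g p) (chs v N k q σ '' Qd d) t u‖ ≤
          C * ∫ p in SS (3 * δ / 4) ε κ (2 * τ) e1, (1 + (|dot2 (t, u) v| * p.1 ^ N +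
            |dot2 (t, u) (perp2 v) * q0| * p.1 ^ e + |dot2 (t, u) (perp2 v)| * (p.2 * p.1 ^ k))) ^ mh *
              mon B β p := by
  obtain ⟨Pt, c, r, hPt, hPc, hc, hr, hPr⟩ := mollify P hP hP0
  obtain ⟨K, hK, hLB⟩ := psi_LB Pt hPt hPc κ e1
  obtain ⟨τ1, hτ1, hcore⟩ := core N e k hN he (hN.trans hk) w hw hw0
  set m := min (min r τ0) (min τ1 d) with hm
  have hm0 : 0 < m := by positivity
  have m1 : m ≤ r := (min_le_left _ _).trans (min_le_left _ _)
  have m2 : m ≤ τ0 := (min_le_left _ _).trans (min_le_right _ _)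
  have m3 : m ≤ τ1 := (min_le_right _ _).trans (min_le_left _ _)
  have m4 : m ≤ d := (min_le_right _ _).trans (min_le_right _ _)
  set B : Rl := b + (N - 1 + k : Nat) with hB
  have hN0 : Zr < N := by exact_mod_cast hN
  have hmonB : ∀ p ∈ QQ, jac N k p * mon b β p = N * mon B β p := by
    intro p hp
    unfold jac mon
    rw [hB, rpow_add hp.1, rpow_natCast, pow_add]; ring
  refine ⟨m / 2, by positivity, by linarith, N * c, by positivity, B, ?_⟩
  intro ε δ hε hε' hδ hδ'
  have hm2 : 2 * (m / 2) = m := by ring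
  rw [hm2]
  set S := SS (3 * δ / 4) ε κ m e1 with hS
  have hST : ∀ p ∈ S, p ∈ TT δ ε κ m e1 := fun p hp => ⟨by have := hp.2.1; linarith, hp.2.2.1, hp.2.2.2⟩
  have TTmono : ∀ p ∈ QQ, p ∈ TT δ ε κ m e1 → p ∈ TT τ0 τ0 κ τ0 e1 := by
    rintro p hp ⟨h1, h2, h3⟩
    exact ⟨by linarith, by linarith, h3.trans (mul_le_mul_of_nonneg_right m2 (le_of_lt hp.2))⟩
  have gval : ∀ p ∈ QQ, p ∈ TT δ ε κ m e1 → jac N k p * g (chs v N k q σ p) =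
      N * Pt (p.1, p.2, κ * p.1 ^ e1 / p.2) * mon B β p ∧ c ≤ Pt (p.1, p.2, κ * p.1 ^ e1 / p.2) := by
    intro p hp hT
    have := hPr _ (iota_small hκ hp hT (by linarith) (by linarith) m1)
    rw [hg p hp (TTmono p hp hT), this.1, ← mul_assoc, hmonB p hp]
    exact ⟨by ring, this.2⟩
  have lower : ∀ p ∈ S, N * c * mon B β p ≤ jac N k p * g (chs v N k q σ p) := by
    intro p hp
    obtain ⟨h1, h2⟩ := gval p hp.1 (hST p hp)
    have := mon_pos (B := B) (β := β) hp.1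
    rw [h1]; gcongr
  have hint : IntegrableOn (mon B β) S := by
    refine Integrable.mono' (((chs_cov hv hN hσ (k := k) (fun z hz => (hq z hz).1) (SS_meas (3 * δ / 4) ε κ m e1)
      (SS_Qd (by linarith)) g).2.1 ig.integrableOn).const_mul (N * c)⁻¹) ?_ ?_
    · refine ContinuousOn.aestronglyMeasurable (fun p hp => ?_) (SS_meas _ _ _ _ _)
      exact (mon_cd hp.1).continuousAt.continuousWithinAt
    · filter_upwards [ae_restrict_mem (SS_meas _ _ _ _ _)] with p hp
      rw [Real.norm_of_nonneg (mon_pos hp.1).le, smul_eq_mul, ← div_eq_inv_mul, le_div_iff₀' pz]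
      exact lower p hp
  refine ⟨hint, lower, ?_⟩
  intro A hA
  obtain ⟨C, hC, hcore⟩ := hcore δ hδ (by linarith) B β ε κ (m / 2) (2 * (A * (N * K))) e1 hκ pz pz
    (by rw [hm2]; exact hint)
  rw [hm2] at hcore
  refine ⟨C, hC, ?_⟩
  intro α hα hsupp t u
  set ψ : Fl := fun p => Pt (p.1, p.2, κ * p.1 ^ e1 / p.2) with hψ
  have hNψ : LB (N * K) (fun p => N * ψ p) := by
    intro p hp
    obtain ⟨a1, a2, a3, a4⟩ := hLB p hp
    have hd : fderiv Rl (fun p => (N:Rl) * ψ p) p = (N:Rl) • fderiv Rl ψ p :=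
      fderiv_const_mul (a1.differentiableAt (by norm_num)) _
    refine ⟨contDiffAt_const.mul a1, ?_, ?_, ?_⟩
    · rw [abs_mul, abs_of_pos hN0]; gcongr
    · rw [hd, smul_apply, smul_eq_mul, mul_left_comm, abs_mul, abs_of_pos hN0]; gcongr
    · rw [hd, smul_apply, smul_eq_mul, mul_left_comm, abs_mul, abs_of_pos hN0]; gcongr
  have key := hcore _ (LB.mul hα hNψ) (fun p hp h => hsupp p hp (left_ne_zero_of_mul h)) (dot2 (t, u) v)
    (dot2 (t, u) (perp2 v) * q0) (σ * dot2 (t, u) (perp2 v))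
  have hσ1 : |σ * dot2 (t, u) (perp2 v)| = |dot2 (t, u) (perp2 v)| := by
    rcases hσ with h | h <;> simp [h]
  rw [hσ1] at key
  refine le_of_eq_of_le ?_ key
  congr 1
  unfold oscInt
  rw [(chs_cov hv hN hσ (k := k) (fun z hz => (hq z hz).1) (Qd_meas d) subset_rfl _).1]
  have e0 : QQ ∩ Qd d = Qd d := inter_eq_right.2 fun _ h => h.1
  rw [← e0, ← setIntegral_indicator (Qd_meas d)]
  refine setIntegral_congr_fun QQ_meas fun p hp => ?_
  by_cases hα0 : α (chs v N k q σ p) = 0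
  · simp only [indicator]; split_ifs <;> simp [hα0]
  have hT := hsupp p hp hα0
  have hpd : p.1 < d := by have := hT.1; linarith
  simp only [indicator_of_mem (show p ∈ Qd d from ⟨hp, hpd⟩)]
  have hph : t * (chs v N k q σ p).1 + u * (chs v N k q σ p).2 = dot2 (t, u) v * p.1 ^ N +
      dot2 (t, u) (perp2 v) * q0 * (p.1 ^ e * w p.1) + σ * dot2 (t, u) (perp2 v) * (p.2 * p.1 ^ k) := by
    rw [dot_split hv, chs, dot_chart_v hv, dot_chart_perp hv, (hq p.1 (by rwa [abs_of_pos hp.1])).2]; ring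
  rw [← hph, Complex.real_smul, ← mul_assoc]
  congr 2
  · rw [← Complex.ofReal_mul]
    congr 1
    linear_combination α (chs v N k q σ p) * ((gval p hp (⟨hT.1, hT.2.1, hT.2.2.trans (mul_le_mul_of_nonneg_right (by linarith) (le_of_lt hp.2))⟩)).1)
  · push_cast; rfl

noncomputable def wt (v : Pl) (t u : Rl) (p : Pl) : Rl := (1 + |dot2 (t, u) v| * nrm2 p +
  |dot2 (t, u) (perp2 v)| * |dot2 p (perp2 v)|) ^ mh

lemma nrm2_nonneg (p : Pl) : 0 ≤ nrm2 p := Real.sqrt_nonneg _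

lemma wt_base (v : Pl) (t u : Rl) (p : Pl) : 1 ≤ 1 + |dot2 (t, u) v| * nrm2 p +
    |dot2 (t, u) (perp2 v)| * |dot2 p (perp2 v)| := by
  have := nrm2_nonneg p
  have h1 : 0 ≤ |dot2 (t, u) v| * nrm2 p := by positivity
  have h2 : 0 ≤ |dot2 (t, u) (perp2 v)| * |dot2 p (perp2 v)| := by positivity
  linarith

lemma wt_nonneg (v : Pl) (t u : Rl) (p : Pl) : 0 ≤ wt v t u p :=
  rpow_nonneg (by linarith [wt_base v t u p]) _

lemma wt_le (v : Pl) (t u : Rl) (p : Pl) : wt v t u p ≤ 1 :=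
  rpow_le_one_of_one_le_of_nonpos (wt_base v t u p) (by norm_num)

lemma wt_cont (v : Pl) (t u : Rl) : Continuous (wt v t u) := by
  refine Continuous.rpow_const ?_ fun p => Or.inl (by linarith [wt_base v t u p])
  unfold nrm2 dot2; fun_prop

lemma wtg_int (ig : Integrable g) (v : Pl) (t u : Rl) : Integrable fun p => wt v t u p * g p := by
  refine ig.bdd_mul (c := 1) (wt_cont v t u).aestronglyMeasurable (ae_of_all _ fun p => ?_)
  rw [Real.norm_of_nonneg (wt_nonneg _ _ _ _)]; exact wt_le _ _ _ _

lemma rp_cmp {y c : Rl} (hx : 0 < x) (hy : 0 < y) (hc : 1 ≤ c) (h : y ≤ c * x) :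
    x ^ (-(1/2:Rl)) ≤ c * y ^ (-(1/2:Rl)) := by
  have h1 : (c * x) ^ (-(1/2:Rl)) ≤ y ^ (-(1/2:Rl)) := rpow_le_rpow_of_nonpos hy h (by norm_num)
  rw [mul_rpow (by linarith) hx.le] at h1
  have h2 : 1 ≤ c * c ^ (-(1/2:Rl)) := by
    have : c * c ^ (-(1/2:Rl)) = c ^ (1/2:Rl) := by
      nth_rewrite 1 [← rpow_one c]
      rw [← rpow_add (by linarith)]; norm_num
    rw [this]; exact one_le_rpow hc (by norm_num)
  calc x ^ (-(1/2)) ≤ c * c ^ (-(1/2)) * x ^ (-(1/2)) := le_mul_of_one_le_left (rpow_nonneg hx.le _) h2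
    _ = c * (c ^ (-(1/2:Rl)) * x ^ (-(1/2:Rl))) := by ring
    _ ≤ _ := by gcongr

lemma osc_two {h : Fl} {S1 S2 Z : Set Pl} (h1 : MeasurableSet S1) (h2 : MeasurableSet S2)
    (hd : Disjoint S1 S2) (hZ : volume Z = 0) (hs : ∀ p, h p ≠ 0 → p ∈ S1 ∪ S2 ∪ Z) (t u : Rl) :
    ‖oscInt h univ t u‖ ≤ ‖oscInt h S1 t u‖ + ‖oscInt h S2 t u‖ := by
  unfold oscInt
  set F : Pl → ℂ := fun p => h p * Complex.exp (Complex.I * (t * p.1 + u * p.2)) with hF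
  rw [setIntegral_univ]
  by_cases hi : Integrable F
  · rw [← setIntegral_eq_integral_of_ae_compl_eq_zero , setIntegral_union hd h2 hi.integrableOn hi.integrableOn]
    · exact norm_add_le _ _
    · filter_upwards [measure_eq_zero_iff_ae_notMem.1 hZ] with p hp hp2
      have : h p = 0 := by grind
      simp [this]
  · rw [integral_undef hi, norm_zero]; positivity

def box (d ε : Rl) : Set Pl := {p | 0 < p.1 ∧ p.1 < d ∧ |p.2| < ε}

lemma box_meas (d ε : Rl) : MeasurableSet (box d ε) :=
  (measurableSet_lt measurable_const measurable_fst).inter ((measurableSet_lt measurable_fst measurable_const).inter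
    (measurableSet_lt measurable_snd.abs measurable_const))

lemma chart_img_meas (hv : Un v) (hN : 1 ≤ N)     (hq : ∀ z, |z| < d → DifferentiableAt Rl q z) {S : Set Pl} (hS : MeasurableSet S)
    (hSd : ∀ p ∈ S, 0 < p.1 ∧ p.1 < d) : MeasurableSet (chart v N k q '' S) :=
  measurable_image_of_fderivWithin hS (fun p hp => (chart_hasFDerivAt v N k q p (by grind)).hasFDerivWithinAt)
    ((chart_inj hv hN q).mono fun p hp => by grind)

lemma chs_image (v : Pl) (N k : Nat) (q : Fr) (σ : Rl) (S : Set Pl) :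
    chs v N k q σ '' S = chart v N k q '' (fun p => (p.1, σ * p.2)) '' S := by
  rw [image_image]; rfl

lemma chs_img_meas (hv : Un v) (hN : 1 ≤ N)     (hσ : σ = 1 ∨ σ = -1) (hq : ∀ z, |z| < d → DifferentiableAt Rl q z) {S : Set Pl} (hS : MeasurableSet S)
    (hSd : S ⊆ Qd d) : MeasurableSet (chs v N k q σ '' S) :=
  measurable_image_of_fderivWithin hS (fun p hp => (chs_fd v N k q σ p (hq _ (by
      rw [abs_of_pos (show 0 < p.1 from (hSd hp).1.1)]; exact (hSd hp).2))).hasFDerivWithinAt)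
    ((chs_inj hv hN q hσ).mono fun p hp => (hSd hp).1.1)

lemma osc_sides (hv : Un v) (hN : 1 ≤ N)     (hq : ∀ z, |z| < d → DifferentiableAt Rl q z) {h : Fl}     (hs : ∀ p, h p ≠ 0 → ∃ z y, 0 < z ∧ z < d ∧ p = chart v N k q (z, y)) (t u : Rl) :
    ‖oscInt h univ t u‖ ≤ ‖oscInt h (chs v N k q 1 '' Qd d) t u‖ + ‖oscInt h (chs v N k q (-1) '' Qd d) t u‖ := by
  refine osc_two (Z := chart v N k q '' Ioo 0 d ×ˢ {0}) (chs_img_meas hv hN (Or.inl rfl) hq (Qd_meas d) subset_rfl)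
    (chs_img_meas hv hN (Or.inr rfl) hq (Qd_meas d) subset_rfl) ?_ ?_ ?_ t u
  · rw [Set.disjoint_left]
    rintro _ ⟨p, hp, rfl⟩ ⟨p', hp', he⟩
    have := chart_inj hv hN q (show (p'.1, -1 * p'.2) ∈ {p : Pl | 0 < p.1} from hp'.1.1)
      (show (p.1, 1 * p.2) ∈ {p : Pl | 0 < p.1} from hp.1.1) he
    rw [Prod.mk.injEq] at this
    have h1 : 0 < p.2 := hp.1.2
    have h2 : 0 < p'.2 := hp'.1.2
    linarith
  · refine addHaar_image_eq_zero_of_differentiableOn_of_addHaar_eq_zero volume (fun p hp => ?_) ?_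
    · exact (chart_hasFDerivAt v N k q p (hq _ (by rw [abs_of_pos hp.1.1]; exact hp.1.2))).differentiableAt.differentiableWithinAt
    · rw [Measure.volume_eq_prod]; simp
  · intro p hp
    obtain ⟨z, y, hz, hzd, rfl⟩ := hs p hp
    rcases lt_trichotomy y 0 with hy | hy | hy
    · left; right
      exact ⟨(z, -y), ⟨⟨hz, neg_pos.2 hy⟩, hzd⟩, by simp [chs]⟩
    · right; exact ⟨(z, y), ⟨⟨hz, hzd⟩, hy⟩, rfl⟩
    · left; left
      exact ⟨(z, y), ⟨⟨hz, hy⟩, hzd⟩, by simp [chs]⟩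

/-- terminal hypothesis for one side -/
def TermHyp (v : Pl) (N k : Nat) (q : Fr) (g : Fl) (κ : Rl) (e1 : Nat) (σ : Rl) : Prop :=
  ∃ τ0 > Zr, (∀ p ∈ QQ, p ∈ TT τ0 τ0 κ τ0 e1 → g (chs v N k q σ p) = 0) ∨
    ∃ (b β : Rl) (P : Rl × Rl × Rl → Rl), ContDiffAt Rl 1 P 0 ∧ 0 < P 0 ∧ ∀ p ∈ QQ, p ∈ TT τ0 τ0 κ τ0 e1 →
      g (chs v N k q σ p) = mon b β p * P (p.1, p.2, κ * p.1 ^ e1 / p.2)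

lemma TT_mono {c a' b' c' : Rl} (h1 : a ≤ a') (h2 : b ≤ b') (h3 : c ≤ c') (hp : p ∈ QQ)
    (h : p ∈ TT a b κ c e1) : p ∈ TT a' b' κ c' e1 :=
  ⟨h.1.trans h1, h.2.1.trans h2, h.2.2.trans (mul_le_mul_of_nonneg_right h3 (le_of_lt hp.2))⟩

lemma term_phys (hv : Un v) (hN : 1 ≤ N) (hk : N ≤ k)     (hqf : qform N q) (ig : Integrable g) (g0 : ∀ p, 0 ≤ g p) (hσ : σ = 1 ∨ σ = -1)
    (hκ : 0 ≤ κ) (e1 : Nat) (hT : TermHyp v N k q g κ e1 σ) :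
    ∃ d > Zr, (∀ z, |z| < d → DifferentiableAt Rl q z) ∧ ∀ d', 0 < d' → d' ≤ d →
    ∃ τ0 > Zr, ∀ τ, 0 < τ → τ ≤ τ0 → ∀ ε δ, 0 < ε → ε < τ → 0 < δ → δ < τ →
      ∀ A > Zr, ∃ C > Zr, ∀ α : Fl, LB A (fun p => α (chs v N k q σ p)) →
        (∀ p ∈ QQ, α (chs v N k q σ p) ≠ 0 → p ∈ TT δ ε κ τ e1) → ∀ t u : Rl,
        ‖oscInt (fun p => α p * g p) (chs v N k q σ '' Qd d') t u‖ ≤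
          C * ∫ p in chart v N k q '' box (3 * δ / 4) (2 * ε), wt v t u p * g p := by
  obtain ⟨q0, e, w, he, hw, hw0, d, hd, hd1, hq, hqb⟩ := qform_nf hqf
  refine ⟨d, hd, fun z hz => (hq z hz).1, fun d' hd' hdd => ?_⟩
  obtain ⟨τ0, hτ0, hT | ⟨b, β, P, hP, hP0, hT⟩⟩ := hT
  · refine ⟨τ0, hτ0, fun τ hτ hτ' ε δ hε hε' hδ hδ' A hA => ⟨1, one_pos, fun α _ hs t u => ?_⟩⟩
    have : oscInt (fun p => α p * g p) (chs v N k q σ '' Qd d') t u = 0 := by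
      unfold oscInt
      refine setIntegral_eq_zero_of_forall_eq_zero ?_
      rintro _ ⟨p, hp, rfl⟩
      have : α (chs v N k q σ p) * g (chs v N k q σ p) = 0 := by
        by_cases h : α (chs v N k q σ p) = 0
        · rw [h, zero_mul]
        · rw [hT p hp.1 (TT_mono (by linarith) (by linarith) hτ' hp.1 (hs p hp.1 h)), mul_zero]
      beta_reduce; rw [this]; simp
    rw [this, norm_zero, one_mul]
    exact integral_nonneg fun p => mul_nonneg (wt_nonneg _ _ _ _) (g0 p)
  · obtain ⟨τ, hτ, hτd, c, hc, B, hmain⟩ := term_a hv hN hk he hw hw0 hd' (fun z hz => hq z (hz.trans_le hdd)) ig hσ hκ e1 b β P hP hP0 hτ0 hT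
    refine ⟨τ, hτ, fun τ' hτ' hle ε δ hε hε' hδ hδ' A hA => ?_⟩
    obtain ⟨h1, h2, h3⟩ := hmain ε δ hε (by linarith) hδ (by linarith)
    obtain ⟨C, hC, h3⟩ := h3 A hA
    refine ⟨C * (3 * c⁻¹), by positivity, fun α hα hs t u => ?_⟩
    refine (h3 α hα (fun p hp h => TT_mono le_rfl le_rfl hle hp (hs p hp h)) t u).trans ?_
    rw [mul_assoc]
    gcongr
    set S := SS (3 * δ / 4) ε κ (2 * τ) e1 with hS
    have hcov := chs_cov hv hN hσ (k := k) (fun z hz => (hq z hz).1) (SS_meas (3 * δ / 4) ε κ (2 * τ) e1) (SS_Qd (by linarith))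
      (fun p => wt v t u p * g p)
    have step : ∫ p in chs v N k q σ '' S, wt v t u p * g p ≤
        ∫ p in chart v N k q '' box (3 * δ / 4) (2 * ε), wt v t u p * g p := by
      refine setIntegral_mono_set (wtg_int ig v t u).integrableOn
        (ae_of_all _ fun p => mul_nonneg (wt_nonneg _ _ _ _) (g0 p)) (HasSubset.Subset.eventuallyLE ?_)
      rintro _ ⟨p, hp, rfl⟩
      refine ⟨(p.1, σ * p.2), ⟨hp.1.1, hp.2.1, ?_⟩, rfl⟩
      have h2 : 0 < p.2 := hp.1.2
      have h3 : |σ * p.2| = p.2 := by rcases hσ with h | h <;> simp [h, abs_of_pos h2]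
      have h4 := hp.2.2.1
      show |σ * p.2| < 2 * ε
      rw [h3]; linarith
    refine le_trans ?_ (mul_le_mul_of_nonneg_left step pz)
    rw [hcov.1, ← integral_const_mul]
    refine integral_mono_of_nonneg ?_ ((hcov.2.1 ((wtg_int ig v t u).integrableOn)).const_mul _) ?_
    · filter_upwards [ae_restrict_mem (SS_meas _ _ _ _ _)] with p hp
      have hp1 : 0 < p.1 := hp.1.1
      have hp2 : 0 < p.2 := hp.1.2
      exact mul_nonneg (rpow_nonneg pz _) (mon_pos hp.1).le
    · filter_upwards [ae_restrict_mem (SS_meas _ _ _ _ _)] with p hp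
      have hp1 : 0 < p.1 := hp.1.1
      have hp2 : 0 < p.2 := hp.1.2
      have hpd : p.1 < d := ((SS_Qd (by linarith)) hp).2
      have hqz := hqb p.1 hp1 hpd
      have hab : |q p.1 + p.1 ^ k * (σ * p.2)| ≤ |q p.1| + p.2 * p.1 ^ k := by
        refine (abs_add_le _ _).trans ?_
        gcongr
        rw [abs_mul, abs_of_pos (pow_pos hp1 k)]
        rcases hσ with h | h <;> simp [h, abs_of_pos hp2, mul_comm]
      have hpk : p.1 ^ k ≤ p.1 ^ N := pow_le_pow_of_le_one hp1.le (hpd.le.trans hd1) hk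
      have hyk : p.2 * p.1 ^ k ≤ 1 * p.1 ^ N := by
        have : p.2 ≤ 1 := by have := hp.2.2.1; linarith
        gcongr
      have hn : nrm2 (chs v N k q σ p) ≤ 3 * p.1 ^ N := by
        refine (nrm_le hv _).trans ?_
        rw [chs, dot_chart_v hv, dot_chart_perp hv, abs_of_pos (pow_pos hp1 N)]
        dsimp only; linarith [hqz.2]
      have hw : (1 + (|dot2 (t, u) v| * p.1 ^ N + |dot2 (t, u) (perp2 v) * q0| * p.1 ^ e +
          |dot2 (t, u) (perp2 v)| * (p.2 * p.1 ^ k))) ^ mh ≤ 3 * wt v t u (chs v N k q σ p) := by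
        refine rp_cmp pz (by linarith [wt_base v t u (chs v N k q σ p)]) (by norm_num) ?_
        have a1 : |dot2 (t, u) v| * nrm2 (chs v N k q σ p) ≤ |dot2 (t, u) v| * (3 * p.1 ^ N) := by gcongr
        have a2 : |dot2 (t, u) (perp2 v)| * |dot2 (chs v N k q σ p) (perp2 v)| ≤
            |dot2 (t, u) (perp2 v)| * (2 * (|q0| * p.1 ^ e) + p.2 * p.1 ^ k) := by
          gcongr
          rw [chs, dot_chart_perp hv]
          exact hab.trans (by linarith [hqz.1])
        rw [abs_mul]
        have a3 : 0 ≤ |dot2 (t, u) (perp2 v)| * (p.2 * p.1 ^ k) := by positivity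
        have a4 : 0 ≤ |dot2 (t, u) (perp2 v)| * |q0| * p.1 ^ e := by positivity
        linarith only [a1, a2, a3, a4]
      have hwn := wt_nonneg v t u (chs v N k q σ p)
      have hmon := mon_pos (B := B) (β := β) hp.1
      calc _ ≤ 3 * wt v t u (chs v N k q σ p) * (c⁻¹ * (jac N k p * g (chs v N k q σ p))) := by
            gcongr
            rw [← div_eq_inv_mul, le_div_iff₀' hc]; exact (h2 p hp)
        _ = _ := by simp only [smul_eq_mul]; ring

lemma BD.congr {K : Rl} (hf : BD K f p s) (h : g =ᶠ[nhds p] f) : BD K g p s := by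
  unfold BD at *
  rw [h.fderiv_eq, h.eq_of_nhds]
  exact ⟨hf.1.congr_of_eventuallyEq h, hf.2⟩

lemma BD.mono {K L : Rl} (hf : BD K f p s) (h : K ≤ L) : BD L f p s :=
  ⟨hf.1, hf.2.1.trans h, hf.2.2.1.trans h, hf.2.2.2.trans h⟩

lemma BD.zero {K : Rl} (hK : 0 ≤ K) : BD K (fun _ => 0) p s :=
  ⟨contDiffAt_const, by simpa, by simpa, by simpa⟩

lemma BD.one_sub {K : Rl} (hf : BD K f p s) : BD (1 + K) (fun p => 1 - f p) p s := by
  obtain ⟨h1, h2, h3, h4⟩ := hf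
  unfold BD
  rw [(fderiv_const_sub _)]
  simp only [neg_apply, mul_neg, abs_neg]
  refine ⟨contDiffAt_const.sub h1, ?_, by linarith, by linarith⟩
  rw [abs_le] at *; constructor <;> linarith

lemma BD.comp {s' a1 b1 b2 m c c2 : Rl} {ζ : Pl → Pl} (hf : BD A f (ζ p) s')
    (hζ : ContDiffAt Rl 1 ζ p) (h1 : HasDerivAt (fun z => ζ (z, p.2)) (a1, b1) p.1)
    (h2 : HasDerivAt (fun y => ζ (p.1, y)) (0, b2) p.2) (e1 : p.1 * a1 = m * (ζ p).1) (e2 : p.1 * b1 = c * s')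
    (e3 : s * b2 = c2 * s') : BD ((1 + |m| + |c| + |c2|) * A) (fun p => f (ζ p)) p s := by
  obtain ⟨f1, f2, f3, f4⟩ := hf
  have hA := (abs_nonneg _).trans f2
  have hcd : ContDiffAt Rl 1 (fun p => f (ζ p)) p := f1.comp p hζ
  have hd := hcd.differentiableAt (by norm_num)
  have fd := (f1.differentiableAt (by norm_num)).hasFDerivAt
  have lin : ∀ a b : Rl, fderiv Rl f (ζ p) (a, b) = a * fderiv Rl f (ζ p) (1, 0) + b * fderiv Rl f (ζ p) (0, 1) := fun a b => by
    rw [← smul_eq_mul, ← smul_eq_mul, ← map_smul, ← map_smul, ← map_add]; simp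
  have m0 := abs_nonneg m
  have c0 := abs_nonneg c
  have c20 := abs_nonneg c2
  refine ⟨hcd, f2.trans ?_, ?_, ?_⟩
  · exact le_mul_of_one_le_left hA (by linarith)
  · rw [((slice1 hd).unique (HasFDerivAt.comp_hasDerivAt p.1  fd h1)), lin]
    have : p.1 * (a1 * fderiv Rl f (ζ p) (1, 0) + b1 * fderiv Rl f (ζ p) (0, 1)) =
      m * ((ζ p).1 * fderiv Rl f (ζ p) (1, 0)) + c * (s' * fderiv Rl f (ζ p) (0, 1)) := by
      linear_combination fderiv Rl f (ζ p) (1, 0) * e1 + fderiv Rl f (ζ p) (0, 1) * e2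
    rw [this]
    refine (abs_add_le _ _).trans ?_
    rw [abs_mul m, abs_mul c]
    have := mul_le_mul_of_nonneg_left f3 m0
    have := mul_le_mul_of_nonneg_left f4 c0
    have := mul_nonneg c20 hA
    linarith
  · rw [((slice2 hd).unique (HasFDerivAt.comp_hasDerivAt p.2 (f := fun y => ζ (p.1, y)) fd h2)), lin]
    have : s * (0 * fderiv Rl f (ζ p) (1, 0) + b2 * fderiv Rl f (ζ p) (0, 1)) = c2 * (s' * fderiv Rl f (ζ p) (0, 1)) := by
      linear_combination fderiv Rl f (ζ p) (0, 1) * e3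
    rw [this, abs_mul]
    have := mul_le_mul_of_nonneg_left f4 c20
    have := mul_nonneg m0 hA
    have := mul_nonneg c0 hA
    linarith

lemma cut_BD (h : ContDiff Rl 1 η) (hc : HasCompactSupport η) :
    ∃ K > 0, ∀ p : Pl, BD K (fun p => η p.2) p 1 ∧ BD K (fun p => η p.2) p p.2 := by
  have hd  := h.continuous_deriv le_rfl
  obtain ⟨K1, h1⟩ := hc.exists_bound_of_continuous h.continuous
  obtain ⟨K2, h2⟩ := hc.deriv.exists_bound_of_continuous hd
  obtain ⟨K3, h3⟩ := hc.deriv.mul_left (f := fun x => x).exists_bound_of_continuous (continuous_id.mul hd)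
  refine ⟨|K1| + |K2| + |K3| + 1, by positivity, fun p => ?_⟩
  have hcd : ContDiffAt Rl 1 (fun p : Pl => η p.2) p := h.contDiffAt.comp p contDiffAt_snd
  have hdf := hcd.differentiableAt (by norm_num)
  have a1 := h1 p.2
  have a2 := h2 p.2
  have a3 := h3 p.2
  simp only [Real.norm_eq_abs, Pi.mul_apply] at a1 a2 a3
  have b1 := le_abs_self K1
  have b2 := le_abs_self K2
  have b3 := le_abs_self K3
  have c1 := abs_nonneg K1
  have c2 := abs_nonneg K2
  have c3 := abs_nonneg K3
  unfold BD
  rw [((slice1 hdf).unique (hasDerivAt_const p.1 (η p.2))), ((slice2 hdf).unique (h.differentiable (by norm_num) p.2).hasDerivAt), mul_zero, abs_zero, one_mul]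
  exact ⟨⟨hcd, by linarith, by linarith, by linarith⟩, hcd, by linarith, by linarith, by linarith⟩

section
variable {v : Pl} (hv : Un v) {N k : Nat} (hN : 1 ≤ N) {q : Fr} {g : Fl} (ig : Integrable g)

include hv hN ig in
lemma phys_int (hq : ∀ z, |z| < d → DifferentiableAt Rl q z)     (hs : ∀ p, α p ≠ 0 → ∃ z y, 0 < z ∧ z < d ∧ p = chart v N k q (z, y))
    (hc : ∀ p : Pl, 0 < p.1 → p.1 < d → ContinuousAt (fun p => α (chart v N k q p)) p ∧ |α (chart v N k q p)| ≤ A) :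
    Integrable fun p => α p * g p := by
  set S : Set Pl := {p | 0 < p.1 ∧ p.1 < d}
  have hS : MeasurableSet S := (measurableSet_lt measurable_const measurable_fst).inter (measurableSet_lt measurable_fst measurable_const)
  have hfd : ∀ p ∈ S, HasFDerivWithinAt (chart v N k q) (chartD v N k (deriv q p.1) p) S p := fun p hp =>
    (chart_hasFDerivAt v N k q p (by grind)).hasFDerivWithinAt
  have hinj : InjOn (chart v N k q) S := (chart_inj hv hN q).mono fun p hp => hp.1
  refine (integrableOn_iff_integrable_of_support_subset fun p hp => ?_).1 (by
    rw [integrableOn_image_iff_integrableOn_abs_det_fderiv_smul volume hS hfd hinj]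
    refine (((integrableOn_image_iff_integrableOn_abs_det_fderiv_smul volume hS hfd hinj g).1 ig.integrableOn).bdd_mul (c := A) (f := fun p => α (chart v N k q p)) ?_ ?_).congr (ae_of_all _ fun p => ?_)
    · exact ContinuousOn.aestronglyMeasurable (fun p hp => (hc p hp.1 hp.2).1.continuousWithinAt) hS
    · filter_upwards [ae_restrict_mem hS] with p hp using (hc p hp.1 hp.2).2
    · ring)
  obtain ⟨z, y, h1, h2, rfl⟩ := hs p fun h => hp (by simp [h])
  exact ⟨_, ⟨h1, h2⟩, rfl⟩

lemma osc_add {a b : Fl} (ha : Integrable a) (hb : Integrable b) (t u : Rl) :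
    ‖oscInt (fun p => a p + b p) univ t u‖ ≤ ‖oscInt a univ t u‖ + ‖oscInt b univ t u‖ := by
  have key : ∀ a : Fl, Integrable a → Integrable fun p : Pl => a p *
      Complex.exp (Complex.I * (t * p.1 + u * p.2)) := fun a ha => by
    refine ha.ofReal.mul_bdd (c := 1) (Continuous.aestronglyMeasurable fz) (ae_of_all _ fun p => ?_)
    rw [mul_comm, ← Complex.ofReal_mul, ← Complex.ofReal_mul, ← Complex.ofReal_add, Complex.norm_exp_ofReal_mul_I]
  unfold oscInt
  simp
  refine le_trans (le_of_eq ?_) (norm_add_le _ _)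
  rw [← integral_add (key a ha) (key b hb)]
  congr 2; ext p; push_cast; ring

/-- admissible amplitudes -/
def Adm (v : Pl) (N k : Nat) (q : Fr) (δ ε A : Rl) (α : Fl) : Prop :=
  (∀ p, α p ≠ 0 → ∃ z y, 0 < z ∧ z ≤ δ ∧ |y| ≤ ε ∧ p = chart v N k q (z, y)) ∧
  ∀ p : Pl, 0 < p.1 → p.1 ≤ δ → |p.2| ≤ ε → BD A (fun p => α (chart v N k q p)) p 1

include hv hN in
lemma Adm.supp (h : Adm v N k q δ ε A α) (hp : 0 < p.1)
    (h0 : α (chart v N k q p) ≠ 0) : p.1 ≤ δ ∧ |p.2| ≤ ε := by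
  obtain ⟨z, y, h1, h2, h3, h4⟩ := h.1 _ h0
  rw [chart_inj hv hN q hp (show (z, y) ∈ {p : Pl | 0 < p.1} from h1) h4]
  grind

include hv hN in
lemma Adm.all (h : Adm v N k q δ ε A α) (hA : 0 ≤ A) (hp : 0 < p.1) :
    BD A (fun p => α (chart v N k q p)) p 1 := by
  by_cases h1 : p.1 ≤ δ ∧ |p.2| ≤ ε
  · exact h.2 p hp h1.1 h1.2
  · refine (BD.zero hA).congr ?_
    filter_upwards [(IsOpen.mem_nhds ((isOpen_lt continuous_const continuous_fst).inter (IsClosed.isOpen_compl (self :=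
        (isClosed_le continuous_fst continuous_const).inter (isClosed_le continuous_snd.abs continuous_const)))) ⟨hp, h1⟩)] with x hx
    by_contra h0
    exact hx.2 (h.supp hv hN hx.1 h0)

noncomputable def cinv (v : Pl) (N k : Nat) (q : Fr) : Pl → Pl := Function.invFunOn (chart v N k q) {p | 0 < p.1}

include hv hN in
lemma cinv_chart (hp : 0 < p.1) : cinv v N k q (chart v N k q p) = p :=
  (chart_inj hv hN q).leftInvOn_invFunOn hp

include hv hN in
lemma cut_ev (α f : Fl) (hp : 0 < p.1) :
    (fun p => (fun x => α x * f (cinv v N k q x)) (chart v N k q p)) =ᶠ[nhds p] fun p => α (chart v N k q p) * f p := by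
  filter_upwards [(isOpen_lt continuous_const continuous_fst).mem_nhds (show p ∈ {p : Pl | 0 < p.1} from hp)] with x hx
  rw [cinv_chart hv hN hx]

include hv hN in
lemma Adm.mul {K : Rl} (h : Adm v N k q δ ε A α)
    (hf : ∀ p : Pl, 0 < p.1 → p.1 ≤ δ → |p.2| ≤ ε → BD K f p 1) :
    Adm v N k q δ ε (2 * (A * K)) fun x => α x * f (cinv v N k q x) := by
  refine ⟨fun p hp => h.1 p (by grind), fun p h1 h2 h3 => ?_⟩
  exact ((h.2 p h1 h2 h3).mul (by grind)).congr (cut_ev hv hN α f h1)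

include hv hN ig in
lemma Adm.int (hq : ∀ z, |z| < d → DifferentiableAt Rl q z) (hδ : δ < d) (hA : 0 ≤ A)     (h : Adm v N k q δ ε A α) : Integrable fun p => α p * g p :=
  phys_int hv hN ig hq  fun p hp => by
      obtain ⟨z, y, h1, h2, h3, h4⟩ := h.1 p hp
      grind
    fun p hp _ => ⟨(h.all hv hN hA hp).1.continuousAt, (h.all hv hN hA hp).2.1⟩
end

def TB (v : Pl) (N k : Nat) (q : Fr) (g : Fl) (κ : Rl) (e1 : Nat) : Prop :=
  ∃ τ > Zr, ∀ ε δ, 0 < ε → ε < τ → 0 < δ → δ < τ → ∀ A > Zr, ∃ C > Zr, ∀ α : Fl,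
    (∀ p, α p ≠ 0 → ∃ z y, 0 < z ∧ z ≤ δ ∧ p = chart v N k q (z, y)) →
    (∀ σ : Rl, σ = 1 ∨ σ = -1 → LB A (fun p => α (chs v N k q σ p)) ∧
      ∀ p ∈ QQ, α (chs v N k q σ p) ≠ 0 → p ∈ TT δ ε κ τ e1) → ∀ t u : Rl,
    ‖oscInt (fun p => α p * g p) univ t u‖ ≤ C * ∫ p in chart v N k q '' box (3 * δ / 4) (2 * ε), wt v t u p * g p

def PB (v : Pl) (N k : Nat) (q : Fr) (g : Fl) : Prop :=
  ∀ ε1 > Zr, ∃ ε, 0 < ε ∧ ε ≤ ε1 ∧ ∃ δ0 > Zr, ∀ δ, 0 < δ → δ < δ0 → ∀ A > Zr, ∃ C > Zr,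
    ∀ α, Adm v N k q δ ε A α → ∀ t u : Rl,
    ‖oscInt (fun p => α p * g p) univ t u‖ ≤ C * ∫ p in chart v N k q '' box (3 * δ / 4) ε1, wt v t u p * g p

section
variable {v : Pl} (hv : Un v) {N k : Nat} (hN : 1 ≤ N) {q : Fr} {g : Fl} (ig : Integrable g)
  (g0 : ∀ p, 0 ≤ g p)

include ig g0 in
lemma wint_mono (v : Pl) (t u : Rl) {S T : Set Pl} (h : S ⊆ T) : ∫ p in S, wt v t u p * g p ≤ ∫ p in T, wt v t u p * g p :=
  setIntegral_mono_set (wtg_int ig v t u).integrableOn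
    (ae_of_all _ fun p => mul_nonneg (wt_nonneg _ _ _ _) (g0 p)) (LE.le.eventuallyLE h)

include hv hN ig g0 in
lemma TB_of (hk : N ≤ k) (hqf : qform N q) (hκ : 0 ≤ κ)
    (hT : ∀ σ : Rl, σ = 1 ∨ σ = -1 → TermHyp v N k q g κ e1 σ) : TB v N k q g κ e1 := by
  obtain ⟨d1, hd1, hq, h1⟩ := term_phys hv hN hk hqf ig g0 (Or.inl rfl) hκ e1 (hT 1 (Or.inl rfl))
  obtain ⟨d2, hd2, -, h2⟩ := term_phys hv hN hk hqf ig g0 (Or.inr rfl) hκ e1 (hT (-1) (Or.inr rfl))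
  obtain ⟨τ1, hτ1, h1⟩ := h1 (min d1 d2) pz (min_le_left _ _)
  obtain ⟨τ2, hτ2, h2⟩ := h2 (min d1 d2) pz (min_le_right _ _)
  refine ⟨min (min d1 d2) (min τ1 τ2), by positivity, fun ε δ hε hε' hδ hδ' A hA => ?_⟩
  obtain ⟨C1, hC1, h1⟩ := h1 _ pz ((min_le_right (min d1 d2) _).trans (min_le_left _ _)) ε δ hε hε' hδ hδ' A hA
  obtain ⟨C2, hC2, h2⟩ := h2 _ pz ((min_le_right (min d1 d2) _).trans (min_le_right _ _)) ε δ hε hε' hδ hδ' A hA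
  refine ⟨C1 + C2, by positivity, fun α hs hα t u => ?_⟩
  refine (osc_sides hv hN (k := k) (fun z hz => hq z (hz.trans_le (min_le_left d1 d2))) (fun p hp => ?_) t u).trans ?_
  · obtain ⟨z, y, h1, h2, h3⟩ := hs p (left_ne_zero_of_mul hp)
    exact ⟨z, y, h1, h2.trans_lt (hδ'.trans_le (min_le_left _ _)), h3⟩
  · rw [add_mul]
    exact add_le_add (h1 α (hα 1 (Or.inl rfl)).1 (hα 1 (Or.inl rfl)).2 t u) (h2 α (hα _ (Or.inr rfl)).1 (hα _ (Or.inr rfl)).2 t u)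

include hv hN in
lemma Adm.all2 (hε : ε ≤ 1) (h : Adm v N k q δ ε A α) (hA : 0 ≤ A) (hp : 0 < p.1) :
    BD A (fun p => α (chart v N k q p)) p p.2 := by
  obtain ⟨h1, h2, h3, h4⟩ := h.all hv hN hA hp
  refine ⟨h1, h2, h3, ?_⟩
  by_cases hy : |p.2| ≤ ε
  · rw [one_mul] at h4
    rw [abs_mul]
    calc _ ≤ 1 * A := mul_le_mul (hy.trans hε) h4 (abs_nonneg _) zero_le_one
      _ = A := one_mul A
  · have : (fun p => α (chart v N k q p)) =ᶠ[nhds p] fun _ => 0 := by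
      filter_upwards [(isOpen_lt continuous_const continuous_fst).mem_nhds (show p ∈ {p : Pl | 0 < p.1} from hp),
        (isOpen_lt continuous_const continuous_snd.abs).mem_nhds (show p ∈ {p : Pl | ε < |p.2|} from not_le.1 hy)] with x hx hx2
      by_contra h0
      exact absurd (h.supp hv hN hx h0).2 (by linarith)
    rw [this.fderiv_eq]; simpa

lemma LB_flip {F : Fl} (h : ∀ p : Pl, 0 < p.1 → p.2 ≠ 0 → BD A F p p.2) (hσ : σ = 1 ∨ σ = -1) :
    LB (3 * A) fun p => F (p.1, σ * p.2) := fun p hp => by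
  have := (h (p.1, σ * p.2) hp.1 (mul_ne_zero (by grind) (hp.2).ne')).comp (ζ := fun p => (p.1, σ * p.2))
     (s := p.2)    (m := 1) (c := 0) (c2 := 1) fz
    ((hasDerivAt_id p.1).prodMk (hasDerivAt_const _ (σ * p.2)))
    ((hasDerivAt_const _ p.1).prodMk (by simpa using (hasDerivAt_id p.2).const_mul σ)) (by ring) (by ring) (by ring)
  norm_num at this
  exact this

include hv hN ig g0 in
lemma PB_of_TB0 (e1 : Nat) (h : TB v N k q g 0 e1) : PB v N k q g := by
  obtain ⟨τ, hτ, h⟩ := h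
  intro ε1 hε1
  have hm : min (min (τ / 2) (ε1 / 2)) 1 ≤ min (τ / 2) (ε1 / 2) := min_le_left _ _
  have m1 := hm.trans (min_le_left _ _)
  have m2 := hm.trans (min_le_right _ _)
  refine ⟨min (min (τ / 2) (ε1 / 2)) 1, by positivity, by linarith, τ, hτ, fun δ hδ hδ' A hA => ?_⟩
  obtain ⟨C, hC, h⟩ := h (min (min (τ / 2) (ε1 / 2)) 1) δ pz (by linarith) hδ hδ' (3 * A) pz
  refine ⟨C, hC, fun α hα t u => (h α (fun p hp => ?_) (fun σ hσ => ⟨?_, fun p hp h0 => ?_⟩) t u).trans ?_⟩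
  · obtain ⟨z, y, h1, h2, -, h3⟩ := hα.1 p hp
    exact ⟨z, y, h1, h2, h3⟩
  · exact LB_flip  (fun p hp _ => hα.all2 hv hN (min_le_right _ _) hA.le hp) hσ
  · have := hα.supp hv hN (p := (p.1, σ * p.2)) hp.1 h0
    have h2 : 0 < p.2 := hp.2
    refine ⟨this.1, ?_, by rw [zero_mul]; positivity⟩
    have h3 : |σ * p.2| = p.2 := by rcases hσ with h | h <;> simp [h, abs_of_pos h2]
    rw [← h3]; exact this.2
  · refine mul_le_mul_of_nonneg_left (wint_mono ig g0 v t u (image_mono fun p hp => ⟨hp.1, hp.2.1, hp.2.2.trans_le ?_⟩)) hC.le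
    linarith

/-- gluing over compact parameter range -/
def QB (v : Pl) (N k : Nat) (q : Fr) (g : Fl) (R : Rl) : Prop :=
  ∃ δ0 > Zr, ∀ δ, 0 < δ → δ < δ0 → ∀ A > Zr, ∃ C > Zr,
    ∀ α, Adm v N k q δ R A α → ∀ t u : Rl,
    ‖oscInt (fun p => α p * g p) univ t u‖ ≤ C * ∫ p in chart v N k q '' box (3 * δ / 4) (R + 1), wt v t u p * g p

lemma chart_shift (v : Pl) (N k : Nat) (q : Fr) (c : Rl) (p : Pl) :
    chart v N k (fun z => q z + c * z ^ k) p = chart v N k q (p.1, c + p.2) := by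
  unfold chart; ring

lemma exists_cut (c : Rl) (hr : 0 < r) : ∃ η : Fr, ContDiff Rl 1 η ∧ HasCompactSupport η ∧
    (∀ x, |x - c| ≤ r / 2 → η x = 1) ∧ ∀ x, η x ≠ 0 → |x - c| ≤ r := by
  let b : ContDiffBump c := ⟨r / 2, r, by positivity, by linarith⟩
  refine ⟨b, b.contDiff, b.hasCompactSupport, fun x hx => b.one_of_mem_closedBall (by simpa [Real.dist_eq] using hx), fun x hx => ?_⟩
  have : x ∈ Function.support b := hx
  rw [b.support_eq, ] at this
  exact this.le

include hv hN ig g0 in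
lemma QB_of (hd : 0 < d) (hq : ∀ z, |z| < d → DifferentiableAt Rl q z)
    (h : ∀ c : Rl, PB v N k (fun z => q z + c * z ^ k) g) (R : Rl) : QB v N k q g R := by
  have key : ∃ η , ContDiff Rl 1 η ∧ HasCompactSupport η ∧ (∀ x ∈ Icc (-R) R, η x = 1) ∧
      ∃ δ0 > 0, ∀ δ, 0 < δ → δ < δ0 → ∀ A > 0, ∃ C > 0, ∀ α, Adm v N k q δ R A α → ∀ t u : Rl,
      ‖oscInt (fun p => α p * η (cinv v N k q p).2 * g p) univ t u‖ ≤ C * ∫ p in chart v N k q '' box (3 * δ / 4) (R + 1), wt v t u p * g p := by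
    refine isCompact_Icc  (b := R).induction_on
      ?_ ?_ ?_ ?_
    · refine ⟨fun _ => 0, contDiff_const, HasCompactSupport.zero, by simp, 1, one_pos, fun δ _ _ A _ => ⟨1, one_pos, fun α _ t u => ?_⟩⟩
      simp  [mul_zero, zero_mul, oscInt, Complex.ofReal_zero, integral_zero, norm_zero, one_mul]
      exact integral_nonneg fun p => mul_nonneg (wt_nonneg _ _ _ _) (g0 p)
    · rintro s t hst ⟨η, h1, h2, h3, h4⟩
      exact ⟨η, h1, h2, fun x hx => h3 x (hst hx), h4⟩
    · rintro s s' ⟨η, h1, h2, h3, δ1, hδ1, h4⟩ ⟨η', h1', h2', h3', δ2, hδ2, h4'⟩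
      refine ⟨fun x => η x + (1 - η x) * η' x, h1.add ((contDiff_const.sub h1).mul h1'), h2.add h2'.mul_left, ?_,
        min d (min δ1 δ2), by positivity, fun δ hδ hδ' A hA => ?_⟩
      · rintro x (hx | hx)
        · simp [h3 x hx]
        · simp [h3' x hx]
      obtain ⟨K, hK, hη⟩ := cut_BD h1 h2
      obtain ⟨K', hK', hη'⟩ := cut_BD h1' h2'
      obtain ⟨C, hC, h4⟩ := h4 δ hδ (hδ'.trans_le ((min_le_right _ _).trans (min_le_left _ _))) A hA
      obtain ⟨C', hC', h4'⟩ := h4' δ hδ (hδ'.trans_le ((min_le_right _ _).trans (min_le_right _ _))) (2 * (A * (1 + K))) pz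
      refine ⟨C + C', by positivity, fun α hα t u => ?_⟩
      have a2 := hα.mul hv hN  fun p _ _ _ => (hη p).1.one_sub
      have hδd := hδ'.trans_le (min_le_left _ _)
      rw [add_mul]
      refine le_trans (le_of_eq ?_) ((osc_add ((hα.mul hv hN  fun p _ _ _ => (hη p).1).int hv hN ig hq hδd pz) ((a2.mul hv hN  fun p _ _ _ => (hη' p).1).int hv hN ig hq hδd pz) t u).trans (add_le_add (h4 α hα t u) (h4' _ a2 t u)))
      congr 2; ext p; ring
    · intro c _
      obtain ⟨ε, hε, hε2, δ0, hδ0, h⟩ := h c (1/2) (by norm_num)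
      obtain ⟨η, h1, h2, h3, h4⟩ := exists_cut c hε
      refine ⟨_, mem_nhdsWithin_of_mem_nhds (Metric.closedBall_mem_nhds c (half_pos hε)), η, h1, h2,
        fun x hx => h3 x (by simpa [Real.dist_eq] using hx), δ0, hδ0, fun δ hδ hδ' A hA => ?_⟩
      obtain ⟨K, hK, hη⟩ := cut_BD h1 h2
      obtain ⟨C, hC, h⟩ := h δ hδ hδ' (3 * (2 * (A * K))) pz
      refine ⟨C, hC, fun α hα t u => ?_⟩
      have a1 := hα.mul hv hN  fun p _ _ _ => (hη p).1
      have hsup : ∀ p : Pl, 0 < p.1 → α (chart v N k q p) * η (cinv v N k q (chart v N k q p)).2 ≠ 0 →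
          |p.2 - c| ≤ ε ∧ |p.2| ≤ R := fun p hp h0 => by
        rw [cinv_chart hv hN hp] at h0
        exact ⟨h4 _ (right_ne_zero_of_mul h0), (hα.supp hv hN hp (left_ne_zero_of_mul h0)).2⟩
      by_cases hex : ∀ p : Pl, 0 < p.1 → α (chart v N k q p) * η (cinv v N k q (chart v N k q p)).2 = 0
      · have : (fun p => α p * η (cinv v N k q p).2 * g p) = fun _ => 0 := by
          ext p
          by_contra h0
          have h0 := left_ne_zero_of_mul h0
          obtain ⟨z, y, b1, -, -, rfl⟩ := hα.1 p (left_ne_zero_of_mul h0)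
          exact h0 (hex (z, y) b1)
        rw [this]
        simp only [oscInt, Complex.ofReal_zero, zero_mul, integral_zero, norm_zero]
        exact mul_nonneg hC.le (integral_nonneg fun p => mul_nonneg (wt_nonneg _ _ _ _) (g0 p))
      push Not at hex
      obtain ⟨p1, hp1, hp2⟩ := hex
      have hcR : |c| ≤ R + 1/2 := by
        obtain ⟨b1, b2⟩ := hsup p1 hp1 hp2
        rw [abs_le] at b1 b2 ⊢
        constructor <;> linarith
      refine (h _ ⟨fun p hp => ?_, fun p b1 b2 b3 => ?_⟩ t u).trans (mul_le_mul_of_nonneg_left (wint_mono ig g0 v t u ?_) hC.le)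
      · obtain ⟨z, y, b1, b2, -, rfl⟩ := a1.1 p hp
        refine ⟨z, y - c, b1, b2, (hsup (z, y) b1 hp).1, ?_⟩
        rw [chart_shift]; simp
      · simp  [chart_shift]
        refine ((a1.all hv hN pz (p := (p.1, c + p.2)) b1).comp (ζ := fun p => (p.1, c + p.2))  (s := 1)
             (m := 1) (c := 0) (c2 := 1) fz
          ((hasDerivAt_id p.1).prodMk (hasDerivAt_const _ (c + p.2)))
          ((hasDerivAt_const _ p.1).prodMk ((hasDerivAt_id p.2).const_add c)) (by ring) (by ring) (by ring)).mono ?_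
        norm_num
      · rintro _ ⟨p, ⟨b1, b2, b3⟩, rfl⟩
        refine ⟨(p.1, c + p.2), ⟨b1, b2, ?_⟩, (chart_shift _ _ _ _ _ _).symm⟩
        exact (abs_add_le _ _).trans_lt (by linarith)
  obtain ⟨η, -, -, h3, δ0, hδ0, h⟩ := key
  refine ⟨δ0, hδ0, fun δ hδ hδ' A hA => ?_⟩
  obtain ⟨C, hC, h⟩ := h δ hδ hδ' A hA
  refine ⟨C, hC, fun α hα t u => le_trans (le_of_eq ?_) (h α hα t u)⟩
  congr 2; ext p
  by_cases h0 : α p = 0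
  · simp [h0]
  · obtain ⟨z, y, b1, b2, b3, rfl⟩ := hα.1 p h0
    rw [cinv_chart hv hN  b1, h3 y (abs_le.1 b3), mul_one]
end

section
variable {v : Pl} (hv : Un v) {N k : Nat} (hN : 1 ≤ N) {q : Fr} {g : Fl} (ig : Integrable g)
  (g0 : ∀ p, 0 ≤ g p)

lemma chart_blow (v : Pl) (N k e : Nat) (q : Fr) (p : Pl) :
    chart v N (k + e) q p = chart v N k q (p.1, p.1 ^ e * p.2) := by
  unfold chart; ring

include hv hN ig g0 in
lemma stepB (he : 1 ≤ e) (hd : 0 < d) (hq : ∀ z, |z| < d → DifferentiableAt Rl q z)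
    (hT : TB v N k q g 1 e) (hQ : ∀ R, QB v N (k + e) q g R) : PB v N k q g := by
  obtain ⟨τ, hτ, hT⟩ := hT
  intro ε1 hε1
  set K := 1 / τ with hK
  have hK0 : 0 < K := by positivity
  obtain ⟨θ, t1, t2, t3, t4⟩ := exists_cut 0 (r := 2 * K) pz
  simp only [sub_zero] at t3 t4
  obtain ⟨L, hL, hθ⟩ := cut_BD t1 t2
  obtain ⟨δ1, hδ1, hQ⟩ := hQ (2 * K)
  have m0 : min (min (τ / 2) (ε1 / 2)) 1 ≤ min (τ / 2) (ε1 / 2) := min_le_left _ _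
  have m1 := m0.trans (min_le_left _ _)
  have m2 := m0.trans (min_le_right _ _)
  set ε := min (min (τ / 2) (ε1 / 2)) 1 with hε
  refine ⟨ε, pz, by linarith, min (min d τ) (min δ1 (min 1 (ε1 / (2 * K + 1)))), by positivity, fun δ hδ hδ' A hA => ?_⟩
  obtain ⟨⟨d1, d2⟩, d3, d4, d5⟩ : (δ < d ∧ δ < τ) ∧ δ < δ1 ∧ δ < 1 ∧ δ < ε1 / (2 * K + 1) := by simpa only [lt_min_iff] using hδ'
  set f : Fl := fun p => θ (p.2 / p.1 ^ e) with hf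
  have hfBD : ∀ p : Pl, 0 < p.1 → BD ((3 + e) * L) f p p.2 := fun p hp => by
    refine ((hθ (p.1, p.2 / p.1 ^ e)).2.comp (ζ := fun p => (p.1, p.2 / p.1 ^ e)) (p := p) (s := p.2)
      (a1 := 1) (b1 := p.2 * (-(e * p.1 ^ (e - 1)) / (p.1 ^ e) ^ 2)) (b2 := 1 / p.1 ^ e) (m := 1) (c := -e) (c2 := 1)
      (contDiffAt_fst.prodMk (contDiffAt_snd.div (contDiffAt_fst.pow e) (pow_pos hp e).ne'))
      ((hasDerivAt_id p.1).prodMk (by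
        simpa [div_eq_mul_inv] using ((hasDerivAt_pow e p.1).inv (pow_pos hp e).ne').const_mul p.2))
      ((hasDerivAt_const _ p.1).prodMk ((hasDerivAt_id p.2).div_const (p.1 ^ e))) (by ring) (by
        obtain ⟨e, rfl⟩ := Nat.exists_eq_add_of_le' he
        simp only [Nat.add_sub_cancel]; field_simp; try ring) (by ring)).mono (le_of_eq ?_)
    simp; left; ring
  obtain ⟨C1, hC1, hT⟩ := hT ε δ pz (by linarith) hδ d2 (3 * (2 * (A * (1 + (3 + e) * L)))) pz
  obtain ⟨C2, hC2, hQ⟩ := hQ δ hδ d3 (2 * (((3 + e * (2 * K)) * A) * L)) pz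
  refine ⟨C1 + C2, by positivity, fun α hα t u => ?_⟩
  set β1 : Fl := fun x => α x * (fun p => 1 - f p) (cinv v N k q x) with hβ1
  set β2 : Fl := fun x => α x * f (cinv v N k q x) with hβ2
  have b1BD : ∀ p : Pl, 0 < p.1 → BD (2 * (A * (1 + (3 + e) * L))) (fun p => β1 (chart v N k q p)) p p.2 := fun p hp =>
    ((hα.all2 hv hN (min_le_right _ _) hA.le hp).mul (hfBD p hp).one_sub).congr (cut_ev hv hN α (fun p => 1 - f p) hp)
  have b1s : ∀ p, β1 p ≠ 0 → ∃ z y, 0 < z ∧ z ≤ δ ∧ p = chart v N k q (z, y) := fun p hp => by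
    obtain ⟨z, y, h1, h2, -, h3⟩ := hα.1 p (left_ne_zero_of_mul hp)
    exact ⟨z, y, h1, h2, h3⟩
  have A2 : Adm v N (k + e) q δ (2 * K) (2 * (((3 + e * (2 * K)) * A) * L)) β2 := by
    refine ⟨fun p hp => ?_, fun p h1 h2 h3 => ?_⟩
    · obtain ⟨z, y, h1, h2, -, rfl⟩ := hα.1 p (left_ne_zero_of_mul hp)
      have h4 := right_ne_zero_of_mul hp
      rw [cinv_chart hv hN (p := (z, y)) h1] at h4
      refine ⟨z, y / z ^ e, h1, h2, t4 _ h4, ?_⟩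
      rw [chart_blow]; congr 2; field_simp
    · have hz1 : p.1 ^ e ≤ 1 := pow_le_one₀ h1.le (by linarith)
      refine ((((hα.all hv hN hA.le (p := (p.1, p.1 ^ e * p.2)) h1).comp (ζ := fun p => (p.1, p.1 ^ e * p.2)) (p := p) (s := 1)
        (a1 := 1) (b1 := e * p.1 ^ (e - 1) * p.2) (b2 := p.1 ^ e) (m := 1) (c := e * (p.1 ^ e * p.2)) (c2 := p.1 ^ e)
        fz ((hasDerivAt_id p.1).prodMk ((hasDerivAt_pow e p.1).mul_const p.2))
        ((hasDerivAt_const _ p.1).prodMk (by simpa using (hasDerivAt_id p.2).const_mul (p.1 ^ e))) (by ring) (by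
          obtain ⟨e, rfl⟩ := Nat.exists_eq_add_of_le' he
          simp only [Nat.add_sub_cancel]; ring) (by ring)).mono (L := (3 + e * (2 * K)) * A) (by
        refine mul_le_mul_of_nonneg_right ?_ hA.le
        rw [abs_mul, abs_mul, abs_one, Nat.abs_cast, abs_of_pos (pow_pos h1 e)]
        have : (e:Rl) * (p.1 ^ e * |p.2|) ≤ e * (1 * (2 * K)) := by gcongr
        linarith)).mul (hθ p).1).congr ?_
      filter_upwards [(isOpen_lt continuous_const continuous_fst).mem_nhds (show p ∈ {p : Pl | 0 < p.1} from h1)] with x hx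
      simp only [hβ2, hf, chart_blow]
      rw [cinv_chart hv hN (p := (x.1, x.1 ^ e * x.2)) hx]
      congr 2; field_simp
  have e0 : (fun p => α p * g p) = fun p => β1 p * g p + β2 p * g p := by ext p; simp only [hβ1, hβ2]; ring
  rw [e0, add_mul]
  refine (osc_add (phys_int hv hN ig hq (A := (2 * (A * (1 + (3 + e) * L)))) (fun p hp => by
      obtain ⟨z, y, h1, h2, h4⟩ := b1s p hp
      exact ⟨z, y, h1, h2.trans_lt d1, h4⟩)
    (fun p hp _ => ⟨(b1BD p hp).1.continuousAt, (b1BD p hp).2.1⟩)) (A2.int hv hN ig hq d1 pz) t u).trans (add_le_add ?_ ?_)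
  · refine (hT β1 b1s (fun σ hσ => ⟨LB_flip (F := fun p => β1 (chart v N k q p)) (fun p hp _ => b1BD p hp) hσ, fun p hp h0 => ?_⟩) t u).trans ?_
    · have hp2 : 0 < p.2 := hp.2
      have h3 : |σ * p.2| = p.2 := by rcases hσ with h | h <;> simp [h, abs_of_pos hp2]
      have hs := hα.supp hv hN (p := (p.1, σ * p.2)) hp.1 (left_ne_zero_of_mul h0)
      have h4 := right_ne_zero_of_mul h0
      rw [chs, cinv_chart hv hN (p := (p.1, σ * p.2)) hp.1] at h4
      have h5 : K < |σ * p.2 / p.1 ^ e| := by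
        by_contra h
        exact h4 (by simp only [hf]; rw [t3 _ (by linarith)]; ring)
      rw [abs_div, h3, abs_of_pos (pow_pos hp.1 e), hK, div_lt_div_iff₀ hτ (pow_pos hp.1 e)] at h5
      exact ⟨hs.1, by rw [← h3]; exact hs.2, by linarith⟩
    · refine mul_le_mul_of_nonneg_left (wint_mono ig g0 v t u (image_mono fun p hp => ⟨hp.1, hp.2.1, hp.2.2.trans_le ?_⟩)) hC1.le
      linarith
  · refine (hQ β2 A2 t u).trans (mul_le_mul_of_nonneg_left (wint_mono ig g0 v t u ?_) hC2.le)
    rintro _ ⟨p, ⟨h1, h2, h3⟩, rfl⟩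
    refine ⟨(p.1, p.1 ^ e * p.2), ⟨h1, h2, ?_⟩, (chart_blow _ _ _ _ _ _).symm⟩
    have h4 : p.1 ^ e ≤ p.1 := pow_le_of_le_one h1.le (by linarith) (by omega)
    show |p.1 ^ e * p.2| < ε1
    rw [abs_mul, abs_of_pos (pow_pos h1 e)]
    rw [lt_div_iff₀ pz] at d5
    calc p.1 ^ e * |p.2| ≤ δ * (2 * K + 1) := by gcongr; linarith
      _ < ε1 := d5

lemma chart_sr (v : Pl) (N k D : Nat) (q h : Fr) (p : Pl) :
    chart v (N * D) (k * D) (fun w => q (w ^ D) + w ^ (k * D) * h (w ^ D)) p =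
      chart v N k q (p.1 ^ D, h (p.1 ^ D) + p.2) := by
  unfold chart
  simp only
  ring

include hv hN ig g0 in
lemma stepSR {D : Nat} (hD : 1 ≤ D) (hh : AnalyticAt Rl h 0) (h0 : h 0 = 0)
    (hP : PB v (N * D) (k * D) (fun w => q (w ^ D) + w ^ (k * D) * h (w ^ D)) g) : PB v N k q g := by
  intro ε1 hε1
  obtain ⟨ε', hε', hε2, δ', hδ', hP⟩ := hP (ε1 / 2) pz
  have hev : ∀ᶠ z in nhds Zr, |h z| < ε' / 2 ∧ |deriv h z| < |deriv h 0| + 1 ∧ AnalyticAt Rl h z := by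
    refine ((hh.continuousAt.abs.eventually_lt continuousAt_const (by simp [h0, hε'])).and
      ((hh.deriv.continuousAt.abs.eventually_lt continuousAt_const (by simp)).and hh.eventually_analyticAt))
  obtain ⟨d0, hd0, hev⟩ := Metric.eventually_nhds_iff.1 hev
  have hev : ∀ z, 0 < z → z < d0 → _ := fun z h1 h2 => hev (y := z) (by rwa [Real.dist_eq, sub_zero, abs_of_pos h1])
  refine ⟨ε' / 2, by positivity, by linarith, min (min d0 1) (δ' ^ D), by positivity, fun δ hδ hδ0 A hA => ?_⟩
  obtain ⟨⟨l1, l2⟩, l3⟩ : (δ < d0 ∧ δ < 1) ∧ δ < δ' ^ D := by simpa only [lt_min_iff] using hδ0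
  have hD0 : D ≠ 0 := by omega
  have root : ∀ z : Rl, 0 < z → ∃ w, 0 < w ∧ w ^ D = z := fun z hz =>
    ⟨z ^ ((D:Rl)⁻¹), by positivity, Real.rpow_inv_natCast_pow hz.le hD0⟩
  obtain ⟨δw, hw0, hw⟩ := root δ hδ
  set M := |deriv h 0| + 1
  obtain ⟨C, hC, hP⟩ := hP δw hw0 (lt_of_pow_lt_pow_left₀ D hδ'.le (by rwa [hw])) ((2 + D + M * D) * A) pz
  refine ⟨C, hC, fun α hα t u => (hP α ⟨fun p hp => ?_, fun p h1 h2 h3 => ?_⟩ t u).trans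
    (mul_le_mul_of_nonneg_left (wint_mono ig g0 v t u ?_) hC.le)⟩
  · obtain ⟨z, y, b1, b2, b3, rfl⟩ := hα.1 p hp
    obtain ⟨w, c1, rfl⟩ := root z b1
    have := (hev _ b1 (b2.trans_lt l1)).1
    refine ⟨w, y - h (w ^ D), c1, le_of_pow_le_pow_left₀ hD0 hw0.le (by rwa [hw]), (abs_sub _ _).trans (by linarith), ?_⟩
    rw [chart_sr]; simp
  · simp only [chart_sr]
    have z0 : 0 < p.1 ^ D := pow_pos h1 D
    have z1 : p.1 ^ D ≤ δ := by rw [← hw]; gcongr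
    obtain ⟨c1, c2, c3⟩ := hev _ z0 (z1.trans_lt l1)
    refine ((hα.all hv hN hA.le (p := (p.1 ^ D, h (p.1 ^ D) + p.2)) z0).comp (ζ := fun p => (p.1 ^ D, h (p.1 ^ D) + p.2)) (p := p)
      (s := 1) (a1 := D * p.1 ^ (D - 1)) (b1 := deriv h (p.1 ^ D) * (D * p.1 ^ (D - 1))) (b2 := 1) (m := D)
      (c := deriv h (p.1 ^ D) * (D * p.1 ^ D)) (c2 := 1) (by
        refine (contDiffAt_fst.pow D).prodMk (ContDiffAt.add ?_ contDiffAt_snd)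
        exact (c3.contDiffAt (n := 1)).comp p (contDiffAt_fst.pow D))
      ((hasDerivAt_pow D p.1).prodMk ((c3.differentiableAt.hasDerivAt.comp p.1 (hasDerivAt_pow D p.1)).add_const p.2))
      ((hasDerivAt_const _ (p.1 ^ D)).prodMk ((hasDerivAt_id p.2).const_add (h (p.1 ^ D))))
      (by obtain ⟨D, rfl⟩ := Nat.exists_eq_add_of_le' hD
          simp only [Nat.add_sub_cancel]; ring)
      (by obtain ⟨D, rfl⟩ := Nat.exists_eq_add_of_le' hD
          simp only [Nat.add_sub_cancel]; ring) (by ring)).mono ?_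
    refine mul_le_mul_of_nonneg_right ?_ hA.le
    rw [abs_one, Nat.abs_cast, abs_mul, abs_mul, Nat.abs_cast, abs_of_pos z0]
    have : |deriv h (p.1 ^ D)| * (D * p.1 ^ D) ≤ M * (D * 1) := by gcongr; linarith
    linarith
  · rintro _ ⟨p, ⟨h1, h2, h3⟩, rfl⟩
    have z2 : p.1 ^ D < 3 * δ / 4 := by
      calc p.1 ^ D < (3 * δw / 4) ^ D := by gcongr
        _ = (3/4) ^ D * δ := by rw [← hw]; ring
        _ ≤ (3/4) ^ 1 * δ := by gcongr ?_ * δ; exact pow_le_pow_of_le_one (by norm_num) (by norm_num) hD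
        _ = _ := by ring
    refine ⟨(p.1 ^ D, h (p.1 ^ D) + p.2), ⟨(pow_pos h1 D), z2, ?_⟩, (chart_sr _ _ _ _ _ _ _).symm⟩
    have := (hev _ (pow_pos h1 D) (by linarith)).1
    exact (abs_add_le _ _).trans_lt (by linarith)
end

/-- local structure of `g` off the zero sets of the `F j` -/
def GH {ι : Type} [Fintype ι] (F : ι → Fl) (γ : ι → Rl) (g : Fl) : Prop :=
  ∃ ρ > Zr, ∀ S : Set Pl, IsPreconnected S → S ⊆ disk2 ρ → (0:Rl×Rl) ∉ S → (∀ p ∈ S, ∀ j, F j p ≠ 0) →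
    (∀ p ∈ S, g p = 0) ∨ ∀ p ∈ S, g p = ∏ j, |F j p| ^ γ j

lemma qform_zero (h : qform N q) : q 0 = 0 := by
  obtain ⟨-, q1, -, h⟩ := h
  simpa using h.self_of_nhds

lemma small_TT (κ : Rl) (e1 : Nat) {V : Set (Rl × Rl × Rl)} (hV : V ∈ nhds 0) (hκ : 0 ≤ κ) :
    ∀ᶠ τ in 𝓝[>] 0, ∀ p : Pl, 0 < p.1 → p.1 ≤ τ → p.2 ≠ 0 → |p.2| ≤ τ → κ * p.1 ^ e1 ≤ τ * |p.2| →
      (p.1, p.2, κ * p.1 ^ e1 / p.2) ∈ V := by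
  obtain ⟨r, hr, h⟩ := Metric.mem_nhds_iff.1 hV
  filter_upwards [Ioo_mem_nhdsGT hr] with τ hτ p h1 h2 h3 h4 h5
  apply h
  rw [mem_ball_zero_iff]
  refine max_lt ?_ (max_lt ?_ ?_)
  · simpa [abs_of_pos h1] using h2.trans_lt hτ.2
  · simpa using h4.trans_lt hτ.2
  · simp only [norm_div, Real.norm_eq_abs, abs_of_nonneg (mul_nonneg hκ (pow_pos h1 e1).le)]
    exact ((div_le_iff₀ pz).2 h5).trans_lt hτ.2

lemma TH {ι : Type} [Fintype ι] {F : ι → Fl} {γ : ι → Rl} (hG : GH F γ g)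
    (hv : Un v) (hN : 1 ≤ N) (hqf : qform N q) (hκ : 0 ≤ κ)
    (e1 : Nat) (hJ : ∀ j, ∃ (a m : Nat) (U : Rl × Rl × Rl → Rl), AnalyticAt Rl U 0 ∧ U 0 ≠ 0 ∧
      ∀ᶠ τ in 𝓝[>] Zr, ∀ p : Pl, 0 < p.1 → p.1 ≤ τ → p.2 ≠ 0 → |p.2| ≤ τ → κ * p.1 ^ e1 ≤ τ * |p.2| →
        F j (chart v N k q p) = p.1 ^ a * p.2 ^ m * U (p.1, p.2, κ * p.1 ^ e1 / p.2))
    (σ : Rl) (hσ : σ = 1 ∨ σ = -1) : TermHyp v N k q g κ e1 σ := by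
  classical
  obtain ⟨ρ, hρ, hG⟩ := hG
  choose a m U hU hU0 hF using hJ
  have hσ1 : |σ| = 1 := by rcases hσ with rfl | rfl <;> simp
  have hσ2 : σ * σ = 1 := by rcases hσ with rfl | rfl <;> norm_num
  have hσ0 : σ ≠ 0 := fun h => by simp [h] at hσ1
  set L : Rl × Rl × Rl → Rl × Rl × Rl := fun x => (x.1, σ * x.2.1, σ * x.2.2) with hL
  have hL0 : ∀ j, U j (L 0) ≠ 0 := fun j => by
    have : L 0 = 0 := by simp [hL]
    rw [this]; exact hU0 j
  obtain ⟨τ, h1, h2, h3⟩ := ((eventually_all.2 hF).and ((small_TT κ e1 ((eventually_all.2 fun j => (hU j).continuousAt.eventually_ne (hU0 j)).and (((continuous_fst.tendsto (0:Rl×Rl×Rl)).eventually (hqf.1.eventually_analyticAt.mono fun z h => h.continuousAt)).and (by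
    have c0 : ContinuousAt (fun x : Rl × Rl × Rl => chart v N k q (x.1, x.2.1)) 0 := by
      unfold chart; refine ContinuousAt.fun_add (ContinuousAt.fun_smul ?_ continuousAt_const) (ContinuousAt.fun_smul ((ContinuousAt.comp (g := q) (f := fun x : Rl × Rl × Rl => x.1) (by simpa using hqf.1.continuousAt) continuousAt_fst).fun_add ?_) continuousAt_const) <;> fun_prop
    have o : IsOpen (disk2 ρ) := isOpen_lt fz fz
    refine c0.eventually (o.mem_nhds ?_)
    have hN' : N ≠ 0 := by omega
    simp only [disk2, mem_setOf_eq, chart]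
    simp [(qform_zero hqf), hN']; positivity))) hκ).and self_mem_nhdsWithin)).exists
  set R : Set Pl := QQ ∩ TT τ τ κ τ e1 with hR
  have hRp : ∀ p ∈ R, 0 < p.1 ∧ 0 < p.2 ∧ (σ * p.2 ≠ 0) ∧ |σ * p.2| ≤ τ ∧ κ * p.1 ^ e1 ≤ τ * |σ * p.2| ∧ p.1 ≤ τ := fun p hp => by
    have h4 : |σ * p.2| = p.2 := by rw [abs_mul, hσ1, one_mul, abs_of_pos hp.1.2]
    refine ⟨hp.1.1, hp.1.2, mul_ne_zero hσ0 (ne_of_gt hp.1.2), ?_, ?_, hp.2.1⟩ <;> rw [h4]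
    exacts [hp.2.2.1, hp.2.2.2]
  have hdiv : ∀ p ∈ R, κ * p.1 ^ e1 / (σ * p.2) = σ * (κ * p.1 ^ e1 / p.2) := fun p hp => by
    have := (hRp p hp).2.1.ne'
    field_simp
    linear_combination -(κ * p.1 ^ e1) * hσ2
  have hpt : ∀ p ∈ R, (∀ j, U j (L (p.1, p.2, κ * p.1 ^ e1 / p.2)) ≠ 0) ∧ ContinuousAt q p.1 ∧ chs v N k q σ p ∈ disk2 ρ ∧
      ∀ j, F j (chs v N k q σ p) = p.1 ^ a j * (σ * p.2) ^ m j * U j (L (p.1, p.2, κ * p.1 ^ e1 / p.2)) := fun p hp => by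
    obtain ⟨b1, b2, b3, b4, b5, b6⟩ := hRp p hp
    have A := h2 (p.1, σ * p.2) b1 b6 b3 b4 b5
    have B := fun j => h1 j (p.1, σ * p.2) b1 b6 b3 b4 b5
    simp only [hdiv p hp] at A B
    exact ⟨A.1, A.2.1, A.2.2, B⟩
  have hconv : Convex Rl R := by
    have e : R = {p : Pl | 0 < p.1} ∩ ({p : Pl | 0 < p.2} ∩ ({p : Pl | p.1 ≤ τ} ∩ ({p : Pl | p.2 ≤ τ} ∩
        {p : Pl | 0 ≤ p.1 ∧ κ * p.1 ^ e1 - τ * p.2 ≤ 0}))) := by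
      ext p; simp only [hR, QQ, TT, mem_inter_iff, mem_prod, mem_Ioi, mem_setOf_eq, sub_nonpos]
      constructor
      · rintro ⟨⟨x1, x2⟩, x3, x4, x5⟩; exact ⟨x1, x2, x3, x4, x1.le, x5⟩
      · rintro ⟨x1, x2, x3, x4, x5, x6⟩; exact ⟨⟨x1, x2⟩, x3, x4, x6⟩
    have c1 : ConvexOn Rl {p : Pl | 0 ≤ p.1} (fun p : Pl => κ * p.1 ^ e1 - τ * p.2) := by
      have := (((convexOn_pow e1 (𝕜 := Rl)).comp_linearMap (LinearMap.fst Rl Rl Rl)).smul hκ).add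
        ((((-τ) • LinearMap.snd Rl Rl Rl).convexOn (convex_univ)).subset (subset_univ _) ((convex_Ici Zr).linear_preimage (LinearMap.fst Rl Rl Rl)))
      refine ⟨this.1, fun x hx y hy a b ha hb hab => ?_⟩
      have := this.2 hx hy ha hb hab
      simp at this ⊢; linarith
    rw [e]
    refine (convex_halfSpace_gt ⟨fun _ _ => rfl, fun _ _ => rfl⟩ _).inter ((convex_halfSpace_gt ⟨fun _ _ => rfl, fun _ _ => rfl⟩ _).inter
      ((convex_halfSpace_le ⟨fun _ _ => rfl, fun _ _ => rfl⟩ _).inter ((convex_halfSpace_le ⟨fun _ _ => rfl, fun _ _ => rfl⟩ _).inter (c1.convex_le 0))))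
  have hpre : IsPreconnected (chs v N k q σ '' R) := by
    refine hconv.isPreconnected.image _ fun p hp => ContinuousAt.continuousWithinAt ?_
    unfold chs chart; refine ContinuousAt.fun_add (ContinuousAt.fun_smul ?_ continuousAt_const) (ContinuousAt.fun_smul ((ContinuousAt.comp (g := q) (f := fun x : Pl => x.1) (hpt p hp).2.1 continuousAt_fst).fun_add ?_) continuousAt_const) <;> fun_prop
  refine ⟨τ, h3, (hG _ hpre (by rintro _ ⟨p, hp, rfl⟩; exact (hpt p hp).2.2.1) (by
    rintro ⟨p, hp, h⟩
    have := dot_chart_v hv N k q (p.1, σ * p.2)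
    unfold chs at h; rw [h] at this
    have h5 := pow_pos (hRp p hp).1 N
    simp only [dot2, Prod.fst_zero, Prod.snd_zero, zero_mul, add_zero] at this; exact h5.ne this) (by
    rintro _ ⟨p, hp, rfl⟩ j
    rw [(hpt p hp).2.2.2 j]
    exact mul_ne_zero (mul_ne_zero (pow_pos (hRp p hp).1 _).ne' (pow_ne_zero _ (hRp p hp).2.2.1)) ((hpt p hp).1 j))).imp (fun h p hp hp' => h _ ⟨p, ⟨hp, hp'⟩, rfl⟩) fun h => ?_⟩
  refine ⟨∑ j, a j * γ j, ∑ j, m j * γ j, fun x => ∏ j, |U j (L x)| ^ γ j, ?_, ?_, fun p hp hp' => ?_⟩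
  · refine contDiffAt_prod fun j _ => ?_
    exact (((fun j =>
      an_comp 0 (hU j) (by rw [hL]; fun_prop) (by simp [hL])) j).contDiffAt.abs (hL0 j)).rpow_const_of_ne (abs_ne_zero.2 (hL0 j))
  · exact Finset.prod_pos fun j _ => Real.rpow_pos_of_pos (abs_pos.2 (hL0 j)) _
  · have hp2 : p ∈ R := ⟨hp, hp'⟩
    rw [h _ ⟨p, hp2, rfl⟩]
    obtain ⟨b1, b2, -⟩ := hRp p hp2
    unfold mon
    rw [Real.rpow_sum_of_pos b1, Real.rpow_sum_of_pos b2, ← Finset.prod_mul_distrib, ← Finset.prod_mul_distrib]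
    refine Finset.prod_congr rfl fun j _ => ?_
    rw [(hpt p hp2).2.2.2 j, abs_mul, abs_mul, abs_pow, abs_pow, abs_mul, hσ1, one_mul, abs_of_pos b1, abs_of_pos b2,
      Real.mul_rpow pz (abs_nonneg _), Real.mul_rpow pz pz,
      Real.rpow_mul b1.le, Real.rpow_mul b2.le, Real.rpow_natCast, Real.rpow_natCast]

lemma lemA {ι : Type} [Fintype ι] (f : ι → Fl) (r : ι → Rl → Rl) (m : ι → Nat) (hf : ∀ j, AnalyticAt Rl (f j) 0)
    (hr : ∀ j, AnalyticAt Rl (r j) 0) (hr0 : ∀ j, r j 0 ≠ 0) (h0 : ∀ j, ∀ᶠ y in nhds 0, f j (0, y) = y ^ m j * r j y) :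
    ∃ (h : Fr) (c : ι → Nat → Rl → Rl) (U : ι → Fl), AnalyticAt Rl h 0 ∧ h 0 = 0 ∧
      (∀ j, (∀ i, AnalyticAt Rl (c j i) 0) ∧ AnalyticAt Rl (U j) 0 ∧ U j 0 ≠ 0 ∧ (∀ i < m j, c j i 0 = 0) ∧
        ∀ᶠ p in nhds 0, f j (p.1, h p.1 + p.2) = ∑ i ∈ Finset.range (m j), c j i p.1 * p.2 ^ i + p.2 ^ m j * U j p) ∧
      ((∀ j, m j = 0) ∨ ∃ j0, 1 ≤ m j0 ∧ ∀ᶠ z in nhds 0, c j0 (m j0 - 1) z = 0) := by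
  have key : ∀ h : Fr, AnalyticAt Rl h 0 → h 0 = 0 → ∀ j (c : Nat → Rl → Rl) (U : Fl), AnalyticAt Rl U 0 →
      (∀ᶠ p in nhds 0, f j (p.1, h p.1 + p.2) = ∑ i ∈ Finset.range (m j), c i p.1 * p.2 ^ i + p.2 ^ m j * U p) →
      (∀ i < m j, c i 0 = 0) ∧ U 0 ≠ 0 := fun h hh hh0 j c U hU e => by
    refine coef_zero (m j) (fun p => f j (p.1, h p.1 + p.2)) c U (r j) hU (hr j).continuousAt (hr0 j) e ?_
    simpa [hh0] using h0 j
  have key2 : ∀ h : Fr, AnalyticAt Rl h 0 → h 0 = 0 → ∀ j, ∃ (c : Nat → Rl → Rl) (U : Fl), (∀ i, AnalyticAt Rl (c i) 0) ∧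
      AnalyticAt Rl U 0 ∧ ∀ᶠ p in nhds 0, f j (p.1, h p.1 + p.2) = ∑ i ∈ Finset.range (m j), c i p.1 * p.2 ^ i + p.2 ^ m j * U p :=
    fun h hh hh0 j => exp_lemma (m j) (fun p => f j (p.1, h p.1 + p.2)) (an_comp 0 (hf j)
      (AnalyticAt.prod fz ((an_comp   0 hh fz rfl).add fz)) (by simp [hh0]))
  by_cases hm : ∀ j, m j = 0
  · choose c U a1 a2 a3 using key2 (fun _ => 0) analyticAt_const rfl
    refine ⟨fun _ => 0, c, U, analyticAt_const, rfl, fun j => ?_, Or.inl hm⟩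
    have := key _ analyticAt_const rfl j _ _ (a2 j) (a3 j)
    exact ⟨a1 j, a2 j, this.2, this.1, a3 j⟩
  · push Not at hm
    obtain ⟨j0, hj0⟩ := hm
    obtain ⟨k, hk⟩ := Nat.exists_eq_succ_of_ne_zero hj0
    obtain ⟨h, c0, U0, hh, hh0, b1, b2, b3, b4⟩ := shift_lemma k (f j0) (hf j0) (r j0) (hr j0) (hr0 j0) (by simpa [hk] using h0 j0)
    have key3 : ∀ j, ∃ (c : Nat → Rl → Rl) (U : Fl), ((∀ i, AnalyticAt Rl (c i) 0) ∧
      AnalyticAt Rl U 0 ∧ ∀ᶠ p in nhds 0, f j (p.1, h p.1 + p.2) = ∑ i ∈ Finset.range (m j), c i p.1 * p.2 ^ i + p.2 ^ m j * U p) ∧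
      (j = j0 → ∀ᶠ z in nhds 0, c k z = 0) := fun j => by
      by_cases hj : j = j0
      · subst hj
        exact ⟨c0, U0, ⟨b1, b2, by simpa [hk] using b4⟩, fun _ => b3⟩
      · obtain ⟨c, U, h⟩ := key2 h hh hh0 j
        exact ⟨c, U, h, fun h => absurd h hj⟩
    choose c U a1 a2 using key3
    refine ⟨h, c, U, hh, hh0, fun j => ?_, Or.inr ⟨j0, by omega, ?_⟩⟩
    · have := key h hh hh0 j _ _ (a1 j).2.1 (a1 j).2.2
      exact ⟨(a1 j).1, (a1 j).2.1, this.2, this.1, (a1 j).2.2⟩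
    · simpa [hk] using a2 j0 rfl

lemma lemB {ι : Type} [Fintype ι] (m : ι → Nat) (c : ι → Nat → Rl → Rl) (hc : ∀ j i, AnalyticAt Rl (c j i) 0)
    (hc0 : ∀ j, ∀ i < m j, c j i 0 = 0) (hne : ¬ ∀ j, ∀ i < m j, ∀ᶠ z in nhds 0, c j i z = 0) :
    ∃ D e , 1 ≤ D ∧ 1 ≤ e ∧ ∃ C : ι → Nat → Rl → Rl, (∀ j i, AnalyticAt Rl (C j i) 0) ∧
      (∀ j, ∀ i < m j, ∀ᶠ w in nhds 0, c j i (w ^ D) = w ^ (e * (m j - i)) * C j i w) ∧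
      (∀ j, ∀ i < m j, (∀ᶠ z in nhds 0, c j i z = 0) → C j i 0 = 0) ∧ ∃ j i, i < m j ∧ C j i 0 ≠ 0 := by
  classical
  have hord : ∀ j i, ∃ (n : Nat) (u : Fr), AnalyticAt Rl u 0 ∧ ((¬ ∀ᶠ z in nhds 0, c j i z = 0) → u 0 ≠ 0 ∧
      (∀ᶠ z in nhds 0, c j i z = z ^ n * u z) ∧ (i < m j → 1 ≤ n)) := fun j i => by
    by_cases h : ∀ᶠ z in nhds 0, c j i z = 0
    · exact ⟨0, 0, analyticAt_const, fun h' => absurd h h'⟩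
    · obtain ⟨n, u, h1, h2, h3⟩ := (hc j i).exists_eventuallyEq_pow_smul_nonzero_iff.2 h
      simp   at h3
      refine ⟨n, u, h1, fun _ => ⟨h2, h3, fun hi => ?_⟩⟩
      by_contra hn
      have := h3.self_of_nhds
      simp [show n = 0 by omega, hc0 j i hi] at this
      exact h2 this.symm
  choose n u hu hnu using hord
  set S : Finset (Σ j, Fin (m j)) := Finset.univ.filter fun x => ¬ ∀ᶠ z in nhds 0, c x.1 x.2 z = 0 with hS
  obtain ⟨⟨j1, i1⟩, hx, hmin⟩ := S.exists_min_image (fun x => (n x.1 x.2 : ℚ) / (m x.1 - x.2 : Nat)) (by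
    push Not at hne
    obtain ⟨j, i, hi, h⟩ := hne
    exact ⟨⟨j, ⟨i, hi⟩⟩, by simpa [hS] using h⟩)
  have hx' : ¬ ∀ᶠ z in nhds (0), c j1 i1 z = 0 := by simpa [hS] using hx
  set D := m j1 - i1 with hD
  set e := n j1 i1 with he
  have hD1 : 1 ≤ D := by omega
  have hle : ∀ j, ∀ i < m j, (¬ ∀ᶠ z in nhds Zr, c j i z = 0) → e * (m j - i) ≤ n j i * D := fun j i hi h => by
    have := hmin ⟨j, ⟨i, hi⟩⟩ (by simpa [hS] using h)
    rw [div_le_div_iff₀ pz (by exact_mod_cast by omega)] at this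
    exact_mod_cast this
  refine ⟨D, e, hD1, (hnu j1 i1 hx').2.2 i1.2, fun j i => if ∀ᶠ z in nhds 0, c j i z = 0 then fun _ => 0 else
    fun w => w ^ (n j i * D - e * (m j - i)) * u j i (w ^ D), fun j i => ?_, fun j i hi => ?_, fun j i hi h => by simp  [if_pos h],
    j1, i1, i1.2, ?_⟩
  · by_cases h : ∀ᶠ z in nhds 0, c j i z = 0
    · simp  [if_pos h]; exact analyticAt_const
    · simp  [if_neg h]
      exact (by fun_prop : AnalyticAt Rl (fun w : Rl => w ^ (n j i * D - e * (m j - i))) 0).mul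
        (an_comp  0 (hu j i) fz (by simp; omega))
  · have ht  := by
      simpa [show D ≠ 0 by omega] using (continuous_pow D (M := Rl).tendsto 0)
    by_cases h : ∀ᶠ z in nhds 0, c j i z = 0
    · simp  [if_pos h]
      filter_upwards [ht.eventually h] with w hw
      simp [hw]
    · simp  [if_neg h]
      filter_upwards [ht.eventually (hnu j i h).2.1] with w hw
      rw [hw, ← mul_assoc, ← pow_add, ← pow_mul, Nat.add_sub_cancel' (hle j i hi h), mul_comm D]
  · simp only [if_neg hx']
    rw [Nat.sub_self, zero_pow (by omega : D ≠ 0), pow_zero, one_mul]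
    exact (hnu j1 i1 hx').1

lemma childpoly (m : Nat) (C : Nat → Rl) {V : Rl} (hV : V ≠ 0) (c : Rl) : ∃ μ ≤ m, ∃ r , AnalyticAt Rl r 0 ∧ r 0 ≠ 0 ∧
    (∀ x, ∑ i ∈ Finset.range m, C i * (c + x) ^ i + (c + x) ^ m * V = x ^ μ * r x) ∧
    (μ = m → ∀ i < m, C i = V * ((-c) ^ (m - i) * m.choose i)) := by
  classical
  set P : Polynomial Rl := ∑ i ∈ Finset.range m, Polynomial.C (C i) * Polynomial.X ^ i + Polynomial.C V * Polynomial.X ^ m with hP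
  have hcoef : ∀ i, P.coeff i = if i < m then C i else if i = m then V else 0 := fun i => by
    simp  [hP, Polynomial.coeff_add, ]
    by_cases h : i < m
    · simp [h.ne]
    · simp [h]
  have hP0 : P ≠ 0 := fun h => by
    have := hcoef m
    simp [h] at this; exact hV this.symm
  have hdeg : P.natDegree = m := by
    refine le_antisymm (Polynomial.natDegree_le_iff_coeff_eq_zero.2 fun i hi => ?_) (Polynomial.le_natDegree_of_ne_zero ?_)
    · rw [hcoef, if_neg (by omega), if_neg (by omega)]
    · rw [hcoef]; simpa using hV
  obtain ⟨Q, hQ, hQ2⟩ := Polynomial.exists_eq_pow_rootMultiplicity_mul_and_not_dvd P hP0 c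
  have hd2 := congrArg Polynomial.natDegree hQ
  rw [Polynomial.natDegree_mul (pow_ne_zero _ (Polynomial.X_sub_C_ne_zero c)) (fun h => hP0 (by rw [hQ, h, mul_zero])), Polynomial.natDegree_pow, Polynomial.natDegree_X_sub_C] at hd2
  refine ⟨P.rootMultiplicity c, by omega, fun x => Q.eval (c + x), ?_, ?_, fun x => ?_, fun h i hi => ?_⟩
  · exact an_comp  0 (AnalyticOnNhd.eval_polynomial  Q _ (mem_univ (c + 0))) fz rfl
  · rw [Polynomial.dvd_iff_isRoot] at hQ2; simpa using hQ2
  · have := congrArg (Polynomial.eval (c + x)) hQ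
    simp [hP, Polynomial.eval_finsetSum] at this
    rw [mul_comm _ V, this]
  · rw [h] at hQ hd2
    rw [(Polynomial.eq_C_of_natDegree_eq_zero (p := Q) (by omega)), mul_comm, sub_eq_add_neg, ← Polynomial.C_neg] at hQ
    have h1 := congrArg (fun p => Polynomial.coeff p m) hQ
    have h2 := congrArg (fun p => Polynomial.coeff p i) hQ
    simp only [Polynomial.coeff_C_mul, Polynomial.coeff_X_add_C_pow, hcoef] at h1 h2
    simp [hi] at h1 h2
    rw [h2, h1]

def Dat {ι : Type} (F : ι → Fl) (v : Pl) (N k : Nat) (q : Fr) (m : ι → Nat) : Prop :=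
  ∀ j, ∃ (a : Nat) (f : Fl) (r : Fr), AnalyticAt Rl f 0 ∧ AnalyticAt Rl r 0 ∧ r 0 ≠ 0 ∧
    (∀ᶠ y in nhds Zr, f (0, y) = y ^ m j * r y) ∧
    ∀ᶠ p in nhds (0:Rl×Rl), 0 < p.1 → F j (chart v N k q p) = p.1 ^ a * f p

def NH {ι : Type} (F : ι → Fl) (v : Pl) (N k : Nat) (q : Fr) (m : ι → Nat) (e : Nat) (C : ι → Nat → Rl → Rl)
    (V : ι → Fl) (A : ι → Nat) : Prop :=
  ∀ j, AnalyticAt Rl (V j) 0 ∧ V j 0 ≠ 0 ∧ (∀ i, AnalyticAt Rl (C j i) 0) ∧ ∀ᶠ p in nhds (0:Rl×Rl), 0 < p.1 →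
    F j (chart v N k q p) = p.1 ^ A j * (∑ i ∈ Finset.range (m j), p.1 ^ (e * (m j - i)) * C j i p.1 * p.2 ^ i + p.2 ^ m j * V j p)

section
variable {ι : Type} [Fintype ι] {F : ι → Fl} {γ : ι → Rl} {g : Fl} (hG : GH F γ g)
  {v : Pl} (hv : Un v) (ig : Integrable g) (g0 : ∀ p, 0 ≤ g p)
  {N k : Nat} (hN : 1 ≤ N) (hk : N ≤ k) {q : Fr} (hqf : qform N q)

include hG hv ig g0 hN hk hqf in
lemma NH_TB {m : ι → Nat} {C : ι → Nat → Rl → Rl} {V : ι → Fl} {A : ι → Nat} (h : NH F v N k q m e C V A) :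
    TB v N k q g 1 e := by
  refine TB_of hv hN ig g0 hk hqf zero_le_one (TH hG hv hN hqf zero_le_one e fun j => ?_)
  obtain ⟨h1, h2, h3, h4⟩ := h j
  refine ⟨A j, m j, fun x => ∑ i ∈ Finset.range (m j), C j i x.1 * x.2.2 ^ (m j - i) + V j (x.1, x.2.1), ?_, ?_, ?_⟩
  · fun_prop
  · exact (congrArg (· + _) (Finset.sum_eq_zero fun i hi => by
          have := Finset.mem_range.1 hi
          simp; omega)).trans_ne (by rw [zero_add]; exact h2)
  · have ht  := by
      have : Continuous fun x : Rl × Rl × Rl => (x.1, x.2.1) := by fun_prop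
      exact this.tendsto 0
    filter_upwards [small_TT 1 e (ht.eventually h4) zero_le_one] with τ hτ p p1 p2 p3 p4 p5
    rw [hτ p p1 p2 p3 p4 p5 p1, mul_assoc]
    congr 1
    simp
    rw [mul_add, Finset.mul_sum]
    congr 1
    refine Finset.sum_congr rfl fun i hi => ?_
    have := Finset.mem_range.1 hi
    rw [div_pow, ← pow_mul]
    have e1 : p.2 ^ m j = p.2 ^ i * p.2 ^ (m j - i) := by rw [← pow_add]; congr 1; omega
    rw [e1]; field_simp

omit [Fintype ι] in
lemma NH_child {m : ι → Nat} (he : 1 ≤ e) {C : ι → Nat → Rl → Rl} {V : ι → Fl} {A : ι → Nat} (h : NH F v N k q m e C V A) (c : Rl) :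
    ∃ m' , (∀ j, m' j ≤ m j) ∧ Dat F v N (k + e) (fun z => q z + c * z ^ (k + e)) m' ∧
      ∀ j, m' j = m j → ∀ i < m j, C j i 0 = V j 0 * ((-c) ^ (m j - i) * (m j).choose i) := by
  choose μ hμ r hr hr0 hr1 hr2 using (fun j => childpoly (m j) (fun i => C j i 0) (h j).2.1 c)
  refine ⟨μ, hμ, fun j => ?_, hr2⟩
  obtain ⟨h1, h2, h3, h4⟩ := h j
  have he' : e ≠ 0 := by omega
  refine ⟨A j + e * m j, fun p => ∑ i ∈ Finset.range (m j), C j i p.1 * (c + p.2) ^ i + (c + p.2) ^ m j * V j (p.1, p.1 ^ e * (c + p.2)),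
    r j, ?_, hr j, hr0 j, Eventually.of_forall fun y => ?_, ?_⟩
  · refine AnalyticAt.fun_add (Finset.analyticAt_fun_sum _ fun i _ => AnalyticAt.fun_mul ?_ fz)
      (AnalyticAt.fun_mul fz (an_comp 0 h1 fz (by simp [he'])))
    exact an_comp  0 (h3 i) fz rfl
  · simp  [zero_pow he', zero_mul]
    exact hr1 j y
  · have ht  := by
      have : Continuous fun p : Pl => (p.1, p.1 ^ e * (c + p.2)) := by fun_prop
      simpa [he', Prod.mk_zero_zero] using (this.tendsto 0)
    filter_upwards [ht.eventually h4] with p hp p1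
    rw [chart_shift, chart_blow, hp p1, pow_add, mul_assoc]
    congr 1
    rw [mul_add (p.1 ^ (e * m j)), Finset.mul_sum]
    congr 1
    · refine Finset.sum_congr rfl fun i hi => ?_
      have := Finset.mem_range.1 hi
      have e1 : p.1 ^ (e * m j) = p.1 ^ (e * (m j - i)) * (p.1 ^ e) ^ i := by
        rw [← pow_mul, ← pow_add, ← mul_add]; congr 2; omega
      rw [e1, mul_pow]; ring
    · rw [mul_pow]; ring

omit [Fintype ι] in
lemma NH_of {m : ι → Nat} {a : ι → Nat} {f : ι → Fl}     (hF : ∀ j, ∀ᶠ p in nhds 0, 0 < p.1 → F j (chart v N k q p) = p.1 ^ a j * f j p) (hh : AnalyticAt Rl h 0) (hh0 : h 0 = 0)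
    {c : ι → Nat → Rl → Rl} {U : ι → Fl} (hU : ∀ j, AnalyticAt Rl (U j) 0 ∧ U j 0 ≠ 0 ∧
        ∀ᶠ p in nhds 0, f j (p.1, h p.1 + p.2) = ∑ i ∈ Finset.range (m j), c j i p.1 * p.2 ^ i + p.2 ^ m j * U j p)
    {D : Nat} (hD : 1 ≤ D) {C : ι → Nat → Rl → Rl} (hC : ∀ j i, AnalyticAt Rl (C j i) 0)
    (hcC : ∀ j, ∀ i < m j, ∀ᶠ w in nhds 0, c j i (w ^ D) = w ^ (e * (m j - i)) * C j i w) :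
    NH F v (N * D) (k * D) (fun w => q (w ^ D) + w ^ (k * D) * h (w ^ D)) m e C (fun j p => U j (p.1 ^ D, p.2)) fun j => D * a j := by
  intro j
  have hD' : D ≠ 0 := by omega
  have t1  := by
    have : Continuous fun p : Pl => (p.1 ^ D, p.2) := by fun_prop
    simpa [hD', Prod.mk_zero_zero] using this.tendsto 0
  have t2  := by
    simpa [hh0, ContinuousAt, Prod.mk_zero_zero] using (continuousAt_fst.prodMk (((an_comp (f := fun p : Pl => p.1)  0 hh fz rfl).continuousAt).add continuousAt_snd))
  refine ⟨an_comp 0 (hU j).1 fz (by simp [hD']), by simpa [hD', Prod.mk_zero_zero] using (hU j).2.1, hC j, ?_⟩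
  filter_upwards [t1.eventually (t2.eventually (hF j)), t1.eventually (hU j).2.2, ((Filter.eventually_all_finset _).2 fun i hi => (continuous_fst.tendsto (0:Rl×Rl)).eventually (hcC j i (Finset.mem_range.1 hi)))] with p p1 p2 p3 p4
  rw [chart_sr, p1 (pow_pos p4 D), p2, ← pow_mul]
  congr 2
  exact Finset.sum_congr rfl fun i hi => by grind

include hk hqf in
lemma qform_sr (hh : AnalyticAt Rl h 0) (hh0 : h 0 = 0) {D : Nat} (hD : 1 ≤ D) :
    qform (N * D) fun w => q (w ^ D) + w ^ (k * D) * h (w ^ D) := by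
  obtain ⟨hq, q1, hq1, hqe⟩ := hqf
  have hD' : D ≠ 0 := by omega
  obtain ⟨f1, hf1, hf2⟩ := div_lemma  (fun p : Pl => h p.2) fz
  have t0  := by
    simpa [hD'] using continuous_pow D (M := Rl).tendsto 0
  have c1 : ∀ {φ : Fr}, AnalyticAt Rl φ 0 → AnalyticAt Rl (fun w => φ (w ^ D)) 0 := fun h =>
    an_comp  0 h fz (by simp [hD'])
  refine ⟨(c1 hq).add (AnalyticAt.mul fz (c1 hh)), fun w => w ^ (D - 1) * q1 (w ^ D) + w ^ (k * D + D - (N * D + 1)) * f1 (0, w ^ D),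
    (AnalyticAt.mul fz (c1 hq1)).add (AnalyticAt.mul fz (an_comp  0 hf1 fz (by simp [hD']))), ?_⟩
  filter_upwards [t0.eventually hqe, (tendsto_const_nhds.prodMk_nhds t0).eventually hf2] with w h1 h2
  simp  [hh0, zero_add] at h2
  have h3  := Nat.mul_le_mul_right D hk
  rw [h1, h2, mul_add, ← mul_assoc, ← mul_assoc, ← mul_assoc, ← pow_add, ← pow_add, ← pow_mul, ← pow_add]
  congr 3 <;> [(rw [mul_add, mul_comm D]; omega); omega]

include hG hv ig g0 in
theorem tree : ∀ (s : Nat) (N k : Nat) (q : Fr) (m : ι → Nat), 1 ≤ N → N ≤ k → qform N q → Dat F v N k q m → ∑ j, m j = s →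
    PB v N k q g := by
  intro s
  induction s using Nat.strong_induction_on with
  | _ s ih =>
  intro N k q m hN hk hqf hD hs
  choose a f r hf hr hr0 hfr hF using hD
  obtain ⟨h, c, U, hh, hh0, hcU, hj0⟩ := lemA f r m hf hr hr0 hfr
  by_cases hz : ∀ j, ∀ i < m j, ∀ᶠ z in nhds 0, c j i z = 0
  · refine stepSR hv hN ig g0 le_rfl hh hh0 ?_
    have hN1 : 1 ≤ N * 1 := by omega
    have hq1 := qform_sr hk hqf hh hh0 le_rfl
    have hnh : NH F v (N * 1) (k * 1) (fun w => q (w ^ 1) + w ^ (k * 1) * h (w ^ 1)) m 0 (fun _ _ _ => 0) (fun j p => U j (p.1 ^ 1, p.2)) fun j => 1 * a j :=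
      NH_of hF hh hh0 (fun j => ⟨(hcU j).2.1, (hcU j).2.2.1, (hcU j).2.2.2.2⟩) le_rfl (fun _ _ => analyticAt_const)
        fun j i hi => by simpa using hz j i hi
    refine PB_of_TB0 hv hN1 ig g0 0 (TB_of hv hN1 ig g0 (by omega) hq1 le_rfl (TH hG hv hN1 hq1 le_rfl 0 fun j => ?_))
    obtain ⟨h1, h2, -, h4⟩ := hnh j
    refine ⟨1 * a j, m j, fun x => U j (x.1 ^ 1, x.2.1), an_comp (f := fun x : Rl × Rl × Rl => (x.1, x.2.1)) 0 h1 fz rfl, h2, ?_⟩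
    have ht  := by
      have : Continuous fun x : Rl × Rl × Rl => (x.1, x.2.1) := by fun_prop
      exact this.tendsto 0
    filter_upwards [small_TT 0 0 (ht.eventually h4) le_rfl] with τ hτ p p1 p2 p3 p4 p5
    rw [hτ p p1 p2 p3 p4 p5 p1]
    simp
    ring
  · obtain ⟨D, e, hD1, he1, C, hC, hcC, hCz, j1, i1, hi1, hne⟩ := lemB m c (fun j => (hcU j).1) (fun j => (hcU j).2.2.2.1) hz
    have hnh := NH_of     hF hh hh0 (fun j => ⟨(hcU j).2.1, (hcU j).2.2.1, (hcU j).2.2.2.2⟩) hD1 hC hcC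
    have hq1 := qform_sr hk hqf hh hh0 hD1
    have hN1  := Nat.mul_pos hN hD1
    have hk1  := Nat.mul_le_mul_right D hk
    refine stepSR hv hN ig g0 hD1 hh hh0 ?_
    obtain ⟨q0, e0, w, -, -, -, d, hd, -, hqd, -⟩ := qform_nf hq1
    refine stepB hv hN1 ig g0 he1 hd (fun z hz => (hqd z hz).1) (NH_TB hG hv ig g0 hN1 hk1 hq1 hnh)
      (QB_of hv hN1 ig g0 hd (fun z hz => (hqd z hz).1) fun b => ?_)
    obtain ⟨m', hm', hdat, hstr⟩ := NH_child he1 hnh b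
    refine ih _ (by
      rw [← hs]
      refine Finset.sum_lt_sum (fun j _ => hm' j) ?_
      by_contra hcon
      push Not at hcon
      have heq  := fun j => le_antisymm (hm' j) (hcon j (Finset.mem_univ j))
      rcases hj0 with hj0 | ⟨j0, h1, h2⟩
      · exact absurd hi1 (by simp [hj0 j1])
      · have x1 := hstr j0 (heq j0) (m j0 - 1) (by omega)
        rw [hCz j0 _ (by omega) h2] at x1
        have hb : b = 0 := by
          rw [show m j0 - (m j0 - 1) = 1 by omega] at x1
          rcases mul_eq_zero.1 x1.symm with x | x
          · exact absurd x ((hnh j0).2.1)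
          · rcases mul_eq_zero.1 x with x | x
            · linarith
            · exact absurd x (by exact_mod_cast (Nat.choose_pos (by omega)).ne')
        apply hne
        rw [hstr j1 (heq j1) i1 hi1, hb, neg_zero, zero_pow (by omega)]; simp) (N * D) (k * D + e) _ m' hN1 (by omega) ?_ hdat rfl
    obtain ⟨y1, y2, y3, y4⟩ := hq1
    refine ⟨y1.add fz, fun z => y2 z + b * z ^ (k * D + e - (N * D + 1)), y3.add fz, ?_⟩
    filter_upwards [y4] with z hz
    rw [hz]
    have : z ^ (k * D + e) = z ^ (N * D + 1) * z ^ (k * D + e - (N * D + 1)) := by rw [← pow_add]; congr 1; omega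
    rw [this]; ring
end

lemma ps_exp {p : FormalMultilinearSeries Rl Pl Rl} (hp : HasFPowerSeriesAt f p 0)     (h0 : ∀ i < n, ∀ w : Pl, p i (fun _ => w) = 0) (w : Pl) :
    ∃ u , ContinuousAt u 0 ∧ u 0 = 0 ∧ ∀ z, z ≠ 0 → f (z • w) = z ^ n * (p n (fun _ => w) + u z) := by
  have hps : ∀ z : Rl, p.partialSum (n + 1) (z • w) = z ^ n * p n fun _ => w := fun z => by
    have hm  := fun i => by
      simpa using ((p i).map_smul_univ (fun _ => z) fun _ => w)
    unfold FormalMultilinearSeries.partialSum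
    rw [Finset.sum_range_succ, hm, Finset.sum_eq_zero, zero_add]
    intro i hi
    rw [hm, h0 i (Finset.mem_range.1 hi), mul_zero]
  have hf0 : f 0 = p 0 fun _ => w := by
    rw [← (hp.coeff_zero fun _ => w)]
  obtain ⟨C, hC⟩ := ((hp.isBigO_sub_partialSum_pow (n + 1)).comp_tendsto (by
    have : Continuous fun z : Rl => z • w := by fun_prop
    simpa using this.tendsto 0)).bound
  have hu0 : (f (Zr • w) - 0 ^ n * p n fun _ => w) / 0 ^ n = 0 := by
    rcases Nat.eq_zero_or_pos n with rfl | hn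
    · simp [hf0]
    · simp [hn.ne']
  refine ⟨fun z => (f (z • w) - z ^ n * p n fun _ => w) / z ^ n, ?_, hu0, fun z hz => ?_⟩
  · rw [ContinuousAt, hu0]
    refine squeeze_zero_norm' (a := fun z => C * ‖w‖ ^ (n + 1) * |z|) ?_ ?_
    · filter_upwards [hC] with z hz
      simp only [Function.comp_def, hps, zero_add] at hz
      by_cases h : z = 0
      · subst h; rw [hu0]; simp
      · rw [norm_div, div_le_iff₀ (norm_pos_iff.2 (pow_ne_zero n h))]
        refine hz.trans (le_of_eq ?_)
        rw [norm_pow, norm_norm, norm_smul, norm_pow, Real.norm_eq_abs z]; ring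
    · have : Continuous fun z : Rl => C * ‖w‖ ^ (n + 1) * |z| := by fun_prop
      simpa using this.tendsto 0
  · field_simp; ring

lemma vo_lt {i : Nat} (h : i < vanishingOrder f) : iteratedFDeriv Rl i f 0 = 0 := by
  by_contra hc
  exact absurd (Nat.sInf_le  hc) (not_le.2 h)

/-- expansion in the blow-up chart -/
lemma low_exp (hf : AnalyticAt Rl f 0) (v : Pl) : ∃ U , AnalyticAt Rl U 0 ∧
    (∀ᶠ p in nhds 0, f (p.1 • (v + p.2 • perp2 v)) = p.1 ^ vanishingOrder f * U p) ∧
    ∀ᶠ y in nhds Zr, U (0, y) = lowestPart f (v + y • perp2 v) / (vanishingOrder f).factorial := by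
  set n := vanishingOrder f with hn
  obtain ⟨p, r, hp⟩ := hf
  have hd : ∀ i w, p i (fun _ => w) = iteratedFDeriv Rl i f 0 (fun _ => w) / i.factorial := fun i w => by
    rw [← (hp.factorial_smul w i), nsmul_eq_mul]; field_simp
  obtain ⟨c, U, hc, hU, he⟩ := exp_lemma  n (fun x : Pl => f (x.2 • (v + x.1 • perp2 v)))
    (an_comp  0 hp.analyticAt fz (by simp))
  have hU2 : ∀ᶠ y in nhds 0, ContinuousAt (fun z => U (y, z)) 0 := by
    have  := by
      have : Continuous fun y : Rl => ((y, 0) : Pl) := by fun_prop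
      exact this.tendsto 0
    filter_upwards [this.eventually hU.eventually_analyticAt] with y hy
    exact ContinuousAt.comp   hy.continuousAt fz
  have key : ∀ᶠ y in nhds 0, (∀ i < n, c i y = 0) ∧ U (y, 0) = p n fun _ => v + y • perp2 v := by
    filter_upwards [he.curry_nhds, hU2] with y h1 h2
    obtain ⟨u, u1, u2, u3⟩ := ps_exp ⟨r, hp⟩ (fun i hi w => by rw [hd, vo_lt hi]; simp) (v + y • perp2 v)
    have := uniq_lemma n (fun i => c i y) (fun z => U (y, z) - (p n (fun _ => v + y • perp2 v) + u z))
      (h2.sub (continuousAt_const.add u1)) (by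
        filter_upwards [h1.filter_mono nhdsWithin_le_nhds, self_mem_nhdsWithin] with z h3 h4
        have h5 := u3 z h4
        rw [h3] at h5
        linear_combination h5)
    refine ⟨this.1, ?_⟩
    linarith
  have ts : Tendsto (fun x : Pl => (x.2, x.1)) (nhds 0) (nhds 0) := by
    have : Continuous fun x : Pl => (x.2, x.1) := by fun_prop
    exact this.tendsto 0
  refine ⟨fun x => U (x.2, x.1), an_comp  0 hU fz rfl, ?_, ?_⟩
  · filter_upwards [ts.eventually he, (continuous_snd.tendsto 0).eventually key] with x h1 h2
    rw [h1, Finset.sum_eq_zero, zero_add]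
    intro i hi
    rw [h2.1 i (Finset.mem_range.1 hi), zero_mul]
  · filter_upwards [key] with y hy
    rw [hy.2, hd]; rfl

lemma low_ne (hf : AnalyticAt Rl f 0) (hnt : ¬ ∀ᶠ p in nhds 0, f p = 0) :
    ∃ w, lowestPart f w ≠ 0 := by
  by_contra hcon
  push Not at hcon
  obtain ⟨p, r, hp⟩ := hf
  have hne : {k : Nat | iteratedFDeriv Rl k f 0 ≠ 0}.Nonempty := by
    by_contra hem
    rw [Set.not_nonempty_iff_eq_empty, Set.eq_empty_iff_forall_notMem] at hem
    apply hnt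
    filter_upwards [Metric.eball_mem_nhds 0 hp.r_pos] with x hx
    have h1 := hp.hasSum_iteratedFDeriv hx
    simp  [(fun k => by simpa using hem k), ] at h1
    exact h1.unique hasSum_zero
  have hmem : iteratedFDeriv Rl (vanishingOrder f) f 0 ≠ 0 := Nat.sInf_mem hne
  apply hmem
  set n := vanishingOrder f with hn
  have hd : ∀ w, p n (fun _ => w) = 0 := fun w => by
    have := hp.factorial_smul w n
    rw [show iteratedFDeriv Rl n f 0 (fun _ => w) = 0 from hcon w, nsmul_eq_mul] at this
    exact (mul_eq_zero.1 this).resolve_left pz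
  let q : FormalMultilinearSeries Rl Pl Rl := fun i => if i = n then p i else 0
  have hq : HasFPowerSeriesOnBall (fun _ : Pl => 0) q 0 ⊤ := by
    refine ⟨?_, ENNReal.zero_lt_top, fun {y} _ => ?_⟩
    · rw [q.radius_eq_top_of_eventually_eq_zero]
      filter_upwards [eventually_gt_atTop n] with i hi
      simp  [q, if_neg hi.ne']
    · have : (fun i => q i fun _ => y) = fun _ => 0 := by
        funext i
        simp  [q]
        split_ifs with h
        · subst h; exact hd y
        · rfl
      rw [this]; exact hasSum_zero
  ext x
  rw [hp.iteratedFDeriv_eq_sum_of_completeSpace]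
  have h2 : iteratedFDeriv Rl n (fun _ : Pl => Zr) 0 = 0 := by
    simp
  simpa [q] using (hq.iteratedFDeriv_eq_sum_of_completeSpace  x).symm

lemma low_an (f : Fl) (w : Pl) : AnalyticAt Rl (lowestPart f) w := by
  exact an_comp  (f := fun x : Pl => fun _ => x) w
    (ContinuousMultilinearMap.analyticAt _ ) (AnalyticAt.pi fun _ => analyticAt_id) rfl

lemma low_smul (f : Fl) (c : Rl) (w : Pl) : lowestPart f (c • w) = c ^ vanishingOrder f * lowestPart f w := by
  unfold lowestPart
  simpa using ((iteratedFDeriv Rl (vanishingOrder f) f 0).map_smul_univ (fun _ => c) fun _ => w)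

lemma low_line (hf : AnalyticAt Rl f 0) (hnt : ¬ ∀ᶠ p in nhds 0, f p = 0)     (hv : Un v) : ¬ ∀ᶠ y in nhds Zr, lowestPart f (v + y • perp2 v) = 0 := by
  intro hc
  obtain ⟨w, hw⟩ := low_ne hf hnt
  apply hw
  refine AnalyticOnNhd.eqOn_zero_of_preconnected_of_eventuallyEq_zero
    (fun x _ => low_an f x) isPreconnected_univ (mem_univ v) ?_ (mem_univ w)
  have c1 : ContinuousAt (fun x : Pl => dot2 x (perp2 v) / dot2 x v) v := by
    unfold dot2
    refine ContinuousAt.div fz fz ?_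
    rw [← sq, ← sq, hv]; exact one_ne_zero
  have c0 : dot2 v (perp2 v) / dot2 v v = 0 := by simp [dot2, perp2, mul_comm]
  rw [ContinuousAt, c0] at c1
  filter_upwards [c1.eventually hc, (by
    have : ContinuousAt (fun x : Pl => dot2 x v) v := by unfold dot2; fun_prop
    exact this.eventually_ne (by unfold dot2; rw [← sq, ← sq, hv]; exact one_ne_zero))] with x h1 h2
  have : x = dot2 x v • (v + (dot2 x (perp2 v) / dot2 x v) • perp2 v) := by
    rw [smul_add, smul_smul, mul_div_cancel₀ _ h2]
    ext <;> simp [dot2, perp2]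
    · linear_combination -x.1 * hv
    · linear_combination -x.2 * hv
  rw [this, low_smul, h1, mul_zero]; rfl

lemma chart11 (v : Pl) (p : Pl) : chart v 1 1 (fun _ => 0) p = p.1 • (v + p.2 • perp2 v) := by
  simp [chart, smul_smul]

lemma Dat_init {ι : Type} {F : ι → Fl} (hF : ∀ j, AnalyticAt Rl (F j) 0) (hnt : ∀ j, ¬ ∀ᶠ p in nhds 0, F j p = 0)
    (hv : Un v) : ∃ m, Dat F v 1 1 (fun _ => 0) m := by
  have : ∀ j, ∃ (m : Nat) (a : Nat) (f : Fl) (r : Fr), AnalyticAt Rl f 0 ∧ AnalyticAt Rl r 0 ∧ r 0 ≠ 0 ∧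
    (∀ᶠ y in nhds 0, f (0, y) = y ^ m * r y) ∧
    ∀ᶠ p in nhds 0, 0 < p.1 → F j (chart v 1 1 (fun _ => 0) p) = p.1 ^ a * f p := fun j => by
    obtain ⟨U, h1, h2, h3⟩ := low_exp (hF j) v
    obtain ⟨m, r, r1, r2, r3⟩ := (an_comp  0 h1 fz rfl).exists_eventuallyEq_pow_smul_nonzero_iff.2 fun hc => low_line (hF j) (hnt j) hv (by
      filter_upwards [hc, h3] with y e1 e2
      rw [e1, eq_div_iff pz, zero_mul] at e2
      exact e2.symm)
    refine ⟨m, vanishingOrder (F j), U, r, h1, r1, r2, by simpa using r3, ?_⟩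
    filter_upwards [h2] with p hp _
    rw [chart11, hp]
  choose m h using this
  exact ⟨m, h⟩

lemma qform0 (N : Nat) : qform N fun _ => 0 := ⟨analyticAt_const, fun _ => 0, analyticAt_const, by simp⟩

/-- the main local estimate in an arbitrary direction -/
lemma PB_main {ι : Type} [Fintype ι] {F : ι → Fl} {γ : ι → Rl} (hG : GH F γ g)
    (hF : ∀ j, AnalyticAt Rl (F j) 0) (hnt : ∀ j, ¬ ∀ᶠ p in nhds 0, F j p = 0)
    (hv : Un v) (ig : Integrable g) (g0 : ∀ p, 0 ≤ g p) : PB v 1 1 (fun _ => 0) g := by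
  obtain ⟨m, hm⟩ := Dat_init hF hnt hv
  exact tree hG hv ig g0 _ 1 1 _ m le_rfl le_rfl (qform0 1) hm rfl

lemma ndecomp (hh : AnalyticAt Rl h 0) (N : Nat) [NeZero N] : ∃ H : Fin N → Rl → Rl, (∀ i, AnalyticAt Rl (H i) 0) ∧
    ∀ᶠ s in nhds 0, h s = ∑ i : Fin N, s ^ (i:Nat) * H i (s ^ N) := by
  obtain ⟨p, r, hp⟩ := hh
  obtain ⟨s0, hs0, hs1⟩ := ENNReal.lt_iff_exists_nnreal_btwn.1 hp.r_pos
  have s0p : 0 < s0 := by exact_mod_cast hs0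
  obtain ⟨C, hC, hb⟩ := p.norm_mul_pow_le_of_lt_radius (hs1.trans_le hp.r_le)
  let P  := fun i => FormalMultilinearSeries.ofScalars Rl fun k => p.coeff (k * N + i)
  have hP : ∀ i, s0 ^ N ≤ (P i).radius := fun i => by
    refine (P i).le_radius_of_bound (C / s0 ^ (i:Nat)) fun k => ?_
    simp only [P, FormalMultilinearSeries.ofScalars_norm]
    rw [le_div_iff₀ pz, ← FormalMultilinearSeries.norm_apply_eq_norm_coef]
    refine le_trans (le_of_eq ?_) (hb (k * N + i))
    push_cast
    ring
  have hP0  := fun i => lt_of_lt_of_le (ENNReal.coe_pos.2 (pow_pos (by linarith) N)) (hP i)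
  refine ⟨fun i => (P i).sum, fun i => ((P i).hasFPowerSeriesOnBall (hP0 i)).analyticAt, ?_⟩
  filter_upwards [(Metric.eball_mem_nhds _ hs0)] with s hs
  have h1 := hp.hasSum (Metric.eball_subset_eball hs1.le hs)
  rw [zero_add] at h1
  have h2 : HasSum (fun x : Fin N × Nat => p (x.2 * N + x.1) fun _ => s) (h s) := by
    have := ((Equiv.prodComm _ _).trans (Nat.divModEquiv N).symm).hasSum_iff.2 h1
    exact this
  exact (h2.prod_fiberwise (fun i => by
    have hm : s ^ N ∈ Metric.eball 0 (P i).radius := by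
      refine Metric.eball_subset_eball (hP i) ?_
      rw [Metric.mem_eball, edist_zero_right, enorm_pow]
      rw [Metric.mem_eball, edist_zero_right] at hs
      exact ENNReal.pow_lt_pow_left (NeZero.ne N) hs
    have := ((P i).hasFPowerSeriesOnBall (hP0 i)).hasSum hm
    rw [zero_add] at this
    refine (this.mul_left (s ^ (i:Nat))).congr_fun ?_
    intro k
    rw [FormalMultilinearSeries.apply_eq_pow_smul_coeff]
    simp  [P, FormalMultilinearSeries.ofScalars_apply_eq]
    ring)).unique (hasSum_fintype _)

lemma det_an {E : Type*} [NormedAddCommGroup E] [NormedSpace Rl E] {M : E → Matrix (Fin N) (Fin N) Rl} {x : E}     (h : ∀ i j, AnalyticAt Rl (fun e => M e i j) x) : AnalyticAt Rl (fun e => (M e).det) x := by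
  simp  [Matrix.det_apply]
  refine Finset.analyticAt_fun_sum _ fun τ _ => ?_
  simp only [Units.smul_def, zsmul_eq_mul]
  fun_prop

lemma bdry0 (hh : AnalyticAt Rl h 0) (hN : 0 < N) (σ : Rl) (hσ : σ = 1 ∨ σ = -1) :
    ∃ b : Fl, AnalyticAt Rl b 0 ∧ (¬ ∀ᶠ p in nhds 0, b p = 0) ∧
      ∀ᶠ p in nhds 0, 0 ≤ σ * p.1 → p.2 = h (|p.1| ^ (N:Rl)⁻¹) → b p = 0 := by
  have : NeZero N := ⟨hN.ne'⟩
  have := fun j : Fin N => ndecomp (h := fun s => s ^ (j:Nat) * h s) fz N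
  choose H hH he using this
  let M  := fun x => Matrix.of fun i j => H j i x
  refine ⟨fun p => (Matrix.scalar (Fin N) p.2 - M (σ * p.1)).det, ?_, ?_, ?_⟩
  · refine det_an fun i j => ?_
    simp  [Matrix.sub_apply, Matrix.scalar_apply, Matrix.diagonal_apply, ]
    refine AnalyticAt.fun_sub ?_ (an_comp  0 (hH j i) fz (by simp))
    split_ifs <;> fun_prop
  · intro hc
    have t  := by
      have : Continuous fun y : Rl => ((0, y) : Pl) := by fun_prop
      exact this.tendsto 0
    apply ((Matrix.charpoly_monic (M 0)).ne_zero)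
    refine Polynomial.eq_zero_of_infinite_isRoot _ ?_
    exact infinite_of_mem_nhds 0 (by
      filter_upwards [(t.eventually hc)] with y hy
      simpa [Matrix.eval_charpoly] using hy)
  · have t  := by
      have hc : Continuous fun p : Pl => |p.1| ^ (N:Rl)⁻¹ :=
        Continuous.rpow_const fz fun p => Or.inr pz
      simpa [Real.zero_rpow (inv_ne_zero (Nat.cast_ne_zero.2 hN.ne'))] using (hc.tendsto 0)
    filter_upwards [t.eventually (eventually_all.2 he)] with p h1 h2 h3
    set s := |p.1| ^ (N:Rl)⁻¹ with hs
    have h4 : s ^ N = σ * p.1 := by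
      rw [Real.rpow_inv_natCast_pow (abs_nonneg _) hN.ne']
      rcases hσ with rfl | rfl
      · rw [abs_of_nonneg (by linarith)]; ring
      · rw [abs_of_nonpos (by linarith)]; ring
    refine Matrix.exists_vecMul_eq_zero_iff.1 ⟨fun i => s ^ (i:Nat), ?_, ?_⟩
    · intro hc
      have := congrFun hc 0
      simp at this
    · rw [Matrix.vecMul_sub]
      funext j
      have := h1 j
      rw [h4] at this
      simp only [Matrix.vecMul, dotProduct, M, Matrix.diagonal_apply, h3, Pi.sub_apply, Matrix.scalar_apply, Matrix.of_apply, ← this, mul_ite, mul_zero, Finset.sum_ite_eq', Finset.mem_univ, if_true, Pi.zero_apply, sub_self]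

lemma bdry_fun {r₀ : Rl} (hr : 0 < r₀) {C : Set Pl} (hC : IsPuiseuxBdryCurve r₀ C) :
    ∃ b : Fl, AnalyticAt Rl b 0 ∧ (¬ ∀ᶠ p in nhds 0, b p = 0) ∧ ∀ᶠ p in nhds 0, p ∈ C → b p = 0 := by
  obtain ⟨N, h, I, σ, hN, hσ, -, hI, hh, -, hC, -⟩ := hC
  obtain ⟨b, b1, b2, b3⟩ := bdry0 (hh 0 (hI ⟨le_rfl, by positivity⟩)) hN σ hσ
  have ts  := by
    have : Continuous fun x : Pl => (x.2, x.1) := by fun_prop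
    exact this.tendsto 0
  rcases hC with rfl | rfl
  · exact ⟨b, b1, b2, b3.mono fun p hp h => by grind⟩
  · refine ⟨fun p => b (p.2, p.1), an_comp  0 b1 fz rfl,
      fun hc => b2 ((ts.eventually hc).mono fun p hp => hp), (ts.eventually b3).mono fun p hp h => hp h.2.1 h.2.2⟩

lemma bdry_list {E : Set Pl} (hE : IsStdDomain E) : ∃ (κ : Type) (_ : Fintype κ) (b : κ → Fl),
    (∀ k, AnalyticAt Rl (b k) 0) ∧ (∀ k, ¬ ∀ᶠ p in nhds 0, b k p = 0) ∧
    ∀ᶠ p in nhds 0, p ∈ frontier E → ∃ k, b k p = 0 := by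
  have hc : ∀ r₀ : Rl, 0 < r₀ → ∀ᶠ p in nhds (0:Rl×Rl), p.1 ^ 2 + p.2 ^ 2 < r₀ ^ 2 := fun r₀ hr => by
    have : Continuous fun p : Pl => p.1 ^ 2 + p.2 ^ 2 := by fun_prop
    exact this.continuousAt.eventually_lt (continuousAt_const ) (by simp_all)
  rcases hE with ⟨r₀, hr, rfl⟩ | ⟨r₀, hr, m, Es, Cs, rfl, -, hEs, hCs, -⟩
  · refine ⟨Empty, inferInstance, fun k => k.elim, fun k => k.elim, fun k => k.elim, ?_⟩
    have ho : IsOpen (disk2 r₀) := isOpen_lt fz fz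
    filter_upwards [hc r₀ hr] with p hp hf
    rw [ho.frontier_eq] at hf
    exact absurd hp hf.2
  · choose b b1 b2 b3 using (fun x : Fin m × Fin 2 => bdry_fun hr (hCs x.1 x.2))
    refine ⟨Fin m × Fin 2, inferInstance, b, b1, b2, ?_⟩
    filter_upwards [hc r₀ hr, eventually_all.2 b3] with p h1 h2 h3
    have h4 : ∃ i, p ∈ frontier (Es i) := by
      have h5 := h3.1
      rw [closure_iUnion_of_finite, mem_iUnion] at h5
      obtain ⟨i, hi⟩ := h5
      exact ⟨i, hi, fun hh => h3.2 (interior_mono (subset_iUnion Es i) hh)⟩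
    obtain ⟨i, hi⟩ := h4
    rcases (hEs i).2.2.2 hi with (h | h) | h
    · exact ⟨(i, 0), h2 (i, 0) h⟩
    · exact ⟨(i, 1), h2 (i, 1) h⟩
    · exact absurd h h1.ne

lemma nrm2_pos (hp : p ≠ 0) : 0 < nrm2 p := by
  refine Real.sqrt_pos.2 ?_
  by_contra hc
  exact hp (Prod.ext (by simpa using (by nlinarith)) (by simpa using (by nlinarith)))

/-- limits of directions of zeros are zeros of the lowest part -/
lemma tan_low {b : Fl} (hb : AnalyticAt Rl b 0) (hw : Un w) {p : Nat → Pl}     (h0 : ∃ᶠ k in atTop, b (p k) = 0) (hp0 : ∀ k, p k ≠ 0) (hp : Tendsto p atTop (nhds 0))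
    (hd : Tendsto (fun k => (nrm2 (p k))⁻¹ • p k) atTop (nhds w)) : lowestPart b w = 0 := by
  obtain ⟨U, h1, h2, h3⟩ := low_exp hb w
  have dc : ∀ w' : Pl, Continuous fun x : Pl => dot2 x w' := fun w' => by unfold dot2; fun_prop
  have t1 : Tendsto (fun k => dot2 (p k) w) atTop (nhds 0) := by
    have := ((dc w).tendsto 0).comp hp
    rwa [show dot2 0 w = 0 by simp [dot2]] at this
  have a1 := ((dc w).tendsto w).comp hd
  have a2 := ((dc (perp2 w)).tendsto w).comp hd
  rw [show dot2 w w = 1 by unfold dot2; linarith] at a1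
  rw [show dot2 w (perp2 w) = 0 by unfold dot2 perp2; ring] at a2
  have hsm : ∀ (c : Rl) (x y : Pl), dot2 (c • x) y = c * dot2 x y := fun c x y => by simp [dot2]; ring
  have t2 : Tendsto (fun k => dot2 (p k) (perp2 w) / dot2 (p k) w) atTop (nhds 0) := by
    have := a2.div a1 one_ne_zero
    rw [zero_div] at this
    refine this.congr fun k => ?_
    simp  [Function.comp_def, Pi.div_apply, hsm]
    rw [mul_div_mul_left _ _ (inv_ne_zero ((fun k => nrm2_pos (hp0 k)) k).ne')]
  have e1 : ∀ᶠ k in atTop, dot2 (p k) w ≠ 0 := by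
    filter_upwards [a1.eventually_ne one_ne_zero] with k hk hc
    apply hk
    simp [hsm, hc]
  have t3 := t1.prodMk_nhds t2
  have h4 : U 0 = 0 := by
    by_contra hne
    obtain ⟨k, k1, k2, k3, k4⟩ := (h0.and_eventually (((h1.continuousAt.tendsto.comp t3).eventually_ne hne).and (e1.and (t3.eventually h2)))).exists
    have : p k = dot2 (p k) w • (w + (dot2 (p k) (perp2 w) / dot2 (p k) w) • perp2 w) := by
      rw [smul_add, smul_smul, mul_div_cancel₀ _ k3]
      ext <;> simp [dot2, perp2]
      · linear_combination -(p k).1 * hw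
      · linear_combination -(p k).2 * hw
    rw [← this, k1] at k4
    exact mul_ne_zero (pow_ne_zero _ k3) k2 k4.symm
  have h5 := h3.self_of_nhds
  rw [show ((0, 0) : Pl) = 0 from rfl, h4, zero_smul, add_zero, eq_comm, div_eq_zero_iff] at h5
  exact h5.resolve_right pz

lemma norm_le_nrm2 (p : Pl) : ‖p‖ ≤ nrm2 p := by
  exact max_le (Real.abs_le_sqrt (by nlinarith )) (Real.abs_le_sqrt (by nlinarith ))

lemma nrm2_sq (p : Pl) : nrm2 p ^ 2 = p.1 ^ 2 + p.2 ^ 2 := Real.sq_sqrt pz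

lemma nrm2_cont : Continuous nrm2 := by unfold nrm2; fun_prop

lemma nrm2_lt (hr : 0 ≤ r) : p ∈ disk2 r ↔ nrm2 p < r := by
  unfold disk2; rw [mem_setOf_eq, ← nrm2_sq]
  exact pow_lt_pow_iff_left₀ (nrm2_nonneg p) hr two_ne_zero

lemma ev_disk {P : Pl → Prop} (h : ∀ᶠ p in nhds 0, P p) : ∃ ρ > 0, ∀ p, nrm2 p < ρ → P p := by
  obtain ⟨ρ, h1, h2⟩ := Metric.eventually_nhds_iff.1 h
  exact ⟨ρ, h1, fun p hp => h2 (by rw [dist_zero_right]; exact (norm_le_nrm2 p).trans_lt hp)⟩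

lemma disk_ev {ρ : Rl} (h : 0 < ρ) : ∀ᶠ p in nhds 0, nrm2 p < ρ :=
  nrm2_cont.continuousAt.eventually_lt continuousAt_const (by simpa [nrm2] using h)

lemma an_O {F : Type*} [NormedAddCommGroup F] [NormedSpace Rl F] [CompleteSpace F] {f : Pl → F} (hf : AnalyticAt Rl f 0)     (h0 : ∀ i < n, iteratedFDeriv Rl i f 0 = 0) : ∃ C > 0, ∀ᶠ p in nhds 0, ‖f p‖ ≤ C * nrm2 p ^ n := by
  obtain ⟨P, r, hp⟩ := hf
  obtain ⟨C, hC, hb⟩ := (HasFPowerSeriesAt.isBigO_sub_partialSum_pow ⟨r, hp⟩ n).exists_pos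
  refine ⟨C, hC, ?_⟩
  filter_upwards [hb.bound] with p hb
  have : P.partialSum n p = 0 := by
    refine Finset.sum_eq_zero fun i hi => ?_
    have := hp.factorial_smul p i
    rw [h0 i (by grind), ← Nat.cast_smul_eq_nsmul Rl] at this
    exact (smul_eq_zero.1 this).resolve_left pz
  rw [this, sub_zero, zero_add, norm_pow, norm_norm] at hb
  refine hb.trans (mul_le_mul_of_nonneg_left ?_ hC.le)
  exact pow_le_pow_left₀ (norm_nonneg _) (norm_le_nrm2 p) n

lemma f_up (hf : AnalyticAt Rl f 0) : ∃ C > 0, ∀ᶠ p in nhds 0,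
    |f p| ≤ C * nrm2 p ^ vanishingOrder f ∧ nrm2 p * ‖fderiv Rl f p‖ ≤ C * nrm2 p ^ vanishingOrder f := by
  obtain ⟨C1, hC1, h1⟩ := an_O hf  fun i hi => vo_lt hi
  have : ∃ C > 0, ∀ᶠ p in nhds 0, nrm2 p * ‖fderiv Rl f p‖ ≤ C * nrm2 p ^ vanishingOrder f := by
    obtain ⟨C, hC, h⟩ := an_O hf.fderiv (n := vanishingOrder f - 1) fun i hi => by
      rw [← norm_eq_zero, norm_iteratedFDeriv_fderiv, vo_lt (by omega), norm_zero]
    refine ⟨C, hC, ?_⟩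
    filter_upwards [h, disk_ev one_pos] with p hp hp1
    have h2 := nrm2_nonneg p
    rcases Nat.eq_zero_or_pos (vanishingOrder f) with h0 | h0
    · simp  [h0, Nat.zero_sub, ] at hp ⊢
      exact (mul_le_of_le_one_left (norm_nonneg _) hp1.le).trans hp
    · obtain ⟨m, hm⟩ := Nat.exists_eq_add_of_lt h0
      rw [show vanishingOrder f = m + 1 by omega] at hp ⊢
      calc _ ≤ nrm2 p * (C * nrm2 p ^ (m + 1 - 1)) := by gcongr
        _ = _ := by simp; ring
  obtain ⟨C2, hC2, h2⟩ := this
  refine ⟨max C1 C2, by positivity, ?_⟩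
  filter_upwards [h1, h2] with p h1 h2
  have := pow_nonneg (nrm2_nonneg p) (vanishingOrder f)
  exact ⟨h1.trans (mul_le_mul_of_nonneg_right (le_max_left _ _) this), h2.trans (mul_le_mul_of_nonneg_right (le_max_right _ _) this)⟩

lemma f_low (hf : AnalyticAt Rl f 0) {K : Set Pl} (hK : IsCompact K)
    (h0 : ∀ w ∈ K, lowestPart f w ≠ 0) : ∃ c > 0, ∀ᶠ p in nhds 0, p ≠ 0 → (nrm2 p)⁻¹ • p ∈ K →
      c * nrm2 p ^ vanishingOrder f ≤ |f p| := by
  rcases K.eq_empty_or_nonempty with rfl | hne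
  · exact ⟨1, one_pos, by simp⟩
  obtain ⟨w0, hw0, hmin⟩ := hK.exists_isMinOn hne
    fun w _ => (low_an f w).continuousAt.abs.continuousWithinAt
  set n := vanishingOrder f with hn
  set m := |lowestPart f w0| with hm
  have mpos  := abs_pos.2 (h0 _ hw0)
  obtain ⟨P, r, hp⟩ := hf
  obtain ⟨C, hC, hb⟩ := (HasFPowerSeriesAt.isBigO_sub_partialSum_pow ⟨r, hp⟩ (n + 1)).exists_pos
  refine ⟨m / (2 * n.factorial), by positivity, ?_⟩
  filter_upwards [hb.bound, disk_ev (show 0 < m / (2 * n.factorial) / C by positivity)] with p hb hr hp0 hpK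
  have hpos := nrm2_pos hp0
  have hd : ∀ i w, P i (fun _ => w) = iteratedFDeriv Rl i f 0 (fun _ => w) / i.factorial := fun i w => by
    rw [← (hp.factorial_smul w i), nsmul_eq_mul]; field_simp
  have : P.partialSum (n + 1) p = lowestPart f p / n.factorial := by
    unfold FormalMultilinearSeries.partialSum
    rw [Finset.sum_range_succ, Finset.sum_eq_zero, zero_add, hd]; · rfl
    intro i hi
    rw [hd, vo_lt (Finset.mem_range.1 hi)]; simp
  rw [this, zero_add, norm_pow, norm_norm, Real.norm_eq_abs] at hb
  have h1 : m * nrm2 p ^ n ≤ |lowestPart f p| := by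
    have h2 : m ≤ |lowestPart f ((nrm2 p)⁻¹ • p)| := hmin hpK
    have h3 : lowestPart f p = nrm2 p ^ n * lowestPart f ((nrm2 p)⁻¹ • p) := by
      rw [← low_smul, smul_smul, mul_inv_cancel₀ hpos.ne', one_smul]
    rw [h3, abs_mul, abs_of_pos (pow_pos hpos n), mul_comm]
    gcongr
  have h4 : C * ‖p‖ ^ (n + 1) ≤ m / (2 * n.factorial) * nrm2 p ^ n := by
    have h5 : ‖p‖ ^ (n + 1) ≤ nrm2 p ^ (n + 1) := pow_le_pow_left₀ (norm_nonneg _) (norm_le_nrm2 p) _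
    rw [lt_div_iff₀ hC] at hr
    calc _ ≤ C * nrm2 p ^ (n + 1) := by gcongr
      _ = nrm2 p * C * nrm2 p ^ n := by ring
      _ ≤ _ := by gcongr
  have h6 : m / n.factorial * nrm2 p ^ n ≤ |lowestPart f p / n.factorial| := by
    rw [abs_div, abs_of_pos (show Zr < n.factorial by positivity), div_mul_eq_mul_div]
    gcongr
  have h7 : |lowestPart f p / n.factorial| - |f p| ≤ |f p - lowestPart f p / n.factorial| := by
    rw [abs_sub_comm]; exact abs_sub_abs_le_abs_sub _ _
  have h8 : m / n.factorial = 2 * (m / (2 * n.factorial)) := by field_simp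
  rw [h8] at h6
  linarith

def LG (K : Set Pl) (s : Rl) (φ : Fl) : Prop := ∃ c > Zr, ∃ C > Zr, ∀ᶠ p in nhds (0:Rl×Rl),
  p ≠ 0 → (nrm2 p)⁻¹ • p ∈ K → ContDiffAt Rl 1 φ p ∧ c * nrm2 p ^ s ≤ φ p ∧ φ p ≤ C * nrm2 p ^ s ∧
    nrm2 p * ‖fderiv Rl φ p‖ ≤ C * nrm2 p ^ s

lemma fd_mul_le {φ ψ : Fl} {a' b' : Rl} (hr : 0 ≤ r) (h1 : DifferentiableAt Rl φ p)
    (h2 : DifferentiableAt Rl ψ p) (ha : |φ p| ≤ a) (hb : |ψ p| ≤ b) (ha' : r * ‖fderiv Rl φ p‖ ≤ a') (hb' : r * ‖fderiv Rl ψ p‖ ≤ b') :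
    r * ‖fderiv Rl (fun p => φ p * ψ p) p‖ ≤ a * b' + b * a' := by
  have a0  := (abs_nonneg _).trans ha
  have b0  := (abs_nonneg _).trans hb
  rw [fderiv_fun_mul h1 h2]
  calc _ ≤ r * (|φ p| * ‖fderiv Rl ψ p‖ + |ψ p| * ‖fderiv Rl φ p‖) := by
        refine mul_le_mul_of_nonneg_left ((norm_add_le _ _).trans (le_of_eq ?_)) hr
        rw [norm_smul, norm_smul]; rfl
    _ = |φ p| * (r * ‖fderiv Rl ψ p‖) + |ψ p| * (r * ‖fderiv Rl φ p‖) := by ring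
    _ ≤ _ := by gcongr

lemma LG.mul {K : Set Pl} {φ ψ : Fl} (h : LG K s φ) (h' : LG K t ψ) :
    LG K (s + t) fun p => φ p * ψ p := by
  obtain ⟨c, hc, C, hC, h⟩ := h
  obtain ⟨c', hc', C', hC', h'⟩ := h'
  refine ⟨c * c', by positivity, 2 * C * C', by positivity, ?_⟩
  filter_upwards [h, h'] with p h h' p0 pK
  obtain ⟨a1, a2, a3, a4⟩ := h p0 pK
  obtain ⟨b1, b2, b3, b4⟩ := h' p0 pK
  have hr := nrm2_pos p0
  have e1  := le_trans pz a2
  have e2  := le_trans pz b2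
  rw [rpow_add hr]
  have h4 : 0 ≤ C * nrm2 p ^ s * C' * nrm2 p ^ t := by positivity
  refine ⟨a1.mul b1, le_of_eq_of_le (by ring) (mul_le_mul a2 b2 pz e1), le_trans (mul_le_mul a3 b3 e2 pz) ?_, (fd_mul_le hr.le fz fz
    ((abs_of_nonneg e1).trans_le a3) ((abs_of_nonneg e2).trans_le b3) a4 b4).trans (by linarith)⟩
  linarith

lemma LG_one (K : Set Pl) : LG K 0 fun _ => 1 :=
  ⟨1, one_pos, 1, one_pos, Eventually.of_forall fun p _ _ => ⟨contDiffAt_const, by simp, by simp, by simp⟩⟩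

lemma LG_abs (hf : AnalyticAt Rl f 0) {K : Set Pl} (hK : IsCompact K)
    (h0 : ∀ w ∈ K, lowestPart f w ≠ 0) (γ : Rl) : LG K (vanishingOrder f * γ) fun p => |f p| ^ γ := by
  obtain ⟨c, hc, h1⟩ := f_low hf hK h0
  obtain ⟨C, hC, h2⟩ := f_up hf
  set n := vanishingOrder f with hn
  refine ⟨min (c ^ γ) (C ^ γ), by positivity, (1 + |γ| * (C / c)) * max (c ^ γ) (C ^ γ), by positivity, ?_⟩
  filter_upwards [h1, h2, hf.eventually_analyticAt] with p h1 h2 han p0 pK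
  have hr := nrm2_pos p0
  have hl := h1 p0 pK
  obtain ⟨hu, hd⟩ := h2
  have apos : 0 < |f p| := lt_of_lt_of_le pz hl
  have fne  := abs_pos.1 apos
  have er : ∀ x : Rl, 0 < x → (x * nrm2 p ^ n) ^ γ = x ^ γ * nrm2 p ^ (n * γ) := fun x hx => by
    rw [mul_rpow hx.le pz, ← rpow_natCast, ← rpow_mul hr.le]
  have hR : 0 < nrm2 p ^ (n * γ) := by positivity
  have hup : |f p| ^ γ ≤ max (c ^ γ) (C ^ γ) * nrm2 p ^ (n * γ) := by
    rcases le_total 0 γ with h | h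
    · refine le_trans ?_ (mul_le_mul_of_nonneg_right (le_max_right _ _) hR.le)
      rw [← er C hC]; exact rpow_le_rpow apos.le hu h
    · refine le_trans ?_ (mul_le_mul_of_nonneg_right (le_max_left _ _) hR.le)
      rw [← er c hc]; exact rpow_le_rpow_of_nonpos pz hl h
  have hg : 0 ≤ |γ| * (C / c) := by positivity
  have hnorm : ‖fderiv Rl (fun p => |f p| ^ γ) p‖ ≤ |γ| * |f p| ^ (γ - 1) * ‖fderiv Rl f p‖ := by
    rw [((han.differentiableAt.hasFDerivAt.abs fne).rpow_const (p := γ) (Or.inl apos.ne')).fderiv, norm_smul, norm_smul, norm_mul, Real.norm_of_nonneg (rpow_nonneg apos.le _)]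
    refine mul_le_mul_of_nonneg_left ?_ pz
    exact mul_le_of_le_one_left (norm_nonneg _) (by
      rcases lt_or_gt_of_ne fne with h | h <;> simp [h])
  refine ⟨?_, (by
    rcases le_total 0 γ with h | h
    · refine (mul_le_mul_of_nonneg_right (min_le_left _ _) hR.le).trans ?_
      rw [← er c hc]; exact rpow_le_rpow pz hl h
    · refine (mul_le_mul_of_nonneg_right (min_le_right _ _) hR.le).trans ?_
      rw [← er C hC]; exact rpow_le_rpow_of_nonpos apos hu h), hup.trans ?_, ?_⟩
  · exact (ContDiffAt.abs han.contDiffAt fne).rpow_const_of_ne apos.ne'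
  · refine mul_le_mul_of_nonneg_right ?_ hR.le
    exact le_mul_of_one_le_left pz (by linarith)
  · have h3 : nrm2 p * ‖fderiv Rl f p‖ ≤ C / c * |f p| := by
      rw [div_mul_eq_mul_div, le_div_iff₀ hc]
      nlinarith
    calc _ ≤ nrm2 p * (|γ| * |f p| ^ (γ - 1) * ‖fderiv Rl f p‖) := by gcongr
      _ = |γ| * |f p| ^ (γ - 1) * (nrm2 p * ‖fderiv Rl f p‖) := by ring
      _ ≤ |γ| * |f p| ^ (γ - 1) * (C / c * |f p|) := by gcongr
      _ = |γ| * (C / c) * (|f p| ^ (γ - 1) * |f p|) := by ring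
      _ = |γ| * (C / c) * |f p| ^ γ := by rw [rpow_sub_one apos.ne', div_mul_cancel₀ _ apos.ne']
      _ ≤ (1 + |γ| * (C / c)) * (max (c ^ γ) (C ^ γ) * nrm2 p ^ (n * γ)) := by
          refine mul_le_mul (by linarith) hup pz (by linarith)
      _ = _ := by ring

lemma LG_prod {ι : Type*} [Fintype ι] {f : ι → Fl} {γ : ι → Rl} (hf : ∀ j, AnalyticAt Rl (f j) 0) {K : Set Pl}     (hK : IsCompact K) (h0 : ∀ w ∈ K, ∀ j, lowestPart (f j) w ≠ 0) :
    LG K (∑ j, vanishingOrder (f j) * γ j) fun p => ∏ j, |f j p| ^ γ j := by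
  classical
  have : ∀ T : Finset ι, LG K (∑ j ∈ T, vanishingOrder (f j) * γ j) fun p => ∏ j ∈ T, |f j p| ^ γ j := fun T => by
    induction T using Finset.induction_on with
    | empty => simpa using LG_one K
    | insert a T ha ih =>
      simp  [Finset.sum_insert ha, Finset.prod_insert ha]
      exact (LG_abs (hf a) hK (by grind) _).mul ih
  exact this _

def Hom (s K : Rl) (h : Fl) (p : Pl) : Prop :=
  ContDiffAt Rl 1 h p ∧ |h p| ≤ K * nrm2 p ^ s ∧ nrm2 p * ‖fderiv Rl h p‖ ≤ K * nrm2 p ^ s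

lemma amp {K : Set Pl} {G : Fl} (hG : LG K s G) : ∃ ρ > 0, ∃ c > 0, ∃ C > 0,
    (∀ p, nrm2 p < ρ → p ≠ 0 → (nrm2 p)⁻¹ • p ∈ K → c * nrm2 p ^ s ≤ G p) ∧
    ∀ rB, 0 < rB → rB ≤ ρ → ∀ A > 0, ∀ α, AlphaBound α A → tsupport α ⊆ disk2 rB → ∀ p, p ≠ 0 → (nrm2 p)⁻¹ • p ∈ K →
      Hom s (C * A) (fun p => α p * G p) p := by
  obtain ⟨c, hc, C, hC, h⟩ := hG
  obtain ⟨ρ, hρ, h⟩ := ev_disk h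
  refine ⟨ρ, hρ, c, hc, 2 * C, by positivity, fun p h1 h2 h3 => (h p h1 h2 h3).2.1, fun rB hr hrρ A hA α hα hs p p0 pK => ?_⟩
  have hr := nrm2_pos p0
  by_cases hp : nrm2 p < rB
  · obtain ⟨a1, a2, a3, a4⟩ := h p (hp.trans_le hrρ) p0 pK
    obtain ⟨b1, b2, b3⟩ := hα
    have e1  := le_trans pz a2
    have hb  := b1.contDiffAt (isOpen_compl_singleton.mem_nhds p0)
    have b4  := by
      have := mul_le_mul_of_nonneg_left (b3 p p0) hr.le
      rwa [mul_comm A, mul_inv_cancel_left₀ hr.ne'] at this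
    have hR : 0 ≤ C * nrm2 p ^ s := by positivity
    refine ⟨hb.mul a1, ?_, (fd_mul_le hr.le (hb.differentiableAt one_ne_zero) (a1.differentiableAt one_ne_zero) (b2 p)
      ((abs_of_nonneg e1).trans_le a3) b4 a4).trans (le_of_eq (by ring))⟩
    rw [abs_mul, abs_of_nonneg e1]
    have := mul_le_mul (b2 p) a3 e1 hA.le
    have := mul_nonneg hA.le hR
    linarith
  · have h1 : (fun p => α p * G p) =ᶠ[nhds p] fun _ => 0 := (notMem_tsupport_iff_eventuallyEq.1 fun hh => hp ((nrm2_lt (by linarith)).1 (hs hh))).mono fun q hq => by simp [hq]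
    refine ⟨contDiffAt_const.congr_of_eventuallyEq h1, ?_, ?_⟩
    · show |α p * G p| ≤ _
      rw [h1.eq_of_nhds]; simpa using pz
    · rw [h1.fderiv_eq]; simpa using pz

lemma dich {E S : Set Pl} (hS : IsPreconnected S) (h : ∀ p ∈ S, p ∉ frontier E) : (∀ p ∈ S, p ∈ E) ∨ ∀ p ∈ S, p ∉ E := by
  rcases hS.subset_or_subset isOpen_interior isClosed_closure.isOpen_compl
    (disjoint_left.2 fun p hp hq => hq (subset_closure (interior_subset hp))) (fun p hp => by
      by_contra hc
      rw [mem_union, not_or, notMem_compl_iff] at hc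
      exact h p hp ⟨hc.2, hc.1⟩) with h | h
  · exact Or.inl fun p hp => interior_subset (h hp)
  · exact Or.inr fun p hp hE => h hp (subset_closure hE)

lemma std_dich {f : Fin n → Fl} {γ : Fin n → Rl} {E S : Set Pl} (hS : IsPreconnected S)
    (h : ∀ p ∈ S, p ∉ frontier E) : (∀ p ∈ S, stdFun n f γ E p = 0) ∨ ∀ p ∈ S, stdFun n f γ E p = ∏ j, |f j p| ^ γ j := by
  rcases dich hS h with h | h
  · exact Or.inr fun p hp => indicator_of_mem (h p hp) _
  · exact Or.inl fun p hp => indicator_of_notMem (h p hp) _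

lemma GH_std {f : Fin n → Fl} {γ : Fin n → Rl} {E : Set Pl} {κ : Type} [Fintype κ] {b : κ → Fl}     (hb : ∀ᶠ p in nhds 0, p ∈ frontier E → ∃ k, b k p = 0) {r1 : Rl} (hr1 : 0 < r1) :
    GH (Sum.elim f b) (Sum.elim γ fun _ => 0) ((disk2 r1).indicator (stdFun n f γ E)) := by
  obtain ⟨ρ, hρ, h⟩ := ev_disk hb
  have hm  := lt_min hρ hr1
  refine ⟨min ρ r1, hm, fun S hS hd _ hne => ?_⟩
  have hn : ∀ p ∈ S, nrm2 p < min ρ r1 := fun p hp => (nrm2_lt hm.le).1 (hd hp)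
  have hi : ∀ p ∈ S, (disk2 r1).indicator (stdFun n f γ E) p = stdFun n f γ E p := fun p hp =>
    indicator_of_mem ((nrm2_lt hr1.le).2 (by grind)) _
  rcases std_dich   hS  fun p hp hE => by
    obtain ⟨k, hk⟩ := h p ((hn p hp).trans_le (min_le_left _ _)) hE
    exact hne p hp (Sum.inr k) hk with h | h
  · exact Or.inl fun p hp => by rw [hi p hp, h p hp]
  · refine Or.inr fun p hp => ?_
    rw [hi p hp, h p hp]; simp

lemma tan_free {E K : Set Pl} (hK : IsCompact K) (h : ∀ w ∈ K, ¬ IsTangentDirAt (frontier E) w) :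
    ∃ ρ > 0, ∀ p, nrm2 p < ρ → p ≠ 0 → (nrm2 p)⁻¹ • p ∈ K → p ∉ frontier E := by
  by_contra! hc
  have hk : ∀ k : Nat, ∃ p , nrm2 p < 1 / (k + 1) ∧ p ≠ 0 ∧ (nrm2 p)⁻¹ • p ∈ K ∧ p ∈ frontier E :=
    fun k => hc _ pz
  choose p h1 h2 h3 h4 using hk
  obtain ⟨w, hw, φ, hφ, hlim⟩ := hK.tendsto_subseq h3
  exact h w hw ⟨p ∘ φ, by grind, (squeeze_zero_norm (fun k => (norm_le_nrm2 _).trans (h1 k).le) tendsto_one_div_add_atTop_nhds_zero_nat).comp hφ.tendsto_atTop, Or.inl hlim⟩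

lemma exc_low {f : Fin n → Fl} {E : Set Pl} {κ : Type} [Fintype κ] {b : κ → Fl}     (hban : ∀ k, AnalyticAt Rl (b k) 0)
    (hb : ∀ᶠ p in nhds 0, p ∈ frontier E → ∃ k, b k p = 0) (hw : Un w)
    (hx : ExceptionalDir n f E w) : ∃ j, lowestPart (Sum.elim f b j) w = 0 := by
  rcases hx with ⟨i, hi⟩ | ⟨p, h1, h2, h3⟩
  · exact ⟨Sum.inl i, hi⟩
  · have hk : ∃ k, ∃ᶠ i in atTop, b k (p i) = 0 := by
      by_contra! hc
      obtain ⟨i, hi, hi'⟩ := ((eventually_all.2 hc).and (h2.eventually hb)).exists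
      obtain ⟨k, hk⟩ := hi' (h1 i).1
      exact hi k hk
    obtain ⟨k, hk⟩ := hk
    refine ⟨Sum.inr k, ?_⟩
    rcases h3 with h3 | h3
    · exact tan_low (hban k) hw hk (by grind) h2 h3
    · have := tan_low (hban k)  (by simpa using hw) hk (fun i => (h1 i).2) h2 h3
      rw [show -w = (-1:Rl) • w by simp, low_smul] at this
      exact (mul_eq_zero.1 this).resolve_left pz

lemma low_disc (hf : AnalyticAt Rl f 0) (hnt : ¬ ∀ᶠ p in nhds 0, f p = 0) (θ₀ : Rl) :
    ∀ᶠ θ in 𝓝[≠] θ₀, lowestPart f (cos θ, sin θ) ≠ 0 := by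
  refine (an_comp   θ₀ (low_an f (cos θ₀, sin θ₀))
      ((by fun_prop : AnalyticAt Rl cos θ₀).prod fz) rfl).eventually_eq_zero_or_eventually_ne_zero.resolve_left fun h => ?_
  refine low_line hf hnt (v := (cos θ₀, sin θ₀)) (by simp) ?_
  have hc : ContinuousAt (fun y : Rl => θ₀ - arctan y) 0 := by fun_prop
  filter_upwards [(hc.tendsto.eventually (by simpa using h))] with y hy
  have e : (cos θ₀, sin θ₀) + y • perp2 (cos θ₀, sin θ₀) =
      √(1 + y ^ 2) • (cos (θ₀ - arctan y), sin (θ₀ - arctan y)) := by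
    rw [cos_sub, sin_sub, cos_arctan, sin_arctan]
    ext <;> simp [perp2] <;> field_simp <;> ring
  rw [e, low_smul, hy, mul_zero]

lemma exc_disc {f : Fin n → Fl} {γ : Fin n → Rl} {E : Set Pl} (hsf : StandardForm n f γ E) (θ₀ : Rl) :
    ∀ᶠ θ in 𝓝[≠] θ₀, ¬ ExceptionalDir n f E (cos θ, sin θ) := by
  obtain ⟨κ, _, b, h1, h2, h3⟩ := bdry_list hsf.domain
  obtain ⟨U, hU, hf⟩ := hsf.analytic
  have : ∀ j, ∀ᶠ θ in 𝓝[≠] θ₀, lowestPart (Sum.elim f b j) (cos θ, sin θ) ≠ 0 := by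
    rintro (i | k)
    · exact low_disc (hf i 0 (mem_of_mem_nhds hU)) (hsf.nontriv i) θ₀
    · exact low_disc (h1 k) (h2 k) θ₀
  filter_upwards [eventually_all.2 this] with θ hθ hx
  obtain ⟨j, hj⟩ := exc_low h1 h3  (by simp) hx
  exact hθ j hj

lemma rad {K ξ : Rl} (hB : -1 < B) (hR : 0 < R) {φ φ' : Fr} (hd : ∀ r > 0, HasDerivAt φ (φ' r) r)
    (hc : ContinuousOn φ' (Ioi 0)) (h1 : ∀ r > 0, |φ r| ≤ K * r ^ B) (h2 : ∀ r > 0, |φ' r| ≤ K * r ^ (B - 1)) (h3 : φ R = 0) :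
    ‖∫ r in Ioo 0 R, (φ r : ℂ) * Complex.exp (Complex.I * ((ξ * r : Rl) : ℂ))‖ ≤
      (2 * B + 4) * K * ∫ r in Ioo 0 R, (1 + |ξ| * r) ^ (-(1/2:Rl)) * r ^ B := by
  rw [← integral_Ioc_eq_integral_Ioo, ← integral_Ioc_eq_integral_Ioo, ← intervalIntegral.integral_of_le hR.le,
    ← intervalIntegral.integral_of_le hR.le]
  have K0 : 0 ≤ K := by simpa using (abs_nonneg _).trans (h1 1 one_pos)
  set F : Rl → ℂ := fun r => (φ r : ℂ) * Complex.exp (Complex.I * ((ξ * r : Rl) : ℂ)) with hF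
  set w : Fr := fun r => (1 + |ξ| * r) ^ (-(1/2:Rl)) * r ^ B with hw
  have nE : ∀ r : Rl, ‖Complex.exp (Complex.I * ((ξ * r : Rl) : ℂ))‖ = 1 := fun r => by
    rw [mul_comm, Complex.norm_exp_ofReal_mul_I]
  have nF : ∀ r, ‖F r‖ = |φ r| := fun r => by rw [hF]; simp only [norm_mul, nE, Complex.norm_real, mul_one]; rfl
  have iB : ∀ a b, IntervalIntegrable (fun r : Rl => r ^ B) volume a b := fun a b => intervalIntegral.intervalIntegrable_rpow' hB
  have w0 : ∀ r > 0, 0 ≤ w r := fun r hr => by positivity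
  have iw : ∀ a b, 0 ≤ a → 0 ≤ b → IntervalIntegrable w volume a b := fun a b ha hb => by
    refine (iB a b).continuousOn_mul (fun r hr => ?_)
    have : 0 ≤ r := (le_inf ha hb).trans hr.1
    refine ContinuousAt.continuousWithinAt (ContinuousAt.rpow_const fz (Or.inl pz))
  have lo : ∀ r > 0, |ξ| * r ≤ 1 → r ^ B ≤ 2 * w r := fun r hr h => by
    have := rp_cmp (x := 1) (y := 1 + |ξ| * r) (c := 2) one_pos pz (by norm_num) (by linarith)
    rw [one_rpow] at this
    rw [hw]; simp only; rw [← mul_assoc]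
    exact le_mul_of_one_le_left pz this
  have part1 : ∀ ε, 0 < ε → |ξ| * ε ≤ 1 → ‖∫ r in Zr..ε, F r‖ ≤ 2 * K * ∫ r in Zr..ε, w r := fun ε hε h => by
    rw [← intervalIntegral.integral_const_mul]
    refine intervalIntegral.norm_integral_le_of_norm_le hε.le (ae_of_all _ fun r hr => ?_) ((iw 0 ε le_rfl hε.le).const_mul _)
    rw [nF]
    have := lo r hr.1 ((mul_le_mul_of_nonneg_left hr.2 (abs_nonneg _)).trans h)
    calc _ ≤ K * (2 * w r) := (h1 r hr.1).trans (by gcongr)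
      _ = _ := by ring
  have mono : 0 ≤ ∫ r in Zr..R, w r := by
    rw [intervalIntegral.integral_of_le hR.le]
    exact setIntegral_nonneg measurableSet_Ioc fun r hr => w0 r hr.1
  by_cases hξ : |ξ| * R ≤ 1
  · refine (part1 R hR hξ).trans ?_
    gcongr; linarith
  · push Not at hξ
    have x0 : 0 < |ξ| := by
      rcases (abs_nonneg ξ).eq_or_lt with h | h
      · rw [← h] at hξ; linarith
      · exact h
    set ε := |ξ|⁻¹ with hε
    have ε0 : 0 < ε := by positivity
    have εR : ε ≤ R := by rw [hε, inv_le_iff_one_le_mul₀ x0, mul_comm]; exact hξ.le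
    have xε : |ξ| * ε = 1 := mul_inv_cancel₀ x0.ne'
    have φc : ContinuousOn φ (Ioi 0) := fun r hr => (hd r hr).continuousAt.continuousWithinAt
    have iF : ∀ a b, 0 ≤ a → a ≤ b → IntervalIntegrable F volume a b := fun a b ha hab => by
      rw [intervalIntegrable_iff_integrableOn_Ioc_of_le hab]
      have hsub : Ioc a b ⊆ Ioi 0 := fun r hr => lt_of_le_of_lt ha hr.1
      refine Integrable.mono' (((intervalIntegrable_iff_integrableOn_Ioc_of_le hab).1 (iB a b)).const_mul K) ?_
        ((ae_restrict_iff' measurableSet_Ioc).2 (ae_of_all _ fun r hr => by rw [nF]; exact h1 r (hsub hr)))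
      refine ContinuousOn.aestronglyMeasurable (fun r hr => ?_) measurableSet_Ioc
      have : ContinuousAt φ r := (hd r (hsub hr)).continuousAt
      exact ContinuousAt.continuousWithinAt fz
    rw [← intervalIntegral.integral_add_adjacent_intervals (iF 0 ε le_rfl ε0.le) (iF ε R ε0.le εR),
      ← intervalIntegral.integral_add_adjacent_intervals (iw 0 ε le_rfl ε0.le) (iw ε R ε0.le hR.le)]
    have p1 := part1 ε ε0 xε.le
    set J1 := ∫ r in Zr..ε, w r with hJ1
    set J2 := ∫ r in ε..R, w r with hJ2
    have bdry : ε ^ (B + 1) ≤ 2 * (B + 1) * J1 := by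
      have e1 : ∫ r in Zr..ε, r ^ B = ε ^ (B + 1) / (B + 1) := by
        rw [integral_rpow (Or.inl hB), zero_rpow (by linarith), sub_zero]
      have e2 : ∫ r in Zr..ε, r ^ B ≤ ∫ r in Zr..ε, 2 * w r := by
        refine intervalIntegral.integral_mono_on_of_le_Ioo ε0.le (iB 0 ε) ((iw 0 ε le_rfl ε0.le).const_mul _) fun r hr => ?_
        exact lo r hr.1 ((mul_le_mul_of_nonneg_left hr.2.le (abs_nonneg _)).trans xε.le)
      rw [e1, intervalIntegral.integral_const_mul, div_le_iff₀ (by linarith)] at e2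
      linarith
    set E : Rl → ℂ := fun r => Complex.exp (Complex.I * ((ξ * r : Rl) : ℂ)) / (Complex.I * ξ) with hE
    have nE' : ∀ r, ‖E r‖ = ε := fun r => by
      rw [hE]; simp only [norm_div, nE, norm_mul, Complex.norm_I, one_mul, Complex.norm_real, one_div]; rfl
    have dE : ∀ r, HasDerivAt E (Complex.exp (Complex.I * ((ξ * r : Rl) : ℂ))) r := fun r => by
      refine ((((((hasDerivAt_id r).const_mul ξ).ofReal_comp).const_mul Complex.I).cexp).div_const (Complex.I * (ξ:ℂ))).congr_deriv ?_
      simp only [mul_one]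
      rw [mul_div_assoc, div_self (mul_ne_zero Complex.I_ne_zero (by exact_mod_cast (abs_pos.1 x0))), mul_one]; rfl
    have hsub : uIcc ε R ⊆ Ioi 0 := by rw [uIcc_of_le εR]; exact fun r hr => ε0.trans_le hr.1
    have p2 : ‖∫ r in ε..R, F r‖ ≤ K * ε ^ (B + 1) + 2 * K * J2 := by
      show ‖∫ r in ε..R, (φ r : ℂ) * Complex.exp (Complex.I * ((ξ * r : Rl) : ℂ))‖ ≤ _
      rw [(intervalIntegral.integral_mul_deriv_eq_deriv_mul (a := ε) (b := R) (u := fun r => (φ r : ℂ)) (v := E)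
        (u' := fun r => (φ' r : ℂ)) (v' := fun r => Complex.exp (Complex.I * ((ξ * r : Rl) : ℂ)))
        (fun r hr => (hd r (hsub hr)).ofReal_comp) (fun r _ => dE r)
        (ContinuousOn.intervalIntegrable (Complex.continuous_ofReal.comp_continuousOn (hc.mono hsub)))
        (Continuous.intervalIntegrable fz _ _)), h3, Complex.ofReal_zero, zero_mul, zero_sub]
      refine (norm_sub_le _ _).trans (add_le_add ?_ ?_)
      · rw [norm_neg, norm_mul, nE', Complex.norm_real, rpow_add_one ε0.ne', ← mul_assoc]
        exact mul_le_mul_of_nonneg_right (h1 ε ε0) ε0.le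
      · rw [hJ2, ← intervalIntegral.integral_const_mul]
        refine intervalIntegral.norm_integral_le_of_norm_le εR (ae_of_all _ fun r hr => ?_) ((iw ε R ε0.le hR.le).const_mul _)
        have r0 : 0 < r := ε0.trans hr.1
        have xr : 1 ≤ |ξ| * r := by rw [← xε]; exact mul_le_mul_of_nonneg_left hr.1.le x0.le
        rw [norm_mul, nE', Complex.norm_real]
        have e1 : ε / r ≤ 2 * (1 + |ξ| * r) ^ (-(1/2:Rl)) := by
          have a1 : (1 + |ξ| * r)⁻¹ ≤ (1 + |ξ| * r) ^ (-(1/2:Rl)) := by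
            rw [← rpow_neg_one]; exact rpow_le_rpow_of_exponent_le (by linarith) (by norm_num)
          have a2 : ε / r ≤ 2 * (1 + |ξ| * r)⁻¹ := by
            rw [hε, div_eq_mul_inv, ← mul_inv, ← div_eq_mul_inv, inv_eq_one_div, div_le_div_iff₀ pz pz]
            linarith
          linarith
        calc _ ≤ K * r ^ (B - 1) * ε := by gcongr; exact h2 r r0
          _ = K * r ^ B * (ε / r) := by rw [rpow_sub_one r0.ne']; field_simp
          _ ≤ K * r ^ B * (2 * (1 + |ξ| * r) ^ (-(1/2:Rl))) := by gcongr
          _ = _ := by rw [hw]; ring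
    have hB1 : 0 ≤ (B + 1) * (K * J2) := mul_nonneg (by linarith) (mul_nonneg K0 (by
      rw [hJ2, intervalIntegral.integral_of_le εR]
      exact setIntegral_nonneg measurableSet_Ioc fun r hr => w0 r (ε0.trans hr.1)))
    have := mul_le_mul_of_nonneg_left bdry K0
    calc _ ≤ 2 * K * J1 + (K * (2 * (B + 1) * J1) + 2 * K * J2) := (norm_add_le _ _).trans (by linarith)
      _ ≤ _ := by linarith

lemma sin_int (a b : Rl) : IntervalIntegrable (fun θ => |sin θ| ^ (-(1/2:Rl))) volume a b := by
  have per : Function.Periodic (fun θ => |sin θ| ^ (-(1/2:Rl))) π := fun θ => by simp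
  refine per.intervalIntegrable (t := -(π/2)) pi_ne_zero ?_ a b
  rw [show -(π/2) + π = π/2 by ring]
  have h0 : ∀ x, 0 < x → IntervalIntegrable (fun θ => |sin θ| ^ (-(1/2:Rl))) volume 0 (min x (π/2)) := fun x hx => by
    refine ((intervalIntegral.intervalIntegrable_rpow' (a := 0) (b := min x (π/2)) (show -1 < -(1/2) by norm_num)).const_mul ((2/π) ^ (-(1/2:Rl)))).mono_fun (Measurable.aestronglyMeasurable fz) ?_
    rw [uIoc_of_le (lt_min hx pz).le]
    refine (ae_restrict_iff' measurableSet_Ioc).2 (ae_of_all _ fun θ hθ => ?_)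
    have h1  := hθ.1
    simp only
    rw [Real.norm_of_nonneg pz, Real.norm_of_nonneg pz, ← mul_rpow pz h1.le]
    refine rpow_le_rpow_of_nonpos pz ?_ (by norm_num)
    have := Real.mul_abs_le_abs_sin  (by rw [abs_of_pos h1]; grind)
    grind
  have h1 : IntervalIntegrable (fun θ => |sin θ| ^ (-(1/2:Rl))) volume 0 (π/2) := by
    simpa using h0 (π/2) pz
  have h2 : IntervalIntegrable (fun θ => |sin θ| ^ (-(1/2:Rl))) volume (-(π/2)) 0 := by
    simpa using (h1.comp_sub_left 0).symm
  exact h2.trans h1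

def Wd (R a b : Rl) : Set Pl := {p : Pl | ∃ ρ θ : Rl, 0 < ρ ∧ ρ < R ∧ a < θ ∧ θ < b ∧
      p = (ρ * Real.cos θ, ρ * Real.sin θ)}

lemma Wd_eq (R a b : Rl) : Wd R a b = polarCoord.symm '' Ioo 0 R ×ˢ Ioo a b := by
  ext p; constructor
  · rintro ⟨r, θ, h1, h2, h3, h4, rfl⟩; exact ⟨(r, θ), by grind, rfl⟩
  · rintro ⟨⟨r, θ⟩, ⟨⟨h1, h2⟩, h3, h4⟩, rfl⟩; exact ⟨r, θ, h1, h2, h3, h4, rfl⟩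

lemma nrm2_polar (hr : 0 ≤ r) (θ : Rl) : nrm2 pol r θ = r := by
  unfold nrm2
  rw [show (r * cos θ) ^ 2 + (r * sin θ) ^ 2 = r ^ 2 * (sin θ ^ 2 + cos θ ^ 2) by ring, sin_sq_add_cos_sq, mul_one, sqrt_sq hr]

lemma polar_inj {r' θ θ' : Rl} (hb : b ≤ a + 2 * π) (hr : 0 < r) (hr' : 0 < r') (h : θ ∈ Ioo a b) (h' : θ' ∈ Ioo a b)
    (e : pol r θ = (r' * cos θ', r' * sin θ')) : r = r' ∧ θ = θ' := by
  have e1 : r = r' := by rw [← nrm2_polar hr.le θ, e, nrm2_polar hr'.le]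
  subst e1
  rw [Prod.mk.injEq] at e
  have : cos (θ - θ') = 1 := by rw [cos_sub, (mul_left_cancel₀ hr.ne' e.1), (mul_left_cancel₀ hr.ne' e.2)]; nlinarith [sin_sq_add_cos_sq θ']
  rw [cos_eq_one_iff_of_lt_of_lt (by linarith [h.1, h'.2]) (by linarith [h'.1, h.2])] at this
  exact ⟨rfl, by linarith⟩

lemma Wd_inj (hb : b ≤ a + 2 * π) : InjOn polarCoord.symm (Ioo 0 R ×ˢ Ioo a b) := by
  rintro ⟨r, θ⟩ ⟨h1, h2⟩ ⟨r', θ'⟩ ⟨h1', h2'⟩ e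
  obtain ⟨e1, e2⟩ := polar_inj hb h1.1 h1'.1 h2 h2' e
  simp  at e1 e2
  rw [e1, e2]

lemma S_meas (R a b : Rl) : MeasurableSet (Ioo 0 R ×ˢ Ioo a b) := measurableSet_Ioo.prod measurableSet_Ioo

lemma Wd_meas (hb : b ≤ a + 2 * π) : MeasurableSet (Wd R a b) := by
  rw [Wd_eq]
  exact (S_meas R a b).image_of_continuousOn_injOn continuous_polarCoord_symm.continuousOn (Wd_inj hb)

lemma polar_cov {E : Type*} [NormedAddCommGroup E] [NormedSpace Rl E] (hb : b ≤ a + 2 * π) (F : Pl → E) :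
    ∫ p in Wd R a b, F p = ∫ x in Ioo 0 R ×ˢ Ioo a b, x.1 • F (x.1 * cos x.2, x.1 * sin x.2) := by
  rw [Wd_eq, integral_image_eq_integral_abs_det_fderiv_smul volume (S_meas R a b)
    (fun x _ => (hasFDerivAt_polarCoord_symm x).hasFDerivWithinAt) (Wd_inj hb)]
  refine setIntegral_congr_fun (S_meas R a b) fun x hx => ?_
  rw [det_fderivPolarCoordSymm, abs_of_pos hx.1.1]; rfl

lemma polar_int (hb : b ≤ a + 2 * π) {F : Fl} (h : IntegrableOn F (Wd R a b)) :
    IntegrableOn (fun x : Pl => x.1 * F (x.1 * cos x.2, x.1 * sin x.2)) (Ioo 0 R ×ˢ Ioo a b) := by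
  rw [Wd_eq, integrableOn_image_iff_integrableOn_abs_det_fderiv_smul volume (S_meas R a b)
    (fun x _ => (hasFDerivAt_polarCoord_symm x).hasFDerivWithinAt) (Wd_inj hb)] at h
  refine h.congr_fun (fun x hx => ?_) (S_meas R a b)
  simp only
  rw [det_fderivPolarCoordSymm, abs_of_pos hx.1.1]; rfl

lemma s_gt (hR : 0 < R) (hab : a < b) (hb : b ≤ a + 2 * π) (hi : IntegrableOn (fun p => nrm2 p ^ s) (Wd R a b)) :
    -1 < s + 1 := by
  have h2 : IntegrableOn (fun x : Pl => x.1 ^ (s + 1)) (Ioo 0 R ×ˢ Ioo a b) := (polar_int hb hi).congr_fun fun x hx => by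
    simp
    rw [nrm2_polar hx.1.1.le, rpow_add_one hx.1.1.ne', mul_comm] (S_meas R a b)
  rw [IntegrableOn, Measure.volume_eq_prod, ← Measure.prod_restrict] at h2
  have : NeZero (volume.restrict (Ioo a b)) := ⟨by
    simpa using hab⟩
  obtain ⟨θ, hθ⟩ := (h2.prod_left_ae).exists
  exact (intervalIntegral.integrableOn_Ioo_rpow_iff hR).1 hθ

lemma lam_polar (t u : Rl) : ∃ L φ , 0 ≤ L ∧ L ^ 2 = t ^ 2 + u ^ 2 ∧ ∀ θ, t * cos θ + u * sin θ = L * sin (θ - φ) := by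
  set z : ℂ := ⟨u, -t⟩ with hz
  refine ⟨‖z‖, z.arg, norm_nonneg _, ?_, fun θ => ?_⟩
  · rw [Complex.sq_norm, Complex.normSq_apply]; ring
  · have h1 := Complex.norm_mul_cos_arg z
    have h2 := Complex.norm_mul_sin_arg z
    rw [sin_sub]
    rw [hz] at h1 h2 ⊢
    linear_combination -sin θ * h1 + cos θ * h2

lemma wt_low (hv : Un v) {u L : Rl} (hL : 0 ≤ L) (hL2 : L ^ 2 = t ^ 2 + u ^ 2) (p : Pl) :
    (1 + L * nrm2 p) ^ (-(1/2:Rl)) ≤ 2 * wt v t u p := by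
  have hn : nrm2 (t, u) = L := by unfold nrm2; rw [← sqrt_sq hL, hL2]
  have hv' : (perp2 v).1 ^ 2 + (perp2 v).2 ^ 2 = 1 := by simp [perp2]; linarith
  have h1 := dot_le_nrm hv (t, u)
  have h2 := dot_le_nrm hv' (t, u)
  have h3 := dot_le_nrm hv' p
  have h0 := nrm2_nonneg p
  rw [hn] at h1 h2
  refine rp_cmp pz pz (by norm_num) ?_
  have e1 : |dot2 (t, u) v| * nrm2 p ≤ L * nrm2 p := by gcongr
  have e2 : |dot2 (t, u) (perp2 v)| * |dot2 p (perp2 v)| ≤ L * nrm2 p := by gcongr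
  linarith

lemma sin_shift (hab : a < b) (hb : b ≤ a + 2 * π) (φ : Rl) :
    IntegrableOn (fun θ => |sin (θ - φ)| ^ (-(1/2:Rl))) (Ioo a b) ∧
    ∫ θ in Ioo a b, |sin (θ - φ)| ^ (-(1/2:Rl)) ≤ ∫ θ in 0.. 0 + 2 * π, |sin θ| ^ (-(1/2:Rl)) := by
  have hi : ∀ c d, IntervalIntegrable (fun θ => |sin (θ - φ)| ^ (-(1/2:Rl))) volume c d := fun c d => by
    simpa using (sin_int (c - φ) (d - φ)).comp_sub_right φ
  refine ⟨((intervalIntegrable_iff_integrableOn_Ioo_of_le hab.le).1 (hi a b)), ?_⟩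
  have per : Function.Periodic (fun θ => |sin θ| ^ (-(1/2:Rl))) (2 * π) := fun θ => by simp
  rw [← per.intervalIntegral_add_eq (a - φ) 0, show a - φ + 2 * π = a + 2 * π - φ by ring,
    ← intervalIntegral.integral_comp_sub_right (fun θ => |sin θ| ^ (-(1/2))) φ, intervalIntegral.integral_of_le (by linarith),
    integral_Ioc_eq_integral_Ioo]
  exact setIntegral_mono_set ((intervalIntegrable_iff_integrableOn_Ioo_of_le (by linarith)).1 (hi _ _))
    (ae_of_all _ fun θ => by positivity) (LE.le.eventuallyLE (Ioo_subset_Ioo_right hb))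

lemma cd_fd {m : Fl} (h : ContDiffAt Rl 1 m p) : ContinuousAt (fderiv Rl m) p :=
  (h.fderiv_right (m := 0) (by norm_num)).continuousAt

lemma side (s a b : Rl) (hab : a < b) (hb : b ≤ a + 2 * π) : ∃ C > Zr, ∀ (R K : Rl) (k m : Fl) (κ : Fr), 0 < R →
    (∀ r > 0, ∀ θ ∈ Ioo a b, Hom s K m pol r θ) → (∀ r > 0, ∀ θ ∈ Ioo a b, k pol r θ = κ θ) →
    (∀ θ, |κ θ| ≤ 1) → (∀ p, R ≤ nrm2 p → m p = 0) → IntegrableOn (fun p => nrm2 p ^ s) (Wd R a b) →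
    ∀ v : Pl, Un v → ∀ t u, ‖oscInt (fun p => k p * m p) (Wd R a b) t u‖ ≤
      C * K * ∫ p in Wd R a b, wt v t u p * nrm2 p ^ s := by
  set M := ∫ θ in Zr..(0 + 2 * π), |sin θ| ^ (-(1/2:Rl)) with hM
  have M0 : 0 ≤ M := (setIntegral_nonneg measurableSet_Ioo fun θ _ => by positivity).trans (sin_shift hab hb 0).2
  refine ⟨4 * |2 * (s + 1) + 4| * M / (b - a) + 1, by positivity, fun R K k m κ hR hm hk hκ h0 hi v hv t u => ?_⟩
  have hB := s_gt hR hab hb hi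
  set B := s + 1 with hBd
  have hB4 : 0 ≤ 2 * B + 4 := by linarith
  obtain ⟨L, φ, L0, L2, hφ⟩ := lam_polar t u
  have K0 : 0 ≤ K := by
    have := (hm 1 one_pos ((a + b) / 2) ⟨by linarith, by linarith⟩).2.1
    rw [nrm2_polar zero_le_one] at this
    simpa using (abs_nonneg _).trans this
  have W0 : 0 ≤ ∫ p in Wd R a b, wt v t u p * nrm2 p ^ s := setIntegral_nonneg (Wd_meas hb) fun p _ =>
    mul_nonneg (wt_nonneg _ _ _ _) (rpow_nonneg (nrm2_nonneg _) _)
  rw [abs_of_nonneg hB4]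
  unfold oscInt
  rw [polar_cov hb]
  set F : Pl → ℂ := fun x => x.1 • (((k (x.1 * cos x.2, x.1 * sin x.2) * m (x.1 * cos x.2, x.1 * sin x.2) : Rl) : ℂ) *
    Complex.exp (Complex.I * ((t : ℂ) * ((x.1 * cos x.2 : Rl) : ℂ) + (u : ℂ) * ((x.1 * sin x.2 : Rl) : ℂ)))) with hF
  by_cases hFi : IntegrableOn F (Ioo 0 R ×ˢ Ioo a b)
  swap
  · rw [integral_undef hFi, norm_zero]; exact mul_nonneg pz W0
  rw [IntegrableOn, Measure.volume_eq_prod, ← Measure.prod_restrict] at hFi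
  rw [Measure.volume_eq_prod, ← Measure.prod_restrict, integral_prod_symm _ hFi]
  set J := ∫ r in Ioo 0 R, (1 + L * r) ^ (-(1/2:Rl)) * r ^ B with hJ
  have iJ : IntegrableOn (fun r => (1 + L * r) ^ (-(1/2:Rl)) * r ^ B) (Ioo 0 R) := by
    rw [← intervalIntegrable_iff_integrableOn_Ioo_of_le hR.le]
    refine (intervalIntegral.intervalIntegrable_rpow' hB).continuousOn_mul (fun r hr => ?_)
    have : 0 ≤ r := by rw [uIcc_of_le hR.le] at hr; exact hr.1
    exact ContinuousAt.continuousWithinAt (ContinuousAt.rpow_const fz (Or.inl pz))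
  have J0 : 0 ≤ J := setIntegral_nonneg measurableSet_Ioo fun r hr => by have := hr.1; positivity
  have inner : ∀ θ ∈ Ioo a b, sin (θ - φ) ≠ 0 → ‖∫ r in Ioo 0 R, F (r, θ)‖ ≤
      (2 * B + 4) * (2 * K) * J * |sin (θ - φ)| ^ (-(1/2:Rl)) := fun θ hθ hs => by
    set ξ := L * sin (θ - φ) with hξ
    have hcurve : ∀ r : Rl, HasDerivAt (fun r : Rl => (pol r θ : Pl)) (cos θ, sin θ) r := fun r => by
      have h1 := (hasDerivAt_id r).mul_const (cos θ)
      have h2 := (hasDerivAt_id r).mul_const (sin θ)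
      rw [one_mul] at h1 h2
      exact h1.prodMk h2
    have e1 : ∫ r in Ioo 0 R, F (r, θ) = ∫ r in Ioo 0 R, ((κ θ * (r * m pol r θ) : Rl) : ℂ) *
        Complex.exp (Complex.I * ((ξ * r : Rl) : ℂ)) := by
      refine setIntegral_congr_fun measurableSet_Ioo fun r hr => ?_
      simp only [hF]
      rw [hk r hr.1 θ hθ, hξ, ← hφ θ, Complex.real_smul]
      have : (t : ℂ) * ((r * cos θ : Rl) : ℂ) + (u : ℂ) * ((r * sin θ : Rl) : ℂ) = (((t * cos θ + u * sin θ) * r : Rl) : ℂ) := by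
        push_cast; ring
      rw [this]; push_cast; ring
    rw [e1]
    refine (rad (K := 2 * K) (ξ := ξ) hB hR (φ := fun r => κ θ * (r * m pol r θ))
      (φ' := fun r => κ θ * (1 * m pol r θ + r * fderiv Rl m pol r θ (cos θ, sin θ)))
      (fun r hr => by
        exact ((hasDerivAt_id r).mul (((hm r hr θ hθ).1.differentiableAt one_ne_zero).hasFDerivAt.comp_hasDerivAt r (hcurve r))).const_mul _)
      (fun r hr => by
        have h1 := (hm r hr θ hθ).1
        have hcc := (hcurve r).continuousAt
        have c1 : ContinuousAt (fun r : Rl => m pol r θ) r := ContinuousAt.comp (g := m) h1.continuousAt hcc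
        have c2 : ContinuousAt (fun r : Rl => fderiv Rl m pol r θ) r := ContinuousAt.comp (g := fderiv Rl m) (cd_fd h1) hcc
        refine ContinuousAt.continuousWithinAt ?_
        exact continuousAt_const.mul ((continuousAt_const.mul c1).add (continuousAt_id.mul (c2.clm_apply (continuousAt_const (y := ((cos θ, sin θ) : Pl)))))))
      (fun r hr => by
        obtain ⟨-, h2, -⟩ := hm r hr θ hθ
        rw [nrm2_polar (le_of_lt hr)] at h2
        rw [abs_mul, abs_mul, abs_of_pos hr, hBd, rpow_add_one (hr).ne']
        calc _ ≤ 1 * (r * (K * r ^ s)) := by gcongr; exact hκ θ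
          _ ≤ _ := by
            have : 0 ≤ K * (r ^ s * r) := by positivity
            linarith)
      (fun r hr => by
        obtain ⟨-, h2, h3⟩ := hm r hr θ hθ
        rw [nrm2_polar (le_of_lt hr)] at h2 h3
        have h4 : |fderiv Rl m pol r θ (cos θ, sin θ)| ≤ ‖fderiv Rl m pol r θ‖ :=
          ((fderiv Rl m pol r θ).le_opNorm _).trans (mul_le_of_le_one_right (norm_nonneg _) (by
            rw [Prod.norm_def]; exact max_le (abs_cos_le_one θ) (abs_sin_le_one θ)))
        rw [abs_mul, one_mul, hBd, add_sub_cancel_right]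
        exact (mul_le_of_le_one_left (abs_nonneg _) (hκ θ)).trans (by
          refine (abs_add_le _ _).trans ?_
          rw [abs_mul, abs_of_pos hr]
          have := mul_le_mul_of_nonneg_left h4 (hr).le
          linarith))
      (by rw [h0 _ (nrm2_polar hR.le θ).ge]; simp)).trans ?_
    rw [mul_assoc ((2 * B + 4) * (2 * K)), hJ, mul_comm (integral _ _) (|sin (θ - φ)| ^ (-(1/2:Rl)))]
    refine mul_le_mul_of_nonneg_left ?_ (mul_nonneg hB4 (mul_nonneg zero_le_two K0))
    rw [← integral_const_mul]
    refine integral_mono_of_nonneg (ae_restrict_of_forall_mem measurableSet_Ioo fun r hr => ?_) (iJ.const_mul _)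
      (ae_restrict_of_forall_mem measurableSet_Ioo fun r hr => ?_)
    · have := hr.1; simp only [Pi.zero_apply]; positivity
    · have r0 := hr.1
      simp only
      rw [← mul_assoc, ← mul_rpow (abs_pos.2 hs).le pz]
      refine mul_le_mul_of_nonneg_right (rpow_le_rpow_of_nonpos pz ?_ (by norm_num)) pz
      rw [hξ, abs_mul, abs_of_nonneg L0]
      have := abs_sin_le_one (θ - φ)
      linarith
  have hae : ∀ᵐ θ : Rl, sin (θ - φ) ≠ 0 := by
    have : (range fun n : ℤ => φ + n * π).Countable := countable_range _
    filter_upwards [this.ae_notMem volume] with θ hθ hs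
    obtain ⟨n, hn⟩ := sin_eq_zero_iff.1 hs
    exact hθ ⟨n, by simp only; linarith⟩
  obtain ⟨i1, i2⟩ := sin_shift hab hb φ
  have step : ‖∫ θ in Ioo a b, ∫ r in Ioo 0 R, F (r, θ)‖ ≤ (2 * B + 4) * (2 * K) * J * M := by
    refine (norm_integral_le_of_norm_le (i1.const_mul ((2 * B + 4) * (2 * K) * J)) ?_).trans ?_
    · rw [ae_restrict_iff' measurableSet_Ioo]
      filter_upwards [hae] with θ h1 h2 using inner θ h2 h1
    · rw [integral_const_mul]
      exact mul_le_mul_of_nonneg_left i2 pz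
  have back : J * (b - a) = ∫ p in Wd R a b, (1 + L * nrm2 p) ^ (-(1/2:Rl)) * nrm2 p ^ s := by
    rw [polar_cov hb]
    have : ∫ x in Ioo 0 R ×ˢ Ioo a b, x.1 • ((1 + L * nrm2 (x.1 * cos x.2, x.1 * sin x.2)) ^ (-(1/2:Rl)) *
        nrm2 (x.1 * cos x.2, x.1 * sin x.2) ^ s) = ∫ x in Ioo 0 R ×ˢ Ioo a b, ((1 + L * x.1) ^ (-(1/2:Rl)) * x.1 ^ B) * (1:Rl) := by
      refine setIntegral_congr_fun (S_meas R a b) fun x hx => ?_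
      have := hx.1.1
      rw [nrm2_polar this.le, hBd, rpow_add_one this.ne', smul_eq_mul]; ring
    rw [this, Measure.volume_eq_prod, setIntegral_prod_mul (fun r : Rl => (1 + L * r) ^ (-(1/2:Rl)) * r ^ B) (fun _ : Rl => (1:Rl))]
    rw [← hJ, setIntegral_const, Real.volume_real_Ioo_of_le hab.le]; simp
  refine step.trans ?_
  rw [← Measure.volume_eq_prod]
  set Q := ∫ p in Wd R a b, wt v t u p * nrm2 p ^ s with hQ
  have hJ' : J ≤ 2 * Q / (b - a) := by rw [le_div_iff₀ (by linarith)]; exact (by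
    rw [back, ← integral_const_mul]
    have iw : IntegrableOn (fun p => wt v t u p * nrm2 p ^ s) (Wd R a b) := by
      refine Integrable.bdd_mul (c := 1) hi (wt_cont v t u).aestronglyMeasurable (ae_of_all _ fun p => ?_)
      rw [Real.norm_of_nonneg (wt_nonneg _ _ _ _)]; exact wt_le _ _ _ _
    refine integral_mono_of_nonneg (ae_of_all _ fun p => ?_) (iw.const_mul 2) (ae_of_all _ fun p => ?_)
    · have := nrm2_nonneg p; simp only [Pi.zero_apply]; positivity
    · simp only
      rw [← mul_assoc]
      exact mul_le_mul_of_nonneg_right (wt_low hv L0 L2 p) (rpow_nonneg (nrm2_nonneg _) _))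
  calc _ ≤ (2 * B + 4) * (2 * K) * (2 * Q / (b - a)) * M := by gcongr
    _ = 4 * (2 * B + 4) * M / (b - a) * K * Q := by ring
    _ ≤ 4 * (2 * B + 4) * M / (b - a) * K * Q + K * Q := le_add_of_nonneg_right (mul_nonneg K0 W0)
    _ = _ := by ring

lemma dir_polar (hr : 0 < r) (θ : Rl) : (nrm2 pol r θ)⁻¹ • pol r θ = (cos θ, sin θ) := by
  rw [nrm2_polar hr.le]; ext <;> simp [hr.ne']

lemma polar_ne (hr : 0 < r) (θ : Rl) : pol r θ ≠ 0 := fun h => by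
  have := nrm2_polar hr.le θ
  rw [h] at this; simp [nrm2] at this; linarith

lemma Wd_conn (R a b : Rl) : IsPreconnected (Wd R a b) := by
  rw [Wd_eq]
  exact ((convex_Ioo 0 R).prod (convex_Ioo a b)).isPreconnected.image _ continuous_polarCoord_symm.continuousOn

lemma std_nonneg (f : Fin n → Fl) (γ : Fin n → Rl) (E : Set Pl) (p : Pl) : 0 ≤ stdFun n f γ E p :=
  indicator_nonneg (fun p _ => by positivity) p

lemma al_zero (hR : 0 < R) (hs : tsupport α ⊆ disk2 R) (hp : R ≤ nrm2 p) : α p = 0 := by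
  by_contra h
  exact absurd ((nrm2_lt hR.le).1 (hs (subset_tsupport α h))) (not_lt.2 hp)

lemma Wd_disk (hR : 0 < R) (hr : R ≤ r) : Wd R a b ⊆ disk2 r := by
  rintro _ ⟨ρ, θ, h1, h2, -, -, rfl⟩
  rw [nrm2_lt (by linarith), nrm2_polar h1.le]; linarith

section
variable {n : Nat} {f : Fin n → Fl} {γ : Fin n → Rl} {E : Set Pl}

lemma arc_data (hf : ∀ j, AnalyticAt Rl (f j) 0) {K : Set Pl} (hK : IsCompact K) (hx : ∀ w ∈ K, ¬ ExceptionalDir n f E w) :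
    (∃ ρ > 0, ∀ p, nrm2 p < ρ → p ≠ 0 → (nrm2 p)⁻¹ • p ∈ K → p ∉ frontier E) ∧
    LG K (∑ j, vanishingOrder (f j) * γ j) fun p => ∏ j, |f j p| ^ γ j :=
  ⟨tan_free hK fun w hw h => hx w hw (Or.inr h), LG_prod hf hK fun w hw j h => hx w hw (Or.inl ⟨j, h⟩)⟩

lemma side2 (hf : ∀ j, AnalyticAt Rl (f j) 0) {r1 : Rl} (hr1 : 0 < r1) (ig : IntegrableOn (stdFun n f γ E) (disk2 r1))     (hab : a < b) (hb : b ≤ a + 2 * π) (hx : ∀ θ ∈ Icc a b, ¬ ExceptionalDir n f E (cos θ, sin θ)) :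
    ∃ ρ > 0, ∀ R, 0 < R → R ≤ ρ → ∀ A > (0), ∃ C > 0, ∀ α, AlphaBound α A → tsupport α ⊆ disk2 R →
      ∀ (k : Fl) (κ : Fr), (∀ r > 0, ∀ θ ∈ Ioo a b, k pol r θ = κ θ) → (∀ θ, |κ θ| ≤ 1) →
      ∀ v : Pl, Un v → ∀ t u,
      ‖oscInt (fun p => k p * (α p * stdFun n f γ E p)) (Wd R a b) t u‖ ≤ C * ∫ p in Wd R a b, wt v t u p * stdFun n f γ E p := by
  set K := (fun θ : Rl => (cos θ, sin θ)) '' Icc a b with hK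
  have Kc : IsCompact K := isCompact_Icc.image fz
  obtain ⟨⟨ρ1, hρ1, h1⟩, hLG⟩ := arc_data   hf Kc (by rintro _ ⟨θ, hθ, rfl⟩; exact hx θ hθ)
  obtain ⟨ρ2, hρ2, c, hc, C1, hC1, hlow, hamp⟩ := amp hLG
  set s := ∑ j, vanishingOrder (f j) * γ j with hs
  obtain ⟨C2, hC2, hside⟩ := side s a b hab hb
  refine ⟨min r1 (min ρ1 ρ2), by positivity, fun R hR hRρ A hA => ?_⟩
  have R3  := hRρ.trans ((min_le_right _ _).trans (min_le_right _ _))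
  have hKm : ∀ r > 0, ∀ θ ∈ Ioo a b, (nrm2 pol r θ)⁻¹ • pol r θ ∈ K := fun r hr θ hθ => by
    rw [dir_polar hr]; exact ⟨θ, Ioo_subset_Icc_self hθ, rfl⟩
  have Wn : ∀ p ∈ Wd R a b, p ≠ 0 ∧ nrm2 p < R ∧ (nrm2 p)⁻¹ • p ∈ K := by
    rintro _ ⟨r, θ, q1, q2, q3, q4, rfl⟩
    exact ⟨polar_ne q1 θ, by rwa [nrm2_polar q1.le], hKm r q1 θ ⟨q3, q4⟩⟩
  have W0 : ∀ v t u, 0 ≤ ∫ p in Wd R a b, wt v t u p * stdFun n f γ E p := fun v t u => setIntegral_nonneg (Wd_meas hb) fun p _ =>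
    mul_nonneg (wt_nonneg _ _ _ _) (std_nonneg f γ E p)
  rcases std_dich (f := f) (γ := γ) (Wd_conn R a b) (E := E) fun p hp => h1 p ((Wn p hp).2.1.trans_le (hRρ.trans ((min_le_right _ _).trans (min_le_left _ _)))) (Wn p hp).1 (Wn p hp).2.2 with hz | hg
  · refine ⟨1, one_pos, fun α _ _ k κ _ _ v _ t u => ?_⟩
    have : oscInt (fun p => k p * (α p * stdFun n f γ E p)) (Wd R a b) t u = 0 := by
      refine setIntegral_eq_zero_of_forall_eq_zero fun p hp => ?_
      simp [hz p hp]
    rw [this, norm_zero, one_mul]; exact W0 v t u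
  · have igW : IntegrableOn (stdFun n f γ E) (Wd R a b) := ig.mono_set (Wd_disk hR (hRρ.trans (min_le_left _ _)))
    have gl : ∀ p ∈ Wd R a b, nrm2 p ^ s ≤ c⁻¹ * stdFun n f γ E p := fun p hp => by
      rw [le_inv_mul_iff₀ hc, hg p hp]
      exact hlow p ((Wn p hp).2.1.trans_le R3) (Wn p hp).1 (Wn p hp).2.2
    refine ⟨C2 * (C1 * A) * c⁻¹, by positivity, fun α hα hsα k κ hk hκ v hv t u => ?_⟩
    have e : oscInt (fun p => k p * (α p * stdFun n f γ E p)) (Wd R a b) t u =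
        oscInt (fun p => k p * (α p * ∏ j, |f j p| ^ γ j)) (Wd R a b) t u := by
      refine setIntegral_congr_fun (Wd_meas hb) fun p hp => ?_
      simp  [hg p hp]
    rw [e]
    refine (hside R (C1 * A) k (fun p => α p * ∏ j, |f j p| ^ γ j) κ hR (fun r hr θ hθ => ?_) hk hκ (fun p hp => ?_) (by
      refine Integrable.mono' (igW.const_mul c⁻¹) (nrm2_cont.measurable.pow_const s).aestronglyMeasurable ?_
      refine ae_restrict_of_forall_mem (Wd_meas hb) fun p hp => ?_
      rw [Real.norm_of_nonneg (rpow_nonneg (nrm2_nonneg _) _)]; exact gl p hp) v hv t u).trans ?_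
    · exact hamp R hR R3 A hA α hα hsα _ (polar_ne hr θ) (hKm r hr θ hθ)
    · rw [al_zero hR hsα hp, zero_mul]
    · rw [mul_assoc _ c⁻¹]
      refine mul_le_mul_of_nonneg_left ?_ pz
      rw [← integral_const_mul]
      have iwt  := by
        refine Integrable.bdd_mul (c := 1) igW (wt_cont v t u).aestronglyMeasurable (ae_of_all _ fun p => ?_)
        rw [Real.norm_of_nonneg (wt_nonneg _ _ _ _)]; exact wt_le _ _ _ _
      refine integral_mono_of_nonneg (ae_of_all _ fun p => mul_nonneg (wt_nonneg _ _ _ _) (rpow_nonneg (nrm2_nonneg _) _)) (iwt.const_mul _)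
        (ae_restrict_of_forall_mem (Wd_meas hb) fun p hp => ?_)
      simp
      rw [mul_left_comm]
      exact mul_le_mul_of_nonneg_left (gl p hp) (wt_nonneg _ _ _ _)
end

lemma exists_cut1 (hr : 0 < r) : ∃ (η : Fr) (M : Rl), 0 < M ∧ ContDiff Rl 1 η ∧ (∀ x, 0 ≤ η x ∧ η x ≤ 1) ∧ (∀ x, |deriv η x| ≤ M) ∧
    (∀ x, |x| ≤ r / 2 → η x = 1) ∧ ∀ x, η x ≠ 0 → |x| ≤ r := by
  let b : ContDiffBump Zr := ⟨r / 2, r, by positivity, by linarith⟩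
  obtain ⟨M, hM⟩ := ((b.contDiff).continuous_deriv le_rfl).bounded_above_of_compact_support b.hasCompactSupport.deriv
  refine ⟨b, |M| + 1, by positivity, b.contDiff, fun x => ⟨b.nonneg, b.le_one⟩, fun x => ((hM x).trans (le_abs_self M)).trans (by linarith),
    fun x hx => b.one_of_mem_closedBall (by simpa  using hx), fun x hx => ?_⟩
  have : x ∈ Function.support b := hx
  rw [b.support_eq] at this
  simpa  using (mem_ball.1 this).le

lemma chart_polar (τ y : Rl) : (cos τ, sin τ) + y • perp2 (cos τ, sin τ) =
      √(1 + y ^ 2) • (cos (τ - arctan y), sin (τ - arctan y)) := by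
  rw [cos_sub, sin_sub, cos_arctan, sin_arctan]
  ext <;> simp [perp2] <;> field_simp <;> ring

lemma chart_Wd {z y ε1 : Rl} (hz : 0 < z) (hy : |y| ≤ ε1) (h1 : arctan ε1 < τ - a) (h2 : arctan ε1 < b - τ)
    (hn : z * √(1 + y ^ 2) < R) : z • ((cos τ, sin τ) + y • perp2 (cos τ, sin τ)) ∈ Wd R a b := by
  obtain ⟨y1, y2⟩ := abs_le.1 hy
  have a1  := arctan_mono y2
  have a2 : - arctan ε1 ≤ arctan y := by rw [← arctan_neg]; gcongr
  refine ⟨z * √(1 + y ^ 2), τ - arctan y, by positivity, hn, by linarith, by linarith, ?_⟩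
  rw [chart_polar, smul_smul]; rfl

noncomputable def psi (v : Pl) (η : Fr) (p : Pl) : Rl := if 0 < dot2 p v then η (dot2 p (perp2 v) / dot2 p v) else 0

lemma psi_meas (v : Pl) (h : Measurable η) : Measurable (psi v η) := by
  unfold psi dot2
  exact Measurable.ite (measurableSet_lt fz fz) fz measurable_const

lemma psi_bd (v : Pl) (h : ∀ x, 0 ≤ η x ∧ η x ≤ 1) (p : Pl) : 0 ≤ psi v η p ∧ psi v η p ≤ 1 := by
  unfold psi; split_ifs
  exacts [h _, ⟨le_rfl, zero_le_one⟩]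

lemma psi_smul (v : Pl) (η : Fr) (hr : 0 < r) (x y : Rl) : psi v η (r * x, r * y) = psi v η (x, y) := by
  have e : ∀ w : Pl, dot2 (r * x, r * y) w = r * dot2 (x, y) w := fun w => by simp  [dot2]; ring
  unfold psi
  rw [e, e, mul_div_mul_left _ _ hr.ne']
  simp  [mul_pos_iff_of_pos_left hr]

lemma psi_chart (hv : Un v) (η : Fr) (hp : 0 < p.1) :
    psi v η (chart v 1 1 (fun _ => 0) p) = η p.2 := by
  unfold psi
  rw [dot_chart_v hv, dot_chart_perp hv, pow_one, if_pos hp, zero_add, mul_div_cancel_left₀ _ hp.ne']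

lemma dec_chart (hv : Un v) (hp : 0 < dot2 p v) :
    p = chart v 1 1 (fun _ => 0) (dot2 p v, dot2 p (perp2 v) / dot2 p v) := by
  unfold chart
  simp
  rw [mul_div_cancel₀ _ hp.ne']
  ext
  · simp [dot2, perp2]; linear_combination -p.1 * hv
  · simp [dot2, perp2]; linear_combination -p.2 * hv

lemma adm_psi (hv : Un v) {M : Rl} (hM : 0 < M) (h1 : ContDiff Rl 1 η)
    (h2 : ∀ x, 0 ≤ η x ∧ η x ≤ 1) (h3 : ∀ x, |deriv η x| ≤ M) (h4 : ∀ x, η x ≠ 0 → |x| ≤ ε) (hR : 0 < R)     (hα : AlphaBound α A) (hs : tsupport α ⊆ disk2 R) : Adm v 1 1 (fun _ => 0) R ε (2 * ((1 + M) * A)) (fun p => psi v η p * α p) := by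
  have hv' : (perp2 v).1 ^ 2 + (perp2 v).2 ^ 2 = 1 := by simp [perp2]; linarith
  constructor
  · intro p hp
    have hψ := left_ne_zero_of_mul hp
    have hn : nrm2 p < R := by
      by_contra h; exact (right_ne_zero_of_mul hp) (al_zero hR hs (not_lt.1 h))
    unfold psi at hψ
    split_ifs at hψ with h
    · exact ⟨_, _, h, ((le_abs_self _).trans (dot_le_nrm hv p)).trans hn.le, h4 _ hψ, dec_chart hv h⟩
    · exact absurd rfl hψ
  · intro p hp _ _
    refine BD.mul ?_ ?_
    · have hη : BD (1 + M) (fun p : Pl => η p.2) p 1 := by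
        have hd : HasFDerivAt (fun p : Pl => η p.2) (deriv η p.2 • ContinuousLinearMap.snd Rl Rl Rl) p :=
          ((h1.differentiable one_ne_zero).differentiableAt.hasDerivAt).comp_hasFDerivAt p hasFDerivAt_snd
        refine ⟨(h1.comp contDiff_snd).contDiffAt, ?_, ?_, ?_⟩
        · rw [abs_of_nonneg (h2 _).1]; linarith [(h2 p.2).2]
        · rw [hd.fderiv]; simp; linarith
        · rw [hd.fderiv]; simp; linarith [h3 p.2]
      refine hη.congr ?_
      filter_upwards [(isOpen_lt continuous_const continuous_fst).mem_nhds hp] with q hq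
      exact psi_chart hv η hq
    · set q := chart v 1 1 (fun _ => 0) p with hq
      have hz : p.1 ≤ nrm2 q := by
        have := (le_abs_self _).trans (dot_le_nrm hv q)
        rwa [hq, dot_chart_v hv, pow_one] at this
      have hn : 0 < nrm2 q := hp.trans_le hz
      have q0 : q ≠ 0 := fun h => by rw [h] at hn; simp [nrm2] at hn
      have e : (fun p : Pl => α (chart v 1 1 (fun _ => 0) p)) = α ∘ (fun p : Pl => p.1 • (v + p.2 • perp2 v)) := by
        funext p; simp only [Function.comp, chart11]
      have eq : p.1 • (v + p.2 • perp2 v) = q := by rw [hq, chart11]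
      have hαc : ContDiffAt Rl 1 α (p.1 • (v + p.2 • perp2 v)) := eq ▸ hα.1.contDiffAt (isOpen_compl_singleton.mem_nhds q0)
      have hc := (hαc.differentiableAt one_ne_zero).hasFDerivAt.comp p ((hasFDerivAt_fst).fun_smul (((hasFDerivAt_snd).smul_const (perp2 v)).const_add v))
      have A0 : 0 ≤ A := (abs_nonneg _).trans (hα.2.1 0)
      have key : ∀ w : Pl, ‖w‖ ≤ nrm2 q → |fderiv Rl α q w| ≤ A := fun w hw => by
        rw [← Real.norm_eq_abs]
        refine ((fderiv Rl α q).le_opNorm w).trans ?_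
        calc _ ≤ (A * (nrm2 q)⁻¹) * nrm2 q := mul_le_mul (hα.2.2 q q0) hw (norm_nonneg _) pz
          _ = A := by field_simp
      refine ⟨?_, hα.2.1 _, ?_, ?_⟩
      · rw [e]; exact ContDiffAt.comp p hαc (ContDiff.contDiffAt fz)
      · rw [e, hc.fderiv, eq, ← smul_eq_mul, ← map_smul]
        refine key _ ?_
        convert norm_le_nrm2 q using 2
        rw [← eq]; simp
      · rw [e, hc.fderiv, eq, one_mul]
        refine (le_of_eq (by simp)).trans (key (p.1 • perp2 v) ?_)
        rw [norm_smul, Real.norm_of_nonneg hp.le]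
        have : ‖perp2 v‖ ≤ 1 := (norm_le_nrm2 _).trans (by unfold nrm2; rw [hv', sqrt_one])
        nlinarith

lemma psi_one (h : ∀ x, |x| ≤ ε / 2 → η x = 1) {θ : Rl} (hθ : |θ - τ| ≤ arctan (ε / 2)) :
    psi (cos τ, sin τ) η (cos θ, sin θ) = 1 := by
  have e1 : dot2 (cos θ, sin θ) (cos τ, sin τ) = cos (θ - τ) := by simp  [dot2]; rw [cos_sub]
  have e2 : dot2 (cos θ, sin θ) (perp2 (cos τ, sin τ)) = - sin (θ - τ) := by simp  [dot2, perp2]; rw [sin_sub]; ring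
  obtain ⟨h1, h2⟩ := abs_le.1 hθ
  have a1 := arctan_lt_pi_div_two (ε / 2)
  have em : arctan (tan (θ - τ)) = θ - τ := arctan_tan (by linarith) (by linarith)
  unfold psi
  rw [e1, e2, if_pos (cos_pos_of_mem_Ioo ⟨by linarith, by linarith⟩), neg_div, ← tan_eq_sin_div_cos]
  refine h _ ?_
  rw [abs_neg, abs_le]
  constructor
  · rw [← arctan_le_arctan_iff, arctan_neg]; linarith
  · rw [← arctan_le_arctan_iff]; linarith

lemma chart_nrm {z : Rl} (hz : 0 ≤ z) (y : Rl) : nrm2 (z • ((cos τ, sin τ) + y • perp2 (cos τ, sin τ))) = z * √(1 + y ^ 2) := by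
  rw [chart_polar, smul_smul]
  exact nrm2_polar pz _

lemma osc_ind {h : Fl} {S : Set Pl} (hS : MeasurableSet S) (t u : Rl) : oscInt h S t u = oscInt (S.indicator h) univ t u := by
  unfold oscInt
  rw [← integral_indicator hS, setIntegral_univ]
  congr 1; funext p
  by_cases hp : p ∈ S <;> simp [hp]

section
variable {n : Nat} {f : Fin n → Fl} {γ : Fin n → Rl} {E : Set Pl}

lemma sf_int (hsf : StandardForm n f γ E) : ∃ r1 > 0, IntegrableOn (stdFun n f γ E) (disk2 r1) := by
  obtain ⟨U, hU, hi⟩ := hsf.integ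
  obtain ⟨ρ, hρ, h⟩ := ev_disk  hU
  exact ⟨ρ, hρ, hi.mono_set fun p hp => h p ((nrm2_lt hρ.le).1 hp)⟩

lemma sf_an (hsf : StandardForm n f γ E) (j : Fin n) : AnalyticAt Rl (f j) 0 := by
  obtain ⟨U, hU, h⟩ := hsf.analytic
  exact h j 0 (mem_of_mem_nhds hU)

lemma disk_meas (r : Rl) : MeasurableSet (disk2 r) := by
  exact measurableSet_lt fz fz

lemma al_meas (h : AlphaBound α A) (μ : Measure Pl) : AEStronglyMeasurable α μ := by
  have : Measurable α := by
    refine measurable_of_measurable_on_compl_singleton 0 ?_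
    exact (continuousOn_iff_continuous_restrict.1 h.1.continuousOn).measurable
  fun_prop

lemma T2 (hsf : StandardForm n f γ E) (h1 : a < τ) (h2 : τ < b) (h3 : τ - π < a) (h4 : b < τ + π)
    (hx : ∀ θ ∈ Icc a b, θ ≠ τ → ¬ ExceptionalDir n f E (cos θ, sin θ)) :
    ∃ r2 > Zr, ∀ R, 0 < R → R ≤ r2 → ∀ A > Zr, ∃ C > Zr, ∀ α, AlphaBound α A → tsupport α ⊆ disk2 R → ∀ t u,
      ‖oscInt (fun p => α p * stdFun n f γ E p) (Wd R a b) t u‖ ≤ C * ∫ p in Wd R a b, wt (cos τ, sin τ) t u p * stdFun n f γ E p := by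
  obtain ⟨r1, hr1, ig⟩ := sf_int hsf
  have hf := sf_an hsf
  obtain ⟨κ, _, bb, b1, b2, b3⟩ := bdry_list hsf.domain
  set v : Pl := (cos τ, sin τ) with hvd
  have hv : Un v := by simp [hvd]
  set g := (disk2 r1).indicator (stdFun n f γ E) with hg
  have ig' : Integrable g := (integrable_indicator_iff (disk_meas r1)).2 ig
  have g0 : ∀ p, 0 ≤ g p := fun p => indicator_nonneg (fun p _ => std_nonneg f γ E p) p
  have hPB : PB v 1 1 (fun _ => 0) g := by
    refine PB_main (GH_std b3 hr1) ?_ ?_ hv ig' g0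
    · rintro (j | j); exacts [hf j, b1 j]
    · rintro (j | j); exacts [hsf.nontriv j, b2 j]
  obtain ⟨ε1, he1, he7, ha1, ha2⟩ : ∃ ε1 > Zr, ε1 ≤ 3/4 ∧ arctan ε1 < τ - a ∧ arctan ε1 < b - τ := by
    have hc : ∀ᶠ x in 𝓝[>] Zr, arctan x < min (τ - a) (b - τ) := by
      have : Tendsto arctan (𝓝[>] Zr) (nhds 0) := by
        have := continuous_arctan.tendsto 0; rw [arctan_zero] at this; exact this.mono_left nhdsWithin_le_nhds
      exact this.eventually_lt_const (lt_min (by linarith) (by linarith))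
    have h34 : ∀ᶠ x in 𝓝[>] Zr, x ≤ 3/4 := nhdsWithin_le_nhds (Iic_mem_nhds (by norm_num))
    obtain ⟨x, hx, hx2, hx3⟩ := (hc.and (h34.and self_mem_nhdsWithin)).exists
    exact ⟨x, hx3, hx2, hx.trans_le (min_le_left _ _), hx.trans_le (min_le_right _ _)⟩
  obtain ⟨ε, hε, hεε, δ0, hδ0, hPB⟩ := hPB ε1 he1
  obtain ⟨η, M, hM, c1, c2, c3, c4, c5⟩ := exists_cut1 hε
  set η0 := arctan (ε / 2) with hη0
  have e0 : 0 < η0 := arctan_pos.2 pz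
  have e1 : η0 < arctan ε1 := arctan_strictMono (by linarith)
  obtain ⟨ρ1, hρ1, S1⟩ := side2 hf hr1 ig (show a < τ - η0 by linarith) (by linarith [pi_pos])
    fun θ hθ => hx θ ⟨hθ.1, by linarith [hθ.2]⟩ (by linarith [hθ.2])
  obtain ⟨ρ2, hρ2, S2⟩ := side2 hf hr1 ig (show τ + η0 < b by linarith) (by linarith [pi_pos])
    fun θ hθ => hx θ ⟨by linarith [hθ.1], hθ.2⟩ (by linarith [hθ.1])
  have hb : b ≤ a + 2 * π := by linarith
  refine ⟨min (min (δ0 / 2) r1) (min ρ1 ρ2), by positivity, fun R hR hR2 A hA => ?_⟩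
  simp only [le_min_iff] at hR2
  obtain ⟨⟨R1, R2⟩, R3, R4⟩ := hR2
  obtain ⟨C0, hC0, P0⟩ := hPB R hR (by linarith) (2 * ((1 + M) * A)) pz
  obtain ⟨C1, hC1, P1⟩ := S1 R hR R3 A hA
  obtain ⟨C2, hC2, P2⟩ := S2 R hR R4 A hA
  refine ⟨C0 + (C1 + C2), by positivity, fun α hα hs t u => ?_⟩
  set H := fun p => α p * stdFun n f γ E p with hH
  set ψ := psi v η with hψ
  set W := Wd R a b with hW
  have W1s : Wd R a (τ - η0) ⊆ W := by
    rintro _ ⟨r, θ, k1, k2, k3, k4, rfl⟩; exact ⟨r, θ, k1, k2, k3, by linarith, rfl⟩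
  have W2s : Wd R (τ + η0) b ⊆ W := by
    rintro _ ⟨r, θ, k1, k2, k3, k4, rfl⟩; exact ⟨r, θ, k1, k2, by linarith, k4, rfl⟩
  have Wm : MeasurableSet W := Wd_meas hb
  have W1m : MeasurableSet (Wd R a (τ - η0)) := Wd_meas (by linarith)
  have W2m : MeasurableSet (Wd R (τ + η0) b) := Wd_meas (by linarith)
  have gs : ∀ p ∈ W, g p = stdFun n f γ E p := fun p hp => indicator_of_mem ((Wd_disk hR R2) hp) _
  have wi : ∀ S ⊆ W, MeasurableSet S → ∫ p in S, wt v t u p * stdFun n f γ E p ≤ ∫ p in W, wt v t u p * stdFun n f γ E p := fun S hS hm => by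
    rw [setIntegral_congr_fun (s := S) (g := fun p => wt v t u p * g p) hm fun p hp => by simp only; rw [← gs p (hS hp)],
      setIntegral_congr_fun (s := W) (g := fun p => wt v t u p * g p) Wm fun p hp => by simp only; rw [← gs p hp]]
    exact wint_mono ig' g0 v t u hS
  have iH : IntegrableOn H W := by
    refine Integrable.bdd_mul (c := A) (ig.mono_set (Wd_disk hR R2)) (al_meas hα _) (ae_of_all _ hα.2.1)
  have i1 : IntegrableOn (fun p => ψ p * H p) W := by
    refine Integrable.bdd_mul (c := 1) iH (psi_meas v c1.continuous.measurable).aestronglyMeasurable (ae_of_all _ fun p => ?_)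
    rw [Real.norm_of_nonneg (psi_bd v c2 p).1]; exact (psi_bd v c2 p).2
  have i2 : IntegrableOn (fun p => (1 - ψ p) * H p) W := by
    refine (iH.sub i1).congr (ae_of_all _ fun p => ?_)
    simp only [Pi.sub_apply]; ring
  have split : W.indicator H = fun p => W.indicator (fun p => ψ p * H p) p +
      ((Wd R a (τ - η0)).indicator (fun p => (1 - ψ p) * H p) p + (Wd R (τ + η0) b).indicator (fun p => (1 - ψ p) * H p) p) := by
    funext p
    by_cases hp : p ∈ W
    · rw [indicator_of_mem hp, indicator_of_mem hp]
      obtain ⟨r, θ, k1, k2, k3, k4, rfl⟩ := hp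
      have m1 : pol r θ ∈ Wd R a (τ - η0) ↔ θ < τ - η0 := by
        constructor
        · rintro ⟨r', θ', l1, l2, l3, l4, e⟩
          rw [(polar_inj hb k1 l1 ⟨k3, k4⟩ ⟨l3, by linarith⟩ e).2]; exact l4
        · intro h; exact ⟨r, θ, k1, k2, k3, h, rfl⟩
      have m2 : pol r θ ∈ Wd R (τ + η0) b ↔ τ + η0 < θ := by
        constructor
        · rintro ⟨r', θ', l1, l2, l3, l4, e⟩
          rw [(polar_inj hb k1 l1 ⟨k3, k4⟩ ⟨by linarith, l4⟩ e).2]; exact l3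
        · intro h; exact ⟨r, θ, k1, k2, h, k4, rfl⟩
      rcases lt_or_ge θ (τ - η0) with q1 | q1
      · rw [indicator_of_mem (m1.2 q1), indicator_of_notMem (fun h => by have := m2.1 h; linarith)]; ring
      rw [indicator_of_notMem (fun h => by have := m1.1 h; linarith)]
      rcases lt_or_ge (τ + η0) θ with q2 | q2
      · rw [indicator_of_mem (m2.2 q2)]; ring
      rw [indicator_of_notMem (fun h => by have := m2.1 h; linarith), hψ, psi_smul v η k1,
        psi_one c4 (abs_le.2 ⟨by linarith, by linarith⟩)]; ring
    · rw [indicator_of_notMem hp, indicator_of_notMem hp, indicator_of_notMem fun h => hp (W1s h),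
        indicator_of_notMem fun h => hp (W2s h)]; ring
  have main : W.indicator (fun p => ψ p * H p) = fun p => (ψ p * α p) * g p := by
    funext p
    by_cases h0 : ψ p * α p = 0
    · rw [h0, zero_mul]
      by_cases hp : p ∈ W
      · rw [indicator_of_mem hp, hH]; simp only; rw [← mul_assoc, h0, zero_mul]
      · rw [indicator_of_notMem hp]
    have hn : nrm2 p < R := by
      by_contra h; exact right_ne_zero_of_mul h0 (al_zero hR hs (not_lt.1 h))
    obtain ⟨z, y, z0, -, hy, e⟩ := (adm_psi hv hM c1 c2 c3 c5 hR hα hs).1 p h0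
    rw [chart11] at e
    have hp : p ∈ W := by
      rw [e, chart_nrm z0.le] at hn
      rw [e]; exact chart_Wd z0 (hy.trans hεε) ha1 ha2 hn
    rw [indicator_of_mem hp, gs p hp, hH]; ring
  rw [osc_ind Wm, split]
  have j2 := (integrable_indicator_iff W1m).2 (i2.mono_set W1s)
  have j3 := (integrable_indicator_iff W2m).2 (i2.mono_set W2s)
  refine (osc_add ((integrable_indicator_iff Wm).2 i1) (j2.add j3) t u).trans ?_
  rw [add_mul]
  refine add_le_add ?_ ((osc_add j2 j3 t u).trans ?_)
  · rw [main]
    refine (P0 _ (adm_psi hv hM c1 c2 c3 c5 hR hα hs) t u).trans (mul_le_mul_of_nonneg_left ?_ hC0.le)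
    rw [setIntegral_congr_fun (s := W) (g := fun p => wt v t u p * g p) Wm fun p hp => by simp only; rw [← gs p hp]]
    refine wint_mono ig' g0 v t u ?_
    rintro _ ⟨p, ⟨p1, p2, p3⟩, rfl⟩
    rw [chart11]
    refine chart_Wd p1 p3.le ha1 ha2 ?_
    have q1 : p.2 ^ 2 ≤ 9 / 16 := by rw [← sq_abs]; nlinarith [abs_nonneg p.2]
    have q2 : √(1 + p.2 ^ 2) ≤ 5 / 4 := by
      rw [Real.sqrt_le_iff]; constructor <;> linarith
    nlinarith [sqrt_nonneg (1 + p.2 ^ 2)]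
  · rw [← osc_ind W1m, ← osc_ind W2m, add_mul]
    have kb : ∀ θ : Rl, |(fun θ => 1 - psi v η (cos θ, sin θ)) θ| ≤ 1 := fun θ => by
      have := psi_bd v c2 (cos θ, sin θ)
      rw [abs_le]; constructor <;> linarith
    refine add_le_add ?_ ?_
    · refine (P1 α hα hs (fun p => 1 - ψ p) (fun θ => 1 - psi v η (cos θ, sin θ)) (fun r hr θ _ => ?_) kb v hv t u).trans
        (mul_le_mul_of_nonneg_left (wi _ W1s W1m) hC1.le)
      simp only [hψ, psi_smul v η hr]
    · refine (P2 α hα hs (fun p => 1 - ψ p) (fun θ => 1 - psi v η (cos θ, sin θ)) (fun r hr θ _ => ?_) kb v hv t u).trans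
        (mul_le_mul_of_nonneg_left (wi _ W2s W2m) hC2.le)
      simp only [hψ, psi_smul v η hr]
end

lemma osc_le {h : Fl} (S : Set Pl) (t u : Rl) : ‖oscInt h S t u‖ ≤ ∫ p in S, |h p| := by
  refine (norm_integral_le_integral_norm _).trans (le_of_eq ?_)
  congr 1; funext p
  rw [norm_mul, Complex.norm_exp]
  simp

lemma ibp2 {m : Fl} (hm : ContDiff Rl 1 m) (hc : HasCompactSupport m) (t u : Rl) :
    (t ^ 2 + u ^ 2) * ‖oscInt m univ t u‖ ≤ ∫ p, |fderiv Rl m p (t, u)| := by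
  set f : Pl → ℂ := fun p => m p with hf
  set e : Pl → ℂ := fun p => Complex.exp (Complex.I * (t * p.1 + u * p.2)) with he
  have fc  := Complex.ofRealCLM.contDiff.comp hm
  have fs  := hc.comp_left  Complex.ofReal_zero
  have ed : ∀ p, HasFDerivAt e (e p • Complex.I • (t • Complex.ofRealCLM.comp (ContinuousLinearMap.fst Rl Rl Rl) +
      u • Complex.ofRealCLM.comp (ContinuousLinearMap.snd Rl Rl Rl))) p := fun p => by
    refine HasFDerivAt.cexp (HasFDerivAt.const_mul ?_ _)
    exact ((Complex.ofRealCLM.comp (ContinuousLinearMap.fst Rl Rl Rl)).hasFDerivAt.const_mul t).add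
      ((Complex.ofRealCLM.comp (ContinuousLinearMap.snd Rl Rl Rl)).hasFDerivAt.const_mul u)
  have e1 : ∀ p, fderiv Rl e p (t, u) = (t ^ 2 + u ^ 2 : Rl) * Complex.I * e p := fun p => by
    rw [(ed p).fderiv]; simp; ring
  have ec : Continuous e := by fun_prop
  have fd : ∀ p, fderiv Rl f p (t, u) = fderiv Rl m p (t, u) := fun p => by
    rw [show f = Complex.ofRealCLM ∘ m from rfl, (Complex.ofRealCLM.hasFDerivAt (x := m p).comp p (hm.differentiable one_ne_zero p).hasFDerivAt).fderiv]; rfl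
  have key := integral_mul_fderiv_eq_neg_fderiv_mul_of_integrable (μ := volume) (f := f)  (v := (t, u)) ?_ ?_ ?_
    (fun x _ => fc.differentiable one_ne_zero x) fun x _ => (ed x).differentiableAt
  · simp only [e1] at key
    have k2 : ∫ p, f p * ((t ^ 2 + u ^ 2 : Rl) * Complex.I * e p) = (t ^ 2 + u ^ 2 : Rl) * Complex.I * oscInt m univ t u := by
      unfold oscInt; rw [setIntegral_univ, ← integral_const_mul]; congr 1; funext p; ring
    rw [k2] at key
    have k3 := congrArg norm key
    rw [norm_mul, norm_mul, Complex.norm_I, mul_one, Complex.norm_real, Real.norm_of_nonneg pz, norm_neg] at k3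
    rw [k3]
    refine (norm_integral_le_integral_norm _).trans (le_of_eq ?_)
    congr 1; funext p
    rw [norm_mul, fd, Complex.norm_real, he]; rw [Complex.norm_exp]
    simp
  · refine (((fc.continuous_fderiv one_ne_zero).clm_apply continuous_const).mul ec).integrable_of_hasCompactSupport ?_
    exact HasCompactSupport.mul_right (fs.fderiv_apply Rl (t, u))
  · simp  [e1]
    exact (fc.continuous.mul (continuous_const.mul ec)).integrable_of_hasCompactSupport fs.mul_right
  · exact (fc.continuous.mul ec).integrable_of_hasCompactSupport fs.mul_right

lemma nrm2_co (p : Pl) : |p.1| ≤ nrm2 p ∧ |p.2| ≤ nrm2 p :=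
  ⟨(norm_fst_le p).trans (norm_le_nrm2 p), (norm_snd_le p).trans (norm_le_nrm2 p)⟩

lemma cut2 {M : Rl} (h1 : ContDiff Rl 1 η) (h3 : ∀ x, |deriv η x| ≤ M) (h4 : ∀ x, η x ≠ 0 → |x| ≤ 1) (L : Rl) (p : Pl) :
    nrm2 p * ‖fderiv Rl (fun p : Pl => 1 - η (L ^ 2 * (p.1 ^ 2 + p.2 ^ 2))) p‖ ≤ 4 * M := by
  have d2 : HasFDerivAt (fun p : Pl => p.2) (ContinuousLinearMap.snd Rl Rl Rl) p := hasFDerivAt_snd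
  have e : (fun p : Pl => 1 - η (L ^ 2 * (p.1 ^ 2 + p.2 ^ 2))) = fun p : Pl => 1 - η (L ^ 2 * (p.1 * p.1 + p.2 * p.2)) := by
    funext p; rw [sq p.1, sq p.2]
  rw [e]
  have hx : L ^ 2 * (p.1 * p.1 + p.2 * p.2) = L ^ 2 * nrm2 p ^ 2 := by rw [nrm2_sq]; ring
  have n0 := nrm2_nonneg p
  have hM : |deriv η (L ^ 2 * nrm2 p ^ 2)| * (L ^ 2 * nrm2 p ^ 2) ≤ M := by
    rcases le_or_gt (L ^ 2 * nrm2 p ^ 2) 1 with h | h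
    · exact (mul_le_of_le_one_right (abs_nonneg _) h).trans (h3 _)
    · have : η =ᶠ[nhds (L ^ 2 * nrm2 p ^ 2)] fun _ => 0 := by
        filter_upwards [Ioi_mem_nhds h] with x hx
        by_contra h0
        exact absurd ((le_abs_self x).trans (h4 x h0)) (not_le.2 hx)
      rw [this.deriv_eq]; simp; exact (abs_nonneg _).trans (h3 0)
  calc _ ≤ nrm2 p * (|deriv η (L ^ 2 * nrm2 p ^ 2)| * (L ^ 2 * (4 * nrm2 p))) := mul_le_mul_of_nonneg_left (by
    have e2 := (((h1.differentiable one_ne_zero (L ^ 2 * (p.1 * p.1 + p.2 * p.2))).hasDerivAt.comp_hasFDerivAt p ((((hasFDerivAt_fst).mul hasFDerivAt_fst).add (d2.mul d2)).const_mul (L ^ 2))).const_sub 1).fderiv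
    simp only [Function.comp_def, Pi.add_apply, Pi.mul_apply] at e2
    rw [e2, norm_neg, norm_smul, norm_smul, hx, Real.norm_eq_abs, Real.norm_of_nonneg (sq_nonneg L)]
    gcongr
    refine ContinuousLinearMap.opNorm_le_bound _ pz fun w => ?_
    simp only [ContinuousLinearMap.add_apply, ContinuousLinearMap.smul_apply, ContinuousLinearMap.coe_fst', ContinuousLinearMap.coe_snd', smul_eq_mul]
    rw [show p.1 * w.1 + p.1 * w.1 + (p.2 * w.2 + p.2 * w.2) = 2 * (p.1 * w.1 + p.2 * w.2) by ring, Real.norm_eq_abs, abs_mul, abs_two]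
    have a1 : |p.1 * w.1| ≤ nrm2 p * ‖w‖ := by
      rw [abs_mul]; exact mul_le_mul (nrm2_co p).1 (norm_fst_le w) (abs_nonneg _) n0
    have a2 : |p.2 * w.2| ≤ nrm2 p * ‖w‖ := by
      rw [abs_mul]; exact mul_le_mul (nrm2_co p).2 (norm_snd_le w) (abs_nonneg _) n0
    have := abs_add_le (p.1 * w.1) (p.2 * w.2)
    linarith) n0
    _ = 4 * |deriv η (L ^ 2 * nrm2 p ^ 2)| * L ^ 2 * nrm2 p ^ 2 := by ring
    _ ≤ _ := by linarith

lemma int_W {E : Type*} [NormedAddCommGroup E] [NormedSpace Rl E] {W : Set Pl} (hW : W =ᵐ[volume] disk2 R) {F : Pl → E}     (h : ∀ p, p ∉ disk2 R → F p = 0) : ∫ p, F p = ∫ p in W, F p := by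
  rw [setIntegral_congr_set hW, setIntegral_eq_integral_of_forall_compl_eq_zero fun p hp => h p hp]

lemma core1 : ∃ C0 > Zr, ∀ (s K R : Rl) (h : Fl) (W : Set Pl), 0 < R → 0 ≤ K → (∀ p, p ≠ 0 → Hom s K h p) → tsupport h ⊆ disk2 R →
    W =ᵐ[volume] disk2 R → MeasurableSet W → (0:Rl×Rl) ∉ W → IntegrableOn (fun p => nrm2 p ^ s) W → ∀ t u,
    ‖oscInt h W t u‖ ≤ C0 * K * ∫ p in W, (1 + nrm2 (t, u) * nrm2 p)⁻¹ * nrm2 p ^ s := by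
  obtain ⟨η, M, hM, c1, c2, c3, c4, c5⟩ := exists_cut1 one_pos
  refine ⟨2 + 3 * (1 + 4 * M), by positivity, fun s K R h W hR hK hH hs hW Wm W0 hi t u => ?_⟩
  set L := nrm2 (t, u) with hL
  have L0 : 0 ≤ L := nrm2_nonneg _
  set ch : Fl := fun p => 1 - η (L ^ 2 * (p.1 ^ 2 + p.2 ^ 2)) with hch
  have chc : ContDiff Rl 1 ch := contDiff_const.sub (c1.comp fz)
  have ch1 : ∀ p, |ch p| ≤ 1 := fun p => by
    have := c2 (L ^ 2 * (p.1 ^ 2 + p.2 ^ 2)); rw [abs_le]; constructor <;> simp only [hch] <;> linarith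
  have chs : ∀ p, L * nrm2 p < 1 / 2 → ∀ᶠ q in nhds p, ch q = 0 := fun p hp => by
    filter_upwards [(isOpen_lt (continuous_const.mul nrm2_cont) continuous_const).mem_nhds hp] with q hq
    have q0 := nrm2_nonneg q
    have hq' : L * nrm2 q < 1 / 2 := hq
    have : 0 ≤ L * nrm2 q := by positivity
    simp only [hch]
    rw [c4, sub_self]
    rw [← nrm2_sq, abs_of_nonneg pz]; nlinarith
  set m : Fl := fun p => ch p * h p with hm
  have mc : ContDiff Rl 1 m := contDiff_iff_contDiffAt.2 fun p => by
    by_cases hp : p = 0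
    · have h0 : m =ᶠ[nhds p] fun _ => 0 := by
        filter_upwards [chs p (by rw [hp]; simp [nrm2])] with q hq
        simp only [hm, hq, zero_mul]
      exact contDiffAt_const.congr_of_eventuallyEq h0
    · exact chc.contDiffAt.mul (hH p hp).1
  have hts : tsupport m ⊆ disk2 R := (tsupport_mul_subset_right (f := ch) (g := h)).trans hs
  have mcs : HasCompactSupport m := by
    refine HasCompactSupport.intro (isCompact_closedBall (0:Rl×Rl) R) fun p hp => ?_
    by_contra h0
    refine hp ?_
    rw [mem_closedBall_zero_iff]; exact (norm_le_nrm2 p).trans ((nrm2_lt hR.le).1 (hts (subset_tsupport m h0))).le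
  have pos : ∀ p ∈ W, 0 < nrm2 p := fun p hp => nrm2_pos fun h => W0 (h ▸ hp)
  have iw : IntegrableOn (fun p => (1 + L * nrm2 p)⁻¹ * nrm2 p ^ s) W := by
    refine Integrable.bdd_mul (c := 1) hi ?_ (ae_of_all _ fun p => ?_)
    · have := nrm2_cont.measurable
      exact Measurable.aestronglyMeasurable fz
    · have := nrm2_nonneg p
      rw [Real.norm_of_nonneg pz]; exact inv_le_one_of_one_le₀ (by nlinarith [mul_nonneg L0 this])
  have ih : IntegrableOn h W := by
    refine Integrable.mono' (hi.const_mul K) (by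
      refine (ContinuousOn.aestronglyMeasurable (fun p hp => ?_) Wm)
      exact ((hH p fun h => W0 (h ▸ hp)).1.continuousAt).continuousWithinAt) (ae_restrict_of_forall_mem Wm fun p hp => ?_)
    exact (hH p fun h => W0 (h ▸ hp)).2.1
  have im : IntegrableOn m W := ih.bdd_mul (c := 1) chc.continuous.aestronglyMeasurable (ae_of_all _ fun p => by rw [Real.norm_eq_abs]; exact ch1 p)
  have split : W.indicator h = fun p => W.indicator m p + W.indicator (fun p => (1 - ch p) * h p) p := by
    funext p
    by_cases hp : p ∈ W
    · simp only [indicator_of_mem hp, hm]; ring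
    · simp only [indicator_of_notMem hp]; ring
  have i2 : IntegrableOn (fun p => (1 - ch p) * h p) W := by
    refine (ih.sub im).congr (ae_of_all _ fun p => ?_)
    simp only [Pi.sub_apply, hm]; ring
  rw [osc_ind Wm, split]
  refine (osc_add ((integrable_indicator_iff Wm).2 im) ((integrable_indicator_iff Wm).2 i2) t u).trans ?_
  rw [← osc_ind Wm, ← osc_ind Wm]
  have b2 : ‖oscInt (fun p => (1 - ch p) * h p) W t u‖ ≤ 2 * K * ∫ p in W, (1 + L * nrm2 p)⁻¹ * nrm2 p ^ s := by
    refine (osc_le W t u).trans ?_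
    rw [← integral_const_mul]
    refine setIntegral_mono_on i2.abs (iw.const_mul _) Wm fun p hp => ?_
    have hp0 := pos p hp
    rw [abs_mul]
    have hr : 0 ≤ nrm2 p ^ s := rpow_nonneg hp0.le s
    by_cases hx : L * nrm2 p ≤ 1
    · calc _ ≤ (2 * (1 + L * nrm2 p)⁻¹) * (K * nrm2 p ^ s) := (mul_le_mul (by
          simp only [hch, sub_sub_cancel]; rw [abs_of_nonneg (c2 _).1]; exact (c2 _).2) ((hH p fun h => W0 (h ▸ hp)).2.1) (abs_nonneg _) zero_le_one).trans (mul_le_mul_of_nonneg_right (by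
          rw [← div_eq_mul_inv, le_div_iff₀ pz]; linarith) pz)
        _ = _ := by ring
    · have k1 : 1 - ch p = 0 := by
        simp only [hch, sub_sub_cancel]
        by_contra h0
        have := (le_abs_self _).trans (c5 _ h0)
        rw [← nrm2_sq] at this
        push Not at hx; nlinarith
      rw [k1, abs_zero, zero_mul]; positivity
  have b1 : ‖oscInt m W t u‖ ≤ 3 * (1 + 4 * M) * K * ∫ p in W, (1 + L * nrm2 p)⁻¹ * nrm2 p ^ s := by
    have wi0 : 0 ≤ ∫ p in W, (1 + L * nrm2 p)⁻¹ * nrm2 p ^ s := integral_nonneg fun p => by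
      have := nrm2_nonneg p
      simp only [Pi.zero_apply]; positivity
    rcases L0.eq_or_lt with hz | hLp
    · have : m = fun _ => 0 := by
        funext p; simp only [hm]
        rw [(chs p (by rw [← hz]; norm_num)).self_of_nhds, zero_mul]
      rw [this]; simp only [oscInt, Complex.ofReal_zero, zero_mul, integral_zero, norm_zero]; positivity
    have e1 : oscInt m W t u = oscInt m univ t u := by
      unfold oscInt
      rw [setIntegral_univ]
      refine (int_W hW fun p hp => ?_).symm
      have : m p = 0 := by
        by_contra h0; exact hp (hts (subset_tsupport m h0))
      rw [this]; simp
    have e2 := ibp2 mc mcs t u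
    rw [int_W hW (fun p hp => by
      rw [fderiv_of_notMem_tsupport Rl (fun h => hp (hts h))]; simp), ← e1] at e2
    have hL2 : t ^ 2 + u ^ 2 = L ^ 2 := by rw [hL, nrm2_sq]
    rw [hL2] at e2
    exact le_of_mul_le_mul_left (e2.trans (by
      rw [← integral_const_mul, ← integral_const_mul]
      refine setIntegral_mono_on ((((mc.continuous_fderiv one_ne_zero).clm_apply continuous_const).integrable_of_hasCompactSupport (mcs.fderiv_apply Rl (t, u))).integrableOn.abs) ((iw.const_mul _).const_mul _) Wm fun p hp => ?_
      have hp0 := pos p hp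
      have pn : p ≠ 0 := fun h => W0 (h ▸ hp)
      have hr : 0 ≤ nrm2 p ^ s := rpow_nonneg hp0.le s
      by_cases hx : L * nrm2 p < 1 / 2
      · have h0 : m =ᶠ[nhds p] fun _ => 0 := by
          filter_upwards [chs p hx] with q hq
          simp only [hm, hq, zero_mul]
        rw [h0.fderiv_eq]; simp; positivity
      push Not at hx
      have k1 := fd_mul_le hp0.le (chc.differentiable one_ne_zero p) ((hH p pn).1.differentiableAt one_ne_zero) (ch1 p) (hH p pn).2.1
        (cut2 c1 c3 c5 L p) (hH p pn).2.2
      have k3 : (L * nrm2 p)⁻¹ ≤ 3 * (1 + L * nrm2 p)⁻¹ := by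
        rw [← div_eq_mul_inv, le_div_iff₀ pz, inv_mul_le_iff₀ pz]; linarith
      calc _ ≤ ‖fderiv Rl m p‖ * L := (by
        rw [← Real.norm_eq_abs]
        exact ((fderiv Rl m p).le_opNorm _).trans (mul_le_mul_of_nonneg_left (norm_le_nrm2 _) (norm_nonneg _)))
        _ = (nrm2 p * ‖fderiv Rl m p‖) * L ^ 2 * (L * nrm2 p)⁻¹ := by field_simp
        _ ≤ (1 * (K * nrm2 p ^ s) + K * nrm2 p ^ s * (4 * M)) * L ^ 2 * (3 * (1 + L * nrm2 p)⁻¹) := by gcongr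
        _ = _ := by ring)) pz
  calc _ ≤ _ := add_le_add b1 b2
    _ = _ := by ring

lemma nrm2_smul (c : Rl) (p : Pl) : nrm2 (c • p) = |c| * nrm2 p := by
  unfold nrm2
  rw [← sqrt_sq_eq_abs, ← sqrt_mul (sq_nonneg c)]
  congr 1; simp; ring

lemma circ_comp : IsCompact {w : Pl | nrm2 w = 1} := by
  refine (isCompact_closedBall 0 1).of_isClosed_subset (isClosed_eq nrm2_cont continuous_const) fun w hw => ?_
  rw [mem_closedBall_zero_iff]; exact (norm_le_nrm2 w).trans hw.le

lemma dir_circ (hp : p ≠ 0) : (nrm2 p)⁻¹ • p ∈ {w : Pl | nrm2 w = 1} := by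
  have := nrm2_pos hp
  rw [mem_setOf_eq, nrm2_smul, abs_of_pos pz, inv_mul_cancel₀ this.ne']

lemma Wd_full (hR : 0 < R) : Wd R 0 (2 * π) =ᵐ[volume] disk2 R := by
  have hs : disk2 R \ Wd R 0 (2 * π) ⊆ univ ×ˢ {0} := by
    rintro p ⟨h1, h2⟩
    by_contra h0
    refine h2 ?_
    have hsrc : -p ∈ polarCoord.source := by simp_all
    have ht := polarCoord.map_source hsrc
    set r := (polarCoord (-p)).1
    set θ := (polarCoord (-p)).2
    have e' : p = (r * cos (θ + π), r * sin (θ + π)) := by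
      rw [cos_add_pi, sin_add_pi, mul_neg, mul_neg, ← neg_neg p, ← (polarCoord.left_inv hsrc)]; rfl
    have hn := (nrm2_lt hR.le).1 h1
    rw [e', nrm2_polar (ht.1).le] at hn
    exact ⟨r, θ + π, ht.1, hn, by linarith [ht.2.1], by linarith [ht.2.2], e'⟩
  exact (Wd_disk hR le_rfl).eventuallyLE.antisymm (ae_le_set.2 (by
    refine measure_mono_null hs ?_
    rw [Measure.volume_eq_prod]; simp))

lemma Wd_clos (h : p ∈ closure (Wd R a b)) : nrm2 p ≤ R := by
  refine closure_minimal  ?_ (isClosed_le nrm2_cont continuous_const) h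
  rintro _ ⟨r, θ, k1, k2, k3, k4, rfl⟩
  rw [mem_setOf_eq, nrm2_polar k1.le]; exact k2.le

section
variable {n : Nat} {f : Fin n → Fl} {γ : Fin n → Rl} {E : Set Pl}

lemma T1 (hsf : StandardForm n f γ E) (hx : ∀ w, nrm2 w = 1 → ¬ ExceptionalDir n f E w) : ∃ R > Zr,
    (∀ j : Fin n, ∃ cj > Zr, ∃ Cj > Zr, ∀ p ∈ Wd R 0 (2 * π),
            cj * nrm2 p ^ (vanishingOrder (f j)) < |f j p| ∧ |f j p| < Cj * nrm2 p ^ (vanishingOrder (f j))) ∧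
          (frontier E ∩ closure (Wd R 0 (2 * π)) ⊆ {0}) ∧
          (∀ A > Zr, ∃ C > Zr, ∀ α : Fl, AlphaBound α A → tsupport α ⊆ disk2 R → ∀ t u : Rl,
              ‖oscInt (fun p => α p * stdFun n f γ E p) (Wd R 0 (2 * π)) t u‖ ≤
                C * ∫ p in Wd R 0 (2 * π), (1 + |t * p.1| + |u * p.2|)⁻¹ * stdFun n f γ E p) := by
  obtain ⟨r1, hr1, ig⟩ := sf_int hsf
  have hf := sf_an hsf
  obtain ⟨⟨ρ0, hρ0, hfr⟩, hLG⟩ := arc_data (γ := γ) hf circ_comp hx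
  obtain ⟨ρ1, hρ1, c, hc, C1, hC1, glow, hamp⟩ := amp hLG
  obtain ⟨C0, hC0, hcore⟩ := core1
  have hF : ∀ j, ∃ cj > Zr, ∃ Cj > Zr, ∀ᶠ p in nhds (0:Rl×Rl), p ≠ 0 → cj * nrm2 p ^ (vanishingOrder (f j)) < |f j p| ∧ |f j p| < Cj * nrm2 p ^ (vanishingOrder (f j)) := fun j => by
    obtain ⟨c, hc, h1⟩ := f_low (hf j) circ_comp fun w hw h => hx w hw (Or.inl ⟨j, h⟩)
    obtain ⟨C, hC, h2⟩ := f_up (hf j)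
    refine ⟨c / 2, by positivity, 2 * C, by positivity, ?_⟩
    filter_upwards [h1, h2] with p q1 q2 hp
    have h3 := q1 hp (dir_circ hp)
    have h4 : 0 < nrm2 p ^ vanishingOrder (f j) := pow_pos (nrm2_pos hp) _
    constructor <;> nlinarith [q2.1]
  choose cj hcj Cj hCj hF using hF
  obtain ⟨ρ2, hρ2, hF⟩ := ev_disk (eventually_all.2 hF)
  set R := min (min (ρ0 / 2) ρ1) (min ρ2 r1) with hRd
  have hR : 0 < R := by positivity
  have R0 : R ≤ ρ0 / 2 := (min_le_left _ _).trans (min_le_left _ _)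
  have R1 : R ≤ ρ1 := (min_le_left _ _).trans (min_le_right _ _)
  set W := Wd R 0 (2 * π) with hWd
  have W0 : (0:Rl×Rl) ∉ W := by
    rintro ⟨r, θ, k1, -, -, -, e⟩; exact polar_ne k1 θ e.symm
  have Wn : ∀ p ∈ W, p ≠ 0 ∧ nrm2 p < R := fun p hp => ⟨fun h => W0 (h ▸ hp), (nrm2_lt hR.le).1 (Wd_disk hR le_rfl hp)⟩
  have Wm : MeasurableSet W := Wd_meas (by linarith)
  have igW := ig.mono_set (Wd_disk (a := 0) (b := 2 * π) hR ((min_le_right _ _).trans (min_le_right _ _)))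
  refine ⟨R, hR, fun j => ⟨cj j, hcj j, Cj j, hCj j, fun p hp => hF p ((Wn p hp).2.trans_le ((min_le_right _ _).trans (min_le_left _ _))) j (Wn p hp).1⟩, ?_, fun A hA => ?_⟩
  · rintro p ⟨h1, h2⟩
    by_contra hp
    exact hfr p (by linarith [Wd_clos h2]) hp (dir_circ hp) h1
  rcases std_dich (n := n) (f := f) (γ := γ) (Wd_conn R 0 (2 * π)) (fun p hp => hfr p (by linarith [(Wn p hp).2]) (Wn p hp).1 (dir_circ (Wn p hp).1)) with hz | hg
  · refine ⟨1, one_pos, fun α _ _ t u => ?_⟩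
    have e : oscInt (fun p => α p * stdFun n f γ E p) W t u = 0 := by
      unfold oscInt
      refine setIntegral_eq_zero_of_forall_eq_zero fun p hp => ?_
      simp only [hz p hp, mul_zero, Complex.ofReal_zero, zero_mul]
    rw [e, norm_zero, one_mul]
    exact integral_nonneg fun p => mul_nonneg pz (std_nonneg f γ E p)
  · set s := ∑ j, vanishingOrder (f j) * γ j with hs
    have gl : ∀ p ∈ W, nrm2 p ^ s ≤ c⁻¹ * stdFun n f γ E p := fun p hp => by
      rw [hg p hp, le_inv_mul_iff₀ hc]
      exact glow p ((Wn p hp).2.trans_le R1) (Wn p hp).1 (dir_circ (Wn p hp).1)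
    refine ⟨C0 * (C1 * A) * (2 * c⁻¹), by positivity, fun α hα hsα t u => ?_⟩
    have e : oscInt (fun p => α p * stdFun n f γ E p) W t u = oscInt (fun p => α p * ∏ j, |f j p| ^ γ j) W t u := by
      unfold oscInt
      refine setIntegral_congr_fun Wm fun p hp => ?_
      simp only [hg p hp]
    rw [e]
    refine (hcore s (C1 * A) R _ W hR pz (fun p hp => hamp R hR R1 A hA α hα hsα p hp (dir_circ hp))
      ((tsupport_mul_subset_left (f := α)).trans hsα) (Wd_full hR) Wm W0 (by
        refine Integrable.mono' (igW.const_mul c⁻¹) (nrm2_cont.measurable.pow_const s).aestronglyMeasurable ?_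
        refine ae_restrict_of_forall_mem Wm fun p hp => ?_
        rw [Real.norm_of_nonneg (rpow_nonneg (nrm2_nonneg _) _)]; exact gl p hp) t u).trans ?_
    rw [mul_assoc _ (2 * c⁻¹)]
    refine mul_le_mul_of_nonneg_left ?_ pz
    rw [← integral_const_mul]
    have iwt : IntegrableOn (fun p => (1 + |t * p.1| + |u * p.2|)⁻¹ * stdFun n f γ E p) W := by
      refine Integrable.bdd_mul (c := 1) igW (Measurable.aestronglyMeasurable fz) (ae_of_all _ fun p => ?_)
      rw [Real.norm_of_nonneg pz]
      exact inv_le_one_of_one_le₀ (by linarith [abs_nonneg (t * p.1), abs_nonneg (u * p.2)])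
    have n0 := nrm2_nonneg (t, u)
    refine integral_mono_of_nonneg (ae_of_all _ fun p => ?_) (iwt.const_mul _) (ae_restrict_of_forall_mem Wm fun p hp => ?_)
    · have := nrm2_nonneg p
      simp only [Pi.zero_apply]; positivity
    have k0 := nrm2_nonneg p
    have k1 : |t * p.1| ≤ nrm2 (t, u) * nrm2 p := by
      rw [abs_mul]; exact mul_le_mul (nrm2_co (t, u)).1 (nrm2_co p).1 (abs_nonneg _) n0
    have k2 : |u * p.2| ≤ nrm2 (t, u) * nrm2 p := by
      rw [abs_mul]; exact mul_le_mul (nrm2_co (t, u)).2 (nrm2_co p).2 (abs_nonneg _) n0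
    calc _ ≤ (2 * (1 + |t * p.1| + |u * p.2|)⁻¹) * (c⁻¹ * stdFun n f γ E p) :=
          mul_le_mul (by
            rw [← div_eq_mul_inv, le_div_iff₀ pz, inv_mul_le_iff₀ pz]; linarith) (gl p hp) (rpow_nonneg k0 _) pz
      _ = _ := by ring
end

section
variable {n : Nat} {f : Fin n → Fl} {γ : Fin n → Rl} {E : Set Pl}

lemma exc_neg (h : ExceptionalDir n f E w) : ExceptionalDir n f E (-w) := by
  rcases h with ⟨i, h⟩ | ⟨p, h1, h2, h3⟩
  · refine Or.inl ⟨i, ?_⟩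
    have := low_smul (f i) (-1) w
    rw [neg_one_smul, h, mul_zero] at this; exact this
  · refine Or.inr ⟨p, h1, h2, ?_⟩
    rw [neg_neg]; exact h3.symm

lemma exc_per : Function.Periodic (fun θ : Rl => ExceptionalDir n f E (cos θ, sin θ)) π := fun θ => by
  have e : (cos (θ + π), sin (θ + π)) = -(cos θ, sin θ) := by simp
  simp only [e]
  exact propext ⟨fun h => by have := exc_neg h; simp_all, exc_neg⟩

lemma arcs (hsf : StandardForm n f γ E) {θ0 : Rl} (h0 : ExceptionalDir n f E (cos θ0, sin θ0)) (θ : Rl) :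
    ∃ τ a b , a < θ ∧ θ < b ∧ a < τ ∧ τ < b ∧ τ - π < a ∧ b < τ + π ∧ ExceptionalDir n f E (cos τ, sin τ) ∧
      ∀ x ∈ Icc a b, x ≠ τ → ¬ ExceptionalDir n f E (cos x, sin x) := by
  set X : Set Rl := {x | ExceptionalDir n f E (cos x, sin x)} with hX
  have hcl : IsClosed X := by
    refine isClosed_of_closure_subset fun x hx => ?_
    by_contra hxX
    rw [mem_closure_iff_frequently] at hx
    refine hx ?_
    filter_upwards [(eventually_nhdsWithin_iff.1 (exc_disc hsf x))] with y hy
    by_cases e : y = x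
    · rw [e]; exact hxX
    · exact hy e
  obtain ⟨k, hk, -⟩ := existsUnique_add_zsmul_mem_Ico pi_pos θ0 θ
  obtain ⟨τ, ⟨hτX, hτ⟩, hmin⟩ := isCompact_Icc  (b := θ0 + k • π).inter_left hcl |>.exists_isLeast ⟨_, (by
    exact Eq.mpr (exc_per  (f := f) (E := E).zsmul k θ0) h0), hk.1, le_rfl⟩
  obtain ⟨ε1, he1, E1⟩ := Metric.eventually_nhds_iff.1 (eventually_nhdsWithin_iff.1 (exc_disc hsf θ))
  obtain ⟨ε2, he2, E2⟩ := Metric.eventually_nhds_iff.1 (eventually_nhdsWithin_iff.1 (exc_disc hsf τ))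
  have hlt  := hτ.2.trans_lt hk.2
  obtain ⟨e, e0, q1, q2, q3, q4⟩ : ∃ e > 0, e < ε1 ∧ e < ε2 ∧ e < θ + π - τ ∧ e < π := by
    have hm : 0 < min (min ε1 ε2) (min (θ + π - τ) π) := lt_min (lt_min he1 he2) (lt_min (by linarith) pi_pos)
    refine ⟨_, half_pos hm, ?_⟩
    have := half_lt_self hm
    exact ⟨this.trans_le ((min_le_left _ _).trans (min_le_left _ _)), this.trans_le ((min_le_left _ _).trans (min_le_right _ _)),
      this.trans_le ((min_le_right _ _).trans (min_le_left _ _)), this.trans_le ((min_le_right _ _).trans (min_le_right _ _))⟩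
  have hτ1 := hτ.1
  refine ⟨τ, θ - e, τ + e, by linarith, by linarith, by linarith, by linarith, by linarith, by linarith, hτX, fun x hx hxτ => ?_⟩
  rcases lt_or_ge x θ with h | h
  · refine E1 ?_ h.ne
    rw [Real.dist_eq, abs_lt]; constructor <;> linarith [hx.1]
  rcases lt_or_ge x τ with h' | h'
  · intro hxX
    exact absurd (hmin ⟨hxX, h, h'.le.trans hτ.2⟩) (not_le.2 h')
  · refine E2 ?_ hxτ
    rw [Real.dist_eq, abs_lt]; constructor <;> linarith [hx.2]

lemma polar_ex (p : Pl) : ∃ θ ∈ Icc (-π) π, p = (nrm2 p * cos θ, nrm2 p * sin θ) := by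
  refine ⟨Complex.arg ⟨p.1, p.2⟩, ⟨(Complex.neg_pi_lt_arg _).le, Complex.arg_le_pi _⟩, ?_⟩
  have e : nrm2 p = ‖(⟨p.1, p.2⟩ : ℂ)‖ := by
    rw [Complex.norm_def, Complex.normSq_mk]; unfold nrm2; ring
  rw [e, Complex.norm_mul_cos_arg, Complex.norm_mul_sin_arg]

lemma Wd_zero (hR : 0 < R) (hab : a < b) : 0 ∈ closure (Wd R a b) := by
  have h : Tendsto (fun r : Rl => (r * cos ((a + b) / 2), r * sin ((a + b) / 2))) (𝓝[>] 0) (nhds 0) := by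
    have : Continuous fun r : Rl => (r * cos ((a + b) / 2), r * sin ((a + b) / 2)) := by fun_prop
    have h2 := this.tendsto 0
    simp   at h2
    exact h2.mono_left nhdsWithin_le_nhds
  refine mem_closure_of_tendsto h ?_
  filter_upwards [Ioo_mem_nhdsGT hR] with r hr
  exact ⟨r, _, hr.1, hr.2, by linarith, by linarith, rfl⟩
end

/-- **Lemma 3.3 (wedge decomposition with Fourier estimates).** For `g = χ_E ∏|fᵢ|^{γᵢ}`
of the standard form (outside the trivial situation), a sufficiently small disk `B`
centered at the origin can be written as a union of wedges `Bᵢ` of two types: on type (1)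
wedges every `fⱼ` is comparable to `|(x,y)|^{n_j}` (`n_j` the order of the zero of `fⱼ` at
the origin), the boundary curves of `E` avoid `cl(Bᵢ)`, and the localized Fourier integral
is bounded by `C∫_{Bᵢ}(1+|tx|+|uy|)^{−1} g`; each type (2) wedge meets a line `lᵢ` through
the origin in the zero set of some lowest-degree part `Fⱼ` or tangent to a boundary curve
of `E`, and the localized Fourier integral is bounded by
`C∫_{Bᵢ}(1+|(t,u)·v||(x,y)|+|(t,u)·v^⊥||(x,y)·v^⊥|)^{−1/2} g` with `v` a unit vector
along `lᵢ`. -/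
theorem wedge_decomposition {n : ℕ} (f : Fin n → ℝ × ℝ → ℝ) (γ : Fin n → ℝ)
    (E : Set (ℝ × ℝ)) (hsf : StandardForm n f γ E)
    (hnontrivial : ¬ (E ∈ 𝓝 (0:ℝ×ℝ) ∧ ∀ i, f i 0 ≠ 0)) :
    ∃ rB > (0:ℝ), ∃ (M : ℕ) (B : Fin M → Set (ℝ × ℝ)),
      disk2 rB ⊆ (⋃ i, closure (B i)) ∧
      ∀ i : Fin M, IsWedge rB (B i) ∧
        (((∀ j : Fin n, ∃ cj > (0:ℝ), ∃ Cj > (0:ℝ), ∀ p ∈ B i,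
            cj * nrm2 p ^ (vanishingOrder (f j)) < |f j p| ∧
            |f j p| < Cj * nrm2 p ^ (vanishingOrder (f j))) ∧
          (frontier E ∩ closure (B i) ⊆ {0}) ∧
          (∀ A > (0:ℝ), ∃ C > (0:ℝ), ∀ α : ℝ × ℝ → ℝ,
            AlphaBound α A → tsupport α ⊆ disk2 rB → ∀ t u : ℝ,
              ‖oscInt (fun p => α p * stdFun n f γ E p) (B i) t u‖ ≤
                C * ∫ p in B i,
                  (1 + |t * p.1| + |u * p.2|)⁻¹ * stdFun n f γ E p)) ∨
         (∃ v : ℝ × ℝ, nrm2 v = 1 ∧ (∃ s : ℝ, s • v ∈ B i) ∧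
          ExceptionalDir n f E v ∧
          (∀ A > (0:ℝ), ∃ C > (0:ℝ), ∀ α : ℝ × ℝ → ℝ,
            AlphaBound α A → tsupport α ⊆ disk2 rB → ∀ t u : ℝ,
              ‖oscInt (fun p => α p * stdFun n f γ E p) (B i) t u‖ ≤
                C * ∫ p in B i,
                  (1 + |dot2 (t, u) v| * nrm2 p +
                      |dot2 (t, u) (perp2 v)| * |dot2 p (perp2 v)|) ^ (-(1/2 : ℝ)) *
                    stdFun n f γ E p))) := by
  classical
  by_cases hX : ∃ θ0 , ExceptionalDir n f E (cos θ0, sin θ0)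
  · obtain ⟨θ0, h0⟩ := hX
    choose τ a b h1 h2 h3 h4 h5 h6 h7 h8 using arcs hsf h0
    choose r2 hr2 hT using fun θ => T2 hsf (h3 θ) (h4 θ) (h5 θ) (h6 θ) (h8 θ)
    obtain ⟨T, -, hT2⟩ := isCompact_Icc  (b := π).elim_nhds_subcover (fun θ => Ioo (a θ) (b θ))
      fun θ _ => Ioo_mem_nhds (h1 θ) (h2 θ)
    obtain ⟨R, hR, hR0⟩ : ∃ R > 0, ∀ θ ∈ T, R ≤ r2 θ := by
      have : ∀ᶠ R in 𝓝[>] 0, ∀ θ ∈ T, R ≤ r2 θ :=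
        (Finset.eventually_all T).2 fun θ _ => nhdsWithin_le_nhds (Iic_mem_nhds (hr2 θ))
      obtain ⟨R, h, h'⟩ := (this.and self_mem_nhdsWithin).exists
      exact ⟨R, h', h⟩
    refine ⟨R, hR, T.card, fun i => Wd R (a (T.equivFin.symm i)) (b (T.equivFin.symm i)), fun p hp => ?_, fun i => ⟨?_, Or.inr ?_⟩⟩
    · obtain ⟨θ, hθ, e⟩ := polar_ex p
      obtain ⟨x, hx, hx2⟩ := mem_iUnion₂.1 (hT2 hθ)
      refine mem_iUnion.2 ⟨T.equivFin ⟨x, hx⟩, ?_⟩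
      beta_reduce; rw [Equiv.symm_apply_apply]
      by_cases hp0 : p = 0
      · rw [hp0]; exact Wd_zero hR ((h1 x).trans (h2 x))
      · exact subset_closure ⟨nrm2 p, θ, nrm2_pos hp0, (nrm2_lt hR.le).1 hp, hx2.1, hx2.2, e⟩
    · set x : Rl := (T.equivFin.symm i : Rl)
      exact ⟨a x, b x, (h1 x).trans (h2 x), by linarith [h5 x, h6 x], rfl⟩
    · set x : Rl := (T.equivFin.symm i : Rl)
      refine ⟨(cos (τ x), sin (τ x)), ?_, ⟨R / 2, ⟨R / 2, τ x, by positivity, by linarith, h3 x, h4 x, rfl⟩⟩, h7 x, hT x R hR (hR0 x ((T.equivFin.symm i).2))⟩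
      have := nrm2_polar zero_le_one (τ x)
      rwa [one_mul, one_mul] at this
  · obtain ⟨R, hR, hT⟩ := T1 hsf fun w hw h => by
      obtain ⟨θ, -, e⟩ := polar_ex w
      rw [hw, one_mul, one_mul] at e
      exact hX ⟨θ, e ▸ h⟩
    refine ⟨R, hR, 1, fun _ => Wd R 0 (2 * π), fun p hp => ?_, fun i => ⟨⟨0, 2 * π, by positivity, by linarith, rfl⟩, Or.inl hT⟩⟩
    refine mem_iUnion.2 ⟨0, ?_⟩
    obtain ⟨θ, hθ, e⟩ := polar_ex p
    by_cases hp0 : p = 0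
    · rw [hp0]; exact Wd_zero hR pz
    obtain ⟨θ', hθ', e'⟩ : ∃ θ' ∈ Icc 0 (2 * π), p = (nrm2 p * cos θ', nrm2 p * sin θ') := by
      rcases lt_or_ge θ 0 with h | h
      · refine ⟨θ + 2 * π, ⟨by linarith [hθ.1], by linarith⟩, ?_⟩
        rw [cos_add_two_pi, sin_add_two_pi]; exact e
      · exact ⟨θ, ⟨h, by linarith [hθ.2]⟩, e⟩
    rw [← closure_Ioo pz] at hθ'
    have hc : Continuous fun θ : Rl => (nrm2 p * cos θ, nrm2 p * sin θ) := by fun_prop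
    rw [e']
    refine closure_mono ?_ (image_closure_subset_closure_image hc ⟨θ', hθ', rfl⟩)
    rintro _ ⟨x, hx, rfl⟩
    exact ⟨nrm2 p, x, (nrm2_pos hp0), ((nrm2_lt hR.le).1 hp), hx.1, hx.2, rfl⟩
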